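/- For every ε > 0 there exists a constant c = c(ε) > 0 such that for all real x ≥ 1 one has ∑_{n ≤ x} Δ(n) ≥ c · x · (Log₂ x)^{1+η−ε}. -/

import Mathlib

open Filter Topology
open scoped Classical

noncomputable def LLog (x : ℝ) : ℝ := max 1 (Real.log x)
noncomputable def LLog2 (x : ℝ) : ℝ := LLog (LLog x)
noncomputable def LLog3 (x : ℝ) : ℝ := LLog (LLog2 x)

/-- `Δ^{(v)}(n)`: the maximal number of divisors of `n` in an interval `(e^u, e^{u+v}]`. -/
noncomputable def DeltaV (v : ℝ) (n : ℕ) : ℕ :=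
  ⨆ u : ℝ, (n.divisors.filter fun d => Real.exp u < (d : ℝ) ∧ (d : ℝ) ≤ Real.exp (u + v)).card

/-- The Erdős–Hooley Delta function. -/
noncomputable def Delta (n : ℕ) : ℕ := DeltaV 1 n

/-- `S_{[y,x)}`: squarefree positive integers all of whose prime factors `p` satisfy `y ≤ p < x`. -/
def Sset (y x : ℝ) : Set ℕ :=
  {n | 0 < n ∧ Squarefree n ∧ ∀ p ∈ n.primeFactors, y ≤ (p : ℝ) ∧ (p : ℝ) < x}

/-- `∏_{y ≤ p < x} (1 + 1/p)⁻¹`, product over primes. -/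
noncomputable def primeProd (y x : ℝ) : ℝ :=
  ∏ᶠ p ∈ {p : ℕ | p.Prime ∧ y ≤ (p : ℝ) ∧ (p : ℝ) < x}, ((1 : ℝ) + 1 / p)⁻¹

/-- number of distinct prime factors -/
def omegaN (n : ℕ) : ℕ := n.primeFactors.card

/-- number of divisors -/
def tauN (n : ℕ) : ℕ := n.divisors.card

/-- `n_{<y}`: the largest divisor of `n` (squarefree) composed of primes `< y`. -/
noncomputable def nsmall (n : ℕ) (y : ℝ) : ℕ :=
  ∏ p ∈ n.primeFactors.filter (fun p : ℕ => (p : ℝ) < y), p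

def Yset (α x : ℝ) : Set ℝ :=
  {y | 0 < y ∧ |LLog2 y - α * LLog2 x| ≤ Real.sqrt (LLog2 x) ∧ ∃ m : ℤ, LLog2 y = m * Real.log 2}

def Uset (α x : ℝ) : Set ℤ :=
  {u | |(u : ℝ) - (Real.log 4 - 1) / Real.log 2 * (α * LLog2 x)| ≤ Real.sqrt (LLog2 x)}

noncomputable def Qfun (t : ℝ) : ℝ := t * Real.log t - t + 1

namespace EH

/-! ### Entropy of relations on a finite weighted set -/

section Entropy
variable {Ω : Type*} [Fintype Ω]

/-- mass of the class of `y` -/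
noncomputable def cls (ν : Ω → ℝ) (R : Ω → Ω → Prop) (y : Ω) : ℝ :=
  ∑ y', if R y y' then ν y' else 0

noncomputable def Ent (ν : Ω → ℝ) (R : Ω → Ω → Prop) : ℝ :=
  - ∑ y, ν y * Real.log (cls ν R y)

/-- number of elements in the class -/
noncomputable def ccard (R : Ω → Ω → Prop) (y : Ω) : ℝ :=
  ∑ y', if R y y' then (1:ℝ) else 0

structure IsLaw (ν : Ω → ℝ) : Prop where
  pos : ∀ y, 0 < ν y
  sum : ∑ y, ν y = 1

lemma cls_congr {ν : Ω → ℝ} {R : Ω → Ω → Prop} (hR : Equivalence R) {y y' : Ω} (h : R y y') :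
    cls ν R y = cls ν R y' := by
  unfold cls
  refine Finset.sum_congr rfl fun z _ => ?_
  have : R y z ↔ R y' z := ⟨fun h1 => hR.trans (hR.symm h) h1, fun h1 => hR.trans h h1⟩
  simp only [this]

lemma ccard_congr {R : Ω → Ω → Prop} (hR : Equivalence R) {y y' : Ω} (h : R y y') :
    ccard R y = ccard R y' := by
  unfold ccard
  refine Finset.sum_congr rfl fun z _ => ?_
  have : R y z ↔ R y' z := ⟨fun h1 => hR.trans (hR.symm h) h1, fun h1 => hR.trans h h1⟩
  simp only [this]

lemma cls_pos {ν : Ω → ℝ} (hν : IsLaw ν) {R : Ω → Ω → Prop} (hR : Equivalence R) (y : Ω) :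
    0 < cls ν R y := by
  unfold cls
  refine Finset.sum_pos' (fun z _ => ?_) ⟨y, Finset.mem_univ _, ?_⟩
  · split_ifs
    · exact (hν.pos z).le
    · exact le_rfl
  · rw [if_pos (hR.refl y)]; exact hν.pos y

lemma ccard_ge_one {R : Ω → Ω → Prop} (hR : Equivalence R) (y : Ω) : 1 ≤ ccard R y := by
  unfold ccard
  have := Finset.single_le_sum (f := fun y' => if R y y' then (1:ℝ) else 0) (s := Finset.univ)
    (fun z _ => by split_ifs <;> norm_num) (Finset.mem_univ y)
  simpa [hR.refl y] using this

lemma cls_le_one {ν : Ω → ℝ} (hν : IsLaw ν) (R : Ω → Ω → Prop) (y : Ω) :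
    cls ν R y ≤ 1 := by
  rw [← hν.sum]
  unfold cls
  refine Finset.sum_le_sum fun z _ => ?_
  split_ifs
  · exact le_rfl
  · exact (hν.pos z).le

lemma Ent_nonneg {ν : Ω → ℝ} (hν : IsLaw ν) {R : Ω → Ω → Prop} (hR : Equivalence R) :
    0 ≤ Ent ν R := by
  unfold Ent
  rw [neg_nonneg]
  refine Finset.sum_nonpos fun y _ => ?_
  exact mul_nonpos_of_nonneg_of_nonpos (hν.pos y).le
    (Real.log_nonpos (cls_pos hν hR y).le (cls_le_one hν R y))

lemma gibbs {ν : Ω → ℝ} (hν : IsLaw ν) (w : Ω → ℝ) (hw : ∀ y, 0 < w y)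
    (h : ∑ y, ν y * w y ≤ 1) : ∑ y, ν y * Real.log (w y) ≤ 0 := by
  have : ∑ y, ν y * Real.log (w y) ≤ ∑ y, (ν y * w y - ν y) := by
    refine Finset.sum_le_sum fun y _ => ?_
    have := Real.log_le_sub_one_of_pos (hw y)
    nlinarith [hν.pos y]
  rw [Finset.sum_sub_distrib, hν.sum] at this
  linarith

lemma cls_mono {ν : Ω → ℝ} (hν : IsLaw ν) {R R' : Ω → Ω → Prop} (h : ∀ y y', R y y' → R' y y')
    (y : Ω) : cls ν R y ≤ cls ν R' y := by
  unfold cls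
  refine Finset.sum_le_sum fun z _ => ?_
  by_cases h1 : R y z
  · rw [if_pos h1, if_pos (h _ _ h1)]
  · rw [if_neg h1]; split_ifs
    · exact (hν.pos z).le
    · exact le_rfl

lemma Ent_anti {ν : Ω → ℝ} (hν : IsLaw ν) {R R' : Ω → Ω → Prop} (hR : Equivalence R)
    (h : ∀ y y', R y y' → R' y y') : Ent ν R' ≤ Ent ν R := by
  unfold Ent
  rw [neg_le_neg_iff]
  refine Finset.sum_le_sum fun y _ => ?_
  exact mul_le_mul_of_nonneg_left (Real.log_le_log (cls_pos hν hR y) (cls_mono hν h y))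
    (hν.pos y).le

lemma Ent_univ {ν : Ω → ℝ} (hν : IsLaw ν) {R : Ω → Ω → Prop} (h : ∀ y y', R y y') :
    Ent ν R = 0 := by
  have : ∀ y, cls ν R y = 1 := fun y => by
    unfold cls; rw [← hν.sum]; exact Finset.sum_congr rfl fun z _ => if_pos (h _ _)
  simp [Ent, this]

/-- sum over a subset of a class of ν/cls is at most 1 -/
lemma sum_div_cls_le {ν : Ω → ℝ} (hν : IsLaw ν) {R : Ω → Ω → Prop} (hR : Equivalence R)
    (p : Ω → Prop) (hp : ∀ y y', p y → p y' → R y y') :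
    ∑ y, (if p y then ν y / cls ν R y else 0) ≤ 1 := by
  by_cases hex : ∃ y, p y
  · obtain ⟨y0, hy0⟩ := hex
    have hc := cls_pos hν hR y0
    have : ∑ y, (if p y then ν y / cls ν R y else 0)
        ≤ ∑ y, (if R y0 y then ν y else 0) / cls ν R y0 := by
      refine Finset.sum_le_sum fun y _ => ?_
      by_cases h1 : p y
      · rw [if_pos h1, if_pos (hp _ _ hy0 h1), cls_congr hR (hp _ _ hy0 h1)]
      · rw [if_neg h1]
        apply div_nonneg _ hc.le
        split_ifs
        · exact (hν.pos _).le
        · exact le_rfl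
    refine this.trans ?_
    rw [← Finset.sum_div]
    exact (div_self hc.ne').le
  · push Not at hex
    rw [Finset.sum_eq_zero]
    · norm_num
    · intro y _; rw [if_neg (hex y)]

lemma Ent_submod {ν : Ω → ℝ} (hν : IsLaw ν) {R1 R2 Rm Rp : Ω → Ω → Prop}
    (h1 : Equivalence R1) (h2 : Equivalence R2) (hm : Equivalence Rm) (hp : Equivalence Rp)
    (hm' : ∀ y y', R1 y y' → R2 y y' → Rm y y')
    (hp1 : ∀ y y', R1 y y' → Rp y y') (hp2 : ∀ y y', R2 y y' → Rp y y') :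
    Ent ν Rm + Ent ν Rp ≤ Ent ν R1 + Ent ν R2 := by
  have key : ∑ y, ν y * (cls ν R1 y * cls ν R2 y / (cls ν Rm y * cls ν Rp y)) ≤ 1 := by
    have e1 : ∀ y, ν y * (cls ν R1 y * cls ν R2 y / (cls ν Rm y * cls ν Rp y))
        = ∑ a, ∑ b, (if Rp a b then ν a * ν b / cls ν Rp a else 0) *
            (if R1 y a ∧ R2 y b then ν y / cls ν Rm y else 0) := by
      intro y
      have : cls ν R1 y * cls ν R2 y = ∑ a, ∑ b, (if R1 y a ∧ R2 y b then ν a * ν b else 0) := by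
        unfold cls
        rw [Finset.sum_mul_sum]
        refine Finset.sum_congr rfl fun a _ => Finset.sum_congr rfl fun b _ => ?_
        by_cases ha : R1 y a <;> by_cases hb : R2 y b <;> simp [ha, hb]
      have e : ν y * (cls ν R1 y * cls ν R2 y / (cls ν Rm y * cls ν Rp y))
        = (ν y / (cls ν Rm y * cls ν Rp y)) * (cls ν R1 y * cls ν R2 y) := by ring
      rw [e, this, Finset.mul_sum]
      refine Finset.sum_congr rfl fun a _ => ?_
      rw [Finset.mul_sum]
      refine Finset.sum_congr rfl fun b _ => ?_
      by_cases hab : R1 y a ∧ R2 y b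
      · have hab' : Rp a b := hp.trans (hp.symm (hp1 _ _ hab.1)) (hp2 _ _ hab.2)
        rw [if_pos hab, if_pos hab, if_pos hab', cls_congr hp (hp1 _ _ hab.1)]
        have := (cls_pos hν hm y).ne'
        have := (cls_pos hν hp a).ne'
        field_simp
      · simp [hab]
    calc _ = ∑ a, ∑ b, ∑ y, (if Rp a b then ν a * ν b / cls ν Rp a else 0) *
            (if R1 y a ∧ R2 y b then ν y / cls ν Rm y else 0) := by
          rw [Finset.sum_congr rfl fun y _ => e1 y, Finset.sum_comm]
          refine Finset.sum_congr rfl fun a _ => Finset.sum_comm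
      _ ≤ ∑ a, ∑ b, (if Rp a b then ν a * ν b / cls ν Rp a else 0) := by
          refine Finset.sum_le_sum fun a _ => Finset.sum_le_sum fun b _ => ?_
          rw [← Finset.mul_sum]
          refine mul_le_of_le_one_right ?_ ?_
          · split_ifs
            · exact div_nonneg (mul_nonneg (hν.pos _).le (hν.pos _).le) (cls_pos hν hp a).le
            · exact le_rfl
          · have := sum_div_cls_le hν hm (fun y => R1 y a ∧ R2 y b) (by
              rintro y y' ⟨ha, hb⟩ ⟨ha', hb'⟩
              exact hm' _ _ (h1.trans ha (h1.symm ha')) (h2.trans hb (h2.symm hb')))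
            refine le_trans (le_of_eq (Finset.sum_congr rfl fun y _ => ?_)) this
            congr
      _ = ∑ a, ν a := by
          refine Finset.sum_congr rfl fun a _ => ?_
          have : ∀ b, (if Rp a b then ν a * ν b / cls ν Rp a else 0)
              = (ν a / cls ν Rp a) * (if Rp a b then ν b else 0) := by
            intro b; split_ifs <;> ring
          rw [Finset.sum_congr rfl fun b _ => this b, ← Finset.mul_sum]
          exact div_mul_cancel₀ _ (cls_pos hν hp a).ne'
      _ ≤ 1 := hν.sum.le
  have p1 := cls_pos hν h1
  have p2 := cls_pos hν h2
  have p3 := cls_pos hν hm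
  have p4 := cls_pos hν hp
  have := gibbs hν _ (fun y => div_pos (mul_pos (p1 y) (p2 y)) (mul_pos (p3 y) (p4 y))) key
  have e2 : ∀ y, ν y * Real.log (cls ν R1 y * cls ν R2 y / (cls ν Rm y * cls ν Rp y))
     = ν y * Real.log (cls ν R1 y) + ν y * Real.log (cls ν R2 y)
        - (ν y * Real.log (cls ν Rm y) + ν y * Real.log (cls ν Rp y)) := by
    intro y
    rw [Real.log_div (mul_pos (p1 y) (p2 y)).ne' (mul_pos (p3 y) (p4 y)).ne',
      Real.log_mul (p1 y).ne' (p2 y).ne', Real.log_mul (p3 y).ne' (p4 y).ne']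
    ring
  rw [Finset.sum_congr rfl fun y _ => e2 y, Finset.sum_sub_distrib, Finset.sum_add_distrib,
    Finset.sum_add_distrib] at this
  unfold Ent
  linarith

/-- conditional entropy bound by the size of the fibres -/
lemma Ent_fibre {ν : Ω → ℝ} (hν : IsLaw ν) {R R' : Ω → Ω → Prop}
    (hR : Equivalence R) (hR' : Equivalence R') (K : Ω → ℝ)
    (hK : ∀ y, ccard R' y ≤ K y) (hK' : ∀ y y', R' y y' → K y = K y') :
    Ent ν R - Ent ν R' ≤ ∑ y, ν y * Real.log (K y) := by
  have hKp : ∀ y, 0 < K y := fun y => lt_of_lt_of_le one_pos ((ccard_ge_one hR' y).trans (hK y))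
  have p1 := cls_pos hν hR
  have p2 := cls_pos hν hR'
  have key : ∑ y, ν y * (cls ν R' y / (K y * cls ν R y)) ≤ 1 := by
    have e1 : ∀ y, ν y * (cls ν R' y / (K y * cls ν R y))
        = ∑ a, ν a / K a * (if R' a y then ν y / cls ν R y else 0) := by
      intro y
      rw [cls, Finset.sum_div, Finset.mul_sum]
      refine Finset.sum_congr rfl fun a _ => ?_
      by_cases h : R' y a
      · rw [if_pos h, if_pos (hR'.symm h), hK' _ _ h]
        have := (hKp a).ne'
        have := (p1 y).ne'
        field_simp
      · rw [if_neg h, if_neg (fun h' => h (hR'.symm h'))]; simp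
    rw [Finset.sum_congr rfl fun y _ => e1 y, Finset.sum_comm, ← hν.sum]
    refine Finset.sum_le_sum fun a _ => ?_
    rw [← Finset.mul_sum, div_mul_eq_mul_div, div_le_iff₀ (hKp a)]
    refine mul_le_mul_of_nonneg_left (le_trans ?_ (hK a)) (hν.pos a).le
    unfold ccard
    refine Finset.sum_le_sum fun y _ => ?_
    split_ifs
    · rw [div_le_one (p1 y)]
      have := Finset.single_le_sum (f := fun y' => if R y y' then ν y' else 0) (s := Finset.univ)
        (fun z _ => by split_ifs; exacts [(hν.pos z).le, le_rfl]) (Finset.mem_univ y)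
      simpa [hR.refl y, cls] using this
    · exact le_rfl
  have := gibbs hν _ (fun y => div_pos (p2 y) (mul_pos (hKp y) (p1 y))) key
  have e2 : ∀ y, ν y * Real.log (cls ν R' y / (K y * cls ν R y))
     = ν y * Real.log (cls ν R' y) - (ν y * Real.log (K y) + ν y * Real.log (cls ν R y)) := by
    intro y
    rw [Real.log_div (p2 y).ne' (mul_pos (hKp y) (p1 y)).ne',
      Real.log_mul (hKp y).ne' (p1 y).ne']
    ring
  rw [Finset.sum_congr rfl fun y _ => e2 y, Finset.sum_sub_distrib, Finset.sum_add_distrib] at this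
  unfold Ent
  linarith

lemma Ent_add_log_ccard {ν : Ω → ℝ} (hν : IsLaw ν) {R : Ω → Ω → Prop} (hR : Equivalence R) :
    (∑ y, ν y * Real.log (ccard R y)) + Ent ν R ≤ Real.log (Fintype.card Ω) := by
  have p1 := cls_pos hν hR
  have p2 : ∀ y, 0 < ccard R y := fun y => lt_of_lt_of_le one_pos (ccard_ge_one hR y)
  have hne : Nonempty Ω := by
    by_contra h
    rw [not_nonempty_iff] at h
    have := hν.sum
    simp at this
  have hc : (0:ℝ) < Fintype.card Ω := by exact_mod_cast Fintype.card_pos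
  have key : ∑ y, ν y * (ccard R y / (Fintype.card Ω * cls ν R y)) ≤ 1 := by
    have e1 : ∀ y, ν y * (ccard R y / (Fintype.card Ω * cls ν R y))
        = ∑ a, (1 / (Fintype.card Ω : ℝ)) * (if R a y then ν y / cls ν R y else 0) := by
      intro y
      rw [ccard, Finset.sum_div, Finset.mul_sum]
      refine Finset.sum_congr rfl fun a _ => ?_
      by_cases h : R y a
      · rw [if_pos h, if_pos (hR.symm h)]
        have := (p1 y).ne'
        field_simp
      · rw [if_neg h, if_neg (fun h' => h (hR.symm h'))]; simp
    rw [Finset.sum_congr rfl fun y _ => e1 y, Finset.sum_comm]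
    have : ∀ a, ∑ y, (1 / (Fintype.card Ω : ℝ)) * (if R a y then ν y / cls ν R y else 0)
        ≤ 1 / Fintype.card Ω := by
      intro a
      rw [← Finset.mul_sum]
      refine mul_le_of_le_one_right (by positivity) ?_
      exact sum_div_cls_le hν hR (fun y => R a y) fun y y' h h' => hR.trans (hR.symm h) h'
    refine (Finset.sum_le_sum fun a _ => this a).trans ?_
    rw [Finset.sum_const, Finset.card_univ, nsmul_eq_mul]
    exact (mul_one_div_cancel hc.ne').le
  have := gibbs hν _ (fun y => div_pos (p2 y) (mul_pos hc (p1 y))) key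
  have e2 : ∀ y, ν y * Real.log (ccard R y / (Fintype.card Ω * cls ν R y))
     = ν y * Real.log (ccard R y) - (ν y * Real.log (Fintype.card Ω)
        + ν y * Real.log (cls ν R y)) := by
    intro y
    rw [Real.log_div (p2 y).ne' (mul_pos hc (p1 y)).ne',
      Real.log_mul hc.ne' (p1 y).ne']
    ring
  rw [Finset.sum_congr rfl fun y _ => e2 y, Finset.sum_sub_distrib, Finset.sum_add_distrib,
    ← Finset.sum_mul, hν.sum] at this
  unfold Ent
  linarith

lemma Ent_le_log_card {ν : Ω → ℝ} (hν : IsLaw ν) {R : Ω → Ω → Prop} (hR : Equivalence R) :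
    Ent ν R ≤ Real.log (Fintype.card Ω) := by
  have := Ent_add_log_ccard hν hR
  have h2 : 0 ≤ ∑ y, ν y * Real.log (ccard R y) := Finset.sum_nonneg fun y _ =>
    mul_nonneg (hν.pos y).le (Real.log_nonneg (ccard_ge_one hR y))
  linarith

/-- invariance under a bijection -/
lemma Ent_equiv {ν : Ω → ℝ} (g : Ω ≃ Ω) (hg : ∀ y, ν (g y) = ν y) {R R' : Ω → Ω → Prop}
    (h : ∀ y y', R' y y' ↔ R (g y) (g y')) : Ent ν R' = Ent ν R := by
  unfold Ent
  congr 1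
  symm
  rw [← Equiv.sum_comp g]
  refine Finset.sum_congr rfl fun y _ => ?_
  rw [hg]
  congr 2
  unfold cls
  rw [← Equiv.sum_comp g]
  refine Finset.sum_congr rfl fun z _ => ?_
  simp only [h, hg]

end Entropy
end EH

namespace EH

/-! ### The binary tree -/

abbrev Lam (r : ℕ) := Fin r → Bool
abbrev Om (r : ℕ) := Lam r → Bool

def agree {r : ℕ} (m : ℕ) (l l' : Lam r) : Prop := ∀ i : Fin r, i.val < m → l i = l' i

lemma agree_refl {r m : ℕ} (l : Lam r) : agree m l l := fun _ _ => rfl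
lemma agree_symm {r m : ℕ} {l l' : Lam r} (h : agree m l l') : agree m l' l :=
  fun i hi => (h i hi).symm
lemma agree_trans {r m : ℕ} {l l' l'' : Lam r} (h : agree m l l') (h' : agree m l' l'') :
    agree m l l'' := fun i hi => (h i hi).trans (h' i hi)
lemma agree_mono {r m m' : ℕ} (hm : m ≤ m') {l l' : Lam r} (h : agree m' l l') : agree m l l' :=
  fun i hi => h i (hi.trans_le hm)
lemma agree_zero {r : ℕ} (l l' : Lam r) : agree 0 l l' := fun _ h => absurd h (Nat.not_lt_zero _)
lemma agree_eq {r m : ℕ} (hm : r ≤ m) {l l' : Lam r} (h : agree m l l') : l = l' :=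
  funext fun i => h i (i.2.trans_le hm)

/-- functions depending only on the first `m` bits -/
def VV (r m : ℕ) : Submodule ℝ (Lam r → ℝ) where
  carrier := {x | ∀ l l', agree m l l' → x l = x l'}
  add_mem' := fun {a b} ha hb l l' h => by simp [ha l l' h, hb l l' h]
  zero_mem' := fun _ _ _ => rfl
  smul_mem' := fun c x hx l l' h => by simp [hx l l' h]

lemma mem_VV {r m : ℕ} {x : Lam r → ℝ} : x ∈ VV r m ↔ ∀ l l', agree m l l' → x l = x l' := Iff.rfl

lemma VV_mono {r m m' : ℕ} (h : m ≤ m') : VV r m ≤ VV r m' :=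
  fun _ hx l l' hl => hx l l' (agree_mono h hl)

lemma VV_top {r m : ℕ} (h : r ≤ m) : VV r m = ⊤ := by
  rw [eq_top_iff]
  intro x _ l l' hl
  rw [agree_eq h hl]

def bv {r : ℕ} (y : Om r) : Lam r → ℝ := fun l => if y l then 1 else 0

lemma bv_inj {r : ℕ} (y : Om r) (l l' : Lam r) : bv y l = bv y l' ↔ y l = y l' := by
  unfold bv
  cases y l <;> cases y l' <;> simp

def Rel {r : ℕ} (m : ℕ) (y y' : Om r) : Prop := bv y - bv y' ∈ VV r m

lemma Rel_equiv {r : ℕ} (m : ℕ) : Equivalence (Rel (r := r) m) where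
  refl := fun y => by unfold Rel; rw [sub_self]; exact zero_mem _
  symm := fun {x y} h => by
    have := (VV r m).neg_mem h
    rw [neg_sub] at this; exact this
  trans := fun {x y z} h h' => by
    have := (VV r m).add_mem h h'
    rw [sub_add_sub_cancel] at this; exact this

lemma Rel_mono {r m m' : ℕ} (h : m ≤ m') {y y' : Om r} (hy : Rel m y y') : Rel m' y y' :=
  VV_mono h hy

lemma Rel_top {r m : ℕ} (h : r ≤ m) (y y' : Om r) : Rel m y y' := by
  unfold Rel; rw [VV_top h]; trivial

/-- halves -/
def hf {r : ℕ} (b : Bool) (Y : Om (r+1)) : Om r := fun l => Y (Fin.cons b l)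

def jn {r : ℕ} (p : Om r × Om r) : Om (r+1) :=
  fun l => if l 0 then p.2 (Fin.tail l) else p.1 (Fin.tail l)

def splitEquiv (r : ℕ) : Om r × Om r ≃ Om (r+1) where
  toFun := jn
  invFun := fun Y => (hf false Y, hf true Y)
  left_inv := fun p => by
    ext l <;> simp [jn, hf]
  right_inv := fun Y => by
    funext l
    unfold jn hf
    have : l = Fin.cons (l 0) (Fin.tail l) := (Fin.cons_self_tail l).symm
    by_cases h : l 0 = true
    · rw [if_pos h]; dsimp only; rw [← h, Fin.cons_self_tail]
    · rw [if_neg h]; dsimp only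
      have h' : l 0 = false := by simpa using h
      rw [← h', Fin.cons_self_tail]

@[simp] lemma hf_false_jn {r : ℕ} (p : Om r × Om r) : hf false (jn p) = p.1 :=
  congrArg Prod.fst ((splitEquiv r).left_inv p)
@[simp] lemma hf_true_jn {r : ℕ} (p : Om r × Om r) : hf true (jn p) = p.2 :=
  congrArg Prod.snd ((splitEquiv r).left_inv p)

lemma agree_cons {r m : ℕ} (b b' : Bool) (l l' : Lam r) :
    agree (m+1) (Fin.cons b l : Lam (r+1)) (Fin.cons b' l') ↔ b = b' ∧ agree m l l' := by
  constructor
  · intro h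
    refine ⟨by simpa using h 0 (by simp), fun i hi => ?_⟩
    have := h i.succ (by simpa using hi)
    simpa using this
  · rintro ⟨rfl, h⟩ i hi
    refine Fin.cases ?_ (fun i hi => ?_) i hi
    · intro _; simp
    · simpa using h i (by simpa using hi)

lemma Rel_succ {r m : ℕ} (Y Y' : Om (r+1)) :
    Rel (m+1) Y Y' ↔ ∀ b, Rel m (hf b Y) (hf b Y') := by
  constructor
  · intro h b l l' hl
    exact h (Fin.cons b l) (Fin.cons b l') ((agree_cons _ _ _ _).2 ⟨rfl, hl⟩)
  · intro h l l' hl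
    rw [← Fin.cons_self_tail l, ← Fin.cons_self_tail l', agree_cons] at hl
    have := h (l 0) (Fin.tail l) (Fin.tail l') hl.2
    rw [← Fin.cons_self_tail l, ← Fin.cons_self_tail l', ← hl.1]
    exact this

lemma Rel_succ' {r m : ℕ} (Y Y' : Om (r+1)) :
    Rel (m+1) Y Y' ↔ Rel m (hf false Y) (hf false Y') ∧ Rel m (hf true Y) (hf true Y') := by
  rw [Rel_succ, Bool.forall_bool]

/-- `Y` depends only on first m bits -/
def dep {r : ℕ} (m : ℕ) (Y : Om r) : Prop := bv Y ∈ VV r m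

lemma dep_iff {r m : ℕ} (Y : Om r) : dep m Y ↔ ∀ l l', agree m l l' → Y l = Y l' := by
  unfold dep; rw [mem_VV]
  simp only [bv_inj]

lemma dep_succ {r m : ℕ} (Y : Om (r+1)) : dep (m+1) Y ↔ dep m (hf false Y) ∧ dep m (hf true Y) := by
  have h := Rel_succ' (m := m) Y (fun _ => false)
  have e1 : ∀ (s : ℕ), bv (fun _ : Lam s => false) = 0 := fun s => by funext l; simp [bv]
  have e2 : ∀ b, hf b (fun _ : Lam (r+1) => false) = fun _ => false := fun b => rfl
  unfold Rel at h
  rw [e2, e2, e1, e1, sub_zero, sub_zero, sub_zero] at h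
  exact h

lemma dep_congr {r m : ℕ} {Y Y' : Om r} (h : Rel m Y Y') : dep m Y ↔ dep m Y' := by
  unfold dep
  have h' := (Rel_equiv m).symm h
  constructor
  · intro hy; have := (VV r m).add_mem h' hy; simpa using this
  · intro hy; have := (VV r m).add_mem h hy; simpa using this

lemma dep_rel {r m : ℕ} {Y Y' : Om r} (h : dep m Y) (h' : dep m Y') : Rel m Y Y' :=
  (VV r m).sub_mem h h'

lemma dep_mono {r m m' : ℕ} (h : m ≤ m') {Y : Om r} (hY : dep m Y) : dep m' Y := VV_mono h hY

lemma dep_top {r m : ℕ} (h : r ≤ m) (Y : Om r) : dep m Y := by unfold dep; rw [VV_top h]; trivial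

/-- sum over a class splits into halves -/
lemma cls_succ {r m : ℕ} (f : Om (r+1) → ℝ) (Y : Om (r+1)) :
    cls f (Rel (m+1)) Y = ∑ y0, ∑ y1, if Rel m (hf false Y) y0 ∧ Rel m (hf true Y) y1 then
      f (jn (y0, y1)) else 0 := by
  unfold cls
  rw [← Equiv.sum_comp (splitEquiv r), Fintype.sum_prod_type]
  refine Finset.sum_congr rfl fun y0 _ => Finset.sum_congr rfl fun y1 _ => ?_
  have : (splitEquiv r) (y0, y1) = jn (y0, y1) := rfl
  rw [this]
  simp only [Rel_succ', hf_false_jn, hf_true_jn]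

lemma cls_succ_prod {r m : ℕ} (f : Om (r+1) → ℝ) (g0 g1 : Om r → ℝ) (Y : Om (r+1))
    (h : ∀ y0 y1, Rel m (hf false Y) y0 → Rel m (hf true Y) y1 → f (jn (y0, y1)) = g0 y0 * g1 y1) :
    cls f (Rel (m+1)) Y = cls g0 (Rel m) (hf false Y) * cls g1 (Rel m) (hf true Y) := by
  rw [cls_succ]
  unfold cls
  rw [Finset.sum_mul_sum]
  refine Finset.sum_congr rfl fun y0 _ => Finset.sum_congr rfl fun y1 _ => ?_
  by_cases h0 : Rel m (hf false Y) y0 <;> by_cases h1 : Rel m (hf true Y) y1 <;> simp [h0, h1]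
  exact h y0 y1 h0 h1

lemma ccard_eq_cls {Ω : Type*} [Fintype Ω] (R : Ω → Ω → Prop) (y : Ω) :
    ccard R y = cls (fun _ => 1) R y := rfl

lemma ccard_succ {r m : ℕ} (Y : Om (r+1)) :
    ccard (Rel (m+1)) Y = ccard (Rel m) (hf false Y) * ccard (Rel m) (hf true Y) := by
  rw [ccard_eq_cls, cls_succ_prod _ (fun _ => 1) (fun _ => 1)]
  · rfl
  · intros; norm_num

lemma Rel_zero {r : ℕ} {Y Y' : Om r} : Rel 0 Y Y' ↔
    Y' = Y ∨ (dep 0 Y ∧ dep 0 Y') := by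
  constructor
  · intro h
    by_cases hd : dep 0 Y
    · exact Or.inr ⟨hd, (dep_congr h).1 hd⟩
    · left
      rw [dep_iff] at hd
      push Not at hd
      obtain ⟨l, l', -, hne⟩ := hd
      funext k
      have h1 := h k l (agree_zero _ _)
      have h2 := h k l' (agree_zero _ _)
      simp only [Pi.sub_apply, bv] at h1 h2
      revert h1 h2 hne
      cases Y l <;> cases Y l' <;> cases Y k <;> cases Y' l <;> cases Y' l' <;> cases Y' k <;>
        norm_num
  · rintro (rfl | ⟨h, h'⟩)
    · exact (Rel_equiv 0).refl _
    · exact dep_rel h h'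

lemma dep_zero {r : ℕ} (Y : Om r) : dep 0 Y ↔ Y = (fun _ => true) ∨ Y = (fun _ => false) := by
  rw [dep_iff]
  constructor
  · intro h
    by_cases h1 : Y (fun _ => true) = true
    · left; funext l; rw [h l _ (agree_zero _ _), h1]
    · right; funext l; rw [h l (fun _ => true) (agree_zero _ _)]; simpa using h1
  · rintro (rfl | rfl) l l' _ <;> rfl

lemma cls_zero_dep {r : ℕ} (f : Om r → ℝ) {Y : Om r} (h : dep 0 Y) :
    cls f (Rel 0) Y = f (fun _ => true) + f (fun _ => false) := by
  unfold cls
  have hne : (fun _ : Lam r => true) ≠ fun _ => false := fun h => by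
    have := congrFun h (fun _ => true); simp at this
  rw [← Finset.sum_pair hne]
  rw [← Finset.sum_filter]
  refine Finset.sum_congr ?_ fun _ _ => rfl
  ext Y'
  simp only [Finset.mem_filter, Finset.mem_univ, true_and, Finset.mem_insert,
    Finset.mem_singleton, ← dep_zero]
  rw [Rel_zero]
  constructor
  · rintro (rfl | h'); exacts [h, h'.2]
  · intro h'; exact Or.inr ⟨h, h'⟩

lemma cls_zero_ndep {r : ℕ} (f : Om r → ℝ) {Y : Om r} (h : ¬ dep 0 Y) :
    cls f (Rel 0) Y = f Y := by
  unfold cls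
  have : ∀ Y', Rel 0 Y Y' ↔ Y' = Y := fun Y' => by rw [Rel_zero]; tauto
  simp [this]

lemma ccard_zero {r : ℕ} (Y : Om r) : ccard (Rel 0) Y = if dep 0 Y then 2 else 1 := by
  rw [ccard_eq_cls]
  split_ifs with h
  · rw [cls_zero_dep _ h]; norm_num
  · rw [cls_zero_ndep _ h]

lemma ccard_sq {r m : ℕ} (h : m + 1 ≤ r) (Y : Om r) :
    ccard (Rel m) Y ^ 2 ≤ ccard (Rel (m+1)) Y := by
  induction m generalizing r with
  | zero =>
    obtain ⟨r, rfl⟩ : ∃ s, r = s + 1 := ⟨r - 1, by omega⟩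
    rw [ccard_succ, ccard_zero, ccard_zero, ccard_zero]
    by_cases h : dep 0 Y
    · have := (dep_succ Y).1 (dep_mono (Nat.zero_le 1) h)
      simp [h, this]; norm_num
    · rw [if_neg h]
      split_ifs <;> norm_num
  | succ m ih =>
    obtain ⟨r, rfl⟩ : ∃ s, r = s + 1 := ⟨r - 1, by omega⟩
    rw [ccard_succ, ccard_succ (m := m+1), mul_pow]
    refine mul_le_mul (ih (by omega) _) (ih (by omega) _) (sq_nonneg _) ?_
    exact (sq_nonneg _).trans (ih (by omega) _)

lemma ccard_pow {r m k : ℕ} (h : m + k ≤ r) (Y : Om r) :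
    ccard (Rel m) Y ^ (2^k) ≤ ccard (Rel (m+k)) Y := by
  induction k with
  | zero => simp
  | succ k ih =>
    have h1 := ih (by omega)
    have h2 := ccard_sq (m := m + k) (by omega) Y
    have h0 : 0 ≤ ccard (Rel m) Y := zero_le_one.trans (ccard_ge_one (Rel_equiv m) Y)
    calc ccard (Rel m) Y ^ (2^(k+1)) = (ccard (Rel m) Y ^ (2^k))^2 := by rw [pow_succ, pow_mul]
      _ ≤ (ccard (Rel (m+k)) Y)^2 := by gcongr
      _ ≤ _ := h2

/-- averaging over a finer relation -/
lemma cls_avg {Ω : Type*} [Fintype Ω] (ν : Ω → ℝ) {R R' : Ω → Ω → Prop} (hR : Equivalence R)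
    (hR' : Equivalence R') (h : ∀ y y', R y y' → R' y y') (Y : Ω) :
    cls ν R' Y = cls (fun y => cls ν R y / ccard R y) R' Y := by
  have e : ∀ y, (if R' Y y then cls ν R y / ccard R y else 0)
      = ∑ z, if R' Y z then (if R z y then ν z / ccard R z else 0) else 0 := by
    intro y
    by_cases hy : R' Y y
    · rw [if_pos hy, cls, Finset.sum_div]
      refine Finset.sum_congr rfl fun z _ => ?_
      by_cases hz : R y z
      · rw [if_pos hz, if_pos (hR'.trans hy (h _ _ hz)), if_pos (hR.symm hz), ccard_congr hR hz]
      · rw [if_neg hz, if_neg (c := R z y) (fun h' => hz (hR.symm h'))]; simp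
    · rw [if_neg hy, Finset.sum_eq_zero]
      intro z _
      by_cases hz : R' Y z
      · rw [if_pos hz, if_neg]
        intro hz'; exact hy (hR'.trans hz (h _ _ hz'))
      · rw [if_neg hz]
  conv_rhs => rw [cls]
  rw [Finset.sum_congr rfl fun y _ => e y, Finset.sum_comm]
  unfold cls
  refine Finset.sum_congr rfl fun z _ => ?_
  by_cases hz : R' Y z
  · simp only [if_pos hz]
    have hc : ccard R z ≠ 0 := (zero_lt_one.trans_le (ccard_ge_one hR z)).ne'
    have : ∀ y, (if R z y then ν z / ccard R z else 0) = ν z / ccard R z * (if R z y then 1 else 0) :=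
      fun y => by split_ifs <;> simp
    rw [Finset.sum_congr rfl fun y _ => this y, ← Finset.mul_sum]
    exact (div_mul_cancel₀ _ hc).symm
  · simp [hz]

/-! ### Gibbs measure -/

structure ASeq (ρ : ℝ) (a : ℕ → ℝ) : Prop where
  hρ0 : 0 < ρ
  hρ1 : ρ < 1/3
  ha1 : a 1 = 2
  ha2 : a 2 = 2 + (2:ℝ) ^ ρ
  harec : ∀ j : ℕ, 3 ≤ j → a j = a (j-1) ^ 2 + a (j-1) ^ ρ - a (j-2) ^ (2*ρ)

lemma ASeq.ge_two {ρ : ℝ} {a : ℕ → ℝ} (h : ASeq ρ a) (j : ℕ) :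
    2 ≤ a (j+1) ∧ a (j+1) ≤ a (j+2) := by
  induction j with
  | zero =>
    have := h.ha1
    have := h.ha2
    have := Real.rpow_pos_of_pos (by norm_num : (0:ℝ) < 2) ρ
    constructor <;> simp <;> linarith
  | succ j ih =>
    obtain ⟨h1, h2⟩ := ih
    have h3 : 2 ≤ a (j+2) := h1.trans h2
    refine ⟨h3, ?_⟩
    have := h.harec (j+3) (by omega)
    simp only [show j + 3 - 1 = j + 2 by omega, show j + 3 - 2 = j + 1 by omega] at this
    rw [show j + 1 + 2 = j + 3 by ring, show j + 1 + 1 = j + 2 by ring, this]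
    have e1 := Real.rpow_pos_of_pos (show 0 < a (j+2) by linarith) ρ
    have e2 : a (j+1) ^ (2*ρ) ≤ a (j+2) := by
      calc a (j+1) ^ (2*ρ) ≤ a (j+1) ^ (1:ℝ) :=
            Real.rpow_le_rpow_of_exponent_le (by linarith) (by linarith [h.hρ1])
        _ ≤ a (j+2) := by rw [Real.rpow_one]; exact h2
    nlinarith

noncomputable def NN (a : ℕ → ℝ) : (r m : ℕ) → Om r → ℝ
  | _, 0, Y => if dep 0 Y then 2 else 1
  | 0, m+1, _ => a (m+2)
  | r+1, m+1, Y => if dep (m+1) Y then a (m+2) else NN a r m (hf false Y) * NN a r m (hf true Y)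

lemma NN_zero (a : ℕ → ℝ) (r : ℕ) (Y : Om r) : NN a r 0 Y = if dep 0 Y then 2 else 1 := by
  cases r <;> rfl
lemma NN_succ (a : ℕ → ℝ) (r m : ℕ) (Y : Om (r+1)) : NN a (r+1) (m+1) Y =
  if dep (m+1) Y then a (m+2) else NN a r m (hf false Y) * NN a r m (hf true Y) := rfl

variable {ρ : ℝ} {a : ℕ → ℝ}

lemma NN_dep (h : ASeq ρ a) {r m : ℕ} (Y : Om r) (hY : dep m Y) :
    NN a r m Y = a (m+1) := by
  cases m with
  | zero => rw [NN_zero, if_pos hY, h.ha1]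
  | succ m =>
    cases r with
    | zero => rfl
    | succ r => rw [NN_succ, if_pos hY]

lemma NN_ge_one (h : ASeq ρ a) {r m : ℕ} (Y : Om r) : 1 ≤ NN a r m Y := by
  induction m generalizing r with
  | zero => rw [NN_zero]; split_ifs <;> norm_num
  | succ m ih =>
    have h2 := (h.ge_two (m+1)).1
    cases r with
    | zero => show 1 ≤ a (m+2); linarith
    | succ r =>
      rw [NN_succ]; split_ifs
      · linarith
      · exact one_le_mul_of_one_le_of_one_le (ih _) (ih _)

lemma NN_congr {r m : ℕ} {Y Y' : Om r} (hY : Rel m Y Y') :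
    NN a r m Y = NN a r m Y' := by
  induction m generalizing r with
  | zero => rw [NN_zero, NN_zero]; simp only [dep_congr hY]
  | succ m ih =>
    cases r with
    | zero => rfl
    | succ r =>
      rw [NN_succ, NN_succ]; simp only [dep_congr hY]
      rw [Rel_succ'] at hY
      rw [ih hY.1, ih hY.2]

noncomputable def ff (ρ : ℝ) (a : ℕ → ℝ) (r m : ℕ) (Y : Om r) : ℝ := NN a r m Y ^ ρ / ccard (Rel m) Y

lemma NN_identity (h : ASeq ρ a) {r m : ℕ} (hm : m + 1 ≤ r) (Y : Om r) :
    cls (ff ρ a r m) (Rel (m+1)) Y = NN a r (m+1) Y := by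
  induction m generalizing r with
  | zero =>
    obtain ⟨r, rfl⟩ : ∃ s, r = s + 1 := ⟨r - 1, by omega⟩
    rw [NN_succ]
    have hff : ∀ Y : Om (r+1), ff ρ a (r+1) 0 Y = if dep 0 Y then 2^ρ/2 else 1 := by
      intro Y
      unfold ff
      rw [NN_zero, ccard_zero]; split_ifs <;> simp
    by_cases hd : dep 1 Y
    · rw [if_pos hd]
      obtain ⟨h0, h1⟩ := (dep_succ Y).1 hd
      have e := cls_succ (m := 0) (ff ρ a (r+1) 0) Y
      have e2 : cls (ff ρ a (r+1) 0) (Rel (0+1)) Y = cls (fun y0 => cls (fun y1 => ff ρ a (r+1) 0 (jn (y0,y1)))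
          (Rel 0) (hf true Y)) (Rel 0) (hf false Y) := by
        rw [e]
        unfold cls
        refine Finset.sum_congr rfl fun y0 _ => ?_
        by_cases h0 : Rel 0 (hf false Y) y0 <;> simp [h0]
      rw [e2, cls_zero_dep _ h0, cls_zero_dep _ h1, cls_zero_dep _ h1, hff, hff, hff, hff]
      have d1 : dep 0 (jn ((fun _ : Lam r => true), (fun _ : Lam r => true))) := by
        rw [dep_zero]; left; funext l; simp [jn]
      have d2 : dep 0 (jn ((fun _ : Lam r => false), (fun _ : Lam r => false))) := by
        rw [dep_zero]; right; funext l; simp [jn]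
      have d3 : ¬ dep 0 (jn ((fun _ : Lam r => false), (fun _ : Lam r => true))) := by
        rw [dep_iff]; intro h
        have := h (fun _ => true) (fun _ => false) (agree_zero _ _); simp [jn] at this
      have d4 : ¬ dep 0 (jn ((fun _ : Lam r => true), (fun _ : Lam r => false))) := by
        rw [dep_iff]; intro h
        have := h (fun _ => true) (fun _ => false) (agree_zero _ _); simp [jn] at this
      rw [if_pos d1, if_pos d2, if_neg d3, if_neg d4]
      rw [show 0 + 2 = 2 from rfl, h.ha2]; ring
    · rw [if_neg hd, cls_succ_prod _ (fun _ => 1) (fun _ => 1), ← ccard_eq_cls, ← ccard_eq_cls,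
        NN_zero, NN_zero, ccard_zero, ccard_zero]
      intro y0 y1 h0 h1
      rw [hff, if_neg]; · norm_num
      intro hd'
      apply hd
      have : Rel 1 Y (jn (y0, y1)) := by rw [Rel_succ']; simp [h0, h1]
      exact (dep_congr this).2 (dep_mono (by norm_num) hd')
  | succ m ih =>
    obtain ⟨r, rfl⟩ : ∃ s, r = s + 1 := ⟨r - 1, by omega⟩
    have prodcase : ∀ Y : Om (r+1), cls (fun Y => ff ρ a r m (hf false Y) * ff ρ a r m (hf true Y)) (Rel (m+1+1)) Y
        = NN a r (m+1) (hf false Y) * NN a r (m+1) (hf true Y) := by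
      intro Y
      rw [cls_succ_prod _ (ff ρ a r m) (ff ρ a r m), ih (by omega), ih (by omega)]
      intro y0 y1 _ _; simp
    have hff : ∀ Y : Om (r+1), ff ρ a (r+1) (m+1) Y = ff ρ a r m (hf false Y) * ff ρ a r m (hf true Y)
        + (if dep (m+1) Y then (a (m+2) ^ ρ - a (m+1) ^ (2*ρ)) / ccard (Rel (m+1)) Y else 0) := by
      intro Y
      unfold ff
      rw [NN_succ, ccard_succ]
      by_cases hd : dep (m+1) Y
      · rw [if_pos hd, if_pos hd]
        obtain ⟨h0, h1⟩ := (dep_succ Y).1 hd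
        rw [NN_dep h _ h0, NN_dep h _ h1]
        have : a (m+1) ^ (2*ρ) = a (m+1) ^ ρ * a (m+1) ^ ρ := by
          rw [← Real.rpow_add (by linarith [(h.ge_two m).1])]; congr 1; ring
        rw [this]
        ring
      · rw [if_neg hd, if_neg hd, Real.mul_rpow (zero_le_one.trans (NN_ge_one h _))
          (zero_le_one.trans (NN_ge_one h _))]
        ring
    have hsplit : cls (ff ρ a (r+1) (m+1)) (Rel (m+1+1)) Y
        = NN a r (m+1) (hf false Y) * NN a r (m+1) (hf true Y)
        + cls (fun Y => if dep (m+1) Y then (a (m+2) ^ ρ - a (m+1) ^ (2*ρ)) / ccard (Rel (m+1)) Y else 0)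
          (Rel (m+1+1)) Y := by
      rw [← prodcase]
      unfold cls
      rw [← Finset.sum_add_distrib]
      refine Finset.sum_congr rfl fun y _ => ?_
      split_ifs with h1 <;> simp [*]
    rw [hsplit, NN_succ]
    by_cases hd : dep (m+1+1) Y
    · rw [if_pos hd]
      obtain ⟨h0, h1⟩ := (dep_succ Y).1 hd
      rw [NN_dep h _ h0, NN_dep h _ h1]
      have : cls (fun Y => if dep (m+1) Y then (a (m+2) ^ ρ - a (m+1) ^ (2*ρ)) / ccard (Rel (m+1)) Y else 0)
          (Rel (m+1+1)) Y = a (m+2) ^ ρ - a (m+1) ^ (2*ρ) := by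
        have hz : dep (m+1) (fun _ : Lam (r+1) => false) :=
          dep_mono (Nat.zero_le _) ((dep_zero _).2 (Or.inr rfl))
        have hc : ccard (Rel (m+1)) (fun _ : Lam (r+1) => false) ≠ 0 :=
          (zero_lt_one.trans_le (ccard_ge_one (Rel_equiv _) _)).ne'
        have : ∀ y : Om (r+1), (if Rel (m+1+1) Y y then (if dep (m+1) y then
            (a (m+2) ^ ρ - a (m+1) ^ (2*ρ)) / ccard (Rel (m+1)) y else 0) else 0)
            = (a (m+2) ^ ρ - a (m+1) ^ (2*ρ)) / ccard (Rel (m+1)) (fun _ : Lam (r+1) => false)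
              * (if Rel (m+1) (fun _ : Lam (r+1) => false) y then 1 else 0) := by
          intro y
          by_cases hy : dep (m+1) y
          · have r1 : Rel (m+1+1) Y y := dep_rel hd (dep_mono (by omega) hy)
            have r2 := dep_rel hz hy
            rw [if_pos hy, if_pos r1, if_pos r2, ccard_congr (Rel_equiv _) r2]; ring
          · rw [if_neg hy, if_neg (c := Rel (m+1) _ y)]; · simp
            intro h'; exact hy ((dep_congr h').1 hz)
        rw [cls, Finset.sum_congr rfl fun y _ => this y, ← Finset.mul_sum]
        exact div_mul_cancel₀ _ hc
      rw [this]
      have := h.harec (m+3) (by omega)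
      simp only [show m + 3 - 1 = m + 2 by omega, show m + 3 - 2 = m + 1 by omega] at this
      rw [show m + 1 + 2 = m + 3 by ring, this, show m+1+1 = m+2 by ring]; ring
    · rw [if_neg hd]
      have : cls (fun Y => if dep (m+1) Y then (a (m+2) ^ ρ - a (m+1) ^ (2*ρ)) / ccard (Rel (m+1)) Y else 0)
          (Rel (m+1+1)) Y = 0 := by
        unfold cls
        refine Finset.sum_eq_zero fun y _ => ?_
        by_cases h1 : Rel (m+1+1) Y y
        · rw [if_pos h1]
          refine if_neg ?_
          intro hy; exact hd ((dep_congr h1).2 (dep_mono (by omega) hy))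
        · rw [if_neg h1]
      rw [this, add_zero]

end EH

namespace EH

variable {ρ : ℝ} {a : ℕ → ℝ}

noncomputable def GG (ρ : ℝ) (a : ℕ → ℝ) (r m : ℕ) (Y : Om r) : ℝ :=
  ∏ k ∈ Finset.Ico m r, (NN a r k Y ^ ρ / NN a r (k+1) Y)

noncomputable def nu (ρ : ℝ) (a : ℕ → ℝ) (r : ℕ) (Y : Om r) : ℝ :=
  GG ρ a r 0 Y / ccard (Rel 0) Y

lemma NN_pos (h : ASeq ρ a) {r m : ℕ} (Y : Om r) : 0 < NN a r m Y :=
  zero_lt_one.trans_le (NN_ge_one h Y)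

lemma GG_pos (h : ASeq ρ a) {r m : ℕ} (Y : Om r) : 0 < GG ρ a r m Y :=
  Finset.prod_pos fun _ _ => div_pos (Real.rpow_pos_of_pos (NN_pos h Y) _) (NN_pos h Y)

lemma GG_congr {r m : ℕ} {Y Y' : Om r} (hY : Rel m Y Y') : GG ρ a r m Y = GG ρ a r m Y' := by
  unfold GG
  refine Finset.prod_congr rfl fun k hk => ?_
  rw [Finset.mem_Ico] at hk
  rw [NN_congr (Rel_mono hk.1 hY), NN_congr (Rel_mono (hk.1.trans (Nat.le_succ k)) hY)]

lemma cls_nu (h : ASeq ρ a) {r m : ℕ} (hm : m ≤ r) (Y : Om r) :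
    cls (nu ρ a r) (Rel m) Y = GG ρ a r m Y := by
  induction m generalizing Y with
  | zero =>
    have : ∀ y, (if Rel 0 Y y then nu ρ a r y else 0) =
        GG ρ a r 0 Y / ccard (Rel 0) Y * (if Rel 0 Y y then 1 else 0) := by
      intro y
      split_ifs with hy
      · rw [nu, GG_congr hy, ccard_congr (Rel_equiv 0) hy, mul_one]
      · simp
    rw [cls, Finset.sum_congr rfl fun y _ => this y, ← Finset.mul_sum]
    exact div_mul_cancel₀ _ (zero_lt_one.trans_le (ccard_ge_one (Rel_equiv 0) Y)).ne'
  | succ m ih =>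
    rw [cls_avg _ (Rel_equiv m) (Rel_equiv (m+1)) (fun y y' h => Rel_mono (Nat.le_succ m) h)]
    have : ∀ y, (if Rel (m+1) Y y then (fun y => cls (nu ρ a r) (Rel m) y / ccard (Rel m) y) y else 0)
        = GG ρ a r (m+1) Y / NN a r (m+1) Y * (if Rel (m+1) Y y then ff ρ a r m y else 0) := by
      intro y
      by_cases hy : Rel (m+1) Y y
      · rw [if_pos hy, if_pos hy]
        dsimp only
        rw [ih (by omega), GG_congr hy, NN_congr hy, ff, GG, Finset.prod_eq_prod_Ico_succ_bot (by omega),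
          ← GG]
        ring
      · simp [hy]
    rw [cls, Finset.sum_congr rfl fun y _ => this y, ← Finset.mul_sum]
    have e := NN_identity h hm Y
    unfold cls at e
    rw [e]
    exact div_mul_cancel₀ _ (NN_pos h Y).ne'

lemma nu_law (h : ASeq ρ a) (r : ℕ) : IsLaw (nu ρ a r) where
  pos := fun y => div_pos (GG_pos h y) (zero_lt_one.trans_le (ccard_ge_one (Rel_equiv 0) y))
  sum := by
    have := cls_nu h (le_refl r) (fun _ => true)
    rw [GG, Finset.Ico_self, Finset.prod_empty] at this
    rw [← this, cls]
    exact Finset.sum_congr rfl fun y _ => (if_pos (Rel_top le_rfl _ _)).symm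

noncomputable def hh (ρ : ℝ) (a : ℕ → ℝ) (r m : ℕ) : ℝ := Ent (nu ρ a r) (Rel m)

lemma hh_diff (h : ASeq ρ a) {r m : ℕ} (hm : m < r) :
    hh ρ a r m - hh ρ a r (m+1) = (∑ y, nu ρ a r y * Real.log (NN a r (m+1) y))
      - ρ * ∑ y, nu ρ a r y * Real.log (NN a r m y) := by
  unfold hh Ent
  rw [Finset.mul_sum, ← Finset.sum_sub_distrib, neg_sub_neg, ← Finset.sum_sub_distrib]
  refine Finset.sum_congr rfl fun y _ => ?_
  rw [cls_nu h hm.le, cls_nu h hm]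
  have : GG ρ a r m y = NN a r m y ^ ρ / NN a r (m+1) y * GG ρ a r (m+1) y := by
    rw [GG, Finset.prod_eq_prod_Ico_succ_bot hm]; rfl
  have p1 := NN_pos h (m := m) y
  have p2 := NN_pos h (m := m+1) y
  have p3 := GG_pos h (m := m+1) y
  have p4 := Real.rpow_pos_of_pos p1 ρ
  rw [this, Real.log_mul (div_pos p4 p2).ne' p3.ne', Real.log_div p4.ne' p2.ne', Real.log_rpow p1]
  ring

lemma hh_top (h : ASeq ρ a) (r : ℕ) : hh ρ a r r = 0 :=
  Ent_univ (nu_law h r) fun _ _ => Rel_top le_rfl _ _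

lemma hh_anti (h : ASeq ρ a) (r : ℕ) {m m' : ℕ} (hm : m ≤ m') : hh ρ a r m' ≤ hh ρ a r m :=
  Ent_anti (nu_law h r) (Rel_equiv m) fun _ _ h => Rel_mono hm h

lemma card_Om (r : ℕ) : Fintype.card (Om r) = 2 ^ (2 ^ r) := by simp

lemma hh_le (h : ASeq ρ a) (r m : ℕ) : hh ρ a r m ≤ 2 ^ r * Real.log 2 := by
  have := Ent_le_log_card (nu_law h r) (Rel_equiv m)
  rw [card_Om] at this
  push_cast at this
  rw [Real.log_pow] at this
  push_cast at this
  exact this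

lemma hh_main (h : ASeq ρ a) (r : ℕ) :
    Real.log (a (r+1)) - Real.log 2 ≤
      ∑ l ∈ Finset.range r, ρ ^ l * (hh ρ a r (r - (l+1)) - hh ρ a r (r - l)) := by
  set e : ℕ → ℝ := fun m => ∑ y, nu ρ a r y * Real.log (NN a r m y) with he
  have key : ∀ k ≤ r, ∑ l ∈ Finset.range k, ρ ^ l * (hh ρ a r (r - (l+1)) - hh ρ a r (r - l))
      = e r - ρ ^ k * e (r - k) := by
    intro k
    induction k with
    | zero => intro _; simp
    | succ k ih =>
      intro hk
      rw [Finset.sum_range_succ, ih (by omega)]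
      have := hh_diff h (r := r) (m := r - (k+1)) (by omega)
      rw [show r - (k+1) + 1 = r - k by omega] at this
      rw [this]
      simp only [he]
      ring
  rw [key r le_rfl]
  have e1 : e r = Real.log (a (r+1)) := by
    simp only [he]
    rw [Finset.sum_congr rfl fun y _ => by rw [NN_dep h y (dep_top le_rfl y)], ← Finset.sum_mul,
      (nu_law h r).sum, one_mul]
  have e2 : e (r - r) ≤ Real.log 2 := by
    simp only [he, Nat.sub_self]
    calc _ ≤ ∑ y, nu ρ a r y * Real.log 2 := by
          refine Finset.sum_le_sum fun y _ => mul_le_mul_of_nonneg_left ?_ ((nu_law h r).pos y).le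
          refine Real.log_le_log (NN_pos h y) ?_
          rw [NN_zero]; split_ifs <;> norm_num
      _ = _ := by rw [← Finset.sum_mul, (nu_law h r).sum, one_mul]
  have h3 : ρ ^ r * e (r-r) ≤ Real.log 2 := by
    have hp : 0 ≤ ρ ^ r := pow_nonneg h.hρ0.le r
    have hp1 : ρ ^ r ≤ 1 := pow_le_one₀ h.hρ0.le (by linarith [h.hρ1])
    have := Real.log_pos (by norm_num : (1:ℝ) < 2)
    nlinarith
  linarith

/-! ### Automorphisms -/

def IsAut {r : ℕ} (g : Equiv.Perm (Lam r)) : Prop :=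
  ∀ m l l', agree m (g l) (g l') ↔ agree m l l'

lemma IsAut.symm {r : ℕ} {g : Equiv.Perm (Lam r)} (h : IsAut g) : IsAut g.symm := by
  intro m l l'
  have := h m (g.symm l) (g.symm l')
  simpa using this.symm

def Inv {r : ℕ} (ν : Om r → ℝ) : Prop :=
  ∀ g : Equiv.Perm (Lam r), IsAut g → ∀ Y, ν (Y ∘ g) = ν Y

lemma dep_comp {r m : ℕ} {g : Equiv.Perm (Lam r)} (h : IsAut g) (Y : Om r) :
    dep m (Y ∘ g) ↔ dep m Y := by
  rw [dep_iff, dep_iff]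
  constructor
  · intro H l l' hl
    have := H (g.symm l) (g.symm l') ((h.symm m l l').2 hl)
    simpa using this
  · intro H l l' hl
    exact H _ _ ((h m l l').2 hl)

lemma aut_decomp {r : ℕ} {g : Equiv.Perm (Lam (r+1))} (h : IsAut g) :
    ∃ (s : Equiv.Perm Bool) (k : Bool → Equiv.Perm (Lam r)), (∀ b, IsAut (k b)) ∧
      ∀ b t, g (Fin.cons b t) = Fin.cons (s b) (k b t) := by
  have hs : ∀ b t t', g (Fin.cons b t) 0 = g (Fin.cons b t') 0 := by
    intro b t t'
    have := (h 1 (Fin.cons b t) (Fin.cons b t')).2 ((agree_cons _ _ _ _).2 ⟨rfl, agree_zero _ _⟩)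
    exact this 0 (by simp)
  let s0 : Bool → Bool := fun b => g (Fin.cons b fun _ => false) 0
  have hs0 : Function.Injective s0 := by
    intro b b' hb
    have : agree 1 (g (Fin.cons b fun _ => false)) (g (Fin.cons b' fun _ => false)) := by
      intro i hi
      have : i = 0 := Fin.ext (by simpa using hi)
      rw [this]; exact hb
    rw [h 1, agree_cons] at this
    exact this.1
  let k0 : Bool → Lam r → Lam r := fun b t => Fin.tail (g (Fin.cons b t))
  have hg : ∀ b t, g (Fin.cons b t) = Fin.cons (s0 b) (k0 b t) := by
    intro b t
    have : s0 b = g (Fin.cons b t) 0 := hs _ _ _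
    rw [this]; exact (Fin.cons_self_tail _).symm
  have hk : ∀ b m t t', agree m (k0 b t) (k0 b t') ↔ agree m t t' := by
    intro b m t t'
    have := h (m+1) (Fin.cons b t) (Fin.cons b t')
    rw [hg, hg, agree_cons, agree_cons] at this
    simpa using this
  have hk0 : ∀ b, Function.Injective (k0 b) := by
    intro b t t' ht
    have := (hk b r t t').1 (by rw [ht]; exact agree_refl _)
    exact agree_eq le_rfl this
  refine ⟨Equiv.ofBijective s0 (Finite.injective_iff_bijective.1 hs0),
    fun b => Equiv.ofBijective (k0 b) (Finite.injective_iff_bijective.1 (hk0 b)), ?_, ?_⟩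
  · intro b m t t'
    exact hk b m t t'
  · intro b t; exact hg b t

lemma NN_comp {r m : ℕ} {g : Equiv.Perm (Lam r)} (h : IsAut g) (Y : Om r) :
    NN a r m (Y ∘ g) = NN a r m Y := by
  induction m generalizing r with
  | zero => rw [NN_zero, NN_zero]; simp only [dep_comp h]
  | succ m ih =>
    cases r with
    | zero => rfl
    | succ r =>
      rw [NN_succ, NN_succ]; simp only [dep_comp h]
      obtain ⟨s, k, hk, hg⟩ := aut_decomp h
      have e : ∀ b, hf b (Y ∘ g) = hf (s b) Y ∘ (k b) := by
        intro b; funext t; simp [hf, hg]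
      have : NN a r m (hf false (Y ∘ g)) * NN a r m (hf true (Y ∘ g))
          = NN a r m (hf false Y) * NN a r m (hf true Y) := by
        rw [e, e, ih (hk _), ih (hk _)]
        have hb : s false ≠ s true := fun h => by simpa using s.injective h
        cases h1 : s false <;> cases h2 : s true <;> simp_all
        exact mul_comm _ _
      rw [this]

lemma nu_inv (r : ℕ) : Inv (nu ρ a r) := by
  intro g hg Y
  unfold nu GG
  rw [ccard_zero, ccard_zero]
  simp only [dep_comp hg, NN_comp hg]

/-! ### Marginals -/

noncomputable def mg {r : ℕ} (ν : Om (r+1) → ℝ) : Om r → ℝ := fun y => ∑ y', ν (jn (y, y'))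

lemma sum_split {r : ℕ} (f : Om (r+1) → ℝ) : ∑ Y, f Y = ∑ y0, ∑ y1, f (jn (y0, y1)) := by
  rw [← Equiv.sum_comp (splitEquiv r), Fintype.sum_prod_type]; rfl

lemma mg_law {r : ℕ} {ν : Om (r+1) → ℝ} (h : IsLaw ν) : IsLaw (mg ν) where
  pos := fun y => Finset.sum_pos (fun _ _ => h.pos _) Finset.univ_nonempty
  sum := by rw [← h.sum, sum_split]; rfl

def bothAut {r : ℕ} (s : Equiv.Perm Bool) (g : Equiv.Perm (Lam r)) : Equiv.Perm (Lam (r+1)) where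
  toFun := fun l => Fin.cons (s (l 0)) (g (Fin.tail l))
  invFun := fun l => Fin.cons (s.symm (l 0)) (g.symm (Fin.tail l))
  left_inv := fun l => by simp [Fin.cons_self_tail]
  right_inv := fun l => by simp [Fin.cons_self_tail]

lemma bothAut_aut {r : ℕ} (s : Equiv.Perm Bool) {g : Equiv.Perm (Lam r)} (h : IsAut g) :
    IsAut (bothAut s g) := by
  intro m l l'
  cases m with
  | zero => exact ⟨fun _ => agree_zero _ _, fun _ => agree_zero _ _⟩
  | succ m =>
    show agree (m+1) (Fin.cons (s (l 0)) (g (Fin.tail l)) : Lam (r+1))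
      (Fin.cons (s (l' 0)) (g (Fin.tail l'))) ↔ _
    rw [agree_cons, h m]
    conv_rhs => rw [← Fin.cons_self_tail l, ← Fin.cons_self_tail l', agree_cons]
    simp

lemma mg_inv {r : ℕ} {ν : Om (r+1) → ℝ} (h : Inv ν) : Inv (mg ν) := by
  intro g hg Y
  unfold mg
  rw [← Equiv.sum_comp (g.arrowCongr (Equiv.refl Bool)).symm]
  refine Finset.sum_congr rfl fun y _ => ?_
  rw [← h (bothAut (Equiv.refl _) g) (bothAut_aut _ hg) (jn (Y, y))]
  congr 1

lemma mg_snd {r : ℕ} {ν : Om (r+1) → ℝ} (h : Inv ν) (y : Om r) :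
    ∑ y', ν (jn (y', y)) = mg ν y := by
  unfold mg
  refine Finset.sum_congr rfl fun y' _ => ?_
  rw [← h (bothAut Equiv.boolNot (Equiv.refl _)) (bothAut_aut _ fun _ _ _ => Iff.rfl) (jn (y', y))]
  congr 1
  funext l
  cases h0 : l 0 <;> simp [jn, bothAut, h0]

lemma Ent_half {r m : ℕ} {ν : Om (r+1) → ℝ} (hl : IsLaw ν) (hi : Inv ν) :
    Ent ν (Rel (m+1)) ≤ 2 * Ent (mg ν) (Rel m) := by
  have heq : ∀ b, Equivalence (fun Y Y' : Om (r+1) => Rel m (hf b Y) (hf b Y')) := fun b =>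
    ⟨fun _ => (Rel_equiv m).refl _, fun h => (Rel_equiv m).symm h, fun h h' => (Rel_equiv m).trans h h'⟩
  have hs := Ent_submod hl (heq false) (heq true) (Rel_equiv (m+1)) (Rp := fun _ _ => True)
    ⟨fun _ => trivial, fun _ => trivial, fun _ _ => trivial⟩
    (fun y y' h h' => (Rel_succ' _ _).2 ⟨h, h'⟩) (fun _ _ _ => trivial) (fun _ _ _ => trivial)
  rw [Ent_univ hl (R := fun _ _ => True) (fun _ _ => trivial)] at hs
  have e0 : Ent ν (fun Y Y' : Om (r+1) => Rel m (hf false Y) (hf false Y')) = Ent (mg ν) (Rel m) := by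
    have hc : ∀ y0 y1, cls ν (fun Y Y' : Om (r+1) => Rel m (hf false Y) (hf false Y')) (jn (y0, y1))
        = cls (mg ν) (Rel m) y0 := by
      intro y0 y1
      unfold cls
      rw [sum_split]
      refine Finset.sum_congr rfl fun z0 _ => ?_
      simp only [hf_false_jn]
      by_cases h : Rel m y0 z0 <;> simp [h, mg]
    unfold Ent
    rw [sum_split]
    congr 1
    refine Finset.sum_congr rfl fun y0 _ => ?_
    simp only [hc]
    rw [← Finset.sum_mul]; rfl
  have e1 : Ent ν (fun Y Y' : Om (r+1) => Rel m (hf true Y) (hf true Y')) = Ent (mg ν) (Rel m) := by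
    have hc : ∀ y0 y1, cls ν (fun Y Y' : Om (r+1) => Rel m (hf true Y) (hf true Y')) (jn (y0, y1))
        = cls (mg ν) (Rel m) y1 := by
      intro y0 y1
      unfold cls
      rw [sum_split, Finset.sum_comm]
      refine Finset.sum_congr rfl fun z0 _ => ?_
      simp only [hf_true_jn]
      by_cases h : Rel m y1 z0 <;> simp [h]
      exact mg_snd hi _
    unfold Ent
    rw [sum_split, Finset.sum_comm]
    congr 1
    refine Finset.sum_congr rfl fun y0 _ => ?_
    simp only [hc]
    rw [← Finset.sum_mul, mg_snd hi]
  rw [e0, e1] at hs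
  linarith

noncomputable def mgk {j : ℕ} : (k : ℕ) → (Om (j+k) → ℝ) → Om j → ℝ
  | 0, ν => ν
  | k+1, ν => mgk k (mg ν)

lemma mgk_spec {j : ℕ} (k : ℕ) (ν : Om (j+k) → ℝ) (hl : IsLaw ν) (hi : Inv ν) :
    IsLaw (mgk k ν) ∧ Inv (mgk k ν) ∧ ∀ m, Ent ν (Rel (m+k)) ≤ 2^k * Ent (mgk k ν) (Rel m) := by
  induction k with
  | zero => exact ⟨hl, hi, fun m => by simp [mgk]⟩
  | succ k ih =>
    obtain ⟨h1, h2, h3⟩ := ih (mg ν) (mg_law hl) (mg_inv hi)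
    refine ⟨h1, h2, fun m => ?_⟩
    have e1 := Ent_half (m := m + k) hl hi
    have e2 := h3 m
    show Ent ν (Rel (m + k + 1)) ≤ 2^(k+1) * Ent (mgk k (mg ν)) (Rel m)
    rw [pow_succ]
    linarith

/-- the level-`j` law -/
noncomputable def mu (ρ : ℝ) (a : ℕ → ℝ) (r j : ℕ) : Om j → ℝ := mgk (r - j) (nu ρ a (j + (r - j)))

lemma mu_spec (h : ASeq ρ a) {r j : ℕ} (hj : j ≤ r) :
    IsLaw (mu ρ a r j) ∧ Inv (mu ρ a r j) ∧
      ∀ m, hh ρ a r (m + (r - j)) ≤ 2^(r-j) * Ent (mu ρ a r j) (Rel m) := by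
  obtain ⟨h1, h2, h3⟩ := mgk_spec (r - j) (nu ρ a (j + (r - j))) (nu_law h _) (nu_inv _)
  refine ⟨h1, h2, fun m => ?_⟩
  have := h3 m
  have e : Ent (nu ρ a (j + (r-j))) (Rel (m + (r-j))) = hh ρ a (j + (r - j)) (m + (r-j)) := rfl
  rw [e] at this
  have e2 : hh ρ a (j + (r - j)) (m + (r-j)) = hh ρ a r (m + (r-j)) := by
    rw [show j + (r - j) = r by omega]
  rw [e2] at this
  exact this

end EH

namespace EH

/-! ### Invariant subspaces -/

def tr {r : ℕ} (j : ℕ) (l : Lam r) : Lam j := fun i => if h : i.val < r then l ⟨i.val, h⟩ else false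

lemma tr_agree {r j m : ℕ} {l l' : Lam r} (h : agree m l l') : agree m (tr j l) (tr j l') := by
  intro i hi
  unfold tr
  split_ifs with h1
  · exact h _ hi
  · rfl

lemma tr_tr {r j : ℕ} (hj : j ≤ r) (u : Lam j) : tr j (tr r u) = u := by
  funext i
  have : i.val < r := i.2.trans_le hj
  simp [tr, this]

lemma agree_of_tr {r j : ℕ} (hj : j ≤ r) {l l' : Lam r} (h : tr j l = tr j l') : agree j l l' := by
  intro i hi
  have := congrFun h ⟨i.val, hi⟩
  simpa [tr] using this

lemma agree_tr_tr {r j : ℕ} (l : Lam r) : agree j (tr r (tr j l)) l := by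
  intro i hi
  simp [tr, hi]

/-- pull back along `tr` -/
noncomputable def upl (r j : ℕ) : (Lam j → ℝ) →ₗ[ℝ] (Lam r → ℝ) := LinearMap.funLeft ℝ ℝ (tr j)

lemma upl_apply {r j : ℕ} (x : Lam j → ℝ) (l : Lam r) : upl r j x l = x (tr j l) := rfl

lemma upl_mem {r j m : ℕ} (hj : j ≤ r) (x : Lam j → ℝ) : upl r j x ∈ VV r m ↔ x ∈ VV j m := by
  constructor
  · intro h l l' hl
    have := h (tr r l) (tr r l') (tr_agree hl)
    rwa [upl_apply, upl_apply, tr_tr hj, tr_tr hj] at this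
  · intro h l l' hl
    exact h _ _ (tr_agree hl)

lemma upl_mem_self {r j : ℕ} (hj : j ≤ r) (x : Lam j → ℝ) : upl r j x ∈ VV r j :=
  (upl_mem hj x).2 (by rw [VV_top le_rfl]; trivial)

lemma finrank_VV {r m : ℕ} (hm : m ≤ r) : Module.finrank ℝ (VV r m) = 2 ^ m := by
  have hr : LinearMap.range (upl r m) = VV r m := by
    ext x
    constructor
    · rintro ⟨y, rfl⟩; exact upl_mem_self hm y
    · intro hx
      refine ⟨fun u => x (tr r u), ?_⟩
      funext l
      exact hx _ _ (agree_tr_tr l)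
  have hi : Function.Injective (upl r m) := by
    intro x y h
    funext u
    have := congrFun h (tr r u)
    rwa [upl_apply, upl_apply, tr_tr hm] at this
  rw [← hr, LinearMap.finrank_range_of_inj hi]
  simp

/-- Action of a permutation. -/
noncomputable def act {r : ℕ} (g : Equiv.Perm (Lam r)) : (Lam r → ℝ) →ₗ[ℝ] (Lam r → ℝ) :=
  LinearMap.funLeft ℝ ℝ g

lemma act_apply {r : ℕ} (g : Equiv.Perm (Lam r)) (x : Lam r → ℝ) (l : Lam r) :
    act g x l = x (g l) := rfl

def InvS {r : ℕ} (U : Submodule ℝ (Lam r → ℝ)) : Prop :=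
  ∀ g : Equiv.Perm (Lam r), IsAut g → ∀ x ∈ U, act g x ∈ U

lemma InvS_VV (r m : ℕ) : InvS (VV r m) := by
  intro g hg x hx l l' hl
  exact hx _ _ ((hg m l l').2 hl)

lemma InvS.inf {r : ℕ} {U U' : Submodule ℝ (Lam r → ℝ)} (h : InvS U) (h' : InvS U') :
    InvS (U ⊓ U') := fun g hg x hx => ⟨h g hg x hx.1, h' g hg x hx.2⟩

def fl {r : ℕ} (i : ℕ) (l : Lam r) : Lam r := fun k => if k.val = i then !(l k) else l k

lemma fl_fl {r : ℕ} (i : ℕ) (l : Lam r) : fl i (fl i l) = l := by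
  funext k; unfold fl; split_ifs <;> simp

lemma fl_agree {r i : ℕ} (l : Lam r) : agree i (fl i l) l := by
  intro k hk; unfold fl; rw [if_neg hk.ne]

lemma fl_agree_iff {r i m : ℕ} (l l' : Lam r) : agree m (fl i l) (fl i l') ↔ agree m l l' := by
  unfold agree fl
  refine forall_congr' fun k => ?_
  split_ifs <;> simp

/-- flip bit i globally -/
def flp {r : ℕ} (i : ℕ) : Equiv.Perm (Lam r) := ⟨fl i, fl i, fl_fl i, fl_fl i⟩

lemma flp_aut {r : ℕ} (i : ℕ) : IsAut (flp (r := r) i) := fun _ l l' => fl_agree_iff l l'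

/-- flip bit i below the head of `u` -/
noncomputable def flu {r : ℕ} (i : ℕ) (u l : Lam r) : Lam r := if agree i l u then fl i l else l

lemma flu_agree {r i : ℕ} (u l : Lam r) : agree i (flu i u l) l := by
  unfold flu; split_ifs
  · exact fl_agree l
  · exact agree_refl l

lemma flu_flu {r : ℕ} (i : ℕ) (u l : Lam r) : flu i u (flu i u l) = l := by
  by_cases h : agree i l u
  · have h' : agree i (fl i l) u := agree_trans (fl_agree l) h
    have e : flu i u l = fl i l := if_pos h
    rw [e, flu, if_pos h', fl_fl]
  · have e : flu i u l = l := if_neg h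
    rw [e, e]

noncomputable def flup {r : ℕ} (i : ℕ) (u : Lam r) : Equiv.Perm (Lam r) :=
  ⟨flu i u, flu i u, flu_flu i u, flu_flu i u⟩

lemma flup_aut {r : ℕ} (i : ℕ) (u : Lam r) : IsAut (flup (r := r) i u) := by
  have key : ∀ m l l', agree m l l' → agree m (flu i u l) (flu i u l') := by
    intro m l l' h
    by_cases hm : m ≤ i
    · exact agree_trans (agree_mono hm (flu_agree u l))
        (agree_trans h (agree_symm (agree_mono hm (flu_agree u l'))))
    · have h1 := agree_mono (not_le.1 hm).le h
      have : agree i l u ↔ agree i l' u :=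
        ⟨fun h => agree_trans (agree_symm h1) h, fun h => agree_trans h1 h⟩
      unfold flu
      simp only [this]
      split_ifs
      · exact (fl_agree_iff _ _).2 h
      · exact h
  intro m l l'
  refine ⟨fun h => ?_, key m l l'⟩
  have := key m _ _ h
  show agree m l l'
  have e : ∀ l, flu i u ((flup i u) l) = l := flu_flu i u
  rwa [e, e] at this

def xorp {r : ℕ} (t : Lam r) : Equiv.Perm (Lam r) where
  toFun := fun l k => xor (l k) (t k)
  invFun := fun l k => xor (l k) (t k)
  left_inv := fun l => by funext k; simp
  right_inv := fun l => by funext k; simp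

lemma xorp_aut {r : ℕ} (t : Lam r) : IsAut (xorp t) := by
  intro m l l'
  unfold agree xorp
  refine forall_congr' fun k => ?_
  simp

noncomputable def haar {r : ℕ} (k : ℕ) (u : Lam r) : Lam r → ℝ := fun l =>
  if agree k l u then (if agree (k+1) l u then 1 else -1) else 0

lemma agree_succ_fl {r k : ℕ} {l u : Lam r} (h : agree k l u) (h' : ¬ agree (k+1) l u) :
    agree (k+1) (fl k l) u := by
  intro i hi
  by_cases hik : i.val = k
  · have : l i ≠ u i := by
      intro he
      apply h'
      intro i' hi'
      by_cases h2 : i'.val = k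
      · have : i' = i := Fin.ext (h2.trans hik.symm)
        rw [this]; exact he
      · exact h i' (by omega)
    unfold fl
    rw [if_pos hik]
    cases hl : l i <;> cases hu : u i <;> simp_all
  · unfold fl; rw [if_neg hik]; exact h i (by omega)

lemma not_agree_fl {r k : ℕ} (hk : k < r) {l u : Lam r} (h : agree (k+1) l u) :
    ¬ agree (k+1) (fl k l) u := by
  intro h'
  have h1 := h ⟨k, hk⟩ (Nat.lt_succ_self k)
  have h2 := h' ⟨k, hk⟩ (Nat.lt_succ_self k)
  simp [fl, h1] at h2

lemma inv_dich {r k : ℕ} (hk : k < r) {U : Submodule ℝ (Lam r → ℝ)} (hU : InvS U)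
    (hP : ¬ VV r (k+1) ≤ U ⊔ VV r k) : U ⊓ VV r (k+1) ≤ VV r k := by
  intro x hx
  by_contra hn
  apply hP
  rw [mem_VV] at hn
  push Not at hn
  obtain ⟨l0, l1, hl, hne⟩ := hn
  have hna : ¬ agree (k+1) l0 l1 := fun h => hne (hx.2 _ _ h)
  have hval : x (fl k l0) = x l1 := hx.2 _ _ (agree_succ_fl hl hna)
  -- haar at l0
  have h0 : haar k l0 ∈ U := by
    have h1 := U.sub_mem hx.1 (hU _ (flup_aut k l0) x hx.1)
    have h2 := U.smul_mem (x l0 - x l1)⁻¹ h1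
    convert h2 using 1
    funext l
    have hne' : x l0 - x l1 ≠ 0 := sub_ne_zero.2 hne
    show haar k l0 l = (x l0 - x l1)⁻¹ * (x l - x (flu k l0 l))
    unfold haar flu
    by_cases ha : agree k l l0
    · rw [if_pos ha, if_pos ha]
      by_cases hb : agree (k+1) l l0
      · rw [if_pos hb, hx.2 _ _ hb, hx.2 _ _ ((fl_agree_iff (i := k) l l0).2 hb), hval]
        field_simp
      · rw [if_neg hb]
        have h3 := agree_succ_fl ha hb
        have h4 : agree (k+1) l (fl k l0) := by
          have := (fl_agree_iff (i := k) (fl k l) l0).2 h3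
          rwa [fl_fl] at this
        rw [hx.2 _ _ h3, hx.2 _ _ h4, hval]
        field_simp
        ring
    · rw [if_neg ha, if_neg ha]; simp
  have hall : ∀ u, haar k u ∈ U := by
    intro u
    have := hU _ (xorp_aut (fun i => xor (l0 i) (u i))) _ h0
    convert this using 1
    funext l
    rw [act_apply]
    have e : ∀ m, agree m (xorp (fun i => xor (l0 i) (u i)) l) l0 ↔ agree m l u := by
      intro m
      unfold agree xorp
      refine forall_congr' fun i => ?_
      simp only [Equiv.coe_fn_mk]
      cases l i <;> cases l0 i <;> cases u i <;> simp
    unfold haar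
    simp only [e]
  intro v hv
  set w : Lam r → ℝ := fun l => (v l - v (fl k l)) / 2 with hw
  have hvw : v = w + (fun l => (v l + v (fl k l)) / 2) := by
    funext l; simp only [hw, Pi.add_apply]; ring
  rw [hvw]
  refine Submodule.add_mem_sup ?_ ?_
  · set n : Lam r → ℝ := fun u => ∑ u' : Lam r, if agree k u u' then (1:ℝ) else 0 with hn
    have hnpos : ∀ u, n u ≠ 0 := by
      intro u
      have := Finset.single_le_sum (f := fun u' => if agree k u u' then (1:ℝ) else 0)
        (s := Finset.univ) (fun z _ => by split_ifs <;> norm_num) (Finset.mem_univ u)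
      simp only [agree_refl, if_true] at this
      exact (zero_lt_one.trans_le this).ne'
    have hncongr : ∀ u u', agree k u u' → n u = n u' := by
      intro u u' h
      simp only [hn]
      refine Finset.sum_congr rfl fun z _ => ?_
      have : agree k u z ↔ agree k u' z :=
        ⟨fun h1 => agree_trans (agree_symm h) h1, fun h1 => agree_trans h h1⟩
      simp only [this]
    have : w = ∑ u, (w u / n u) • haar k u := by
      funext l
      rw [Finset.sum_apply]
      have e : ∀ u, ((w u / n u) • haar k u) l = (w l / n l) * (if agree k l u then 1 else 0) := by
        intro u
        rw [Pi.smul_apply, smul_eq_mul]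
        unfold haar
        by_cases ha : agree k l u
        · rw [if_pos ha, if_pos ha, hncongr l u ha]
          by_cases hb : agree (k+1) l u
          · rw [if_pos hb]
            have : w l = w u := by
              simp only [hw]
              rw [hv _ _ hb, hv _ _ ((fl_agree_iff (i := k) l u).2 hb)]
            rw [this]
          · rw [if_neg hb]
            have h3 := agree_succ_fl ha hb
            have h4 : agree (k+1) l (fl k u) := by
              have := (fl_agree_iff (i := k) (fl k l) u).2 h3
              rwa [fl_fl] at this
            have : w l = - w u := by
              simp only [hw]
              rw [hv _ _ h3, hv _ _ h4]; ring
            rw [this]; ring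
        · rw [if_neg ha, if_neg ha]; simp
      rw [Finset.sum_congr rfl fun u _ => e u, ← Finset.mul_sum]
      exact (div_mul_cancel₀ _ (hnpos l)).symm
    rw [this]
    exact U.sum_mem fun u _ => U.smul_mem _ (hall u)
  · intro l l' h
    dsimp only
    by_cases hb : agree (k+1) l l'
    · rw [hv _ _ hb, hv _ _ ((fl_agree_iff (i := k) l l').2 hb)]
    · have h3 := agree_succ_fl h hb
      have h4 : agree (k+1) l (fl k l') := by
        have := (fl_agree_iff (i := k) (fl k l) l').2 h3
        rwa [fl_fl] at this
      rw [hv _ _ h3, hv _ _ h4]; ring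

/-! ### The six-fibre bound -/

def Zc {r : ℕ} (k : ℕ) (y y' : Om r) : Prop := ∀ l l', agree k l l' →
  (bv y l - bv y' l) + (bv y (fl (k+1) l) - bv y' (fl (k+1) l))
  = (bv y l' - bv y' l') + (bv y (fl (k+1) l') - bv y' (fl (k+1) l'))

lemma Zc_equiv {r : ℕ} (k : ℕ) : Equivalence (Zc (r := r) k) where
  refl := fun y l l' _ => by simp
  symm := fun {y y'} h l l' hl => by have := h l l' hl; linarith
  trans := fun {x y z} h h' l l' hl => by have := h l l' hl; have := h' l l' hl; linarith

lemma fl_cons {r : ℕ} (i : ℕ) (b : Bool) (t : Lam r) :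
    fl (i+1) (Fin.cons b t : Lam (r+1)) = Fin.cons b (fl i t) := by
  funext k
  refine Fin.cases ?_ (fun k => ?_) k
  · simp [fl]
  · simp [fl]

lemma Zc_succ {r k : ℕ} (Y Y' : Om (r+1)) :
    Zc (k+1) Y Y' ↔ Zc k (hf false Y) (hf false Y') ∧ Zc k (hf true Y) (hf true Y') := by
  have : Zc (k+1) Y Y' ↔ ∀ b, Zc k (hf b Y) (hf b Y') := by
    constructor
    · intro h b l l' hl
      have := h (Fin.cons b l) (Fin.cons b l') ((agree_cons _ _ _ _).2 ⟨rfl, hl⟩)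
      rw [fl_cons, fl_cons] at this
      exact this
    · intro h l l' hl
      rw [← Fin.cons_self_tail l, ← Fin.cons_self_tail l', agree_cons] at hl
      have := h (l 0) (Fin.tail l) (Fin.tail l') hl.2
      rw [← Fin.cons_self_tail l, ← Fin.cons_self_tail l', fl_cons, fl_cons, ← hl.1]
      exact this
  rw [this, Bool.forall_bool]

def four : Om 2 ≃ (Bool × Bool) × (Bool × Bool) where
  toFun := fun y => ((y ![false, false], y ![false, true]), (y ![true, false], y ![true, true]))
  invFun := fun p l => if l 0 then (if l 1 then p.2.2 else p.2.1) else (if l 1 then p.1.2 else p.1.1)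
  left_inv := fun y => by
    funext l
    have : l = ![l 0, l 1] := by funext i; fin_cases i <;> rfl
    cases h0 : l 0 <;> cases h1 : l 1 <;> rw [h0, h1] at this <;> rw [this] <;> simp
  right_inv := fun p => by simp

def b2i (b : Bool) : ℤ := if b then 1 else 0
def four_s (p : (Bool × Bool) × (Bool × Bool)) : ℤ :=
  b2i p.1.1 + b2i p.1.2 - b2i p.2.1 - b2i p.2.2

lemma four_card : ∀ p : (Bool × Bool) × (Bool × Bool),
    (Finset.univ.filter fun q => four_s q = four_s p).card ≤ 6 := by decide

lemma Zc_zero (y y' : Om 2) (h : Zc 0 y y') : four_s (four y') = four_s (four y) := by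
  have h1 := h ![false, false] ![true, false] (agree_zero _ _)
  have e1 : fl (0+1) (![false, false] : Lam 2) = ![false, true] := by
    funext i; fin_cases i <;> rfl
  have e2 : fl (0+1) (![true, false] : Lam 2) = ![true, true] := by
    funext i; fin_cases i <;> rfl
  rw [e1, e2] at h1
  have hb : ∀ (y : Om 2) l, bv y l = ((b2i (y l) : ℤ) : ℝ) := by
    intro y l; unfold bv b2i; split_ifs <;> simp
  simp only [hb] at h1
  have h2 : (four_s (four y') : ℝ) = four_s (four y) := by
    unfold four_s four
    simp only [Equiv.coe_fn_mk]
    push_cast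
    linarith
  exact_mod_cast h2

lemma ccard_Zc (k : ℕ) (y : Om (k+2)) : ccard (Zc k) y ≤ 6 ^ (2 ^ k) := by
  induction k with
  | zero =>
    unfold ccard
    have : ∀ y', (if Zc 0 y y' then (1:ℝ) else 0) ≤ if four_s (four y') = four_s (four y) then 1 else 0 := by
      intro y'
      by_cases h : Zc 0 y y'
      · rw [if_pos h, if_pos (Zc_zero y y' h)]
      · rw [if_neg h]; split_ifs <;> norm_num
    refine (Finset.sum_le_sum fun y' _ => this y').trans ?_
    rw [Equiv.sum_comp four (fun q => if four_s q = four_s (four y) then (1:ℝ) else 0)]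
    rw [Finset.sum_boole]
    have := four_card (four y)
    norm_num
    exact_mod_cast this
  | succ k ih =>
    have h1 := ih (hf false y)
    have h2 := ih (hf true y)
    have : ccard (Zc (k+1)) y = ccard (Zc k) (hf false y) * ccard (Zc k) (hf true y) := by
      unfold ccard
      rw [sum_split, Finset.sum_mul_sum]
      refine Finset.sum_congr rfl fun y0 _ => Finset.sum_congr rfl fun y1 _ => ?_
      simp only [Zc_succ, hf_false_jn, hf_true_jn]
      by_cases h0 : Zc k (hf false y) y0 <;> by_cases h1 : Zc k (hf true y) y1 <;> simp [h0, h1]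
    rw [this, pow_succ 2 k, mul_two, pow_add]
    refine mul_le_mul h1 h2 ?_ (by positivity)
    exact zero_le_one.trans (ccard_ge_one (Zc_equiv k) _)

end EH

namespace EH

abbrev Sub (r : ℕ) := Submodule ℝ (Lam r → ℝ)

def RelU {r j : ℕ} (U : Sub r) (y y' : Om j) : Prop := upl r j (bv y - bv y') ∈ U

lemma RelU_equiv {r j : ℕ} (U : Sub r) : Equivalence (RelU (j := j) U) where
  refl := fun y => by unfold RelU; rw [sub_self, map_zero]; exact zero_mem _
  symm := fun {x y} h => by
    unfold RelU at *
    rw [← neg_sub, map_neg]; exact U.neg_mem h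
  trans := fun {x y z} h h' => by
    unfold RelU at *
    rw [← sub_add_sub_cancel _ (bv y), map_add]; exact U.add_mem h h'

noncomputable def HH (r j : ℕ) (μ : Om j → ℝ) (U : Sub r) : ℝ := Ent μ (RelU (j := j) U)

lemma RelU_VV {r j m : ℕ} (hj : j ≤ r) : RelU (j := j) (VV r m) = Rel m := by
  funext y y'; exact propext (upl_mem hj _)

lemma HH_VV {r j m : ℕ} (hj : j ≤ r) (μ : Om j → ℝ) : HH r j μ (VV r m) = Ent μ (Rel m) := by
  unfold HH; rw [RelU_VV hj]

lemma HH_inf {r j : ℕ} (hj : j ≤ r) (μ : Om j → ℝ) (U : Sub r) :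
    HH r j μ (U ⊓ VV r j) = HH r j μ U := by
  unfold HH
  congr 1
  funext y y'
  exact propext ⟨fun h => h.1, fun h => ⟨h, upl_mem_self hj _⟩⟩

section
variable {r j : ℕ} {μ : Om j → ℝ}

lemma HH_anti (hμ : IsLaw μ) {U U' : Sub r} (h : U ≤ U') : HH r j μ U' ≤ HH r j μ U :=
  Ent_anti hμ (RelU_equiv U) fun _ _ hy => h hy

lemma HH_nonneg (hμ : IsLaw μ) (U : Sub r) : 0 ≤ HH r j μ U := Ent_nonneg hμ (RelU_equiv U)

lemma HH_le (hμ : IsLaw μ) (U : Sub r) : HH r j μ U ≤ 2^j * Real.log 2 := by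
  have := Ent_le_log_card hμ (RelU_equiv (j := j) U)
  rw [card_Om] at this
  unfold HH
  push_cast at this
  rw [Real.log_pow] at this
  exact_mod_cast this

lemma HH_submod (hμ : IsLaw μ) (U U' : Sub r) :
    HH r j μ (U ⊓ U') + HH r j μ (U ⊔ U') ≤ HH r j μ U + HH r j μ U' :=
  Ent_submod hμ (RelU_equiv U) (RelU_equiv U') (RelU_equiv _) (RelU_equiv _)
    (fun _ _ h h' => ⟨h, h'⟩) (fun _ _ h => (le_sup_left : U ≤ U ⊔ U') h)
    (fun _ _ h => (le_sup_right : U' ≤ U ⊔ U') h)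

lemma HH_zero (hμ : IsLaw μ) (hj : j ≤ r) {U : Sub r} (h : VV r j ≤ U) : HH r j μ U = 0 :=
  Ent_univ hμ fun _ _ => h (upl_mem_self hj _)

/-- induced automorphism on the top levels -/
noncomputable def ind (j : ℕ) (hj : j ≤ r) (g : Equiv.Perm (Lam r)) (hg : IsAut g) :
    Equiv.Perm (Lam j) where
  toFun := fun u => tr j (g (tr r u))
  invFun := fun u => tr j (g.symm (tr r u))
  left_inv := fun u => by
    have h1 : agree j (tr r (tr j (g (tr r u)))) (g (tr r u)) := agree_tr_tr _
    have h2 := (hg.symm j _ _).2 h1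
    rw [Equiv.symm_apply_apply] at h2
    have h3 := tr_agree (j := j) h2
    rw [tr_tr hj] at h3
    exact agree_eq le_rfl h3
  right_inv := fun u => by
    have h1 : agree j (tr r (tr j (g.symm (tr r u)))) (g.symm (tr r u)) := agree_tr_tr _
    have h2 := (hg j _ _).2 h1
    rw [Equiv.apply_symm_apply] at h2
    have h3 := tr_agree (j := j) h2
    rw [tr_tr hj] at h3
    exact agree_eq le_rfl h3

lemma ind_tr (hj : j ≤ r) (g : Equiv.Perm (Lam r)) (hg : IsAut g) (l : Lam r) :
    ind j hj g hg (tr j l) = tr j (g l) := by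
  show tr j (g (tr r (tr j l))) = _
  have h1 : agree j (tr r (tr j l)) l := agree_tr_tr _
  exact agree_eq le_rfl (tr_agree ((hg j _ _).2 h1))

lemma ind_aut (hj : j ≤ r) (g : Equiv.Perm (Lam r)) (hg : IsAut g) : IsAut (ind j hj g hg) := by
  have key : ∀ (g : Equiv.Perm (Lam r)) (hg : IsAut g) m u u', agree m u u' →
      agree m (ind j hj g hg u) (ind j hj g hg u') := by
    intro g hg m u u' h
    exact tr_agree ((hg m _ _).2 (tr_agree h))
  intro m u u'
  refine ⟨fun h => ?_, key g hg m u u'⟩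
  have := key g.symm hg.symm m _ _ h
  have e : ∀ u, ind j hj g.symm hg.symm (ind j hj g hg u) = u := fun u =>
    (ind j hj g hg).symm_apply_apply u
  rwa [e, e] at this

lemma HH_comap (hinv : Inv μ) (hj : j ≤ r) (g : Equiv.Perm (Lam r)) (hg : IsAut g) (U : Sub r) :
    HH r j μ (U.comap (act g)) = HH r j μ U := by
  unfold HH
  refine Ent_equiv (Equiv.arrowCongr (ind j hj g hg).symm (Equiv.refl _)) (fun y => ?_) (fun y y' => ?_)
  · exact hinv _ (ind_aut hj g hg) y
  · unfold RelU
    rw [Submodule.mem_comap]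
    have : act g (upl r j (bv y - bv y')) = upl r j (bv ((Equiv.arrowCongr (ind j hj g hg).symm (Equiv.refl _)) y)
        - bv ((Equiv.arrowCongr (ind j hj g hg).symm (Equiv.refl _)) y')) := by
      funext l
      rw [act_apply, upl_apply, upl_apply, Pi.sub_apply, Pi.sub_apply]
      unfold bv
      simp [Equiv.arrowCongr, ind_tr]
    rw [this]
end

/-! ### automorphism action on subspaces -/

lemma act_inj {r : ℕ} (g : Equiv.Perm (Lam r)) : Function.Bijective (act g) := by
  refine Function.bijective_iff_has_inverse.2 ⟨act g.symm, fun x => ?_, fun x => ?_⟩ <;>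
  · funext l; simp [act_apply]

noncomputable def actE {r : ℕ} (g : Equiv.Perm (Lam r)) : (Lam r → ℝ) ≃ₗ[ℝ] (Lam r → ℝ) :=
  LinearEquiv.ofBijective (act g) (act_inj g)

lemma comap_act {r : ℕ} (g : Equiv.Perm (Lam r)) (U : Sub r) :
    U.comap (act g) = U.comap (actE g).toLinearMap := rfl

lemma comap_symm {r : ℕ} (g : Equiv.Perm (Lam r)) (U : Sub r) :
    (U.comap (act g)).comap (act g.symm) = U := by
  ext x
  simp only [Submodule.mem_comap]
  have : act g (act g.symm x) = x := by funext l; simp [act_apply]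
  rw [this]

lemma comap_symm' {r : ℕ} (g : Equiv.Perm (Lam r)) (U : Sub r) :
    (U.comap (act g.symm)).comap (act g) = U := by
  have := comap_symm g.symm U
  rwa [Equiv.symm_symm] at this

lemma finrank_comap {r : ℕ} (g : Equiv.Perm (Lam r)) (U : Sub r) :
    Module.finrank ℝ (U.comap (act g)) = Module.finrank ℝ U := by
  rw [comap_act, Submodule.comap_equiv_eq_map_symm]
  exact LinearEquiv.finrank_map_eq _ _

lemma InvS.comap {r : ℕ} {U : Sub r} (h : InvS U) {g : Equiv.Perm (Lam r)} (hg : IsAut g) :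
    U.comap (act g) = U := by
  apply le_antisymm
  · intro x hx
    have := h _ hg.symm _ hx
    have e : act g.symm (act g x) = x := by funext l; simp [act_apply]
    rwa [e] at this
  · intro x hx; exact h g hg x hx

lemma InvS_of_le {r : ℕ} {U : Sub r} (h : ∀ g, IsAut g → U ≤ U.comap (act g)) : InvS U :=
  fun g hg _ hx => h g hg hx

/-! ### the functional Psi -/
section
variable (r : ℕ) (α nb : ℝ) (μ : (j : ℕ) → Om j → ℝ)

noncomputable def Psi : List ℕ → Sub r → ℝ
  | [], U => nb * Module.finrank ℝ U
  | j :: ls, U => sInf ((fun W : Sub r => α * HH r j (μ j) W + Module.finrank ℝ W + Psi ls W) '' {W | U ≤ W})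

noncomputable def fPsi (j : ℕ) (ls : List ℕ) (W : Sub r) : ℝ :=
  α * HH r j (μ j) W + Module.finrank ℝ W + Psi r α nb μ ls W

lemma Psi_nil (U : Sub r) : Psi r α nb μ [] U = nb * Module.finrank ℝ U := rfl

lemma Psi_cons (j : ℕ) (ls : List ℕ) (U : Sub r) :
    Psi r α nb μ (j :: ls) U = sInf (fPsi r α nb μ j ls '' {W | U ≤ W}) := rfl

lemma finrank_range : (Set.range fun U : Sub r => (Module.finrank ℝ U : ℝ)).Finite := by
  refine Set.Finite.subset ((Finset.range (2^r+1)).finite_toSet.image (fun n : ℕ => (n:ℝ))) ?_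
  rintro _ ⟨U, rfl⟩
  refine ⟨Module.finrank ℝ U, ?_, rfl⟩
  have := Submodule.finrank_le U
  rw [Module.finrank_fintype_fun_eq_card] at this
  simp at this ⊢
  omega

lemma HH_range (j : ℕ) (ν : Om j → ℝ) : (Set.range fun U : Sub r => HH r j ν U).Finite := by
  refine Set.Finite.subset (Set.finite_range (fun R : Om j → Om j → Prop => Ent ν R)) ?_
  rintro _ ⟨U, rfl⟩
  exact ⟨RelU U, rfl⟩

lemma fin_add {X : Type*} {f g : X → ℝ} (hf : (Set.range f).Finite) (hg : (Set.range g).Finite) :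
    (Set.range fun x => f x + g x).Finite := by
  refine Set.Finite.subset (hf.image2 (fun a b => a + b) hg) ?_
  rintro _ ⟨x, rfl⟩
  exact ⟨f x, ⟨x, rfl⟩, g x, ⟨x, rfl⟩, rfl⟩

lemma fin_mul {X : Type*} (c : ℝ) {f : X → ℝ} (hf : (Set.range f).Finite) :
    (Set.range fun x => c * f x).Finite := by
  refine Set.Finite.subset (hf.image (fun a => c * a)) ?_
  rintro _ ⟨x, rfl⟩
  exact ⟨f x, ⟨x, rfl⟩, rfl⟩

lemma Psi_range (ls : List ℕ) : (Set.range (Psi r α nb μ ls)).Finite := by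
  induction ls with
  | nil => exact fin_mul nb (finrank_range r)
  | cons j ls ih =>
    have hf : (Set.range (fPsi r α nb μ j ls)).Finite :=
      fin_add (fin_add (fin_mul α (HH_range r j (μ j))) (finrank_range r)) ih
    refine Set.Finite.subset (hf.finite_subsets.image sInf) ?_
    rintro _ ⟨U, rfl⟩
    exact ⟨_, Set.image_subset_range _ _, rfl⟩

lemma fPsi_range (j : ℕ) (ls : List ℕ) : (Set.range (fPsi r α nb μ j ls)).Finite :=
  fin_add (fin_add (fin_mul α (HH_range r j (μ j))) (finrank_range r)) (Psi_range r α nb μ ls)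

lemma Psi_le (j : ℕ) (ls : List ℕ) {U W : Sub r} (h : U ≤ W) :
    Psi r α nb μ (j :: ls) U ≤ fPsi r α nb μ j ls W :=
  csInf_le ((fPsi_range r α nb μ j ls).subset (Set.image_subset_range _ _)).bddBelow ⟨W, h, rfl⟩

lemma Psi_att (j : ℕ) (ls : List ℕ) (U : Sub r) :
    ∃ W, U ≤ W ∧ Psi r α nb μ (j :: ls) U = fPsi r α nb μ j ls W := by
  have hne : (fPsi r α nb μ j ls '' {W | U ≤ W}).Nonempty := ⟨_, U, le_refl U, rfl⟩
  obtain ⟨W, hW, h⟩ := hne.csInf_mem ((fPsi_range r α nb μ j ls).subset (Set.image_subset_range _ _))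
  exact ⟨W, hW, h.symm⟩

variable {r α nb μ}

lemma fPsi_comap {j : ℕ} {ls : List ℕ} (hj : j ≤ r) (hinv : Inv (μ j))
    (ih : ∀ U : Sub r, ∀ g : Equiv.Perm (Lam r), IsAut g →
      Psi r α nb μ ls (U.comap (act g)) = Psi r α nb μ ls U)
    (g : Equiv.Perm (Lam r)) (hg : IsAut g) (W : Sub r) :
    fPsi r α nb μ j ls (W.comap (act g)) = fPsi r α nb μ j ls W := by
  unfold fPsi
  rw [HH_comap hinv hj g hg, finrank_comap, ih W g hg]

lemma Psi_comap {ls : List ℕ} (hls : ∀ j ∈ ls, j ≤ r ∧ Inv (μ j)) (U : Sub r)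
    (g : Equiv.Perm (Lam r)) (hg : IsAut g) :
    Psi r α nb μ ls (U.comap (act g)) = Psi r α nb μ ls U := by
  induction ls generalizing U g with
  | nil => rw [Psi_nil, Psi_nil, finrank_comap]
  | cons j ls ih =>
    have hj := hls j (by simp)
    have ih' := fun U g hg => ih (fun k hk => hls k (by simp [hk])) U g hg
    rw [Psi_cons, Psi_cons]
    congr 1
    ext t
    constructor
    · rintro ⟨W, hW, rfl⟩
      refine ⟨W.comap (act g.symm), ?_, fPsi_comap hj.1 hj.2 ih' _ hg.symm W⟩
      have := Submodule.comap_mono (f := act g.symm) hW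
      rwa [comap_symm] at this
    · rintro ⟨W, hW, rfl⟩
      exact ⟨W.comap (act g), Submodule.comap_mono hW, fPsi_comap hj.1 hj.2 ih' _ hg W⟩


lemma fPsi_submod (hα : 0 ≤ α) {j : ℕ} {ls : List ℕ} (hμ : IsLaw (μ j))
    (ih : ∀ U U' : Sub r, Psi r α nb μ ls (U ⊓ U') + Psi r α nb μ ls (U ⊔ U') ≤
      Psi r α nb μ ls U + Psi r α nb μ ls U') (U U' : Sub r) :
    fPsi r α nb μ j ls (U ⊓ U') + fPsi r α nb μ j ls (U ⊔ U') ≤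
      fPsi r α nb μ j ls U + fPsi r α nb μ j ls U' := by
  unfold fPsi
  have h1 := mul_le_mul_of_nonneg_left (HH_submod hμ U U') hα
  have h2 : (Module.finrank ℝ ↥(U ⊔ U') : ℝ) + Module.finrank ℝ ↥(U ⊓ U') =
    Module.finrank ℝ U + Module.finrank ℝ U' := by
    exact_mod_cast Submodule.finrank_sup_add_finrank_inf_eq U U'
  have h3 := ih U U'
  linarith

lemma Psi_submod (hα : 0 ≤ α) {ls : List ℕ} (hls : ∀ j ∈ ls, IsLaw (μ j)) (U U' : Sub r) :
    Psi r α nb μ ls (U ⊓ U') + Psi r α nb μ ls (U ⊔ U') ≤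
      Psi r α nb μ ls U + Psi r α nb μ ls U' := by
  induction ls generalizing U U' with
  | nil =>
    have h2 : (Module.finrank ℝ ↥(U ⊔ U') : ℝ) + Module.finrank ℝ ↥(U ⊓ U') =
      Module.finrank ℝ U + Module.finrank ℝ U' := by
      exact_mod_cast Submodule.finrank_sup_add_finrank_inf_eq U U'
    simp only [Psi_nil]
    rw [← mul_add, ← mul_add, ← h2, add_comm]
  | cons j ls ih =>
    obtain ⟨W, hW, e⟩ := Psi_att r α nb μ j ls U
    obtain ⟨W', hW', e'⟩ := Psi_att r α nb μ j ls U'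
    have := fPsi_submod hα (hls j (by simp)) (ih fun k hk => hls k (by simp [hk])) W W'
    rw [e, e']
    have h1 := Psi_le r α nb μ j ls (inf_le_inf hW hW')
    have h2 := Psi_le r α nb μ j ls (sup_le_sup hW hW')
    linarith

lemma Psi_att_inv (hα : 0 ≤ α) {j : ℕ} {ls : List ℕ} (hls : ∀ k ∈ j :: ls, k ≤ r ∧ IsLaw (μ k) ∧ Inv (μ k))
    {U : Sub r} (hU : InvS U) :
    ∃ W, U ≤ W ∧ InvS W ∧ Psi r α nb μ (j :: ls) U = fPsi r α nb μ j ls W := by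
  have hex : ∃ n, ∃ W, U ≤ W ∧ Psi r α nb μ (j :: ls) U = fPsi r α nb μ j ls W ∧
      Module.finrank ℝ W = n := by
    obtain ⟨W, hW, h⟩ := Psi_att r α nb μ j ls U
    exact ⟨_, W, hW, h, rfl⟩
  obtain ⟨W, hW, he, hn⟩ := Nat.find_spec hex
  refine ⟨W, hW, InvS_of_le fun g hg => ?_, he⟩
  have hj := hls j (by simp)
  have ec := fPsi_comap (α := α) (nb := nb) (ls := ls) hj.1 hj.2.2 (fun U g hg => Psi_comap
    (fun k hk => ⟨(hls k (by simp [hk])).1, (hls k (by simp [hk])).2.2⟩) U g hg) g hg W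
  have hW' : U ≤ W.comap (act g) := by
    rw [← hU.comap hg]; exact Submodule.comap_mono hW
  have hs := fPsi_submod (nb := nb) hα hj.2.1 (Psi_submod (ls := ls) hα fun k hk => (hls k (by simp [hk])).2.1)
    W (W.comap (act g))
  have h1 := Psi_le r α nb μ j ls (le_inf hW hW')
  have h2 := Psi_le r α nb μ j ls (hW.trans (le_sup_left : W ≤ W ⊔ W.comap (act g)))
  have e2 : Psi r α nb μ (j :: ls) U = fPsi r α nb μ j ls (W ⊓ W.comap (act g)) := by
    apply le_antisymm h1; linarith
  have h3 := Nat.find_min' hex ⟨_, le_inf hW hW', e2, rfl⟩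
  rw [← hn] at h3
  have h4 := Submodule.eq_of_le_of_finrank_le (inf_le_left : W ⊓ W.comap (act g) ≤ W) h3
  exact inf_eq_left.1 h4
end

end EH

namespace EH

section
variable {r j : ℕ} {μ : Om j → ℝ}

lemma hyp1 (hμ : IsLaw μ) (hj : j ≤ r) (hbig : 0.99 * 2^(j-1) ≤ Ent μ (Rel (j-1)))
    {m M : ℕ} (hM : M < j) :
    HH r j μ (VV r m) - HH r j μ (VV r M) ≤ 2^M / 2 := by
  rw [HH_VV hj, HH_VV hj]
  obtain ⟨k, hk⟩ : ∃ k, M + k = j - 1 := ⟨j - 1 - M, by omega⟩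
  have h1 := Ent_fibre hμ (Rel_equiv m) (Rel_equiv M) (ccard (Rel M)) (fun y => le_rfl)
    (fun y y' h => ccard_congr (Rel_equiv M) h)
  have h2 := Ent_add_log_ccard hμ (Rel_equiv (r := j) (j-1))
  have h3 : 2^k * ∑ y, μ y * Real.log (ccard (Rel M) y) ≤ ∑ y, μ y * Real.log (ccard (Rel (j-1)) y) := by
    rw [Finset.mul_sum]
    refine Finset.sum_le_sum fun y _ => ?_
    have := Real.log_le_log (by have := ccard_ge_one (Rel_equiv M) y; positivity)
      (ccard_pow (m := M) (k := k) (by omega) y)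
    rw [Real.log_pow, hk] at this
    have := mul_le_mul_of_nonneg_left this (hμ.pos y).le
    push_cast at this
    linarith
  rw [card_Om] at h2
  push_cast at h2
  rw [Real.log_pow] at h2
  push_cast at h2
  have e : (2:ℝ)^j = 2 * 2^(j-1) := by rw [← pow_succ']; congr 1; omega
  have e' : (2:ℝ)^(j-1) = 2^M * 2^k := by rw [← pow_add, hk]
  have hl := Real.log_two_lt_d9
  have hpos : (0:ℝ) < 2^(j-1) := by positivity
  have hk0 : (0:ℝ) < 2^k := by positivity
  have h4 : 2^k * ∑ y, μ y * Real.log (ccard (Rel M) y) ≤ 2^k * (2^M/2) := by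
    rw [e] at h2
    nlinarith
  have h5 := le_of_mul_le_mul_left h4 hk0
  linarith

lemma gapA (hμ : IsLaw μ)
    (h1 : ∀ m M, M < j → HH r j μ (VV r m) - HH r j μ (VV r M) ≤ 2^M / 2)
    (hj : j ≤ r) (j' : ℕ) (hj' : j' < j) (U : Sub r) (hU : InvS U) (hUj : U ≤ VV r j')
    {m : ℕ} (hm : m ≤ j') (hmU : VV r m ≤ U) :
    HH r j μ (VV r m) - HH r j μ U ≤ Module.finrank ℝ U - 2^m := by
  induction j' with
  | zero =>
    have : m = 0 := by omega
    subst this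
    have : U = VV r 0 := le_antisymm hUj hmU
    subst this
    rw [finrank_VV (by omega)]; simp
  | succ k ih =>
    by_cases hmk : m = k + 1
    · subst hmk
      have : U = VV r (k+1) := le_antisymm hUj hmU
      subst this
      rw [finrank_VV (by omega)]; simp
    · by_cases hP : VV r (k+1) ≤ U ⊔ VV r k
      · have e := Submodule.finrank_sup_add_finrank_inf_eq U (VV r k)
        rw [finrank_VV (by omega : k ≤ r)] at e
        have a1 := Submodule.finrank_mono hP
        rw [finrank_VV (by omega : k+1 ≤ r)] at a1
        have a2 := Submodule.finrank_mono (le_inf hmU (VV_mono (r := r) (by omega : m ≤ k)))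
        rw [finrank_VV (by omega : m ≤ r)] at a2
        have a3 : 2^k + 2^m ≤ Module.finrank ℝ U := by rw [pow_succ] at a1; omega
        have a4 : (2:ℝ)^k + 2^m ≤ Module.finrank ℝ U := by exact_mod_cast a3
        have b := h1 m (k+1) hj'
        have b2 := HH_anti hμ hUj
        rw [pow_succ] at b
        linarith
      · have := inv_dich (by omega) hU hP
        exact ih (by omega) ((le_inf le_rfl hUj).trans this) (by omega)

lemma tr_fl {i : ℕ} (hj : j ≤ r) (L : Lam r) : tr j (fl i L) = fl i (tr j L) := by
  funext k
  have : k.val < r := k.2.trans_le hj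
  simp [tr, fl, this]

lemma gap (hμ : IsLaw μ) 
    (h1 : ∀ m M, M < j → HH r j μ (VV r m) - HH r j μ (VV r M) ≤ 2^M / 2)
    (hj : j ≤ r) (U : Sub r) (hU : InvS U) (hUj : U ≤ VV r j)
    {m : ℕ} (hm : m < j) (hmU : VV r m ≤ U) (hmU' : ¬ VV r (m+1) ≤ U) :
    HH r j μ (VV r m) - HH r j μ U ≤ Module.finrank ℝ U - 2^m := by
  obtain ⟨k, rfl⟩ : ∃ k, j = k + 1 := ⟨j - 1, by omega⟩
  by_cases hP : VV r (k+1) ≤ U ⊔ VV r k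
  swap
  · have := inv_dich (by omega) hU hP
    exact gapA hμ h1 hj k (by omega) U hU ((le_inf le_rfl hUj).trans this) (by omega) hmU
  have hmk : m < k := by
    rcases Nat.lt_or_ge m k with h | h
    · exact h
    · have : m = k := by omega
      subst this
      rw [sup_eq_left.2 hmU] at hP
      exact absurd hP hmU'
  obtain ⟨d, hd, hdk, hmd, hmax⟩ : ∃ d, (¬ VV r (d+1) ≤ U ⊔ VV r d) ∧ d < k ∧ m ≤ d ∧
      ∀ i, d < i → i ≤ k → VV r (i+1) ≤ U ⊔ VV r i := by
    have hp : ¬ VV r (m+1) ≤ U ⊔ VV r m := by rwa [sup_eq_left.2 hmU]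
    let p : ℕ → Prop := fun d => ¬ VV r (d+1) ≤ U ⊔ VV r d
    have hs := Nat.findGreatest_spec (P := p) (n := k) hmk.le hp
    have hle := Nat.findGreatest_le (P := p) k
    have hge := Nat.le_findGreatest (P := p) hmk.le hp
    refine ⟨Nat.findGreatest p k, hs, ?_, hge, fun i hi hik => ?_⟩
    · refine lt_of_le_of_ne hle fun h => ?_
      rw [h] at hs; exact hs hP
    · have := Nat.findGreatest_is_greatest hi hik
      simpa [p] using this
  have hsup : VV r (k+1) ≤ U ⊔ VV r (d+1) := by
    have : ∀ i, d < i → i ≤ k + 1 → VV r i ≤ U ⊔ VV r (d+1) := by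
      intro i hi
      induction i, hi using Nat.le_induction with
      | base => intro _; exact le_sup_right
      | succ i hi ih =>
        intro h
        refine (hmax i (by omega) (by omega)).trans (sup_le le_sup_left (ih (by omega)))
    exact this (k+1) (by omega) le_rfl
  have hdich := inv_dich (by omega) hU hd
  set U' := U ⊓ VV r (d+1) with hU'
  have hU'd : U' = U ⊓ VV r d := le_antisymm (le_inf inf_le_left hdich)
    (inf_le_inf_left _ (VV_mono (by omega)))
  have hA := gapA hμ h1 hj d (by omega) U' (hU.inf (InvS_VV _ _)) hdich hmd
    (le_inf hmU (VV_mono (by omega)))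
  have hS := HH_submod hμ U (VV r d)
  rw [← hU'd] at hS
  have e := Submodule.finrank_sup_add_finrank_inf_eq U (VV r (d+1))
  rw [finrank_VV (by omega : d+1 ≤ r), ← hU'] at e
  have a1 := Submodule.finrank_mono hsup
  rw [finrank_VV (by omega : k+1 ≤ r)] at a1
  have a2 : (2:ℝ)^(k+1) + Module.finrank ℝ U' ≤ Module.finrank ℝ U + 2^(d+1) := by
    have : 2^(k+1) + Module.finrank ℝ U' ≤ Module.finrank ℝ U + 2^(d+1) := by omega
    exact_mod_cast this
  suffices hfin : HH r (k+1) μ (VV r d) - HH r (k+1) μ (U ⊔ VV r d) ≤ 2^(k+1) - 2^(d+1) by linarith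
  rcases Nat.lt_or_ge (d+1) k with hdk' | hdk'
  · have h3 := HH_le hμ (VV r d)
    have h4 := HH_nonneg hμ (U ⊔ VV r d)
    have h5 : (2:ℝ)^(d+1) ≤ 2^(k-1) := pow_le_pow_right₀ (by norm_num) (by omega)
    have h6 : (2:ℝ)^(k+1) = 4 * 2^(k-1) := by
      have : k + 1 = (k - 1) + 2 := by omega
      rw [this, pow_add]; ring
    have hl := Real.log_two_lt_d9
    have : (0:ℝ) < 2^(k-1) := by positivity
    rw [h6] at h3 ⊢
    nlinarith
  · have : k = d + 1 := by omega
    subst this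
    have hZ : ∀ y y' : Om (d+2), RelU (U ⊔ VV r d) y y' → Zc d y y' := by
      intro y y' h
      obtain ⟨u, hu, v, hv, huv⟩ := Submodule.mem_sup.1 h
      set D := bv y - bv y' with hD
      have hw : u + act (flp (d+1)) u ∈ VV r d := by
        apply hdich
        refine ⟨U.add_mem hu (hU _ (flp_aut _) u hu), ?_⟩
        intro l l' hl
        have huj := hUj hu
        show u l + u (fl (d+1) l) = u l' + u (fl (d+1) l')
        by_cases hll : agree (d+1+1) l l'
        · rw [huj _ _ hll, huj _ _ ((fl_agree_iff (i := d+1) l l').2 hll)]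
        · have h' := agree_succ_fl hl hll
          have h'' := (fl_agree_iff (i := d+1) _ _).2 h'
          rw [fl_fl] at h''
          rw [huj _ _ h', huj _ _ h'', add_comm]
      have hv' : v + act (flp (d+1)) v ∈ VV r d := (VV r d).add_mem hv (InvS_VV r d _ (flp_aut _) v hv)
      have hz := (VV r d).add_mem hw hv'
      have ez : u + act (flp (d+1)) u + (v + act (flp (d+1)) v) = upl r (d+1+1) D + act (flp (d+1)) (upl r (d+1+1) D) := by
        rw [← huv, map_add]; abel
      rw [ez] at hz
      intro l l' hl
      have := hz (tr r l) (tr r l') (tr_agree hl)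
      have ef : ∀ l : Lam r, act (flp (d+1)) (upl r (d+1+1) D) l = D (fl (d+1) (tr (d+1+1) l)) := by
        intro l
        rw [act_apply, upl_apply]
        show D (tr (d+1+1) (fl (d+1) l)) = _
        rw [tr_fl hj]
      simp only [Pi.add_apply, upl_apply, ef, tr_tr hj] at this
      exact this
    have f1 := Ent_anti hμ (RelU_equiv (j := d+2) (U ⊔ VV r d)) hZ
    have f2 := Ent_fibre hμ (RelU_equiv (j := d+2) (VV r d)) (Zc_equiv d) (fun _ => 6^(2^d))
      (fun y => ccard_Zc d y) (fun _ _ _ => rfl)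
    rw [← Finset.sum_mul, hμ.sum, one_mul, Real.log_pow] at f2
    have f3 : Real.log 6 < 2 := by
      rw [Real.log_lt_iff_lt_exp (by norm_num)]
      have := Real.exp_one_gt_d9
      have e2 : Real.exp 2 = Real.exp 1 * Real.exp 1 := by rw [← Real.exp_add]; norm_num
      rw [e2]; nlinarith
    have f4 : (0:ℝ) < 2^d := by positivity
    push_cast at f2
    unfold HH
    have e1 : (2:ℝ)^(d+1+1) - 2^(d+1) = 2 * 2^d := by ring
    rw [e1]
    nlinarith
end

end EH

namespace EH

structure Fam (r : ℕ) (α : ℝ) (μ : (j : ℕ) → Om j → ℝ) : Prop where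
  α0 : 0 < α
  α1 : α ≤ 1
  law : ∀ j, 1 ≤ j → j ≤ r → IsLaw (μ j)
  inv : ∀ j, 1 ≤ j → j ≤ r → Inv (μ j)
  big : ∀ j, 1 ≤ j → j ≤ r → 2^(j-1) ≤ α * Ent (μ j) (Rel (j-1))

noncomputable def Tm (α : ℝ) (μ : (j : ℕ) → Om j → ℝ) (j m : ℕ) : ℝ :=
  α * Ent (μ j) (Rel m) - (2^j - 2^m)

noncomputable def Phi (r : ℕ) (α nb : ℝ) (μ : (j : ℕ) → Om j → ℝ) (ls : List ℕ) (a : ℕ) : ℝ :=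
  (ls.map fun j => if a < j then Tm α μ j a else 0).sum - nb * (2^r - 2^a)

noncomputable def base (r : ℕ) (nb : ℝ) (ls : List ℕ) : ℝ :=
  (ls.map fun j => (2:ℝ)^j).sum + nb * 2^r

section
variable {r : ℕ} {α nb : ℝ} {μ : (j : ℕ) → Om j → ℝ}

lemma Fam.hyp1 (F : Fam r α μ) {j : ℕ} (h1 : 1 ≤ j) (hj : j ≤ r) (m M : ℕ) (hM : M < j) :
    HH r j (μ j) (VV r m) - HH r j (μ j) (VV r M) ≤ 2^M / 2 := by
  refine EH.hyp1 (F.law j h1 hj) hj ?_ hM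
  have := F.big j h1 hj
  have h2 := Ent_nonneg (F.law j h1 hj) (Rel_equiv (j-1))
  have h3 := mul_le_mul_of_nonneg_right F.α1 h2
  have : (0:ℝ) < 2^(j-1) := by positivity
  linarith

lemma Fam.Tm_mono (F : Fam r α μ) {j a m : ℕ} (hj : j ≤ r) (ham : a ≤ m) (hm : m < j) :
    Tm α μ j a ≤ Tm α μ j m := by
  rcases ham.eq_or_lt with rfl | h
  · exact le_rfl
  have h1 := F.hyp1 (by omega) hj a m hm
  rw [HH_VV hj, HH_VV hj] at h1
  have h2 : (2:ℝ)^a ≤ 2^m/2 := by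
    obtain ⟨k, rfl⟩ : ∃ k, m = k+1 := ⟨m-1, by omega⟩
    have : (2:ℝ)^a ≤ 2^k := pow_le_pow_right₀ (by norm_num) (by omega)
    rw [pow_succ]; linarith
  have h3 : α * (Ent (μ j) (Rel a) - Ent (μ j) (Rel m)) ≤ 2^m/2 := by
    have := mul_le_mul_of_nonneg_left h1 F.α0.le
    have : α * (2^m/2) ≤ 1 * (2^m/2) := mul_le_mul_of_nonneg_right F.α1 (by positivity)
    linarith
  unfold Tm
  linarith

lemma Fam.Tm_nonpos (F : Fam r α μ) {j m : ℕ} (hj : j ≤ r) (hm : m + 2 ≤ j) :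
    Tm α μ j m ≤ 0 := by
  have h1 := HH_le (r := r) (F.law j (by omega) hj) (VV r m)
  rw [HH_VV hj] at h1
  have h0 := Ent_nonneg (F.law j (by omega) hj) (Rel_equiv m)
  have h2 := mul_le_mul_of_nonneg_right F.α1 h0
  have h3 : (2:ℝ)^m ≤ 2^j/4 := by
    obtain ⟨k, rfl⟩ : ∃ k, j = k+2 := ⟨j-2, by omega⟩
    have : (2:ℝ)^m ≤ 2^k := pow_le_pow_right₀ (by norm_num) (by omega)
    rw [pow_add]; linarith
  have hl := Real.log_two_lt_d9
  have : (0:ℝ) < 2^j := by positivity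
  unfold Tm
  nlinarith

lemma Fam.Tm_succ (F : Fam r α μ) {m : ℕ} (hj : m + 1 ≤ r) : 0 ≤ Tm α μ (m+1) m := by
  have := F.big (m+1) (by omega) hj
  simp only [Nat.add_sub_cancel] at this
  unfold Tm
  rw [pow_succ]; linarith

lemma exists_level {W : Sub r} {a : ℕ} (ha : a ≤ r) (haW : VV r a ≤ W) :
    ∃ b, a ≤ b ∧ b ≤ r ∧ VV r b ≤ W ∧ (b = r ∨ ¬ VV r (b+1) ≤ W) := by
  have hs := Nat.findGreatest_spec (P := fun b => VV r b ≤ W) ha haW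
  refine ⟨_, Nat.le_findGreatest (P := fun b => VV r b ≤ W) ha haW,
    Nat.findGreatest_le (P := fun b => VV r b ≤ W) r, hs, ?_⟩
  by_contra hc
  push Not at hc
  have h1 := Nat.findGreatest_le (P := fun b => VV r b ≤ W) r
  have := Nat.le_findGreatest (P := fun b => VV r b ≤ W)
    (Nat.lt_of_le_of_ne h1 hc.1) hc.2
  omega

theorem chain (F : Fam r α μ) (hnb : 0 ≤ nb) (ls : List ℕ) (k : ℕ)
    (hk : ∀ j ∈ ls, k ≤ j ∧ 1 ≤ j ∧ j ≤ r) (hs : ls.Pairwise (· ≤ ·))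
    (hΦ : ∀ m, k ≤ m → m ≤ r → 0 ≤ Phi r α nb μ ls m)
    (U : Sub r) (hU : InvS U) (a : ℕ) (ha : a ≤ r) (haU : VV r a ≤ U)
    (haU' : a = r ∨ ¬ VV r (a+1) ≤ U) :
    base r nb ls + min 0 (Phi r α nb μ ls a) ≤ Psi r α nb μ ls U := by
  induction ls generalizing k U a with
  | nil =>
    have h1 : (2:ℝ)^a ≤ Module.finrank ℝ U := by
      have := Submodule.finrank_mono haU
      rw [finrank_VV ha] at this
      exact_mod_cast this
    have h2 := min_le_right 0 (Phi r α nb μ [] a)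
    have h3 := mul_le_mul_of_nonneg_left h1 hnb
    rw [Psi_nil]
    unfold Phi at h2 ⊢
    unfold base
    simp only [List.map_nil, List.sum_nil] at h2 ⊢
    linarith
  | cons j ls ih =>
    obtain ⟨hkj, hj1, hjr⟩ := hk j (by simp)
    obtain ⟨W, hUW, hW, hPsi⟩ := Psi_att_inv (nb := nb) F.α0.le (fun i hi =>
      ⟨(hk i hi).2.2, F.law i (hk i hi).2.1 (hk i hi).2.2, F.inv i (hk i hi).2.1 (hk i hi).2.2⟩) hU
    obtain ⟨b, hab, hbr, hbW, hbW'⟩ := exists_level ha (haU.trans hUW)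
    rw [List.pairwise_cons] at hs
    have hcons : ∀ m, Phi r α nb μ (j :: ls) m =
        (if m < j then Tm α μ j m else 0) + Phi r α nb μ ls m := by
      intro m; unfold Phi; simp only [List.map_cons, List.sum_cons]; ring
    have hIH := ih j (fun i hi => ⟨hs.1 i hi, (hk i (by simp [hi])).2⟩) hs.2 (fun m hm hmr => by
      have := hΦ m (by omega) hmr
      rwa [hcons, if_neg (by omega), zero_add] at this) W hW b hbr hbW hbW'
    have hbase : base r nb (j :: ls) = 2^j + base r nb ls := by
      unfold base; simp only [List.map_cons, List.sum_cons]; ring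
    rw [hPsi, hbase]
    unfold fPsi
    rcases Nat.lt_or_ge b j with hbj | hbj
    · have hg := gap (F.law j hj1 hjr) (F.hyp1 hj1 hjr) hjr (W ⊓ VV r j) (hW.inf (InvS_VV _ _))
        inf_le_right hbj (le_inf hbW (VV_mono hbj.le)) (fun h => by
          rcases hbW' with h' | h'
          · omega
          · exact h' (h.trans inf_le_left))
      rw [HH_inf hjr, HH_VV hjr] at hg
      have hf : (Module.finrank ℝ ↥(W ⊓ VV r j) : ℝ) ≤ Module.finrank ℝ W := by
        exact_mod_cast Submodule.finrank_mono (inf_le_left : W ⊓ VV r j ≤ W)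
      have hf2 : (2:ℝ)^b ≤ Module.finrank ℝ ↥(W ⊓ VV r j) := by
        have := Submodule.finrank_mono (le_inf hbW (VV_mono hbj.le))
        rw [finrank_VV hbr] at this
        exact_mod_cast this
      have h1 : 2^j + Tm α μ j b ≤ α * HH r j (μ j) W + Module.finrank ℝ W := by
        unfold Tm
        have x1 := mul_le_mul_of_nonneg_left hg F.α0.le
        have x2 := mul_le_mul_of_nonneg_right F.α1 (sub_nonneg.2 hf2)
        linarith
      have h2 : min 0 (Phi r α nb μ (j::ls) b) ≤ Tm α μ j b + min 0 (Phi r α nb μ ls b) := by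
        rw [hcons, if_pos hbj]
        by_cases hT : 0 ≤ Tm α μ j b
        · rcases le_total 0 (Phi r α nb μ ls b) with hp | hp
          · rw [min_eq_left hp]; exact (min_le_left _ _).trans (by linarith)
          · rw [min_eq_right hp]; exact min_le_right _ _
        · have hjb : b + 2 ≤ j := by
            by_contra hc
            have : j = b + 1 := by omega
            subst this
            exact hT (F.Tm_succ hjr)
          have hp : Phi r α nb μ ls b ≤ 0 := by
            unfold Phi
            have s1 : (ls.map fun j => if b < j then Tm α μ j b else 0).sum ≤ 0 := by
              refine (List.sum_le_card_nsmul _ 0 fun x hx => ?_).trans (by simp)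
              obtain ⟨i, hi, rfl⟩ := List.mem_map.1 hx
              have := hs.1 i hi
              rw [if_pos (by omega)]
              exact F.Tm_nonpos (hk i (by simp [hi])).2.2 (by omega)
            have s2 : (2:ℝ)^b ≤ 2^r := pow_le_pow_right₀ (by norm_num) hbr
            have s3 := mul_nonneg hnb (sub_nonneg.2 s2)
            linarith
          rw [min_eq_right hp]; exact min_le_right _ _
      have h3 : Phi r α nb μ (j::ls) a ≤ Phi r α nb μ (j::ls) b := by
        unfold Phi
        have s1 : ((j::ls).map fun j => if a < j then Tm α μ j a else 0).sum ≤
            ((j::ls).map fun j => if b < j then Tm α μ j b else 0).sum := by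
          refine List.sum_le_sum fun i hi => ?_
          have hji : j ≤ i := by
            rcases List.mem_cons.1 hi with rfl | h
            · exact le_rfl
            · exact hs.1 i h
          rw [if_pos (by omega), if_pos (by omega)]
          exact F.Tm_mono (hk i hi).2.2 hab (by omega)
        have s2 : (2:ℝ)^a ≤ 2^b := pow_le_pow_right₀ (by norm_num) hab
        have s3 := mul_le_mul_of_nonneg_left s2 hnb
        linarith
      have h4 := min_le_min_left 0 h3
      linarith
    · have h1 := HH_nonneg (r := r) (F.law j hj1 hjr) W
      have h2 : (2:ℝ)^j ≤ Module.finrank ℝ W := by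
        have := Submodule.finrank_mono ((VV_mono hbj).trans hbW)
        rw [finrank_VV hjr] at this
        exact_mod_cast this
      have h3 := hΦ b (by omega) hbr
      rw [hcons, if_neg (by omega), zero_add] at h3
      rw [min_eq_left h3] at hIH
      have h4 := min_le_left 0 (Phi r α nb μ (j::ls) a)
      have h5 := mul_nonneg F.α0.le h1
      linarith

theorem chain_main (F : Fam r α μ) (hnb : 0 ≤ nb) (ls : List ℕ)
    (hk : ∀ j ∈ ls, 1 ≤ j ∧ j ≤ r) (hs : ls.Pairwise (· ≤ ·))
    (hΦ : ∀ m, m ≤ r → 0 ≤ Phi r α nb μ ls m) :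
    base r nb ls ≤ Psi r α nb μ ls (VV r 0) := by
  have hd : (0 = r ∨ ¬ VV r (0+1) ≤ VV r 0) := by
    rcases Nat.eq_zero_or_pos r with h | h
    · exact Or.inl h.symm
    · right
      intro hle
      have := Submodule.finrank_mono hle
      rw [finrank_VV (by omega), finrank_VV (by omega)] at this
      norm_num at this
  have := chain F hnb ls 0 (fun j hj => ⟨by omega, hk j hj⟩) hs (fun m _ hm => hΦ m hm)
    (VV r 0) (InvS_VV _ _) 0 (by omega) le_rfl hd
  rwa [min_eq_left (hΦ 0 (by omega)), add_zero] at this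
end

end EH

namespace EH

lemma pow_diff_bound {ρ τ : ℝ} (hρ0 : 0 < ρ) (hρ1 : ρ < 1/3) (hτ0 : 0 < τ) (hτ1 : τ < 1) (l : ℕ) :
    ρ^l - (ρ*(1-τ))^l ≤ τ * ρ / (1-ρ) * (1 - ρ^l) := by
  have h1 : (0:ℝ) < 1 - ρ := by linarith
  rw [div_mul_eq_mul_div, le_div_iff₀ h1]
  rw [mul_pow]
  have b : 1 - l * τ ≤ (1-τ)^l := by
    have := one_add_mul_le_pow (a := -τ) (by linarith) l
    have e : (1 + -τ) = 1 - τ := by ring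
    rw [e] at this; linarith
  have g : (l:ℝ) * ρ^l * (1-ρ) ≤ ρ * (1 - ρ^l) := by
    induction l with
    | zero => simp
    | succ k ih =>
      have ih' := ih (by
        have := one_add_mul_le_pow (a := -τ) (by linarith) k
        have e : (1 + -τ) = 1 - τ := by ring
        rw [e] at this; linarith)
      have p : 0 < ρ^k := by positivity
      have p1 : ρ^k ≤ 1 := pow_le_one₀ hρ0.le (by linarith)
      push_cast
      rw [pow_succ]
      have x1 := mul_le_mul_of_nonneg_left ih' hρ0.le
      have x2 : 0 ≤ ρ * (1-ρ) * (1-ρ^k) := by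
        have : 0 ≤ 1 - ρ^k := by linarith
        positivity
      nlinarith
  have p : 0 < ρ^l := by positivity
  have h3 : ρ^l - ρ^l * (1-τ)^l ≤ τ * (l * ρ^l) := by nlinarith
  have h4 := mul_le_mul_of_nonneg_right h3 h1.le
  have h5 := mul_le_mul_of_nonneg_left g hτ0.le
  linarith

lemma tele (S : ℕ → ℝ) (hS0 : S 0 = 0) (r : ℕ) : ∑ l ∈ Finset.range r, (S (l+1) - S l) = S r := by
  rw [Finset.sum_range_sub, hS0, sub_zero]

lemma absS {S : ℕ → ℝ} {r : ℕ} (hr : 1 ≤ r) (hS0 : S 0 = 0) (hm : Monotone S) (hSr : S r ≤ 1.3863)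
    {ρ τ : ℝ} (hρ0 : 0 < ρ) (hρ1 : ρ < 1/3) (hτ0 : 0 < τ) (hτ1 : τ < 1)
    (hP : 1/(1-ρ/2) - τ*ρ/100 ≤ ∑ l ∈ Finset.range r, ρ^l * (S (l+1) - S l)) :
    1 < S 1 ∧ 1 < (1 - ρ*(1-τ)/2) * ∑ l ∈ Finset.range r, (ρ*(1-τ))^l * (S (l+1) - S l) := by
  set P := ∑ l ∈ Finset.range r, ρ^l * (S (l+1) - S l) with hPdef
  set Q := ∑ l ∈ Finset.range r, (ρ*(1-τ))^l * (S (l+1) - S l) with hQdef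
  have hP0 : 1 + ρ/2 ≤ 1/(1-ρ/2) := by rw [le_div_iff₀ (by linarith)]; nlinarith
  have hPQ : P - Q ≤ τ * ρ / (1-ρ) * (S r - P) := by
    rw [← tele S hS0 r, hPdef, hQdef, ← Finset.sum_sub_distrib, ← Finset.sum_sub_distrib, Finset.mul_sum]
    refine Finset.sum_le_sum fun l _ => ?_
    have := mul_le_mul_of_nonneg_right (pow_diff_bound hρ0 hρ1 hτ0 hτ1 l) (sub_nonneg.2 (hm (Nat.le_succ l)))
    have e : Nat.succ l = l + 1 := rfl
    rw [e] at this
    linarith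
  have hτρ : τ * ρ ≤ ρ := by nlinarith
  have hτρ0 : 0 < τ * ρ := by positivity
  constructor
  · have h1 : P ≤ S 1 + ρ * (S r - S 1) := by
      obtain ⟨k, rfl⟩ : ∃ k, r = k + 1 := ⟨r - 1, by omega⟩
      have t := tele S hS0 (k+1)
      rw [Finset.sum_range_succ'] at t
      rw [hPdef, Finset.sum_range_succ']
      simp only [pow_zero, one_mul, zero_add, hS0, sub_zero] at t ⊢
      have : ∑ l ∈ Finset.range k, ρ^(l+1) * (S (l+1+1) - S (l+1)) ≤
          ρ * ∑ l ∈ Finset.range k, (S (l+1+1) - S (l+1)) := by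
        rw [Finset.mul_sum]
        refine Finset.sum_le_sum fun l _ => ?_
        refine mul_le_mul_of_nonneg_right ?_ (sub_nonneg.2 (hm (Nat.le_succ _)))
        rw [pow_succ]
        exact mul_le_of_le_one_left hρ0.le (pow_le_one₀ hρ0.le (by linarith))
      nlinarith
    nlinarith
  · have h1 : 0 < 1 - ρ := by linarith
    have h2 : (P - Q) * (1-ρ) ≤ τ * ρ * (S r - P) := by
      rw [div_mul_eq_mul_div, le_div_iff₀ h1] at hPQ; exact hPQ
    -- (S r - P)/(1-ρ) ≤ .3863 + small
    have h3 : S r - P ≤ 0.3863 * (1-ρ) + τ*ρ/100 := by nlinarith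
    have h4 : (P - Q) ≤ τ * ρ * 0.4 := by
      have : (P-Q) * (1-ρ) ≤ (τ * ρ * 0.4) * (1-ρ) := by
        refine h2.trans ?_
        have : S r - P ≤ 0.4 * (1-ρ) := by nlinarith
        nlinarith
      exact le_of_mul_le_mul_right this h1
    have h5 : (1-ρ/2) * (1/(1-ρ/2)) = 1 := by field_simp; rw [div_self (by linarith)]
    have h6 : 1 - τ*ρ/100 ≤ (1-ρ/2) * P := by nlinarith
    have h7 : 0 ≤ (1 - ρ*(1-τ)/2) := by nlinarith
    have h8 : (1 - ρ*(1-τ)/2) * (P - τ*ρ*0.4) ≤ (1 - ρ*(1-τ)/2) * Q :=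
      mul_le_mul_of_nonneg_left (by linarith) h7
    refine lt_of_lt_of_le ?_ h8
    have e : (1 - ρ*(1-τ)/2) * (P - τ*ρ*0.4) = (1-ρ/2)*P + τ*ρ*(P/2) - (1 - ρ*(1-τ)/2) * (τ*ρ*0.4) := by ring
    rw [e]
    have h9 : (1 - ρ*(1-τ)/2) * (τ*ρ*0.4) ≤ τ*ρ*0.4 := by nlinarith
    nlinarith

lemma brack {S : ℕ → ℝ} {r : ℕ} (hS0 : S 0 = 0) (hm : Monotone S) (hSr : S r ≤ 1.3863)
    {α θ : ℝ} (hα0 : 0 < α) (hα1 : α ≤ 1) (hθ0 : 0 < θ) (hθ1 : θ < 1/6) (hS1 : 1 ≤ S 1)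
    (hP : 1 < α * ((1 - θ) * ∑ l ∈ Finset.range r, (2*θ)^l * (S (l+1) - S l))) (n : ℕ) (hn : n + 1 ≤ r) :
    0 < ∑ l ∈ Finset.range (n+1), (2*θ)^l * (α * (1-θ) * S (l+1) - 1)
      + (2*θ)^n * (α * (θ - θ/20) * S (n+1)) := by
  set x := 2*θ with hx
  have hx1 : 0 < 1 - x := by linarith
  have hx0 : 0 < x := by linarith
  set f : ℕ → ℝ := fun l => α * (1-θ) * S l - 1 with hf
  set g : ℕ → ℝ := fun n => (1-x) * ∑ l ∈ Finset.range n, x^l * f (l+1) + x^n * f r with hg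
  have hαθ : 0 ≤ α * (1-θ) := mul_nonneg hα0.le (by linarith)
  have hgr : g r = α * ((1-θ) * ∑ l ∈ Finset.range r, x^l * (S (l+1) - S l)) - 1 := by
    have : ∀ k, (1-x) * ∑ l ∈ Finset.range k, x^l * f (l+1) + x^k * f k =
        α * ((1-θ) * ∑ l ∈ Finset.range k, x^l * (S (l+1) - S l)) - 1 := by
      intro k
      induction k with
      | zero => simp [hf, hS0]
      | succ k ih =>
        rw [Finset.sum_range_succ, Finset.sum_range_succ]
        simp only [hf] at ih ⊢
        rw [pow_succ]
        linear_combination ih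
    exact this r
  have hdec : ∀ k ≤ r, g r ≤ g k := by
    intro k hk
    induction hk using Nat.decreasingInduction with
    | self => exact le_rfl
    | of_succ k hk ih =>
      refine ih.trans ?_
      simp only [hg]
      rw [Finset.sum_range_succ, pow_succ]
      have : f (k+1) ≤ f r := by
        simp only [hf]
        have := mul_le_mul_of_nonneg_left (hm (by omega : k+1 ≤ r)) hαθ
        linarith
      have h2 : 0 ≤ (1-x) * x^k * (f r - f (k+1)) := mul_nonneg (by positivity) (by linarith)
      linarith
  have h1 := hdec (n+1) hn
  have h2 : 0 < g r := by rw [hgr]; linarith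
  have hSn : 1 ≤ S (n+1) := hS1.trans (hm (by omega))
  have hkey : x * f r ≤ (1-x) * (α * (θ - θ/20) * S (n+1)) := by
    simp only [hf, hx]
    have a1 : α * (1-θ) * S r ≤ α * (1-θ) * 1.3863 := mul_le_mul_of_nonneg_left hSr hαθ
    have a2 : α * 1 ≤ α * S (n+1) := mul_le_mul_of_nonneg_left hSn hα0.le
    have a3 : 2 * (α * (1-θ) * 1.3863 - 1) ≤ (1-2*θ) * (0.95 * α) := by nlinarith
    have a4 : (1-2*θ) * (0.95 * α) ≤ (1-2*θ) * (0.95 * (α * S (n+1))) :=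
      mul_le_mul_of_nonneg_left (by linarith) (by linarith)
    have a5 : 2 * (α * (1-θ) * S r - 1) ≤ (1-2*θ) * (0.95 * (α * S (n+1))) := by linarith
    have := mul_le_mul_of_nonneg_left a5 hθ0.le
    linarith
  have h3 : 0 < (1-x) * (∑ l ∈ Finset.range (n+1), x^l * (α * (1-θ) * S (l+1) - 1)
      + x^n * (α * (θ - θ/20) * S (n+1))) := by
    have e : g (n+1) = (1-x) * ∑ l ∈ Finset.range (n+1), x^l * (α * (1-θ) * S (l+1) - 1) + x^n * (x * f r) := by
      simp only [hg, hf]; rw [pow_succ]; ring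
    have := mul_le_mul_of_nonneg_left hkey (by positivity : 0 ≤ x^n)
    linarith
  exact pos_of_mul_pos_right h3 hx1.le

end EH

namespace EH

variable {ρ : ℝ} {a : ℕ → ℝ}

noncomputable def SS (ρ : ℝ) (a : ℕ → ℝ) (r l : ℕ) : ℝ := 2/2^r * hh ρ a r (r - l)

lemma Plim (h : ASeq ρ a) (hlim : Tendsto (fun j : ℕ => (2:ℝ) ^ ((j:ℝ) - 2) / Real.log (a j))
      atTop (nhds (1 - ρ/2))) {e : ℝ} (he : 0 < e) :
    ∃ r0, ∀ r ≥ r0, 1/(1-ρ/2) - e ≤ ∑ l ∈ Finset.range r, ρ^l * (SS ρ a r (l+1) - SS ρ a r l) := by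
  have hρ0 := h.hρ0
  have hρ1 := h.hρ1
  have h1 : Tendsto (fun r : ℕ => 2/2^r * Real.log (a (r+1))) atTop (nhds (1/(1-ρ/2))) := by
    have := (hlim.comp (tendsto_add_atTop_nat 1)).inv₀ (by linarith)
    rw [one_div]
    refine this.congr fun r => ?_
    simp only [Function.comp]
    rw [inv_div]
    have e : (2:ℝ) ^ (((r+1:ℕ):ℝ) - 2) = 2^r / 2 := by
      have : (((r+1:ℕ):ℝ) - 2) = (r:ℝ) - 1 := by push_cast; ring
      rw [this, Real.rpow_sub (by norm_num), Real.rpow_natCast, Real.rpow_one]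
    rw [e]; field_simp
  have h2 : Tendsto (fun r : ℕ => 2/2^r * Real.log 2) atTop (nhds 0) := by
    have := (tendsto_pow_atTop_nhds_zero_of_lt_one (r := (1/2:ℝ)) (by norm_num) (by norm_num)).mul_const (2 * Real.log 2)
    rw [zero_mul] at this
    refine this.congr fun r => ?_
    rw [one_div, inv_pow]; field_simp
  have h3 := h1.sub h2
  rw [sub_zero] at h3
  obtain ⟨r0, hr0⟩ := eventually_atTop.1 (h3.eventually (lt_mem_nhds (by linarith : 1/(1-ρ/2) - e < 1/(1-ρ/2))))
  refine ⟨r0, fun r hr => (hr0 r hr).le.trans ?_⟩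
  have h4 := mul_le_mul_of_nonneg_left (hh_main h r) (by positivity : (0:ℝ) ≤ 2/2^r)
  rw [Finset.mul_sum] at h4
  have h5 : 2/2^r * Real.log (a (r+1)) - 2/2^r * Real.log 2 = 2/2^r * (Real.log (a (r+1)) - Real.log 2) := by ring
  rw [h5]
  refine h4.trans (le_of_eq (Finset.sum_congr rfl fun l _ => ?_))
  unfold SS; ring

lemma SS_zero (h : ASeq ρ a) (r : ℕ) : SS ρ a r 0 = 0 := by
  unfold SS; rw [Nat.sub_zero, hh_top h, mul_zero]

lemma SS_mono (h : ASeq ρ a) (r : ℕ) : Monotone (SS ρ a r) := fun _ _ hl =>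
  mul_le_mul_of_nonneg_left (hh_anti h r (by omega)) (by positivity)

lemma SS_le (h : ASeq ρ a) (r l : ℕ) : SS ρ a r l ≤ 1.3863 := by
  have := mul_le_mul_of_nonneg_left (hh_le h r (r-l)) (by positivity : (0:ℝ) ≤ 2/2^r)
  have e : (2:ℝ)/2^r * (2^r * Real.log 2) = 2 * Real.log 2 := by field_simp
  have := Real.log_two_lt_d9
  unfold SS; linarith

lemma Ent_ge_SS (h : ASeq ρ a) {r j m : ℕ} (hj : j ≤ r) (hj1 : 1 ≤ j) (hm : m ≤ j) :
    2^(j-1) * SS ρ a r (j-m) ≤ Ent (mu ρ a r j) (Rel m) := by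
  have h1 := (mu_spec h hj).2.2 m
  have e : m + (r - j) = r - (j - m) := by omega
  rw [e] at h1
  unfold SS
  have e2 : (2:ℝ)^r = 2^(r-j) * (2 * 2^(j-1)) := by
    rw [← pow_succ', ← pow_add]; congr 1; omega
  have p : (0:ℝ) < 2^(r-j) := by positivity
  have p2 : (0:ℝ) < 2^(j-1) := by positivity
  have : (2:ℝ)^(j-1) * (2/2^r * hh ρ a r (r - (j-m))) = hh ρ a r (r-(j-m)) / 2^(r-j) := by
    rw [e2]; field_simp
  rw [this, div_le_iff₀ p]
  linarith

noncomputable def cc (θ : ℝ) (r j : ℕ) : ℝ := if j ≤ r then θ^(j-1) else θ^r/20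

noncomputable def FF (α : ℝ) (μ : (j : ℕ) → Om j → ℝ) (m j : ℕ) : ℝ := if m < j then Tm α μ j m else 0

lemma abel1 (c F : ℕ → ℝ) (C : ℝ) (hF : F 0 = 0) (r : ℕ) :
    ∑ k ∈ Finset.range r, (c (k+1) - C) * (F (k+1) - F k) =
    ∑ k ∈ Finset.range r, (c (k+1) - c (k+2)) * F (k+1) + (c (r+1) - C) * F r := by
  induction r with
  | zero => simp [hF]
  | succ r ih =>
    rw [Finset.sum_range_succ, Finset.sum_range_succ, ih]; ring

theorem params (h : ASeq ρ a) (hlim : Tendsto (fun j : ℕ => (2:ℝ) ^ ((j:ℝ) - 2) / Real.log (a j))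
      atTop (nhds (1 - ρ/2))) {θ : ℝ} (hθ0 : 0 < θ) (hθ1 : θ < ρ/2) :
    ∃ r0, ∀ r ≥ r0, 1 ≤ r → ∃ α, 0 < α ∧ α < 1 ∧ Fam r α (mu ρ a r) ∧
      ∀ m < r, 0 < ∑ k ∈ Finset.range r, (cc θ r (k+1) - cc θ r (r+1)) *
        (FF α (mu ρ a r) m (k+1) - FF α (mu ρ a r) m k) - cc θ r (r+1) * (2^r - 2^m) := by
  have hρ0 := h.hρ0
  have hρ1 := h.hρ1
  set τ := 1 - 2*θ/ρ with hτ
  have hτ0 : 0 < τ := by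
    rw [hτ, sub_pos, div_lt_one hρ0]; linarith
  have hτ1 : τ < 1 := by
    rw [hτ]; have : 0 < 2*θ/ρ := by positivity
    linarith
  have hx : ρ * (1-τ) = 2*θ := by rw [hτ]; field_simp; ring
  obtain ⟨r0, hr0⟩ := Plim h hlim (e := τ*ρ/100) (by positivity)
  refine ⟨r0, fun r hr hr1 => ?_⟩
  obtain ⟨hS1, hQ⟩ := absS hr1 (SS_zero h r) (SS_mono h r) (SS_le h r r) hρ0 hρ1 hτ0 hτ1 (hr0 r hr)
  rw [hx, mul_div_cancel_left₀ _ (two_ne_zero)] at hQ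
  set Q := (1-θ) * ∑ l ∈ Finset.range r, (2*θ)^l * (SS ρ a r (l+1) - SS ρ a r l) with hQd
  obtain ⟨α, hα1, hα2⟩ : ∃ α, max (1 / SS ρ a r 1) (1/Q) < α ∧ α < 1 := by
    apply exists_between
    rw [max_lt_iff]
    exact ⟨by rw [div_lt_one (by linarith)]; exact hS1, by rw [div_lt_one (by linarith)]; exact hQ⟩
  rw [max_lt_iff, div_lt_iff₀ (by linarith), div_lt_iff₀ (by linarith)] at hα1
  have hα0 : 0 < α := by
    by_contra hc
    have := hα1.1
    nlinarith
  have F : Fam r α (mu ρ a r) := by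
    refine ⟨hα0, hα2.le, fun j _ hj => (mu_spec h hj).1, fun j _ hj => (mu_spec h hj).2.1, fun j h1 hj => ?_⟩
    have h2 := Ent_ge_SS h (m := j-1) hj h1 (by omega)
    have e : j - (j-1) = 1 := by omega
    rw [e] at h2
    have h3 := mul_le_mul_of_nonneg_left h2 hα0.le
    have p : (0:ℝ) < 2^(j-1) := by positivity
    nlinarith [hα1.1]
  refine ⟨α, hα0, hα2, F, fun m hm => ?_⟩
  obtain ⟨n, rfl⟩ : ∃ n, r = m + (n + 1) := ⟨r - m - 1, by omega⟩
  have hb := brack (SS_zero h _) (SS_mono h _) (SS_le h _ _) hα0 hα2.le hθ0 (by linarith) hS1.le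
    hα1.2 n (by omega)
  set r := m + (n+1) with hrd
  set S := SS ρ a r with hSd
  rw [abel1 _ _ _ (by simp [FF]), sub_self, zero_mul, add_zero]
  have e1 : ∑ k ∈ Finset.range r, (cc θ r (k+1) - cc θ r (k+2)) * FF α (mu ρ a r) m (k+1) =
      ∑ l ∈ Finset.range (n+1), (cc θ r (m+l+1) - cc θ r (m+l+2)) * FF α (mu ρ a r) m (m+l+1) := by
    rw [hrd, Finset.sum_range_add, ← hrd]
    rw [Finset.sum_eq_zero, zero_add]
    intro k hk
    rw [Finset.mem_range] at hk
    unfold FF; rw [if_neg (by omega), mul_zero]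
  have cc1 : ∀ l ≤ n, cc θ r (m+l+1) = θ^(m+l) := fun l hl => by
    unfold cc; rw [if_pos (by omega)]; simp
  have cc2 : cc θ r (m+n+2) = θ^(m+n+1)/20 := by
    unfold cc; rw [if_neg (by omega), hrd]; rfl
  have e3 : r + 1 = m+n+2 := by omega
  have cmono : ∀ l ≤ n, 0 ≤ cc θ r (m+l+1) - cc θ r (m+l+2) := by
    intro l hl
    have p : 0 < θ^(m+l) := by positivity
    have q : θ^(m+l+1) ≤ θ^(m+l) := by rw [pow_succ]; nlinarith
    rcases hl.eq_or_lt with rfl | hl'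
    · rw [cc1 _ le_rfl, cc2]
      have : 0 < θ^(m+l+1) := by positivity
      linarith
    · rw [cc1 l hl, show m+l+2 = m+(l+1)+1 by ring, cc1 (l+1) (by omega)]
      rw [← add_assoc]; linarith
  have e2 : ∑ l ∈ Finset.range (n+1), (cc θ r (m+l+1) - cc θ r (m+l+2)) *
      (α * 2^(m+l) * S (l+1) - (2^(m+l+1) - 2^m)) ≤
      ∑ l ∈ Finset.range (n+1), (cc θ r (m+l+1) - cc θ r (m+l+2)) * FF α (mu ρ a r) m (m+l+1) := by
    refine Finset.sum_le_sum fun l hl => ?_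
    rw [Finset.mem_range] at hl
    refine mul_le_mul_of_nonneg_left ?_ (cmono l (by omega))
    unfold FF Tm
    rw [if_pos (by omega)]
    have h2 := Ent_ge_SS h (r := r) (m := m) (j := m+l+1) (by omega) (by omega) (by omega)
    have e4 : m + l + 1 - m = l + 1 := by omega
    rw [e4, Nat.add_sub_cancel] at h2
    have h3 := mul_le_mul_of_nonneg_left h2 hα0.le
    linarith
  have hA : ∀ k ≤ n, ∑ l ∈ Finset.range k, (cc θ r (m+l+1) - cc θ r (m+l+2)) *
      (α * 2^(m+l) * S (l+1) - (2^(m+l+1) - 2^m)) - θ^(m+k) * (2^(m+k) - 2^m) =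
      (2*θ)^m * ∑ l ∈ Finset.range k, (2*θ)^l * (α * (1-θ) * S (l+1) - 1) := by
    intro k hk
    induction k with
    | zero => simp
    | succ k ih =>
      have := ih (by omega)
      rw [Finset.sum_range_succ, Finset.sum_range_succ]
      rw [cc1 k (by omega), show m+k+2 = m+(k+1)+1 by ring, cc1 (k+1) (by omega)]
      simp only [mul_pow, pow_add, pow_one] at this ⊢
      linear_combination this
  have hA' := hA n le_rfl
  rw [e3, cc2]
  have hlast : ∑ l ∈ Finset.range (n+1), (cc θ r (m+l+1) - cc θ r (m+l+2)) *
      (α * 2^(m+l) * S (l+1) - (2^(m+l+1) - 2^m)) - θ^(m+n+1)/20 * (2^r - 2^m) =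
      (2*θ)^m * (∑ l ∈ Finset.range (n+1), (2*θ)^l * (α * (1-θ) * S (l+1) - 1)
      + (2*θ)^n * (α * (θ - θ/20) * S (n+1))) := by
    rw [Finset.sum_range_succ, Finset.sum_range_succ, cc1 n le_rfl, cc2, hrd]
    simp only [mul_pow, pow_add, pow_one] at hA' ⊢
    linear_combination hA'
  have : 0 < (2*θ)^m * (∑ l ∈ Finset.range (n+1), (2*θ)^l * (α * (1-θ) * S (l+1) - 1)
      + (2*θ)^n * (α * (θ - θ/20) * S (n+1))) := by positivity
  rw [e1]
  linarith

end EH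

namespace EH

/-! ### random sums -/
section lawX
variable {r : ℕ} (μ : (j : ℕ) → Om j → ℝ)

noncomputable def lawX (r : ℕ) : List (ℝ × ℕ) → ((Lam r → ℝ) → ℝ) → ℝ
  | [], g => g 0
  | (l, j) :: a, g => ∑ y : Om j, μ j y * lawX r a (fun d => g (d + l • upl r j (bv y)))

variable {μ}

lemma lawX_nil (g : (Lam r → ℝ) → ℝ) : lawX μ r [] g = g 0 := rfl
lemma lawX_cons (l : ℝ) (j : ℕ) (a : List (ℝ × ℕ)) (g : (Lam r → ℝ) → ℝ) :
    lawX μ r ((l, j) :: a) g = ∑ y : Om j, μ j y * lawX μ r a (fun d => g (d + l • upl r j (bv y))) := rfl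

lemma lawX_mono (hμ : ∀ j, IsLaw (μ j)) (a : List (ℝ × ℕ)) {g g' : (Lam r → ℝ) → ℝ}
    (h : ∀ d, g d ≤ g' d) : lawX μ r a g ≤ lawX μ r a g' := by
  induction a generalizing g g' with
  | nil => exact h 0
  | cons x a ih =>
    obtain ⟨l, j⟩ := x
    rw [lawX_cons, lawX_cons]
    exact Finset.sum_le_sum fun y _ => mul_le_mul_of_nonneg_left (ih fun d => h _) ((hμ j).pos y).le

lemma lawX_const (hμ : ∀ j, IsLaw (μ j)) (a : List (ℝ × ℕ)) (c : ℝ) :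
    lawX μ r a (fun _ => c) = c := by
  induction a with
  | nil => rfl
  | cons x a ih =>
    obtain ⟨l, j⟩ := x
    rw [lawX_cons, ih, ← Finset.sum_mul, (hμ j).sum, one_mul]

lemma lawX_nonneg (hμ : ∀ j, IsLaw (μ j)) (a : List (ℝ × ℕ)) {g : (Lam r → ℝ) → ℝ}
    (h : ∀ d, 0 ≤ g d) : 0 ≤ lawX μ r a g := by
  rw [← lawX_const (r := r) hμ a 0]
  exact lawX_mono hμ a h

lemma lawX_add (a : List (ℝ × ℕ)) (g g' : (Lam r → ℝ) → ℝ) :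
    lawX μ r a (fun d => g d + g' d) = lawX μ r a g + lawX μ r a g' := by
  induction a generalizing g g' with
  | nil => rfl
  | cons x a ih =>
    obtain ⟨l, j⟩ := x
    simp only [lawX_cons]
    rw [← Finset.sum_add_distrib]
    refine Finset.sum_congr rfl fun y _ => ?_
    rw [ih, mul_add]

lemma lawX_smul (a : List (ℝ × ℕ)) (c : ℝ) (g : (Lam r → ℝ) → ℝ) :
    lawX μ r a (fun d => c * g d) = c * lawX μ r a g := by
  induction a generalizing g with
  | nil => rfl
  | cons x a ih =>
    obtain ⟨l, j⟩ := x
    simp only [lawX_cons]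
    rw [Finset.mul_sum]
    refine Finset.sum_congr rfl fun y _ => ?_
    rw [ih]; ring

lemma lawX_sum {ι : Type*} (t : Finset ι) (a : List (ℝ × ℕ)) (g : ι → (Lam r → ℝ) → ℝ) :
    lawX μ r a (fun d => ∑ i ∈ t, g i d) = ∑ i ∈ t, lawX μ r a (g i) := by
  induction t using Finset.induction_on with
  | empty =>
    simp only [Finset.sum_empty]
    have := lawX_smul (μ := μ) (r := r) a 0 (fun _ => 0)
    simpa using this
  | insert i t hi ih =>
    simp only [Finset.sum_insert hi]
    rw [lawX_add, ih]

/-! ### nearness -/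
def near (C : ℝ) (U : Sub r) (z : Lam r → ℝ) : Prop := ∃ u ∈ U, ∀ l, |z l - u l| ≤ C

lemma near_add {C : ℝ} {U : Sub r} {z v : Lam r → ℝ} (hv : v ∈ U) : near C U (z + v) ↔ near C U z := by
  constructor
  · rintro ⟨u, hu, h⟩
    refine ⟨u - v, U.sub_mem hu hv, fun l => ?_⟩
    have := h l
    simp only [Pi.add_apply, Pi.sub_apply] at *
    convert this using 2; ring
  · rintro ⟨u, hu, h⟩
    refine ⟨u + v, U.add_mem hu hv, fun l => ?_⟩
    have := h l
    simp only [Pi.add_apply] at *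
    convert this using 2; ring

lemma near_sup {C : ℝ} {U : Sub r} {z v : Lam r → ℝ} {t : ℝ} (h : near C U (z + t • v)) :
    near C (U ⊔ Submodule.span ℝ {v}) z := by
  have h2 : near C (U ⊔ Submodule.span ℝ {v}) (z + t • v) := by
    obtain ⟨u, hu, h⟩ := h
    exact ⟨u, Submodule.mem_sup_left hu, h⟩
  refine (near_add ?_).1 h2
  exact Submodule.mem_sup_right (Submodule.smul_mem _ _ (Submodule.mem_span_singleton_self v))

lemma near_interval {C : ℝ} {U : Sub r} {v : Lam r → ℝ} (hv : v ∉ U) :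
    ∃ K : ℝ, 0 ≤ K ∧ ∀ z : Lam r → ℝ, ∃ x : ℝ, ∀ t : ℝ, near C U (z + t • v) → x ≤ t ∧ t ≤ x + K := by
  obtain ⟨f, hf, hU⟩ := Submodule.exists_le_ker_of_notMem (p := U) hv
  by_cases hC : 0 ≤ C
  swap
  · refine ⟨0, le_rfl, fun z => ⟨0, fun t ⟨u, _, h⟩ => ?_⟩⟩
    exact absurd ((abs_nonneg _).trans (h (fun _ => false))) hC
  set M : ℝ := ∑ l, |f (Pi.single l 1)| with hM
  have hM0 : 0 ≤ M := Finset.sum_nonneg fun _ _ => abs_nonneg _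
  have hfz : ∀ z : Lam r → ℝ, (∀ l, |z l| ≤ C) → |f z| ≤ M * C := by
    intro z hz
    have e : f z = ∑ l, z l * f (Pi.single l 1) := by
      conv_lhs => rw [LinearMap.pi_apply_eq_sum_univ f z]
      simp only [smul_eq_mul]
      refine Finset.sum_congr rfl fun l _ => ?_
      congr 2
      funext i
      simp [Pi.single_apply, eq_comm]
    rw [e, hM, Finset.sum_mul]
    refine (Finset.abs_sum_le_sum_abs _ _).trans (Finset.sum_le_sum fun l _ => ?_)
    rw [abs_mul, mul_comm]
    exact mul_le_mul_of_nonneg_left (hz l) (abs_nonneg _)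
  set c := f v with hc
  refine ⟨2 * (M * C / |c|), by positivity, fun z => ⟨- f z / c - M * C / |c|, fun t ⟨u, hu, h⟩ => ?_⟩⟩
  have h1 := hfz (z + t • v - u) h
  have hu0 : f u = 0 := by have := hU hu; simpa using this
  rw [map_sub, map_add, map_smul, hu0, sub_zero, smul_eq_mul, ← hc] at h1
  have e2 : f z + t * c = c * (t - (- f z / c)) := by field_simp; ring
  rw [e2, abs_mul] at h1
  have hcp : 0 < |c| := abs_pos.2 hf
  have h3 : |t - (- f z / c)| ≤ M * C / |c| := by
    rw [le_div_iff₀ hcp]; linarith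
  rw [abs_le] at h3
  constructor <;> linarith [h3.1, h3.2]

/-! ### collision functional -/
noncomputable def indn (C : ℝ) (U : Sub r) (z : Lam r → ℝ) : ℝ := if near C U z then 1 else 0

lemma indn_nonneg {C : ℝ} {U : Sub r} {z : Lam r → ℝ} : 0 ≤ indn C U z := by
  unfold indn; split_ifs <;> norm_num
lemma indn_le {C : ℝ} {U : Sub r} {z : Lam r → ℝ} : indn C U z ≤ 1 := by
  unfold indn; split_ifs <;> norm_num

noncomputable def conc (μ : (j : ℕ) → Om j → ℝ) (C : ℝ) (a : List (ℝ × ℕ)) (U : Sub r) (d : Lam r → ℝ) : ℝ :=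
  lawX μ r a (fun d' => indn C U (d' - d))

noncomputable def JJ (μ : (j : ℕ) → Om j → ℝ) (C s : ℝ) (a : List (ℝ × ℕ)) (U : Sub r) : ℝ :=
  lawX μ r a (fun d => conc μ C a U d ^ s)

lemma conc_nonneg (hμ : ∀ j, IsLaw (μ j)) {C : ℝ} {a : List (ℝ × ℕ)} {U : Sub r} {d : Lam r → ℝ} :
    0 ≤ conc μ C a U d := lawX_nonneg hμ _ fun _ => indn_nonneg

lemma conc_le_one (hμ : ∀ j, IsLaw (μ j)) {C : ℝ} {a : List (ℝ × ℕ)} {U : Sub r} {d : Lam r → ℝ} :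
    conc μ C a U d ≤ 1 := by
  rw [← lawX_const (r := r) hμ a 1]
  exact lawX_mono hμ _ fun _ => indn_le

lemma JJ_nonneg (hμ : ∀ j, IsLaw (μ j)) {C s : ℝ} {a : List (ℝ × ℕ)} {U : Sub r} :
    0 ≤ JJ μ C s a U := lawX_nonneg hμ _ fun _ => Real.rpow_nonneg (conc_nonneg hμ) _

lemma JJ_le_one (hμ : ∀ j, IsLaw (μ j)) {C s : ℝ} (hs : 0 ≤ s) {a : List (ℝ × ℕ)} {U : Sub r} :
    JJ μ C s a U ≤ 1 := by
  rw [← lawX_const (r := r) hμ a 1]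
  exact lawX_mono hμ _ fun _ => Real.rpow_le_one (conc_nonneg hμ) (conc_le_one hμ) hs

/-- shifted concentration -/
noncomputable def concS (μ : (j : ℕ) → Om j → ℝ) (C : ℝ) (a : List (ℝ × ℕ)) (U : Sub r) (v : Lam r → ℝ)
    (d : Lam r → ℝ) : ℝ :=
  lawX μ r a (fun d' => indn C U (d' - d + v))

lemma concS_nonneg (hμ : ∀ j, IsLaw (μ j)) {C : ℝ} {a : List (ℝ × ℕ)} {U : Sub r} {v d : Lam r → ℝ} :
    0 ≤ concS μ C a U v d := lawX_nonneg hμ _ fun _ => indn_nonneg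

lemma rpow_sum_le {ι : Type*} (t : Finset ι) (f : ι → ℝ) (hf : ∀ i ∈ t, 0 ≤ f i) {s : ℝ} (hs : 0 < s) (hs1 : s ≤ 1) :
    (∑ i ∈ t, f i) ^ s ≤ ∑ i ∈ t, f i ^ s := by
  induction t using Finset.induction_on with
  | empty => simp [Real.zero_rpow hs.ne']
  | insert i t hi ih =>
    rw [Finset.sum_insert hi, Finset.sum_insert hi]
    have h1 := hf i (Finset.mem_insert_self _ _)
    have h2 : ∀ i ∈ t, 0 ≤ f i := fun k hk => hf k (Finset.mem_insert_of_mem hk)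
    exact (Real.rpow_add_le_add_rpow h1 (Finset.sum_nonneg h2) hs.le hs1).trans (by gcongr; exact ih h2)

noncomputable def dl (r j : ℕ) (y y' : Om j) : Lam r → ℝ := upl r j (bv y' - bv y)

lemma dl_mem {j : ℕ} {U : Sub r} {y y' : Om j} : dl r j y y' ∈ U ↔ RelU U y y' := by
  unfold dl RelU
  rw [← neg_sub, map_neg, U.neg_mem_iff]

noncomputable def phi (μ : (j : ℕ) → Om j → ℝ) (s : ℝ) (j : ℕ) (U : Sub r) : ℝ :=
  ∑ y, μ j y * cls (μ j) (RelU (j := j) U) y ^ s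

lemma JJ_cons_le (hμ : ∀ j, IsLaw (μ j)) {C s : ℝ} (hs : 0 < s) (hs1 : s ≤ 1) (l : ℝ) (j : ℕ)
    (a : List (ℝ × ℕ)) (U : Sub r) :
    JJ μ C s ((l, j) :: a) U ≤ phi μ s j U * JJ μ C s a U +
      ∑ y : Om j, ∑ y' : Om j, if RelU U y y' then 0 else
        lawX μ r a (fun d => concS μ C a U (l • dl r j y y') d ^ s) := by
  unfold JJ
  rw [lawX_cons]
  unfold phi
  rw [Finset.sum_mul, ← Finset.sum_add_distrib]
  refine Finset.sum_le_sum fun y _ => ?_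
  have hpt : ∀ d : Lam r → ℝ, conc μ C ((l, j) :: a) U (d + l • upl r j (bv y)) ^ s ≤
      cls (μ j) (RelU U) y ^ s * conc μ C a U d ^ s + ∑ y' : Om j, if RelU U y y' then 0 else
        concS μ C a U (l • dl r j y y') d ^ s := by
    intro d
    have e : conc μ C ((l, j) :: a) U (d + l • upl r j (bv y)) = cls (μ j) (RelU U) y * conc μ C a U d +
        ∑ y' : Om j, if RelU U y y' then 0 else μ j y' * concS μ C a U (l • dl r j y y') d := by
      unfold conc cls
      rw [lawX_cons, Finset.sum_mul, ← Finset.sum_add_distrib]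
      refine Finset.sum_congr rfl fun y' _ => ?_
      have hz : ∀ d' : Lam r → ℝ, d' + l • upl r j (bv y') - (d + l • upl r j (bv y)) =
          d' - d + l • dl r j y y' := by
        intro d'; unfold dl; rw [map_sub, smul_sub]; abel
      simp only [hz]
      split_ifs with h
      · rw [add_zero]
        congr 2
        funext d'
        unfold indn
        congr 1
        exact propext (near_add (U.smul_mem _ (dl_mem.2 h)))
      · rw [zero_mul, zero_add]; rfl
    rw [e]
    have hc0 : 0 ≤ cls (μ j) (RelU U) y := (cls_pos (hμ j) (RelU_equiv U) y).le
    refine (Real.rpow_add_le_add_rpow (mul_nonneg hc0 (conc_nonneg hμ)) ?_ hs.le hs1).trans ?_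
    · refine Finset.sum_nonneg fun y' _ => ?_
      split_ifs
      · exact le_rfl
      · exact mul_nonneg ((hμ j).pos _).le (concS_nonneg hμ)
    rw [Real.mul_rpow hc0 (conc_nonneg hμ)]
    gcongr
    refine (rpow_sum_le _ _ (fun y' _ => ?_) hs hs1).trans (Finset.sum_le_sum fun y' _ => ?_)
    · split_ifs
      · exact le_rfl
      · exact mul_nonneg ((hμ j).pos _).le (concS_nonneg hμ)
    · split_ifs
      · rw [Real.zero_rpow hs.ne']
      · refine Real.rpow_le_rpow (mul_nonneg ((hμ j).pos _).le (concS_nonneg hμ)) ?_ hs.le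
        refine mul_le_of_le_one_left (concS_nonneg hμ) ?_
        rw [← (hμ j).sum]
        exact Finset.single_le_sum (f := μ j) (fun z _ => ((hμ j).pos z).le) (Finset.mem_univ y')
  have hy0 : 0 ≤ μ j y := ((hμ j).pos y).le
  have hy1 : μ j y ≤ 1 := by
    rw [← (hμ j).sum]
    exact Finset.single_le_sum (f := μ j) (fun z _ => ((hμ j).pos z).le) (Finset.mem_univ y)
  refine (mul_le_mul_of_nonneg_left (lawX_mono hμ a hpt) hy0).trans ?_
  rw [lawX_add, lawX_smul, lawX_sum, mul_add, mul_assoc]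
  gcongr
  have hS : ∑ y' : Om j, lawX μ r a (fun d => if RelU U y y' then 0 else concS μ C a U (l • dl r j y y') d ^ s)
      = ∑ y' : Om j, if RelU U y y' then 0 else
        lawX μ r a (fun d => concS μ C a U (l • dl r j y y') d ^ s) := by
    refine Finset.sum_congr rfl fun y' _ => ?_
    split_ifs
    · exact lawX_const hμ a 0
    · rfl
  rw [hS]
  refine mul_le_of_le_one_left (Finset.sum_nonneg fun y' _ => ?_) hy1
  split_ifs
  · exact le_rfl
  · exact lawX_nonneg hμ _ fun d => Real.rpow_nonneg (concS_nonneg hμ) _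

end lawX

/-! ### random slots -/
section slots
variable {r : ℕ} {μ : (j : ℕ) → Om j → ℝ}

/-- expectation over the active values in a list of slots -/
noncomputable def Eact (val : ℕ → ℝ) (w : Finset ℕ → ℕ → ℝ) :
    List (Finset ℕ × ℕ) → (List (ℝ × ℕ) → ℝ) → ℝ
  | [], F => F []
  | (P, j) :: Ls, F => (1 - ∑ p ∈ P, w P p) * Eact val w Ls F
      + ∑ p ∈ P, w P p * Eact val w Ls (fun a => F ((val p, j) :: a))

variable {val : ℕ → ℝ} {w : Finset ℕ → ℕ → ℝ}

structure GoodSlot (w : Finset ℕ → ℕ → ℝ) (P : Finset ℕ) : Prop where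
  nonneg : ∀ p ∈ P, 0 ≤ w P p
  le_one : ∑ p ∈ P, w P p ≤ 1

lemma Eact_mono {Ls : List (Finset ℕ × ℕ)} (hg : ∀ x ∈ Ls, GoodSlot w x.1) {F F' : List (ℝ × ℕ) → ℝ}
    (h : ∀ a, F a ≤ F' a) : Eact val w Ls F ≤ Eact val w Ls F' := by
  induction Ls generalizing F F' with
  | nil => exact h []
  | cons x Ls ih =>
    obtain ⟨P, j⟩ := x
    have hP := hg (P, j) (by simp)
    have ih' := fun {F F'} h => ih (F := F) (F' := F') (fun x hx => hg x (by simp [hx])) h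
    unfold Eact
    refine add_le_add (mul_le_mul_of_nonneg_left (ih' h) (by have := hP.le_one; simp only at this; linarith)) ?_
    exact Finset.sum_le_sum fun p hp => mul_le_mul_of_nonneg_left (ih' fun a => h _) (hP.nonneg p hp)

lemma Eact_add {Ls : List (Finset ℕ × ℕ)} (F F' : List (ℝ × ℕ) → ℝ) :
    Eact val w Ls (fun a => F a + F' a) = Eact val w Ls F + Eact val w Ls F' := by
  induction Ls generalizing F F' with
  | nil => rfl
  | cons x Ls ih =>
    obtain ⟨P, j⟩ := x
    unfold Eact
    simp only [ih, mul_add, Finset.sum_add_distrib]; ring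

lemma Eact_smul {Ls : List (Finset ℕ × ℕ)} (c : ℝ) (F : List (ℝ × ℕ) → ℝ) :
    Eact val w Ls (fun a => c * F a) = c * Eact val w Ls F := by
  induction Ls generalizing F with
  | nil => rfl
  | cons x Ls ih =>
    obtain ⟨P, j⟩ := x
    unfold Eact
    simp only [ih]
    rw [mul_add, Finset.mul_sum]
    congr 1
    · ring
    · exact Finset.sum_congr rfl fun p _ => by ring

lemma Eact_sum {ι : Type*} (t : Finset ι) {Ls : List (Finset ℕ × ℕ)} (F : ι → List (ℝ × ℕ) → ℝ) :
    Eact val w Ls (fun a => ∑ i ∈ t, F i a) = ∑ i ∈ t, Eact val w Ls (F i) := by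
  induction t using Finset.induction_on with
  | empty =>
    simp only [Finset.sum_empty]
    have := Eact_smul (val := val) (w := w) (Ls := Ls) 0 (fun _ => 0)
    simpa using this
  | insert i t hi ih =>
    simp only [Finset.sum_insert hi]
    rw [Eact_add, ih]

lemma Eact_const {Ls : List (Finset ℕ × ℕ)} (c : ℝ) : Eact val w Ls (fun _ => c) = c := by
  induction Ls with
  | nil => rfl
  | cons x Ls ih =>
    obtain ⟨P, j⟩ := x
    unfold Eact
    simp only [ih]
    rw [← Finset.sum_mul]; ring

lemma Eact_nonneg {Ls : List (Finset ℕ × ℕ)} (hg : ∀ x ∈ Ls, GoodSlot w x.1) {F : List (ℝ × ℕ) → ℝ}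
    (h : ∀ a, 0 ≤ F a) : 0 ≤ Eact val w Ls F := by
  rw [← Eact_const (val := val) (w := w) (Ls := Ls) 0]
  exact Eact_mono hg h

noncomputable def RR (μ : (j : ℕ) → Om j → ℝ) (C s : ℝ) (val : ℕ → ℝ) (w : Finset ℕ → ℕ → ℝ)
    (Ls : List (Finset ℕ × ℕ)) (U : Sub r) : ℝ := Eact val w Ls (fun a => JJ μ C s a U)

lemma jensen_slot {ι : Type*} (P : Finset ι) (w b : ι → ℝ) (hw : ∀ p ∈ P, 0 ≤ w p) (h1 : ∑ p ∈ P, w p ≤ 1)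
    (hb : ∀ p ∈ P, 0 ≤ b p) {s : ℝ} (hs : 0 < s) (hs1 : s < 1) :
    ∑ p ∈ P, w p * b p ^ s ≤ (∑ p ∈ P, w p * b p) ^ s := by
  have hq : s⁻¹.HolderConjugate (1 - s)⁻¹ := by
    rw [Real.holderConjugate_iff]
    constructor
    · exact (one_lt_inv₀ hs).2 hs1
    · simp
  have := Real.inner_le_Lp_mul_Lq_of_nonneg P (f := fun p => (w p * b p) ^ s) (g := fun p => w p ^ (1 - s)) hq
    (fun p hp => Real.rpow_nonneg (mul_nonneg (hw p hp) (hb p hp)) _) (fun p hp => Real.rpow_nonneg (hw p hp) _)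
  have e1 : ∑ p ∈ P, (w p * b p) ^ s * w p ^ (1 - s) = ∑ p ∈ P, w p * b p ^ s := by
    refine Finset.sum_congr rfl fun p hp => ?_
    rw [Real.mul_rpow (hw p hp) (hb p hp)]
    rcases (hw p hp).eq_or_lt with h | h
    · rw [← h, Real.zero_rpow hs.ne']; ring
    · have : w p ^ s * w p ^ (1 - s) = w p := by
        rw [← Real.rpow_add h]; simp
      calc _ = (w p ^ s * w p ^ (1 - s)) * b p ^ s := by ring
        _ = _ := by rw [this]
  have e2 : ∑ p ∈ P, ((w p * b p) ^ s) ^ s⁻¹ = ∑ p ∈ P, w p * b p :=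
    Finset.sum_congr rfl fun p hp => Real.rpow_rpow_inv (mul_nonneg (hw p hp) (hb p hp)) hs.ne'
  have e3 : ∑ p ∈ P, (w p ^ (1 - s)) ^ (1 - s)⁻¹ = ∑ p ∈ P, w p :=
    Finset.sum_congr rfl fun p hp => Real.rpow_rpow_inv (hw p hp) (by linarith)
  rw [e1, e2, e3] at this
  simp only [one_div, inv_inv] at this
  refine this.trans ?_
  refine mul_le_of_le_one_right (Real.rpow_nonneg (Finset.sum_nonneg fun p hp => mul_nonneg (hw p hp) (hb p hp)) _) ?_
  exact Real.rpow_le_one (Finset.sum_nonneg hw) h1 (by linarith)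

lemma slot_conc (hμ : ∀ j, IsLaw (μ j)) {C s : ℝ} (hs : 0 < s) (hs1 : s < 1) {P : Finset ℕ} (hP : GoodSlot w P)
    {U : Sub r} {v : Lam r → ℝ} {K b : ℝ}
    (hK : ∀ z : Lam r → ℝ, ∃ x : ℝ, ∀ t : ℝ, near C U (z + t • v) → x ≤ t ∧ t ≤ x + K)
    (hb : ∀ x : ℝ, ∑ p ∈ P.filter (fun p => x ≤ val p ∧ val p ≤ x + K), w P p ≤ b) (a : List (ℝ × ℕ)) :
    ∑ p ∈ P, w P p * lawX μ r a (fun d => concS μ C a U (val p • v) d ^ s)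
      ≤ b ^ s * JJ μ C s a (U ⊔ Submodule.span ℝ {v}) := by
  have hb0 : 0 ≤ b := (Finset.sum_nonneg fun p hp => hP.nonneg p (Finset.mem_of_mem_filter p hp)).trans (hb 0)
  unfold JJ
  rw [← lawX_smul]
  simp_rw [← lawX_smul]
  rw [← lawX_sum]
  refine lawX_mono hμ a fun d => ?_
  refine (jensen_slot P (w P) _ hP.nonneg hP.le_one (fun p _ => concS_nonneg hμ) hs hs1).trans ?_
  rw [← Real.mul_rpow hb0 (conc_nonneg hμ)]
  refine Real.rpow_le_rpow (Finset.sum_nonneg fun p hp => mul_nonneg (hP.nonneg p hp) (concS_nonneg hμ)) ?_ hs.le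
  unfold concS conc
  rw [← lawX_smul]
  simp_rw [← lawX_smul]
  rw [← lawX_sum]
  refine lawX_mono hμ a fun d' => ?_
  obtain ⟨x, hx⟩ := hK (d' - d)
  by_cases hn : near C (U ⊔ Submodule.span ℝ {v}) (d' - d)
  · have e : indn C (U ⊔ Submodule.span ℝ {v}) (d' - d) = 1 := if_pos hn
    rw [e, mul_one]
    refine le_trans ?_ (hb x)
    rw [Finset.sum_filter]
    refine Finset.sum_le_sum fun p hp => ?_
    unfold indn
    have := hP.nonneg p hp
    by_cases h : near C U (d' - d + val p • v)
    · rw [if_pos h, if_pos (hx _ h), mul_one]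
    · rw [if_neg h, mul_zero]
      split_ifs
      · exact this
      · exact le_rfl
  · have e : indn C (U ⊔ Submodule.span ℝ {v}) (d' - d) = 0 := if_neg hn
    rw [e, mul_zero]
    refine (Finset.sum_eq_zero fun p _ => ?_).le
    have : indn C U (d' - d + val p • v) = 0 := if_neg fun h => hn (near_sup h)
    rw [this, mul_zero]

lemma RR_cons_le (hμ : ∀ j, IsLaw (μ j)) {C s : ℝ} (hs : 0 < s) (hs1 : s < 1) {P : Finset ℕ} (j : ℕ)
    {Ls : List (Finset ℕ × ℕ)} (hP : GoodSlot w P) (hg : ∀ x ∈ Ls, GoodSlot w x.1)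
    {U : Sub r} {K b : ℝ}
    (hK : ∀ y y' : Om j, ¬ RelU U y y' → ∀ z : Lam r → ℝ, ∃ x : ℝ, ∀ t : ℝ,
      near C U (z + t • dl r j y y') → x ≤ t ∧ t ≤ x + K)
    (hb : ∀ x : ℝ, ∑ p ∈ P.filter (fun p => x ≤ val p ∧ val p ≤ x + K), w P p ≤ b) :
    RR μ C s val w ((P, j) :: Ls) U ≤ (1 - (∑ p ∈ P, w P p) * (1 - phi μ s j U)) * RR μ C s val w Ls U +
      ∑ y : Om j, ∑ y' : Om j, if RelU U y y' then 0 else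
        b ^ s * RR μ C s val w Ls (U ⊔ Submodule.span ℝ {dl r j y y'}) := by
  have h1 : ∑ p ∈ P, w P p * Eact val w Ls (fun a => JJ μ C s ((val p, j) :: a) U) ≤
      (∑ p ∈ P, w P p) * phi μ s j U * RR μ C s val w Ls U + ∑ y : Om j, ∑ y' : Om j, if RelU U y y' then 0 else
        b ^ s * RR μ C s val w Ls (U ⊔ Submodule.span ℝ {dl r j y y'}) := by
    simp_rw [← Eact_smul]
    rw [← Eact_sum]
    have e : (∑ p ∈ P, w P p) * phi μ s j U * RR μ C s val w Ls U + (∑ y : Om j, ∑ y' : Om j, if RelU U y y' then 0 else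
        b ^ s * RR μ C s val w Ls (U ⊔ Submodule.span ℝ {dl r j y y'})) =
        Eact val w Ls (fun a => (∑ p ∈ P, w P p) * phi μ s j U * JJ μ C s a U + ∑ y : Om j, ∑ y' : Om j, if RelU U y y' then 0 else
        b ^ s * JJ μ C s a (U ⊔ Submodule.span ℝ {dl r j y y'})) := by
      rw [Eact_add, Eact_smul, Eact_sum]
      unfold RR
      congr 1
      refine Finset.sum_congr rfl fun y _ => ?_
      rw [Eact_sum]
      refine Finset.sum_congr rfl fun y' _ => ?_
      split_ifs
      · rw [Eact_const]
      · rw [Eact_smul]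
    rw [e]
    refine Eact_mono hg fun a => ?_
    refine (Finset.sum_le_sum fun p hp => mul_le_mul_of_nonneg_left
      (JJ_cons_le (C := C) hμ hs hs1.le (val p) j a U) (hP.nonneg p hp)).trans ?_
    simp_rw [mul_add]
    rw [Finset.sum_add_distrib]
    refine add_le_add (le_of_eq ?_) ?_
    · rw [← Finset.sum_mul, mul_assoc]
    simp_rw [Finset.mul_sum]
    rw [Finset.sum_comm]
    refine Finset.sum_le_sum fun y _ => ?_
    rw [Finset.sum_comm]
    refine Finset.sum_le_sum fun y' _ => ?_
    split_ifs with h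
    · simp
    · exact slot_conc hμ hs hs1 hP (hK y y' h) hb a
  have : RR μ C s val w ((P, j) :: Ls) U = (1 - ∑ p ∈ P, w P p) * RR μ C s val w Ls U
      + ∑ p ∈ P, w P p * Eact val w Ls (fun a => JJ μ C s ((val p, j) :: a) U) := rfl
  rw [this]
  linarith [h1]

end slots
end EH

namespace EH

section
variable {r : ℕ} {μ : (j : ℕ) → Om j → ℝ}

lemma Ent_zero {Ω : Type*} [Fintype Ω] {ν : Ω → ℝ} (hν : IsLaw ν) {R : Ω → Ω → Prop} (hR : Equivalence R)
    (h : Ent ν R = 0) (y y' : Ω) : R y y' := by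
  by_contra hn
  have hlt : cls ν R y < 1 := by
    rw [← hν.sum]
    unfold cls
    refine Finset.sum_lt_sum (fun z _ => ?_) ⟨y', Finset.mem_univ _, ?_⟩
    · split_ifs
      · exact le_rfl
      · exact (hν.pos z).le
    · rw [if_neg hn]; exact hν.pos y'
  have hneg : ∑ z, ν z * Real.log (cls ν R z) < 0 := by
    refine Finset.sum_neg' (fun z _ => ?_) ⟨y, Finset.mem_univ _, ?_⟩
    · exact mul_nonpos_of_nonneg_of_nonpos (hν.pos z).le
        (Real.log_nonpos (cls_pos hν hR z).le (cls_le_one hν R z))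
    · exact mul_neg_of_pos_of_neg (hν.pos y) (Real.log_neg (cls_pos hν hR y) hlt)
  unfold Ent at h
  linarith

lemma exp_neg_le_quad {x : ℝ} (hx : 0 ≤ x) : Real.exp (-x) ≤ 1 - x + x^2 := by
  have h1 := Real.add_one_le_exp x
  rw [Real.exp_neg]
  have h2 : (Real.exp x)⁻¹ ≤ (x+1)⁻¹ := inv_anti₀ (by linarith) h1
  refine h2.trans ?_
  rw [inv_le_iff_one_le_mul₀ (by linarith)]
  nlinarith [pow_nonneg hx 3]

lemma exists_s (hμ : ∀ j, IsLaw (μ j)) (r : ℕ) {η : ℝ} (hη : 0 < η) :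
    ∃ s : ℝ, 0 < s ∧ s < 1 ∧ ∀ j ≤ r, ∀ U : Sub r, (1 - η) * s * HH r j (μ j) U ≤ 1 - phi μ s j U := by
  set T : ℝ := ∑ j ∈ Finset.range (r+1), ∑ y : Om j, - Real.log (μ j y) with hT
  have hl : ∀ j (y : Om j), 0 ≤ - Real.log (μ j y) := by
    intro j y
    have h1 : μ j y ≤ 1 := by
      rw [← (hμ j).sum]
      exact Finset.single_le_sum (f := μ j) (fun z _ => ((hμ j).pos z).le) (Finset.mem_univ y)
    have := Real.log_nonpos ((hμ j).pos y).le h1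
    linarith
  have hT0 : 0 ≤ T := Finset.sum_nonneg fun j _ => Finset.sum_nonneg fun y _ => hl j y
  have hs0 : 0 < min (1/2) (η / (T+1)) := lt_min (by norm_num) (by positivity)
  refine ⟨min (1/2) (η / (T+1)), hs0, ?_, ?_⟩
  · exact (min_le_left _ _).trans_lt (by norm_num)
  intro j hj U
  set s := min (1/2) (η / (T+1)) with hs
  have hsT : s * T ≤ η := by
    have h1 : s ≤ η / (T+1) := min_le_right _ _
    calc s * T ≤ η / (T+1) * (T+1) := by
            apply mul_le_mul h1 (by linarith) hT0 (by positivity)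
      _ = η := by field_simp
  have hpt : ∀ y : Om j, cls (μ j) (RelU U) y ^ s ≤ 1 + (1 - η) * s * Real.log (cls (μ j) (RelU U) y) := by
    intro y
    have hc := cls_pos (hμ j) (RelU_equiv (r := r) U) y
    have hc1 := cls_le_one (hμ j) (RelU (r := r) U) y
    have hlt : - Real.log (cls (μ j) (RelU U) y) ≤ T := by
      have h1 : μ j y ≤ cls (μ j) (RelU U) y := by
        unfold cls
        have := Finset.single_le_sum (f := fun y' => if RelU U y y' then μ j y' else 0) (s := Finset.univ)
          (fun z _ => by split_ifs; exacts [((hμ j).pos z).le, le_rfl]) (Finset.mem_univ y)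
        simpa [(RelU_equiv (r := r) U).refl y] using this
      have h2 := Real.log_le_log ((hμ j).pos y) h1
      have h3 : - Real.log (μ j y) ≤ T :=
        (Finset.single_le_sum (f := fun y => - Real.log (μ j y)) (fun z _ => hl j z) (Finset.mem_univ y)).trans
          (Finset.single_le_sum (f := fun j => ∑ y : Om j, - Real.log (μ j y))
            (fun j _ => Finset.sum_nonneg fun y _ => hl j y) (Finset.mem_range.2 (by omega)))
      linarith
    have hl0 : 0 ≤ - Real.log (cls (μ j) (RelU U) y) := by
      have := Real.log_nonpos hc.le hc1; linarith
    set t := - Real.log (cls (μ j) (RelU U) y) with ht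
    have hlog : Real.log (cls (μ j) (RelU U) y) = - t := by rw [ht]; ring
    rw [Real.rpow_def_of_pos hc, hlog]
    have := exp_neg_le_quad (x := s * t) (by positivity)
    have e : -t * s = -(s * t) := by ring
    rw [e]
    have h4 : s * t ≤ η := (mul_le_mul_of_nonneg_left hlt hs0.le).trans hsT
    have h5 : (s*t)^2 ≤ η * (s * t) := by
      rw [sq]; exact mul_le_mul_of_nonneg_right h4 (by positivity)
    linarith
  have : phi μ s j U ≤ 1 - (1 - η) * s * HH r j (μ j) U := by
    unfold phi HH Ent
    calc ∑ y, μ j y * cls (μ j) (RelU U) y ^ s ≤ ∑ y, μ j y * (1 + (1 - η) * s * Real.log (cls (μ j) (RelU U) y)) :=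
          Finset.sum_le_sum fun y _ => mul_le_mul_of_nonneg_left (hpt y) ((hμ j).pos y).le
      _ = ∑ y, μ j y + (1 - η) * s * ∑ y, μ j y * Real.log (cls (μ j) (RelU U) y) := by
          rw [Finset.mul_sum, ← Finset.sum_add_distrib]
          exact Finset.sum_congr rfl fun y _ => by ring
      _ = _ := by rw [(hμ j).sum]; ring
  linarith

structure SlotOK (val : ℕ → ℝ) (w : Finset ℕ → ℕ → ℝ) (B σ q : ℝ) (P : Finset ℕ) (i : ℕ) : Prop where
  good : GoodSlot w P
  act : q ≤ ∑ p ∈ P, w P p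
  loc : ∀ K : ℝ, 0 ≤ K → ∀ x : ℝ,
    ∑ p ∈ P.filter (fun p => x ≤ val p ∧ val p ≤ x + K), w P p ≤ B * (K+1) * Real.exp (-σ * i)

def LsOK (val : ℕ → ℝ) (w : Finset ℕ → ℕ → ℝ) (B σ q : ℝ) (r nb : ℕ) : List (Finset ℕ × ℕ) → Prop
  | [] => True
  | (P, j) :: Ls => SlotOK val w B σ q P (nb + Ls.length + 1) ∧ (1 ≤ j ∧ j ≤ r) ∧ LsOK val w B σ q r nb Ls

lemma LsOK.good {val : ℕ → ℝ} {w : Finset ℕ → ℕ → ℝ} {B σ q : ℝ} {r nb : ℕ} {Ls : List (Finset ℕ × ℕ)}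
    (h : LsOK val w B σ q r nb Ls) : ∀ x ∈ Ls, GoodSlot w x.1 := by
  induction Ls with
  | nil => simp
  | cons x Ls ih =>
    obtain ⟨P, j⟩ := x
    obtain ⟨h1, _, h3⟩ := h
    intro x hx
    rcases List.mem_cons.1 hx with rfl | hx
    · exact h1.good
    · exact ih h3 x hx

/-- the energy -/
noncomputable def Eng (r : ℕ) (α : ℝ) (nb : ℕ) (μ : (j : ℕ) → Om j → ℝ) (ls : List ℕ) (U : Sub r) : ℝ :=
  Psi r α nb μ ls U - (nb + ls.length) * Module.finrank ℝ U

lemma Eng_step1 (α : ℝ) (nb j : ℕ) (ls : List ℕ) (U : Sub r) :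
    Eng r α nb μ (j :: ls) U ≤ Eng r α nb μ ls U + α * HH r j (μ j) U := by
  have := Psi_le r α nb μ j ls (le_refl U)
  unfold fPsi at this
  unfold Eng
  simp only [List.length_cons]
  push_cast
  nlinarith

lemma finrank_sup_span {U : Sub r} {v : Lam r → ℝ} (hv : v ∉ U) :
    Module.finrank ℝ (U ⊔ Submodule.span ℝ {v} : Sub r) = Module.finrank ℝ U + 1 := by
  have h := Submodule.finrank_sup_add_finrank_inf_eq U (Submodule.span ℝ {v})
  have h0 : U ⊓ Submodule.span ℝ {v} = ⊥ := by
    rw [eq_bot_iff]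
    rintro x ⟨hx, hx2⟩
    obtain ⟨c, rfl⟩ := Submodule.mem_span_singleton.1 hx2
    by_cases hc : c = 0
    · simp [hc]
    · exact absurd ((U.smul_mem_iff hc).1 hx) hv
  have hv0 : v ≠ 0 := fun h => hv (h ▸ U.zero_mem)
  rw [h0, finrank_span_singleton hv0, finrank_bot] at h
  simpa using h

lemma Eng_step2 (α : ℝ) (nb j : ℕ) (ls : List ℕ) (U : Sub r) {v : Lam r → ℝ} (hv : v ∉ U) :
    Eng r α nb μ (j :: ls) U ≤ Eng r α nb μ ls (U ⊔ Submodule.span ℝ {v}) +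
      α * HH r j (μ j) (U ⊔ Submodule.span ℝ {v}) + (nb + ls.length + 1) := by
  have := Psi_le r α nb μ j ls (le_sup_left : U ≤ U ⊔ Submodule.span ℝ {v})
  unfold fPsi at this
  unfold Eng
  rw [finrank_sup_span hv] at *
  simp only [List.length_cons]
  push_cast at *
  nlinarith

set_option maxHeartbeats 2000000 in
theorem Lp_claim (hμ : ∀ j, IsLaw (μ j)) (C : ℝ) {s σ B α α2 q : ℝ} (hs : 0 < s) (hs1 : s < 1) (hσ : 0 < σ)
    (hB : 0 ≤ B) (hα : 0 ≤ α) (hα2 : α < α2) (hq : 0 ≤ q)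
    (hφ : ∀ j, j ≤ r → ∀ U : Sub r, s * σ * α2 * HH r j (μ j) U ≤ q * (1 - phi μ s j U)) (U : Sub r) :
    ∃ G : ℝ, 0 ≤ G ∧ ∀ (val : ℕ → ℝ) (w : Finset ℕ → ℕ → ℝ) (nb : ℕ) (Ls : List (Finset ℕ × ℕ)),
      LsOK val w B σ q r nb Ls →
      RR μ C s val w Ls U ≤ G * Real.exp (- (s * σ) * Eng r α nb μ (Ls.map Prod.snd) U) := by
  -- induction on codimension
  induction hn : 2^r - Module.finrank ℝ U using Nat.strong_induction_on generalizing U with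
  | _ n ih =>
  subst hn
  have hle : ∀ W : Sub r, Module.finrank ℝ W ≤ 2^r := by
    intro W
    have := Submodule.finrank_le W
    rw [Module.finrank_fintype_fun_eq_card] at this
    simpa using this
  have ih' : ∀ v : Lam r → ℝ, v ∉ U → ∃ G : ℝ, 0 ≤ G ∧ ∀ (val : ℕ → ℝ) (w : Finset ℕ → ℕ → ℝ) (nb : ℕ) (Ls : List (Finset ℕ × ℕ)),
      LsOK val w B σ q r nb Ls →
      RR μ C s val w Ls (U ⊔ Submodule.span ℝ {v}) ≤ G * Real.exp (- (s * σ) * Eng r α nb μ (Ls.map Prod.snd) (U ⊔ Submodule.span ℝ {v})) := by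
    intro v hv
    refine ih _ ?_ _ rfl
    have h1 := finrank_sup_span hv
    have h2 := hle (U ⊔ Submodule.span ℝ {v})
    omega
  choose! G hG0 hG using ih'
  have hKK : ∀ v : Lam r → ℝ, v ∉ U → ∃ K : ℝ, 0 ≤ K ∧ ∀ z : Lam r → ℝ, ∃ x : ℝ, ∀ t : ℝ, near C U (z + t • v) → x ≤ t ∧ t ≤ x + K :=
    fun v hv => near_interval hv
  choose! K hK0 hK using hKK
  set KK : ℝ := ∑ j ∈ Finset.range (r+1), ∑ y : Om j, ∑ y' : Om j, if RelU U y y' then 0 else K (dl r j y y') with hKKd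
  have hnn : ∀ j, ∀ y y' : Om j, (0:ℝ) ≤ if RelU U y y' then 0 else K (dl r j y y') := by
    intro j y y'
    split_ifs with h
    · exact le_rfl
    · exact hK0 _ fun h' => h (dl_mem.1 h')
  have hKK0 : 0 ≤ KK := Finset.sum_nonneg fun j _ => Finset.sum_nonneg fun y _ => Finset.sum_nonneg fun y' _ => hnn j y y'
  have hKle : ∀ j ≤ r, ∀ y y' : Om j, ¬ RelU U y y' → K (dl r j y y') ≤ KK := by
    intro j hj y y' h
    have h1 := Finset.single_le_sum (f := fun y' : Om j => if RelU U y y' then 0 else K (dl r j y y')) (s := Finset.univ)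
      (fun z _ => hnn j y z) (Finset.mem_univ y')
    have h2 := Finset.single_le_sum (f := fun y : Om j => ∑ y' : Om j, if RelU U y y' then 0 else K (dl r j y y')) (s := Finset.univ)
      (fun z _ => Finset.sum_nonneg fun z' _ => hnn j z z') (Finset.mem_univ y)
    have h3 := Finset.single_le_sum (f := fun j => ∑ y : Om j, ∑ y' : Om j, if RelU U y y' then 0 else K (dl r j y y'))
      (s := Finset.range (r+1))
      (fun z _ => Finset.sum_nonneg fun z' _ => Finset.sum_nonneg fun z'' _ => hnn z z' z'') (Finset.mem_range.2 (by omega : j < r+1))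
    simp only [if_neg h] at h1
    exact h1.trans (h2.trans h3)
  set c1 : ℝ := (B * (KK+1)) ^ s * Real.exp (s * σ * (α * (2^r * Real.log 2))) with hc1
  have hc10 : 0 ≤ c1 := by positivity
  set Cst : ℝ := ∑ j ∈ Finset.range (r+1), ∑ y : Om j, ∑ y' : Om j, if RelU U y y' then 0 else c1 * G (dl r j y y') with hCst
  have hnn2 : ∀ j, ∀ y y' : Om j, (0:ℝ) ≤ if RelU U y y' then 0 else c1 * G (dl r j y y') := by
    intro j y y'
    split_ifs with h
    · exact le_rfl
    · exact mul_nonneg hc10 (hG0 _ fun h' => h (dl_mem.1 h'))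
  have hCst0 : 0 ≤ Cst := Finset.sum_nonneg fun j _ => Finset.sum_nonneg fun y _ => Finset.sum_nonneg fun y' _ => hnn2 j y y'
  obtain ⟨hm, hm0, hmin⟩ : ∃ hm : ℝ, 0 < hm ∧ ∀ j ≤ r, 0 < HH r j (μ j) U → hm ≤ HH r j (μ j) U := by
    obtain ⟨j0, _, hj0⟩ := Finset.exists_min_image (Finset.range (r+1))
      (fun j => if 0 < HH r j (μ j) U then HH r j (μ j) U else 1) ⟨0, by simp⟩
    refine ⟨if 0 < HH r j0 (μ j0) U then HH r j0 (μ j0) U else 1, ?_, fun j hj h => ?_⟩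
    · split_ifs with h
      · exact h
      · norm_num
    · have := hj0 j (Finset.mem_range.2 (by omega))
      rw [if_pos h] at this
      exact this
  set γ : ℝ := 1 - Real.exp (-(s * σ * (α2 - α) * hm)) with hγ
  have hγ0 : 0 < γ := by
    have : 0 < s * σ * (α2 - α) * hm := by
      have : 0 < α2 - α := by linarith
      positivity
    have := Real.exp_lt_one_iff.2 (show -(s * σ * (α2 - α) * hm) < 0 by linarith)
    linarith
  have hCle : ∀ j ≤ r, (∑ y : Om j, ∑ y' : Om j, if RelU U y y' then 0 else c1 * G (dl r j y y')) ≤ Cst :=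
    fun j hj => Finset.single_le_sum (f := fun j => ∑ y : Om j, ∑ y' : Om j, if RelU U y y' then 0 else c1 * G (dl r j y y'))
      (s := Finset.range (r+1))
      (fun z _ => Finset.sum_nonneg fun z' _ => Finset.sum_nonneg fun z'' _ => hnn2 z z' z'') (Finset.mem_range.2 (by omega : j < r+1))
  clear_value Cst c1 KK γ
  clear hCst hKKd
  have hCγ : 0 ≤ 1 + Cst / γ := by positivity
  refine ⟨1 + Cst / γ, hCγ, ?_⟩
  intro val w nb Ls
  induction Ls with
  | nil =>
    intro _
    have e : Eng r α nb μ ([] : List ℕ) U = 0 := by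
      unfold Eng; rw [Psi_nil]; simp
    show JJ μ C s [] U ≤ _
    simp only [List.map_nil]
    rw [e, mul_zero, Real.exp_zero, mul_one]
    have : JJ μ C s [] U ≤ 1 := JJ_le_one hμ hs.le
    have : 0 ≤ Cst / γ := by positivity
    linarith
  | cons x Ls ihL =>
    obtain ⟨P, j⟩ := x
    rintro ⟨hP, ⟨hj1, hjr⟩, hLs⟩
    have ihL := ihL hLs
    have hstep := RR_cons_le (r := r) (μ := μ) (C := C) (val := val) hμ hs hs1 j hP.good hLs.good (U := U) (K := KK)
      (b := B * (KK+1) * Real.exp (-σ * (nb + Ls.length + 1 : ℕ)))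
      (fun y y' h z => by
        obtain ⟨x, hx⟩ := hK (dl r j y y') (fun h' => h (dl_mem.1 h')) z
        refine ⟨x, fun t ht => ⟨(hx t ht).1, (hx t ht).2.trans ?_⟩⟩
        have := hKle j hjr y y' h
        linarith) (hP.loc KK hKK0)
    refine hstep.trans ?_
    simp only [List.map_cons]
    set ls := Ls.map Prod.snd with hls
    have hlen : ls.length = Ls.length := by simp [hls]
    set E := Real.exp (- (s * σ) * Eng r α nb μ (j :: ls) U) with hE
    have hE0 : 0 < E := Real.exp_pos _
    set H := HH r j (μ j) U with hH
    have hH0 : 0 ≤ H := HH_nonneg (hμ j) U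
    have hsσ : 0 < s * σ := by positivity
    -- first term
    have hqp : s * σ * α2 * H ≤ (∑ p ∈ P, w P p) * (1 - phi μ s j U) := by
      refine (hφ j hjr U).trans (mul_le_mul_of_nonneg_right hP.act ?_)
      by_contra hneg
      push Not at hneg
      have h1 := hφ j hjr U
      have h2 : 0 ≤ s * σ * α2 * HH r j (μ j) U := by
        have : 0 ≤ α2 := by linarith
        positivity
      rcases hq.eq_or_lt with h0 | h0
      · -- q = 0 : phi ≤ 1 anyway
        have : phi μ s j U ≤ 1 := by
          unfold phi
          rw [← (hμ j).sum]
          refine Finset.sum_le_sum fun y _ => mul_le_of_le_one_right ((hμ j).pos y).le ?_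
          exact Real.rpow_le_one (cls_pos (hμ j) (RelU_equiv U) y).le (cls_le_one (hμ j) _ y) hs.le
        linarith
      · nlinarith
    have hf1 : 1 - (∑ p ∈ P, w P p) * (1 - phi μ s j U) ≤ Real.exp (-(s * σ * α2 * H)) := by
      have := Real.add_one_le_exp (-(s * σ * α2 * H))
      linarith
    have hRR0 : 0 ≤ RR μ C s val w Ls U := Eact_nonneg hLs.good fun a => JJ_nonneg hμ
    have hfirst : (1 - (∑ p ∈ P, w P p) * (1 - phi μ s j U)) * RR μ C s val w Ls U ≤
        (1 + Cst / γ) * E * Real.exp (-(s * σ * (α2 - α) * H)) := by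
      calc _ ≤ Real.exp (-(s * σ * α2 * H)) * RR μ C s val w Ls U := mul_le_mul_of_nonneg_right hf1 hRR0
        _ ≤ Real.exp (-(s * σ * α2 * H)) * ((1 + Cst / γ) * Real.exp (- (s * σ) * Eng r α nb μ ls U)) :=
            mul_le_mul_of_nonneg_left ihL (Real.exp_pos _).le
        _ ≤ Real.exp (-(s * σ * α2 * H)) * ((1 + Cst / γ) * (E * Real.exp (s * σ * (α * H)))) := by
            have hc : 0 ≤ 1 + Cst / γ := by positivity
            refine mul_le_mul_of_nonneg_left (mul_le_mul_of_nonneg_left ?_ hc) (Real.exp_pos _).le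
            rw [hE, ← Real.exp_add]
            apply Real.exp_le_exp.2
            have := Eng_step1 (μ := μ) α nb j ls U
            nlinarith
        _ = _ := by
            have : Real.exp (-(s * σ * (α2 - α) * H)) = Real.exp (-(s * σ * α2 * H)) * Real.exp (s * σ * (α * H)) := by
              rw [← Real.exp_add]; congr 1; ring
            rw [this]; ring
    have hsecond : (∑ y : Om j, ∑ y' : Om j, if RelU U y y' then 0 else
        (B * (KK+1) * Real.exp (-σ * (nb + Ls.length + 1 : ℕ))) ^ s * RR μ C s val w Ls (U ⊔ Submodule.span ℝ {dl r j y y'})) ≤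
        E * ∑ y : Om j, ∑ y' : Om j, if RelU U y y' then 0 else c1 * G (dl r j y y') := by
      rw [Finset.mul_sum]
      refine Finset.sum_le_sum fun y _ => ?_
      rw [Finset.mul_sum]
      refine Finset.sum_le_sum fun y' _ => ?_
      split_ifs with h
      · simp
      have hv : dl r j y y' ∉ U := fun h' => h (dl_mem.1 h')
      have h1 := hG _ hv val w nb Ls hLs
      rw [← hls] at h1
      rw [Real.mul_rpow (by positivity) (Real.exp_pos _).le, ← Real.exp_mul]
      have h2 := Eng_step2 (μ := μ) α nb j ls U hv
      have h3 : HH r j (μ j) (U ⊔ Submodule.span ℝ {dl r j y y'}) ≤ 2^r * Real.log 2 := by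
        refine (HH_le (hμ j) _).trans ?_
        have : 0 ≤ Real.log 2 := Real.log_nonneg (by norm_num)
        gcongr
        norm_num
      have h4 : Real.exp (-σ * (nb + Ls.length + 1 : ℕ) * s) * Real.exp (- (s * σ) * Eng r α nb μ ls (U ⊔ Submodule.span ℝ {dl r j y y'}))
          ≤ E * Real.exp (s * σ * (α * (2^r * Real.log 2))) := by
        rw [hE, ← Real.exp_add, ← Real.exp_add]
        apply Real.exp_le_exp.2
        rw [hlen] at h2
        push_cast
        have h5 := mul_le_mul_of_nonneg_left h3 hα
        have h6 := mul_le_mul_of_nonneg_left (h2.trans (add_le_add_left (add_le_add_right h5 _) _)) hsσ.le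
        linarith
      calc _ ≤ (B * (KK+1))^s * Real.exp (-σ * (nb + Ls.length + 1 : ℕ) * s) *
            (G (dl r j y y') * Real.exp (- (s * σ) * Eng r α nb μ ls (U ⊔ Submodule.span ℝ {dl r j y y'}))) :=
              mul_le_mul_of_nonneg_left h1 (by positivity)
        _ = (B * (KK+1))^s * G (dl r j y y') * (Real.exp (-σ * (nb + Ls.length + 1 : ℕ) * s) * Real.exp (- (s * σ) * Eng r α nb μ ls (U ⊔ Submodule.span ℝ {dl r j y y'}))) := by ring
        _ ≤ (B * (KK+1))^s * G (dl r j y y') * (E * Real.exp (s * σ * (α * (2^r * Real.log 2)))) :=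
            mul_le_mul_of_nonneg_left h4 (mul_nonneg (by positivity) (hG0 _ hv))
        _ = _ := by rw [hc1]; ring
    refine (add_le_add hfirst hsecond).trans ?_
    rcases hH0.eq_or_lt with h0 | h0
    · have hall := Ent_zero (hμ j) (RelU_equiv U) (show Ent (μ j) (RelU U) = 0 from h0.symm)
      have : (∑ y : Om j, ∑ y' : Om j, if RelU U y y' then 0 else c1 * G (dl r j y y')) = 0 := by
        refine Finset.sum_eq_zero fun y _ => Finset.sum_eq_zero fun y' _ => if_pos (hall y y')
      rw [this, ← h0]
      simp
    · have h1 := hCle j hjr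
      have h2 : Real.exp (-(s * σ * (α2 - α) * H)) ≤ 1 - γ := by
        rw [hγ, sub_sub_cancel]
        apply Real.exp_le_exp.2
        have := hmin j hjr h0
        have h3 : 0 ≤ s * σ * (α2 - α) := by
          have : 0 < α2 - α := by linarith
          positivity
        nlinarith
      have hc : 0 ≤ 1 + Cst / γ := by positivity
      calc _ ≤ (1 + Cst / γ) * E * (1 - γ) + E * Cst :=
            add_le_add (mul_le_mul_of_nonneg_left h2 (by positivity)) (mul_le_mul_of_nonneg_left h1 hE0.le)
        _ = (1 + Cst / γ) * E - γ * E := by field_simp; ring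
        _ ≤ _ := by nlinarith
end
end EH

namespace EH

/-! ### random subsets of primes -/
noncomputable def ap (p : ℕ) : ℝ := 1 / ((p:ℝ) + 1)

lemma ap_pos (p : ℕ) : 0 < ap p := by unfold ap; positivity
lemma ap_le_one (p : ℕ) : ap p ≤ 1 := by
  unfold ap; rw [div_le_one (by positivity)]; have : (0:ℝ) ≤ p := by positivity
  linarith

noncomputable def wt (P S : Finset ℕ) : ℝ := (∏ p ∈ S, ap p) * ∏ p ∈ P \ S, (1 - ap p)

lemma wt_nonneg (P S : Finset ℕ) : 0 ≤ wt P S :=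
  mul_nonneg (Finset.prod_nonneg fun p _ => (ap_pos p).le)
    (Finset.prod_nonneg fun p _ => by linarith [ap_le_one p])

noncomputable def EE (P : Finset ℕ) (f : Finset ℕ → ℝ) : ℝ := ∑ S ∈ P.powerset, wt P S * f S

lemma EE_empty (f : Finset ℕ → ℝ) : EE ∅ f = f ∅ := by simp [EE, wt]

lemma EE_insert {P : Finset ℕ} {p : ℕ} (hp : p ∉ P) (f : Finset ℕ → ℝ) :
    EE (insert p P) f = (1 - ap p) * EE P f + ap p * EE P (fun S => f (insert p S)) := by
  unfold EE
  rw [Finset.sum_powerset_insert hp, Finset.mul_sum, Finset.mul_sum]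
  congr 1
  · refine Finset.sum_congr rfl fun S hS => ?_
    have hpS : p ∉ S := fun h => hp (Finset.mem_powerset.1 hS h)
    unfold wt
    rw [Finset.insert_sdiff_of_notMem _ hpS, Finset.prod_insert (fun h => hp (Finset.mem_sdiff.1 h).1)]
    ring
  · refine Finset.sum_congr rfl fun S hS => ?_
    have hpS : p ∉ S := fun h => hp (Finset.mem_powerset.1 hS h)
    have e : insert p P \ insert p S = P \ S := by
      ext x; simp only [Finset.mem_sdiff, Finset.mem_insert]
      constructor
      · rintro ⟨h1, h2⟩
        push Not at h2
        exact ⟨h1.resolve_left h2.1, h2.2⟩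
      · rintro ⟨h1, h2⟩
        refine ⟨Or.inr h1, ?_⟩
        push Not
        exact ⟨fun h => hp (h ▸ h1), h2⟩
    unfold wt
    rw [Finset.prod_insert hpS, e]; ring

lemma EE_congr {P : Finset ℕ} {f g : Finset ℕ → ℝ} (h : ∀ S ⊆ P, f S = g S) : EE P f = EE P g :=
  Finset.sum_congr rfl fun S hS => by rw [h S (Finset.mem_powerset.1 hS)]

lemma EE_mono {P : Finset ℕ} {f g : Finset ℕ → ℝ} (h : ∀ S ⊆ P, f S ≤ g S) : EE P f ≤ EE P g :=
  Finset.sum_le_sum fun S hS => mul_le_mul_of_nonneg_left (h S (Finset.mem_powerset.1 hS)) (wt_nonneg _ _)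

lemma EE_add (P : Finset ℕ) (f g : Finset ℕ → ℝ) : EE P (fun S => f S + g S) = EE P f + EE P g := by
  unfold EE; rw [← Finset.sum_add_distrib]; exact Finset.sum_congr rfl fun S _ => by ring

lemma EE_smul (P : Finset ℕ) (c : ℝ) (f : Finset ℕ → ℝ) : EE P (fun S => c * f S) = c * EE P f := by
  unfold EE; rw [Finset.mul_sum]; exact Finset.sum_congr rfl fun S _ => by ring

lemma EE_sum {ι : Type*} (t : Finset ι) (P : Finset ℕ) (f : ι → Finset ℕ → ℝ) :
    EE P (fun S => ∑ i ∈ t, f i S) = ∑ i ∈ t, EE P (f i) := by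
  unfold EE; rw [Finset.sum_comm]; exact Finset.sum_congr rfl fun S _ => by rw [Finset.mul_sum]

lemma EE_const (P : Finset ℕ) (c : ℝ) : EE P (fun _ => c) = c := by
  induction P using Finset.induction_on with
  | empty => rw [EE_empty]
  | insert p P hp ih => rw [EE_insert hp, ih]; ring

lemma EE_nonneg {P : Finset ℕ} {f : Finset ℕ → ℝ} (h : ∀ S ⊆ P, 0 ≤ f S) : 0 ≤ EE P f := by
  rw [← EE_const P 0]; exact EE_mono h

lemma EE_union {P Q : Finset ℕ} (h : Disjoint P Q) (f : Finset ℕ → ℝ) :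
    EE (P ∪ Q) f = EE P (fun S => EE Q (fun T => f (S ∪ T))) := by
  induction P using Finset.induction_on generalizing f with
  | empty => rw [EE_empty, Finset.empty_union]; simp
  | insert p P hp ih =>
    have hd : Disjoint P Q := Finset.disjoint_of_subset_left (Finset.subset_insert _ _) h
    have hpQ : p ∉ Q := Finset.disjoint_left.1 h (Finset.mem_insert_self _ _)
    rw [Finset.insert_union, EE_insert (by simp [hp, hpQ]), EE_insert hp, ih hd, ih hd]
    simp only [Finset.insert_union]

/-- marginals -/
lemma EE_marg {P Q : Finset ℕ} (h : Q ⊆ P) (f : Finset ℕ → ℝ) : EE P (fun S => f (S ∩ Q)) = EE Q f := by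
  have e : P = Q ∪ (P \ Q) := by rw [Finset.union_sdiff_of_subset h]
  conv_lhs => rw [e]
  rw [EE_union Finset.disjoint_sdiff]
  refine EE_congr fun S hS => ?_
  rw [← EE_const (P \ Q) (f S)]
  refine EE_congr fun T hT => ?_
  congr 1
  ext x
  simp only [Finset.mem_inter, Finset.mem_union]
  constructor
  · rintro ⟨h1 | h1, h2⟩
    · exact h1
    · exact absurd h2 (Finset.mem_sdiff.1 (hT h1)).2
  · exact fun h1 => ⟨Or.inl h1, hS h1⟩

lemma inter_union_left {P Q S T : Finset ℕ} (h : Disjoint P Q) (hS : S ⊆ P) (hT : T ⊆ Q) :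
    (S ∪ T) ∩ P = S := by
  ext x
  simp only [Finset.mem_inter, Finset.mem_union]
  constructor
  · rintro ⟨h1 | h1, h2⟩
    · exact h1
    · exact absurd (hT h1) (Finset.disjoint_left.1 h h2)
  · exact fun h1 => ⟨Or.inl h1, hS h1⟩

lemma inter_union_right {P Q S T : Finset ℕ} (h : Disjoint P Q) (hS : S ⊆ P) (hT : T ⊆ Q) :
    (S ∪ T) ∩ Q = T := by
  rw [Finset.union_comm]; exact inter_union_left h.symm hT hS

lemma EE_mul {P Q : Finset ℕ} (h : Disjoint P Q) (f g : Finset ℕ → ℝ) :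
    EE (P ∪ Q) (fun S => f (S ∩ P) * g (S ∩ Q)) = EE P f * EE Q g := by
  rw [EE_union h, mul_comm, ← EE_smul]
  refine EE_congr fun S hS => ?_
  rw [mul_comm, ← EE_smul]
  refine EE_congr fun T hT => ?_
  rw [inter_union_left h hS hT, inter_union_right h hS hT]

/-- product over disjoint families -/
lemma EE_prod {ι : Type*} (t : Finset ι) (Q : ι → Finset ℕ)
    (h : ∀ i ∈ t, ∀ j ∈ t, i ≠ j → Disjoint (Q i) (Q j)) (f : ι → Finset ℕ → ℝ) :
    EE (t.biUnion Q) (fun S => ∏ i ∈ t, f i (S ∩ Q i)) = ∏ i ∈ t, EE (Q i) (f i) := by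
  induction t using Finset.induction_on with
  | empty => simp [EE_const]
  | insert i t hi ih =>
    rw [Finset.biUnion_insert, Finset.prod_insert hi]
    have hd : Disjoint (Q i) (t.biUnion Q) := by
      rw [Finset.disjoint_biUnion_right]
      exact fun j hj => h i (Finset.mem_insert_self _ _) j (Finset.mem_insert_of_mem hj) (fun e => hi (e ▸ hj))
    rw [← ih (fun j hj k hk => h j (Finset.mem_insert_of_mem hj) k (Finset.mem_insert_of_mem hk)), ← EE_mul hd]
    refine EE_congr fun S hS => ?_
    rw [Finset.prod_insert hi]
    congr 1
    refine Finset.prod_congr rfl fun j hj => ?_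
    congr 1
    rw [Finset.inter_assoc, Finset.inter_eq_right.2 (Finset.subset_biUnion_of_mem Q hj)]

/-- weight of a singleton -/
noncomputable def w1 (P : Finset ℕ) (p : ℕ) : ℝ := ap p * ∏ q ∈ P.erase p, (1 - ap q)

lemma w1_nonneg (P : Finset ℕ) (p : ℕ) : 0 ≤ w1 P p :=
  mul_nonneg (ap_pos p).le (Finset.prod_nonneg fun q _ => by linarith [ap_le_one q])

lemma w1_le (P : Finset ℕ) (p : ℕ) : w1 P p ≤ ap p :=
  mul_le_of_le_one_right (ap_pos p).le
    (Finset.prod_le_one (fun q _ => by linarith [ap_le_one q]) (fun q _ => by linarith [ap_pos q]))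

lemma one_sub_sum_le_prod (P : Finset ℕ) : 1 - ∑ q ∈ P, ap q ≤ ∏ q ∈ P, (1 - ap q) := by
  induction P using Finset.induction_on with
  | empty => simp
  | insert p P hp ih =>
    rw [Finset.sum_insert hp, Finset.prod_insert hp]
    have h1 : ∏ q ∈ P, (1 - ap q) ≤ 1 :=
      Finset.prod_le_one (fun q _ => by linarith [ap_le_one q]) (fun q _ => by linarith [ap_pos q])
    nlinarith [ap_pos p, ap_le_one p]

lemma w1_ge (P : Finset ℕ) (p : ℕ) : ap p * (1 - ∑ q ∈ P, ap q) ≤ w1 P p := by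
  refine mul_le_mul_of_nonneg_left (le_trans ?_ (one_sub_sum_le_prod _)) (ap_pos p).le
  have : ∑ q ∈ P.erase p, ap q ≤ ∑ q ∈ P, ap q :=
    Finset.sum_le_sum_of_subset_of_nonneg (Finset.erase_subset _ _) fun q _ _ => (ap_pos q).le
  linarith

lemma EE_single {P : Finset ℕ} {p : ℕ} (hp : p ∈ P) (f : Finset ℕ → ℝ) :
    EE P (fun S => if S = {p} then f S else 0) = w1 P p * f {p} := by
  unfold EE
  rw [Finset.sum_eq_single ({p} : Finset ℕ)]
  · dsimp only
    rw [if_pos rfl]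
    unfold wt w1
    rw [Finset.prod_singleton, Finset.sdiff_singleton_eq_erase]
  · intro S _ h; dsimp only; rw [if_neg h, mul_zero]
  · intro h; exact absurd (Finset.mem_powerset.2 (by simpa using hp)) h

lemma sum_single_eq {P S : Finset ℕ} (hS : S ⊆ P) (c : ℕ → ℝ) (e : ℝ) :
    (if h : ∃ p, S = {p} then c h.choose else e) =
      (1 - ∑ p ∈ P, if S = {p} then (1:ℝ) else 0) * e + ∑ p ∈ P, if S = {p} then c p else 0 := by
  split_ifs with h
  · have hp : S = {h.choose} := h.choose_spec
    set p := h.choose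
    have hpP : p ∈ P := hS (by rw [hp]; simp)
    have e1 : ∀ g : ℕ → ℝ, (∑ q ∈ P, if S = {q} then g q else 0) = g p := by
      intro g
      rw [Finset.sum_eq_single p]
      · rw [if_pos hp]
      · intro q _ hq; rw [if_neg]; intro h'; rw [hp] at h'; exact hq (Finset.singleton_injective h').symm
      · intro h'; exact absurd hpP h'
    rw [e1, e1 c]; ring
  · push Not at h
    have e1 : ∀ g : ℕ → ℝ, (∑ q ∈ P, if S = {q} then g q else 0) = 0 :=
      fun g => Finset.sum_eq_zero fun q _ => if_neg (h q)
    rw [e1, e1 c]; ring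

lemma EE_ite (P : Finset ℕ) (p : ℕ) (hp : p ∈ P) (c : ℝ) : EE P (fun S => if S = {p} then c else 0) = w1 P p * c :=
  EE_single hp (fun _ => c)

lemma EE_singles (P : Finset ℕ) (c : ℕ → ℝ) (e : ℝ) :
    EE P (fun S => if h : ∃ p, S = {p} then c h.choose else e) =
      (1 - ∑ p ∈ P, w1 P p) * e + ∑ p ∈ P, w1 P p * c p := by
  rw [EE_congr (fun S hS => sum_single_eq hS c e)]
  have : (fun S : Finset ℕ => (1 - ∑ p ∈ P, if S = {p} then (1:ℝ) else 0) * e + ∑ p ∈ P, if S = {p} then c p else 0)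
    = fun S => e + (-e * (∑ p ∈ P, if S = {p} then (1:ℝ) else 0) + ∑ p ∈ P, if S = {p} then c p else 0) := by
    funext S; ring
  rw [this, EE_add, EE_add, EE_smul, EE_const, EE_sum, EE_sum]
  have h1 : ∑ p ∈ P, EE P (fun S => if S = {p} then (1:ℝ) else 0) = ∑ p ∈ P, w1 P p :=
    Finset.sum_congr rfl fun p hp => by rw [EE_ite P p hp, mul_one]
  have h2 : ∑ p ∈ P, EE P (fun S => if S = {p} then c p else 0) = ∑ p ∈ P, w1 P p * c p :=
    Finset.sum_congr rfl fun p hp => EE_ite P p hp _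
  rw [h1, h2]; ring

lemma w1_good (P : Finset ℕ) : GoodSlot w1 P where
  nonneg := fun p _ => w1_nonneg P p
  le_one := by
    have h := EE_singles P (fun _ => 0) 1
    simp only [mul_zero, Finset.sum_const_zero, add_zero, mul_one] at h
    have : 0 ≤ EE P (fun S => if h : ∃ p, S = {p} then (0:ℝ) else 1) := by
      refine EE_nonneg fun S _ => ?_
      split_ifs <;> norm_num
    linarith

/-! ### active slots -/
noncomputable def actv : List (Finset ℕ × ℕ) → Finset ℕ → List (ℕ × ℕ)
  | [], _ => []
  | (P, j) :: Ls, S => if h : ∃ p, S ∩ P = {p} then (h.choose, j) :: actv Ls S else actv Ls S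

def unL : List (Finset ℕ × ℕ) → Finset ℕ
  | [] => ∅
  | (P, _) :: Ls => P ∪ unL Ls

lemma actv_cons (P : Finset ℕ) (j : ℕ) (Ls : List (Finset ℕ × ℕ)) (S : Finset ℕ) :
    actv ((P, j) :: Ls) S = if h : ∃ p, S ∩ P = {p} then (h.choose, j) :: actv Ls S else actv Ls S := by
  rw [actv]

lemma actv_congr {Ls : List (Finset ℕ × ℕ)} {S T : Finset ℕ} (h : S ∩ unL Ls = T ∩ unL Ls) :
    actv Ls S = actv Ls T := by
  induction Ls with
  | nil => rfl
  | cons x Ls ih =>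
    obtain ⟨P, j⟩ := x
    have h1 : S ∩ P = T ∩ P := by
      have := congrArg (· ∩ P) h
      simp only [Finset.inter_assoc] at this
      rwa [show unL ((P, j) :: Ls) ∩ P = P from Finset.inter_eq_right.2 Finset.subset_union_left] at this
    have h2 : S ∩ unL Ls = T ∩ unL Ls := by
      have := congrArg (· ∩ unL Ls) h
      simp only [Finset.inter_assoc] at this
      rwa [show unL ((P, j) :: Ls) ∩ unL Ls = unL Ls from Finset.inter_eq_right.2 Finset.subset_union_right] at this
    simp only [actv_cons, h1, ih h2]

def DisjL : List (Finset ℕ × ℕ) → Prop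
  | [] => True
  | (P, _) :: Ls => Disjoint P (unL Ls) ∧ DisjL Ls

noncomputable def vmap (val : ℕ → ℝ) (a : List (ℕ × ℕ)) : List (ℝ × ℕ) := a.map fun x => (val x.1, x.2)

lemma EE_actv (val : ℕ → ℝ) {Ls : List (Finset ℕ × ℕ)} (hd : DisjL Ls) (F : List (ℝ × ℕ) → ℝ) :
    EE (unL Ls) (fun S => F (vmap val (actv Ls S))) = Eact val w1 Ls F := by
  induction Ls generalizing F with
  | nil => simp [unL, EE_empty, actv, vmap, Eact]
  | cons x Ls ih =>
    obtain ⟨P, j⟩ := x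
    obtain ⟨h1, h2⟩ := hd
    show EE (P ∪ unL Ls) _ = _
    rw [EE_union h1]
    have : ∀ S ⊆ P, EE (unL Ls) (fun T => F (vmap val (actv ((P, j) :: Ls) (S ∪ T)))) =
        if h : ∃ p, S = {p} then Eact val w1 Ls (fun a => F ((val h.choose, j) :: a)) else Eact val w1 Ls F := by
      intro S hS
      have h3 : ∀ T ⊆ unL Ls, actv Ls (S ∪ T) = actv Ls T := by
        intro T hT
        apply actv_congr
        rw [inter_union_right h1 hS hT, Finset.inter_eq_left.2 hT]
      split_ifs with h
      · rw [← ih h2]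
        refine EE_congr fun T hT => ?_
        simp only [actv_cons, inter_union_left h1 hS hT, dif_pos h, h3 T hT]
        rfl
      · rw [← ih h2]
        refine EE_congr fun T hT => ?_
        simp only [actv_cons, inter_union_left h1 hS hT, dif_neg h, h3 T hT]
    rw [EE_congr this, EE_singles P (fun p => Eact val w1 Ls (fun a => F ((val p, j) :: a)))]
    rfl

/-- lower bound by tuples of singletons -/
lemma EE_tuple {ι : Type*} [Fintype ι] (Q : ι → Finset ℕ) (h : ∀ i j, i ≠ j → Disjoint (Q i) (Q j))
    (f : Finset ℕ → ℝ) (hf : ∀ S, 0 ≤ f S) (good : (ι → ℕ) → Prop)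
    (hg : ∀ S, ∀ p : ι → ℕ, (∀ i, S ∩ Q i = {p i}) → good p → 1 ≤ f S) :
    ∑ p ∈ Fintype.piFinset Q, (if good p then ∏ i, w1 (Q i) (p i) else 0) ≤ EE (Finset.univ.biUnion Q) f := by
  have h1 : ∀ p ∈ Fintype.piFinset Q, (if good p then ∏ i, w1 (Q i) (p i) else 0) =
      EE (Finset.univ.biUnion Q) (fun S => if good p then ∏ i, (if S ∩ Q i = {p i} then (1:ℝ) else 0) else 0) := by
    intro p hp
    split_ifs with hgp
    · rw [EE_prod Finset.univ Q (fun i _ j _ hij => h i j hij) (fun i T => if T = {p i} then 1 else 0)]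
      refine Finset.prod_congr rfl fun i _ => ?_
      rw [EE_ite _ _ (Fintype.mem_piFinset.1 hp i), mul_one]
    · rw [EE_const]
  rw [Finset.sum_congr rfl h1, ← EE_sum]
  refine EE_mono fun S _ => ?_
  by_cases hex : ∃ p ∈ Fintype.piFinset Q, good p ∧ ∀ i, S ∩ Q i = {p i}
  · obtain ⟨p, hp, hgp, hS⟩ := hex
    rw [Finset.sum_eq_single p]
    · rw [if_pos hgp, Finset.prod_eq_one fun i _ => if_pos (hS i)]
      exact hg S p hS hgp
    · intro q _ hq
      split_ifs
      · obtain ⟨i, hi⟩ := Function.ne_iff.1 hq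
        refine Finset.prod_eq_zero (Finset.mem_univ i) (if_neg fun e => hi ?_)
        rw [hS i] at e
        exact (Finset.singleton_injective e).symm
      · rfl
    · exact fun h => absurd hp h
  · refine le_trans (Finset.sum_eq_zero fun p hp => ?_).le (hf S)
    split_ifs with hgp
    · push Not at hex
      obtain ⟨i, hi⟩ := hex p hp hgp
      exact Finset.prod_eq_zero (Finset.mem_univ i) (if_neg hi)
    · rfl
end EH

namespace EH

/-! Prime number estimates -/

def prs (N : ℕ) : Finset ℕ := (Finset.range (N+1)).filter Nat.Prime

lemma mem_prs {N p : ℕ} : p ∈ prs N ↔ p ≤ N ∧ p.Prime := by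
  simp [prs, Nat.lt_succ_iff]

lemma log_fact (N : ℕ) : Real.log (N.factorial) =
    ∑ p ∈ prs N, ((N.factorial).factorization p : ℝ) * Real.log p := by
  have h0 : N.factorial ≠ 0 := Nat.factorial_ne_zero N
  conv_lhs => rw [← Nat.prod_factorization_pow_eq_self h0]
  rw [Finsupp.prod_of_support_subset (s := prs N)]
  · push_cast
    rw [Real.log_prod]
    · exact Finset.sum_congr rfl fun p _ => by rw [Real.log_pow]
    · intro p hp
      have := (mem_prs.1 hp).2.pos
      positivity
  · intro p hp
    rw [Nat.support_factorization, Nat.mem_primeFactors] at hp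
    rw [mem_prs]
    exact ⟨(Nat.Prime.dvd_factorial hp.1).1 hp.2.1, hp.1⟩
  · intro i _; simp

lemma fac_ge {N p : ℕ} (hp : p.Prime) : (N:ℝ)/p - 1 ≤ ((N.factorial).factorization p : ℝ) := by
  have h1 : N / p ≤ (N.factorial).factorization p := by
    rw [Nat.factorization_factorial hp (b := Nat.log p N + 2) (by omega)]
    have : N / p = N / p ^ 1 := by simp
    rw [this]
    exact Finset.single_le_sum (f := fun i => N / p ^ i) (fun _ _ => Nat.zero_le _) (by simp)
  have h2 : (N:ℝ)/p < (N / p : ℕ) + 1 := by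
    have hp0 : (0:ℝ) < p := by exact_mod_cast hp.pos
    rw [div_lt_iff₀ hp0]
    have := Nat.lt_div_mul_add (a := N) hp.pos
    have h3 : (N:ℝ) < ((N / p * p + p : ℕ):ℝ) := by exact_mod_cast this
    push_cast at h3; linarith
  have h3 : ((N / p : ℕ):ℝ) ≤ ((N.factorial).factorization p : ℝ) := by exact_mod_cast h1
  linarith

lemma fac_le {N p : ℕ} (hp : p.Prime) : ((N.factorial).factorization p : ℝ) ≤ (N:ℝ)/(p-1) := by
  have := Fact.mk hp
  have h := sub_one_mul_padicValNat_factorial (p := p) N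
  rw [Nat.factorization_def _ hp]
  have hp1 : (1:ℝ) < p := by exact_mod_cast hp.one_lt
  rw [le_div_iff₀ (by linarith)]
  have h2 : (p - 1) * padicValNat p (N.factorial) ≤ N := by rw [h]; omega
  have h3 : (((p - 1 : ℕ):ℝ)) * (padicValNat p (N.factorial) : ℝ) ≤ N := by exact_mod_cast h2
  rw [Nat.cast_sub hp.one_lt.le] at h3
  push_cast at h3
  linarith

lemma theta_prs (N : ℕ) : ∑ p ∈ prs N, Real.log p ≤ Real.log 4 * N := by
  have h := Chebyshev.theta_le_log4_mul_x (x := N) (by positivity)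
  rw [Chebyshev.theta_eq_sum_Icc] at h
  refine le_trans (le_of_eq ?_) h
  refine Finset.sum_congr ?_ fun _ _ => rfl
  ext p; simp [mem_prs]

lemma mert_up {N : ℕ} (hN : 1 ≤ N) : ∑ p ∈ prs N, Real.log p / p ≤ Real.log N + Real.log 4 := by
  have hN0 : (0:ℝ) < N := by exact_mod_cast hN
  have h1 : Real.log (N.factorial) ≤ N * Real.log N := by
    rw [← Real.log_pow]
    apply Real.log_le_log (by exact_mod_cast N.factorial_pos)
    exact_mod_cast Nat.factorial_le_pow N
  rw [log_fact] at h1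
  have h2 : ∑ p ∈ prs N, ((N:ℝ)/p - 1) * Real.log p ≤ N * Real.log N := by
    refine le_trans (Finset.sum_le_sum fun p hp => ?_) h1
    have hp := (mem_prs.1 hp).2
    exact mul_le_mul_of_nonneg_right (fac_ge hp) (Real.log_nonneg (by exact_mod_cast hp.one_lt.le))
  have h3 : ∑ p ∈ prs N, ((N:ℝ)/p - 1) * Real.log p =
      N * ∑ p ∈ prs N, Real.log p / p - ∑ p ∈ prs N, Real.log p := by
    rw [Finset.mul_sum, ← Finset.sum_sub_distrib]
    exact Finset.sum_congr rfl fun p _ => by ring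
  have h4 := theta_prs N
  have : N * ∑ p ∈ prs N, Real.log p / p ≤ N * (Real.log N + Real.log 4) := by nlinarith
  exact le_of_mul_le_mul_left this hN0

lemma tail_bd : ∃ C : ℝ, 0 ≤ C ∧ ∀ P : Finset ℕ, (∀ p ∈ P, p.Prime) →
    ∑ p ∈ P, Real.log p * (1/((p:ℝ)-1) - ap p) ≤ C := by
  have hs : Summable (fun n : ℕ => 8 * (1 / (n:ℝ)^(3/2:ℝ))) :=
    (Real.summable_one_div_nat_rpow.2 (by norm_num)).mul_left 8
  refine ⟨∑' n : ℕ, 8 * (1 / (n:ℝ)^(3/2:ℝ)), tsum_nonneg fun n => by positivity, fun P hP => ?_⟩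
  refine le_trans (Finset.sum_le_sum fun p hp => ?_) (hs.sum_le_tsum P (fun n _ => by positivity))
  have h2 : (2:ℝ) ≤ p := by exact_mod_cast (hP p hp).two_le
  have hl : Real.log p ≤ (p:ℝ)^(1/2:ℝ) / (1/2) := Real.log_le_rpow_div (by linarith) (by norm_num)
  have e1 : 1/((p:ℝ)-1) - ap p ≤ 4 / (p:ℝ)^2 := by
    unfold ap
    rw [div_sub_div _ _ (by linarith) (by linarith), div_le_div_iff₀ (by nlinarith) (by nlinarith)]
    nlinarith
  have e0 : 0 ≤ 1/((p:ℝ)-1) - ap p := by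
    unfold ap
    rw [div_sub_div _ _ (by linarith) (by linarith)]
    apply div_nonneg <;> nlinarith
  have hr : (p:ℝ)^2 = (p:ℝ)^(1/2:ℝ) * (p:ℝ)^(3/2:ℝ) := by
    rw [← Real.rpow_add (by linarith)]; norm_num
  have hpp : 0 < (p:ℝ)^(1/2:ℝ) := Real.rpow_pos_of_pos (by linarith) _
  have hpp3 : 0 < (p:ℝ)^(3/2:ℝ) := Real.rpow_pos_of_pos (by linarith) _
  calc Real.log p * (1/((p:ℝ)-1) - ap p) ≤ ((p:ℝ)^(1/2:ℝ) / (1/2)) * (4 / (p:ℝ)^2) :=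
        mul_le_mul hl e1 e0 (by positivity)
    _ = 8 * (1 / (p:ℝ)^(3/2:ℝ)) := by rw [hr]; field_simp; norm_num

lemma mert_low : ∃ C : ℝ, 0 ≤ C ∧ ∀ N : ℕ, 1 ≤ N → Real.log N - C ≤ ∑ p ∈ prs N, Real.log p * ap p := by
  obtain ⟨C, hC, h⟩ := tail_bd
  refine ⟨C + 1, by linarith, fun N hN => ?_⟩
  have hN0 : (0:ℝ) < N := by exact_mod_cast hN
  have hN1 : (1:ℝ) ≤ N := by exact_mod_cast hN
  have h1 := Stirling.le_log_factorial_stirling (n := N) (by omega)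
  have hl := Real.log_nonneg hN1
  have hp : 0 ≤ Real.log (2 * Real.pi) := Real.log_nonneg (by linarith [Real.pi_gt_three])
  rw [log_fact] at h1
  have h2 : ∑ p ∈ prs N, ((N.factorial).factorization p : ℝ) * Real.log p ≤
      N * ∑ p ∈ prs N, Real.log p * (1/((p:ℝ)-1)) := by
    rw [Finset.mul_sum]
    refine Finset.sum_le_sum fun p hp => ?_
    have hp := (mem_prs.1 hp).2
    have := mul_le_mul_of_nonneg_right (fac_le (N := N) hp)
      (Real.log_nonneg (by exact_mod_cast hp.one_lt.le : (1:ℝ) ≤ p))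
    calc _ ≤ _ := this
      _ = _ := by ring
  have h3 := h (prs N) (fun p hp => (mem_prs.1 hp).2)
  simp only [mul_sub] at h3
  rw [Finset.sum_sub_distrib] at h3
  have h4 : N * (Real.log N - 1) ≤ N * ∑ p ∈ prs N, Real.log p * (1/((p:ℝ)-1)) := by nlinarith
  have h5 := le_of_mul_le_mul_left h4 hN0
  linarith

noncomputable def Pr (u v : ℝ) : Finset ℕ :=
  (prs ⌊Real.exp v⌋₊).filter fun p => u < Real.log p

lemma mem_Pr {u v : ℝ} {p : ℕ} : p ∈ Pr u v ↔ p.Prime ∧ u < Real.log p ∧ Real.log p ≤ v := by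
  unfold Pr
  rw [Finset.mem_filter, mem_prs]
  constructor
  · rintro ⟨⟨h1, h2⟩, h3⟩
    refine ⟨h2, h3, ?_⟩
    rw [Real.log_le_iff_le_exp (by exact_mod_cast h2.pos)]
    exact (Nat.le_floor_iff (Real.exp_pos v).le).1 h1
  · rintro ⟨h1, h2, h3⟩
    refine ⟨⟨?_, h1⟩, h2⟩
    rw [Real.log_le_iff_le_exp (by exact_mod_cast h1.pos)] at h3
    exact (Nat.le_floor_iff (Real.exp_pos v).le).2 h3

lemma Pr_zero (v : ℝ) : Pr 0 v = prs ⌊Real.exp v⌋₊ := by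
  unfold Pr
  rw [Finset.filter_true_of_mem]
  intro p hp
  exact Real.log_pos (by exact_mod_cast (mem_prs.1 hp).2.one_lt)

lemma Pr_split {u v w : ℝ} (h1 : u ≤ v) (h2 : v ≤ w) : Pr u w = Pr u v ∪ Pr v w := by
  ext p
  simp only [Finset.mem_union, mem_Pr]
  constructor
  · rintro ⟨a, b, c⟩
    rcases le_or_gt (Real.log p) v with h | h
    · exact Or.inl ⟨a, b, h⟩
    · exact Or.inr ⟨a, h, c⟩
  · rintro (⟨a, b, c⟩ | ⟨a, b, c⟩)
    · exact ⟨a, b, c.trans h2⟩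
    · exact ⟨a, h1.trans_lt b, c⟩

lemma Pr_disj {u v v' w : ℝ} (h : v ≤ v') : Disjoint (Pr u v) (Pr v' w) := by
  rw [Finset.disjoint_left]
  intro p h1 h2
  rw [mem_Pr] at h1 h2
  linarith [h1.2.2, h2.2.1]

/-- Mertens in logarithmic windows -/
lemma mertens : ∃ C : ℝ, 0 < C ∧ ∀ u v : ℝ, 0 ≤ u → u ≤ v →
    (v - u - C ≤ ∑ p ∈ Pr u v, Real.log p * ap p) ∧ (∑ p ∈ Pr u v, Real.log p / p ≤ v - u + C) := by
  obtain ⟨C, hC, hlow⟩ := mert_low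
  have hl4 : 0 < Real.log 4 := Real.log_pos (by norm_num)
  have hl2 : 0 < Real.log 2 := Real.log_pos (by norm_num)
  have key : ∀ v : ℝ, 0 ≤ v → (v - Real.log 2 - C ≤ ∑ p ∈ Pr 0 v, Real.log p * ap p) ∧
      (∑ p ∈ Pr 0 v, Real.log p / p ≤ v + Real.log 4) := by
    intro v hv
    rw [Pr_zero]
    have h1 : 1 ≤ ⌊Real.exp v⌋₊ := (Nat.one_le_floor_iff _).2 (Real.one_le_exp hv)
    set N := ⌊Real.exp v⌋₊
    have hN0 : (0:ℝ) < N := by exact_mod_cast h1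
    have hN1 : (1:ℝ) ≤ N := by exact_mod_cast h1
    have h2 : Real.log N ≤ v := by
      rw [Real.log_le_iff_le_exp hN0]
      exact Nat.floor_le (Real.exp_pos v).le
    have h3 : v ≤ Real.log N + Real.log 2 := by
      rw [← Real.log_mul hN0.ne' (by norm_num), Real.le_log_iff_exp_le (by positivity)]
      have := Nat.lt_floor_add_one (Real.exp v)
      change _ < (N:ℝ) + 1 at this
      linarith
    refine ⟨?_, ?_⟩
    · have := hlow N h1; linarith
    · have := mert_up h1; linarith
  refine ⟨C + Real.log 2 + Real.log 4, by linarith, fun u v hu huv => ?_⟩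
  have hd : Disjoint (Pr 0 u) (Pr u v) := Pr_disj le_rfl
  obtain ⟨a1, a2⟩ := key u hu
  obtain ⟨b1, b2⟩ := key v (hu.trans huv)
  rw [Pr_split hu huv, Finset.sum_union hd] at b1 b2
  have hle : ∀ u v, ∑ p ∈ Pr u v, Real.log p * ap p ≤ ∑ p ∈ Pr u v, Real.log p / p := by
    intro u v
    refine Finset.sum_le_sum fun p hp => ?_
    have hp := (mem_Pr.1 hp).1
    have hp0 : (0:ℝ) < p := by exact_mod_cast hp.pos
    have : ap p ≤ 1 / p := by
      unfold ap; exact one_div_le_one_div_of_le hp0 (by linarith)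
    calc _ ≤ Real.log p * (1/p) := mul_le_mul_of_nonneg_left this (Real.log_nonneg (by exact_mod_cast hp.one_lt.le))
      _ = _ := by ring
  have := hle 0 u
  constructor <;> linarith

lemma ap_le_inv {p : ℕ} (hp : 0 < p) : ap p ≤ 1 / p := by
  have hp0 : (0:ℝ) < p := by exact_mod_cast hp
  unfold ap; exact one_div_le_one_div_of_le hp0 (by linarith)

/-- mass bounds -/
lemma mass : ∃ C : ℝ, 0 < C ∧ ∀ u v : ℝ, 0 < u → u ≤ v →
    ((v - u - C) / v ≤ ∑ p ∈ Pr u v, ap p) ∧ (∑ p ∈ Pr u v, ap p ≤ (v - u + C) / u) := by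
  obtain ⟨C, hC, h⟩ := mertens
  refine ⟨C, hC, fun u v hu huv => ?_⟩
  obtain ⟨h1, h2⟩ := h u v hu.le huv
  constructor
  · rw [div_le_iff₀ (by linarith), Finset.sum_mul]
    refine h1.trans (Finset.sum_le_sum fun p hp => ?_)
    have hp := mem_Pr.1 hp
    nlinarith [ap_pos p]
  · rw [le_div_iff₀ hu, Finset.sum_mul]
    refine le_trans (Finset.sum_le_sum fun p hp => ?_) h2
    have hp := mem_Pr.1 hp
    have := ap_le_inv hp.1.pos
    have := ap_pos p
    rw [div_eq_mul_one_div]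
    nlinarith

/-- Euler product lower bound -/
lemma tele2 (N : ℕ) (hN : 2 ≤ N) :
    ∏ n ∈ Finset.Icc 2 N, ((n:ℝ) * (n+1) / ((n-1) * (n+2))) = 3 * N / (N+2) := by
  induction N, hN using Nat.le_induction with
  | base => norm_num
  | succ n hn ih =>
    have h2 : (2:ℝ) ≤ n := by exact_mod_cast hn
    rw [← Finset.insert_Icc_right_eq_Icc_add_one (by omega), Finset.prod_insert (by simp), ih]
    push_cast
    have : (n:ℝ) + 1 - 1 ≠ 0 := by linarith
    field_simp
    ring

lemma euler_low (N : ℕ) : Real.log N / 3 ≤ ∏ p ∈ prs N, (1 + ap p) := by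
  rcases Nat.lt_or_ge N 2 with h | hN
  · interval_cases N <;> simp <;> exact Finset.prod_nonneg fun p _ => by linarith [ap_pos p]
  have hN2 : (2:ℝ) ≤ N := by exact_mod_cast hN
  let f : ℕ →* ℝ := { toFun := fun n => (n:ℝ)⁻¹, map_one' := by simp, map_mul' := by intro a b; simp [mul_comm] }
  have hf : ∀ n, f n = (n:ℝ)⁻¹ := fun n => rfl
  obtain ⟨h1, h2⟩ := EulerProduct.summable_and_hasSum_smoothNumbers_prod_primesBelow_geometric (f := f)
    (by
      intro p hp
      rw [hf, norm_inv, Real.norm_natCast]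
      exact inv_lt_one_of_one_lt₀ (by exact_mod_cast hp.one_lt)) (N+1)
  have hprs : (N+1).primesBelow = prs N := by ext p; simp [mem_prs, Nat.mem_primesBelow, Nat.lt_succ_iff]
  rw [hprs] at h2
  have h3 : Real.log N ≤ ∏ p ∈ prs N, (1 - f p)⁻¹ := by
    have hmem : ∀ n ∈ Finset.Icc 1 N, n ∈ (N+1).smoothNumbers := by
      intro n hn
      rw [Finset.mem_Icc] at hn
      rw [Nat.mem_smoothNumbers']
      intro p hp hd
      have := Nat.le_of_dvd hn.1 hd
      omega
    have h4 : ∑ n ∈ Finset.Icc 1 N, (n:ℝ)⁻¹ ≤ ∏ p ∈ prs N, (1 - f p)⁻¹ := by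
      rw [← h2.tsum_eq, ← Finset.sum_attach]
      have := h2.summable.sum_le_tsum ((Finset.Icc 1 N).attach.image fun n => (⟨n.1, hmem n.1 n.2⟩ : (N+1).smoothNumbers))
        (fun i _ => by rw [hf]; positivity)
      rw [Finset.sum_image] at this
      · exact this
      · intro a _ b _ hab
        simp only [Subtype.mk.injEq] at hab
        exact Subtype.ext hab
    have h5 := log_add_one_le_harmonic N
    rw [harmonic_eq_sum_Icc] at h5
    push_cast at h5
    refine le_trans ?_ (h5.trans h4)
    exact Real.log_le_log (by linarith) (by linarith)
  have h6 : ∏ p ∈ prs N, (1 - f p)⁻¹ = (∏ p ∈ prs N, (1 + ap p)) *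
      ∏ p ∈ prs N, ((p:ℝ) * (p+1) / ((p-1) * (p+2))) := by
    rw [← Finset.prod_mul_distrib]
    refine Finset.prod_congr rfl fun p hp => ?_
    have hp2 : (2:ℝ) ≤ p := by exact_mod_cast (mem_prs.1 hp).2.two_le
    have : (p:ℝ) - 1 ≠ 0 := by linarith
    rw [hf]; unfold ap
    have e : 1 - (p:ℝ)⁻¹ = (p-1)/p := by field_simp
    rw [e, inv_div]
    field_simp
    ring
  have h7 : ∏ p ∈ prs N, ((p:ℝ) * (p+1) / ((p-1) * (p+2))) ≤ 3 := by
    have : ∏ p ∈ prs N, ((p:ℝ) * (p+1) / ((p-1) * (p+2))) ≤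
        ∏ n ∈ Finset.Icc 2 N, ((n:ℝ) * (n+1) / ((n-1) * (n+2))) := by
      have h1 : ∀ n ∈ Finset.Icc 2 N, (1:ℝ) ≤ (n:ℝ) * (n+1) / ((n-1) * (n+2)) := by
        intro n hn
        have : (2:ℝ) ≤ n := by exact_mod_cast (Finset.mem_Icc.1 hn).1
        rw [le_div_iff₀ (by nlinarith)]; nlinarith
      have hsub : prs N ⊆ Finset.Icc 2 N := by
        intro p hp
        have := mem_prs.1 hp
        exact Finset.mem_Icc.2 ⟨this.2.two_le, this.1⟩
      refine Finset.prod_le_prod_of_subset_of_one_le hsub (fun n hn => ?_) (fun n hn _ => h1 n hn)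
      linarith [h1 n (hsub hn)]
    rw [tele2 N hN] at this
    refine this.trans ?_
    rw [div_le_iff₀ (by linarith)]; linarith
  have h8 : 0 ≤ ∏ p ∈ prs N, (1 + ap p) := Finset.prod_nonneg fun p _ => by linarith [ap_pos p]
  rw [h6] at h3
  nlinarith

end EH

namespace EH

/-! Lists of levels -/

def mkL {α : Type*} (f : ℕ → α) (nb : ℕ) : ℕ → List α
  | 0 => []
  | k+1 => f (nb + k + 1) :: mkL f nb k

lemma mkL_length {α : Type*} (f : ℕ → α) (nb k : ℕ) : (mkL f nb k).length = k := by
  induction k with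
  | zero => rfl
  | succ k ih => simp [mkL, ih]

lemma mkL_map {α β : Type*} (f : ℕ → α) (g : α → β) (nb k : ℕ) :
    (mkL f nb k).map g = mkL (fun i => g (f i)) nb k := by
  induction k with
  | zero => rfl
  | succ k ih => simp [mkL, ih]

lemma mem_mkL {α : Type*} {f : ℕ → α} {nb k : ℕ} {x : α} (h : x ∈ mkL f nb k) :
    ∃ i, nb < i ∧ i ≤ nb + k ∧ x = f i := by
  induction k with
  | zero => simp [mkL] at h
  | succ k ih =>
    rcases List.mem_cons.1 h with h | h
    · exact ⟨nb+k+1, by omega, by omega, h⟩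
    · obtain ⟨i, h1, h2, h3⟩ := ih h
      exact ⟨i, h1, by omega, h3⟩

lemma mkL_sum (f : ℕ → ℝ) (nb k : ℕ) : (mkL f nb k).sum = ∑ i ∈ Finset.Ioc nb (nb+k), f i := by
  induction k with
  | zero => simp [mkL]
  | succ k ih =>
    rw [← add_assoc, ← Finset.insert_Ioc_right_eq_Ioc_add_one (by omega), Finset.sum_insert (by simp), ← ih]
    simp [mkL]

lemma mkL_pairwise {α : Type*} (f : ℕ → α) (R : α → α → Prop) (h : ∀ i j, i < j → R (f j) (f i)) (nb k : ℕ) :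
    (mkL f nb k).Pairwise R := by
  induction k with
  | zero => simp [mkL]
  | succ k ih =>
    refine List.Pairwise.cons (fun x hx => ?_) ih
    obtain ⟨i, h1, h2, rfl⟩ := mem_mkL hx
    exact h _ _ (by omega)

def lev (n : ℕ → ℕ) (r i : ℕ) : ℕ := Nat.findGreatest (fun j => i ≤ n j) r

variable {n : ℕ → ℕ} {r : ℕ}

lemma lev_le (i : ℕ) : lev n r i ≤ r := Nat.findGreatest_le r

lemma lev_spec {i : ℕ} (h : 0 < lev n r i) : i ≤ n (lev n r i) := by
  unfold lev at h ⊢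
  exact Nat.findGreatest_of_ne_zero (P := fun j => i ≤ n j) rfl h.ne'

lemma lt_lev_iff (hn : Antitone n) {i k : ℕ} (hk : k < r) : k < lev n r i ↔ i ≤ n (k+1) := by
  constructor
  · intro h
    exact (lev_spec (by omega)).trans (hn h)
  · intro h
    exact Nat.le_findGreatest (P := fun j => i ≤ n j) hk h

lemma lev_anti (hn : Antitone n) {i i' : ℕ} (h : i ≤ i') : lev n r i' ≤ lev n r i := by
  rcases Nat.eq_zero_or_pos (lev n r i') with h0 | h0
  · omega
  · exact Nat.le_findGreatest (P := fun j => i ≤ n j) (lev_le _) (h.trans (lev_spec h0))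

lemma abel_lev (hn : Antitone n) (F : ℕ → ℝ) (hF : F 0 = 0) (nb : ℕ) (hnb : ∀ k < r, nb ≤ n (k+1)) (hr : 1 ≤ r) :
    ∑ i ∈ Finset.Ioc nb (n 1), F (lev n r i) =
      ∑ k ∈ Finset.range r, ((n (k+1) : ℝ) - nb) * (F (k+1) - F k) := by
  have h1 : ∀ i, F (lev n r i) = ∑ k ∈ Finset.range r, if i ≤ n (k+1) then F (k+1) - F k else 0 := by
    intro i
    have e : ∀ k ∈ Finset.range r, (if i ≤ n (k+1) then F (k+1) - F k else 0) =
        if k < lev n r i then F (k+1) - F k else 0 := by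
      intro k hk
      simp only [lt_lev_iff hn (Finset.mem_range.1 hk)]
    rw [Finset.sum_congr rfl e, ← Finset.sum_filter]
    have e2 : (Finset.range r).filter (fun k => k < lev n r i) = Finset.range (lev n r i) := by
      ext k; have := lev_le (n := n) (r := r) i
      simp only [Finset.mem_filter, Finset.mem_range]; omega
    rw [e2, Finset.sum_range_sub, hF, sub_zero]
  simp only [h1]
  rw [Finset.sum_comm]
  refine Finset.sum_congr rfl fun k hk => ?_
  rw [← Finset.sum_filter, Finset.sum_const]
  have e : (Finset.Ioc nb (n 1)).filter (fun i => i ≤ n (k+1)) = Finset.Ioc nb (n (k+1)) := by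
    ext i
    have := hn (show 1 ≤ k+1 by omega)
    simp only [Finset.mem_filter, Finset.mem_Ioc]; omega
  rw [e, Nat.card_Ioc, nsmul_eq_mul, Nat.cast_sub (hnb k (Finset.mem_range.1 hk))]

noncomputable def nn (θ : ℝ) (r N j : ℕ) : ℕ := ⌊cc θ r j * N⌋₊

lemma cc_pos {θ : ℝ} (h0 : 0 < θ) (j : ℕ) : 0 < cc θ r j := by
  unfold cc; split_ifs <;> positivity

lemma cc_anti {θ : ℝ} (h0 : 0 < θ) (h1 : θ < 1) : Antitone (cc θ r) := by
  intro i j hij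
  unfold cc
  split_ifs with h2 h3 h3
  · exact pow_le_pow_of_le_one h0.le h1.le (by omega)
  · omega
  · have : θ^r ≤ θ^(i-1) := pow_le_pow_of_le_one h0.le h1.le (by omega)
    have : 0 < θ^r := by positivity
    linarith
  · exact le_rfl

lemma nn_anti {θ : ℝ} (h0 : 0 < θ) (h1 : θ < 1) (N : ℕ) : Antitone (nn θ r N) := by
  intro i j hij
  exact Nat.floor_le_floor (mul_le_mul_of_nonneg_right (cc_anti h0 h1 hij) (by positivity))

/-- the list of levels -/
noncomputable def lsN (θ : ℝ) (r N : ℕ) : List ℕ :=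
  mkL (lev (nn θ r N) r) (nn θ r N (r+1)) (nn θ r N 1 - nn θ r N (r+1))

lemma pow_geom (r : ℕ) : ∑ k ∈ Finset.range r, (2:ℝ)^k = 2^r - 1 := by
  have := geom_sum_eq (show (2:ℝ) ≠ 1 by norm_num) r
  rw [this]; norm_num

theorem levels {θ α : ℝ} {μ : (j : ℕ) → Om j → ℝ} (h0 : 0 < θ) (h1 : θ < 1) (hr : 1 ≤ r) (F : Fam r α μ)
    (hp : ∀ m < r, 0 < ∑ k ∈ Finset.range r, (cc θ r (k+1) - cc θ r (r+1)) *
        (FF α μ m (k+1) - FF α μ m k) - cc θ r (r+1) * (2^r - 2^m)) :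
    ∃ N0 : ℕ, ∀ N ≥ N0, ∑ k ∈ Finset.range r, (nn θ r N (k+1) : ℝ) * 2^k ≤
      Eng r α (nn θ r N (r+1)) μ (lsN θ r N) (VV r 0) := by
  have hlim : ∀ j, Tendsto (fun N : ℕ => (nn θ r N j : ℝ) / N) atTop (nhds (cc θ r j)) := by
    intro j
    exact (tendsto_nat_floor_mul_div_atTop (cc_pos h0 j).le).comp tendsto_natCast_atTop_atTop
  have hPhi : ∀ N m, Phi r α (nn θ r N (r+1)) μ (lsN θ r N) m =
      ∑ k ∈ Finset.range r, ((nn θ r N (k+1) : ℝ) - nn θ r N (r+1)) * (FF α μ m (k+1) - FF α μ m k)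
        - nn θ r N (r+1) * (2^r - 2^m) := by
    intro N m
    have hn := nn_anti (r := r) h0 h1 N
    unfold Phi lsN
    rw [mkL_map, mkL_sum, Nat.add_sub_cancel' (hn (by omega : 1 ≤ r+1))]
    rw [← abel_lev hn (FF α μ m) (by simp [FF]) _ (fun k hk => hn (by omega)) hr]
    rfl
  have hev : ∀ m, ∀ᶠ N : ℕ in atTop, m ≤ r → 0 ≤ Phi r α (nn θ r N (r+1)) μ (lsN θ r N) m := by
    intro m
    rcases lt_trichotomy m r with hm | hm | hm
    · have ht : Tendsto (fun N : ℕ => ∑ k ∈ Finset.range r, ((nn θ r N (k+1) : ℝ)/N - (nn θ r N (r+1):ℝ)/N) *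
          (FF α μ m (k+1) - FF α μ m k) - (nn θ r N (r+1) : ℝ)/N * (2^r - 2^m)) atTop
          (nhds (∑ k ∈ Finset.range r, (cc θ r (k+1) - cc θ r (r+1)) *
        (FF α μ m (k+1) - FF α μ m k) - cc θ r (r+1) * (2^r - 2^m))) := by
        refine Tendsto.sub (tendsto_finsetSum _ fun k _ => ?_) ((hlim _).mul_const _)
        exact ((hlim _).sub (hlim _)).mul_const _
      filter_upwards [ht.eventually_const_lt (hp m hm), eventually_gt_atTop 0] with N hN hN0 _
      rw [hPhi]
      have hN0' : (0:ℝ) < N := by exact_mod_cast hN0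
      have := mul_pos hN0' hN
      refine le_of_lt (lt_of_lt_of_eq this ?_)
      rw [mul_sub, Finset.mul_sum]
      congr 1
      · refine Finset.sum_congr rfl fun k _ => ?_
        field_simp
      · field_simp
    · refine Eventually.of_forall fun N _ => ?_
      rw [hPhi, hm, Finset.sum_eq_zero]
      · simp
      · intro k hk
        have := Finset.mem_range.1 hk
        unfold FF
        rw [if_neg (by omega), if_neg (by omega)]; simp
    · exact Eventually.of_forall fun N h => by omega
  have hev2 : ∀ᶠ N : ℕ in atTop, ∀ m ∈ Finset.range (r+1), m ≤ r → 0 ≤ Phi r α (nn θ r N (r+1)) μ (lsN θ r N) m :=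
    (Finset.eventually_all _).2 fun m _ => hev m
  obtain ⟨N0, hN0⟩ := eventually_atTop.1 hev2
  refine ⟨N0, fun N hN => ?_⟩
  have hn := nn_anti (r := r) h0 h1 N
  have hch := chain_main F (nb := nn θ r N (r+1)) (by positivity) (lsN θ r N)
    (by
      intro j hj
      obtain ⟨i, hi1, hi2, rfl⟩ := mem_mkL hj
      refine ⟨?_, lev_le i⟩
      have : nn θ r N (r+1) ≤ nn θ r N 1 := hn (by omega)
      exact (lt_lev_iff hn (by omega)).2 (by simpa using (by omega : i ≤ nn θ r N 1)))
    (mkL_pairwise _ _ (fun i j hij => lev_anti hn hij.le) _ _)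
    (fun m hm => hN0 N hN m (by simp; omega) hm)
  unfold Eng
  have hfr : Module.finrank ℝ (VV r 0) = 1 := by rw [finrank_VV (by omega)]; simp
  rw [hfr]
  refine le_trans (le_of_eq ?_) (sub_le_sub_right hch _)
  have hle : nn θ r N (r+1) ≤ nn θ r N 1 := hn (by omega)
  unfold base lsN
  rw [mkL_map, mkL_sum, mkL_length, Nat.add_sub_cancel' hle]
  have e : ∀ i, (2:ℝ)^(lev (nn θ r N) r i) = ((2:ℝ)^(lev (nn θ r N) r i) - 1) + 1 := fun i => by ring
  rw [Finset.sum_congr rfl fun i _ => e i, Finset.sum_add_distrib,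
    abel_lev hn (fun j => (2:ℝ)^j - 1) (by simp) _ (fun k hk => hn (by omega)) hr, Finset.sum_const, Nat.card_Ioc]
  have e2 : ∑ k ∈ Finset.range r, ((nn θ r N (k+1) : ℝ) - nn θ r N (r+1)) * ((2:ℝ)^(k+1) - 1 - (2^k - 1)) =
      ∑ k ∈ Finset.range r, (nn θ r N (k+1) : ℝ) * 2^k - nn θ r N (r+1) * (2^r - 1) := by
    rw [← pow_geom, Finset.mul_sum, ← Finset.sum_sub_distrib]
    exact Finset.sum_congr rfl fun k _ => by ring
  rw [e2]
  rw [Nat.cast_sub hle]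
  simp only [nsmul_eq_mul, mul_one, Nat.cast_one]
  rw [Nat.cast_sub hle]
  ring

end EH

namespace EH

/-! Slots of primes and fractional classes -/

noncomputable def fr (t : ℝ) : ℝ := t - ⌈t⌉₊ + 1

lemma fr_pos {t : ℝ} (ht : 0 ≤ t) : 0 < fr t := by
  have := Nat.ceil_lt_add_one ht
  unfold fr; linarith

lemma fr_le (t : ℝ) : fr t ≤ 1 := by
  have := Nat.le_ceil t
  unfold fr; linarith

lemma fr_eq {t : ℝ} {m : ℕ} (h1 : (m:ℝ) < t) (h2 : t ≤ m + 1) : fr t = t - m := by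
  have : ⌈t⌉₊ = m + 1 := by
    rw [Nat.ceil_eq_iff (by omega)]
    constructor
    · simpa using h1
    · push_cast; exact h2
  unfold fr; rw [this]; push_cast; ring

noncomputable def Cls (L x y u v : ℝ) : Finset ℕ :=
  (Pr u v).filter fun p => x < fr (Real.log p / L) ∧ fr (Real.log p / L) ≤ y

lemma mem_Cls {L x y u v : ℝ} {p : ℕ} : p ∈ Cls L x y u v ↔
    (p.Prime ∧ u < Real.log p ∧ Real.log p ≤ v) ∧ x < fr (Real.log p / L) ∧ fr (Real.log p / L) ≤ y := by
  unfold Cls; rw [Finset.mem_filter, mem_Pr]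

lemma Cls_sub (L x y u v : ℝ) : Cls L x y u v ⊆ Pr u v := Finset.filter_subset _ _

lemma Cls_disj {L x y x' y' u v u' v' : ℝ} (h : y ≤ x') : Disjoint (Cls L x y u v) (Cls L x' y' u' v') := by
  rw [Finset.disjoint_left]
  intro p h1 h2
  rw [mem_Cls] at h1 h2
  linarith [h1.2.2, h2.2.1]

lemma sum_biUnion_le' {ι : Type*} (t : Finset ι) (Q : ι → Finset ℕ) (f : ℕ → ℝ) (hf : ∀ p, 0 ≤ f p) :
    ∑ p ∈ t.biUnion Q, f p ≤ ∑ i ∈ t, ∑ p ∈ Q i, f p := by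
  induction t using Finset.induction_on with
  | empty => simp
  | insert a t ha ih =>
    rw [Finset.biUnion_insert, Finset.sum_insert ha]
    have h1 := Finset.sum_union_inter (s₁ := Q a) (s₂ := t.biUnion Q) (f := f)
    have h2 : 0 ≤ ∑ p ∈ Q a ∩ t.biUnion Q, f p := Finset.sum_nonneg fun p _ => hf p
    linarith

lemma slot_arith1 {g σ E c X : ℝ} (hg0 : 0 < g) (hg1 : g < 1) (hσ : σ = g / 8) (hE : E ≤ 1 + σ + σ^2)
    (hc : c ≤ σ * g / 200) (hX : X ≤ E - 1 + c) : X ≤ g / 4 := by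
  subst hσ
  have : g * g ≤ g := by nlinarith
  nlinarith

lemma slot_arith2 {g σ S X : ℝ} (hg0 : 0 < g) (hσ : σ = g / 8)
    (h1 : σ - σ^2 - σ*g/200 ≤ S) (h2 : S ≤ X + 8 * (σ*g/160 + σ*g/200)) : σ * (1 - g * 3/8) ≤ X := by
  have h3 : σ^2 = σ * g / 8 := by rw [sq]; nth_rewrite 2 [hσ]; ring
  have : 0 < σ * g := by rw [hσ]; positivity
  linarith

lemma slot_arith3 {g σ κ : ℝ} (hg0 : 0 < g) (hσ0 : 0 < σ) (hh : 1 - g = κ) :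
    κ * σ ≤ (σ * (1 - g*3/8)) * (1 - g/4) := by
  rw [← hh]; nlinarith [mul_pos hσ0 hg0, mul_pos (mul_pos hσ0 hg0) hg0]


/-- small fractional class: upper bound -/
lemma small_cls : ∃ C : ℝ, 0 < C ∧ ∀ L η A B : ℝ, 0 < L → 0 ≤ η → 1 ≤ A → A ≤ B →
    ∑ p ∈ Cls L 0 η (L*A) (L*B), ap p ≤ (B - A + 2) * (2 * (η + C / L) / A) := by
  obtain ⟨C, hC, h⟩ := mass
  refine ⟨C, hC, fun L η A B hL hη hA hAB => ?_⟩
  have hsub : Cls L 0 η (L*A) (L*B) ⊆ (Finset.Icc ⌊A⌋₊ ⌊B⌋₊).biUnion fun m => Pr (m*L) ((m+η)*L) := by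
    intro p hp
    rw [mem_Cls] at hp
    obtain ⟨⟨h1, h2, h3⟩, _, h5⟩ := hp
    set t := Real.log p / L with ht
    have e : Real.log p = t * L := by rw [ht]; field_simp
    have hA1 : A < t := by rw [e] at h2; nlinarith
    have hB1 : t ≤ B := by rw [e] at h3; nlinarith
    have hc1 : 1 ≤ ⌈t⌉₊ := Nat.one_le_ceil_iff.2 (by linarith)
    obtain ⟨m, hm⟩ := Nat.exists_eq_add_of_le' hc1
    have hlt : (m:ℝ) < t := by
      have := Nat.ceil_lt_add_one (show 0 ≤ t by linarith)
      rw [hm] at this; push_cast at this; linarith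
    have hle : t ≤ m + 1 := by
      have := Nat.le_ceil t
      rw [hm] at this; push_cast at this; exact this
    rw [fr_eq hlt hle] at h5
    rw [Finset.mem_biUnion]
    refine ⟨m, Finset.mem_Icc.2 ⟨?_, Nat.le_floor (by linarith)⟩, mem_Pr.2 ⟨h1, ?_, ?_⟩⟩
    · have h6 : (⌊A⌋₊:ℝ) < m + 1 := lt_of_le_of_lt (Nat.floor_le (by linarith)) (by linarith)
      have : ⌊A⌋₊ < m + 1 := by exact_mod_cast h6
      omega
    · rw [e]; nlinarith
    · rw [e]; nlinarith
  have h1 : ∀ m ∈ Finset.Icc ⌊A⌋₊ ⌊B⌋₊, ∑ p ∈ Pr (m*L) ((m+η)*L), ap p ≤ 2 * (η + C / L) / A := by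
    intro m hm
    have hf : A / 2 ≤ m := by
      have h1 : (1:ℝ) ≤ ⌊A⌋₊ := by exact_mod_cast (Nat.one_le_floor_iff _).2 hA
      have h2 := Nat.lt_floor_add_one A
      have h3 : (⌊A⌋₊:ℝ) ≤ m := by exact_mod_cast (Finset.mem_Icc.1 hm).1
      linarith
    have hm0 : (0:ℝ) < m := by linarith
    refine ((h (m*L) ((m+η)*L) (by positivity) (by nlinarith)).2).trans ?_
    have e : ((m+η)*L - m*L + C) / (m*L) = (η + C/L) / m := by field_simp; ring
    rw [e, div_le_div_iff₀ hm0 (by linarith)]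
    have : 0 ≤ η + C/L := by positivity
    nlinarith
  calc ∑ p ∈ Cls L 0 η (L*A) (L*B), ap p
      ≤ ∑ p ∈ (Finset.Icc ⌊A⌋₊ ⌊B⌋₊).biUnion fun m : ℕ => Pr (m*L) ((m+η)*L), ap p :=
        Finset.sum_le_sum_of_subset_of_nonneg hsub fun p _ _ => (ap_pos p).le
    _ ≤ ∑ m ∈ Finset.Icc ⌊A⌋₊ ⌊B⌋₊, ∑ p ∈ Pr (m*L) ((m+η)*L), ap p :=
        sum_biUnion_le' _ _ _ (fun p => (ap_pos p).le)
    _ ≤ ∑ m ∈ Finset.Icc ⌊A⌋₊ ⌊B⌋₊, 2 * (η + C / L) / A := Finset.sum_le_sum h1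
    _ = (Finset.Icc ⌊A⌋₊ ⌊B⌋₊).card * (2 * (η + C / L) / A) := by rw [Finset.sum_const, nsmul_eq_mul]
    _ ≤ (B - A + 2) * (2 * (η + C / L) / A) := by
        apply mul_le_mul_of_nonneg_right _ (by positivity)
        rw [Nat.card_Icc]
        have hle : ⌊A⌋₊ ≤ ⌊B⌋₊ + 1 := (Nat.floor_le_floor hAB).trans (by omega)
        rw [Nat.cast_sub hle]
        have := Nat.floor_le (show 0 ≤ B by linarith)
        have := Nat.lt_floor_add_one A
        push_cast; linarith

/-- box mass lower bound -/
lemma box_mass {x y : ℝ} (hx : 0 ≤ x) (hxy : x < y) (hy : y ≤ 1) : ∃ L0 : ℝ, 0 < L0 ∧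
    ∀ L R Y : ℝ, L0 ≤ L → 1 ≤ R → 1 ≤ Y →
    (y - x) / 5 / Y ≤ ∑ p ∈ Cls L x y (Y * (L * R)) ((Y + 4) * (L * R)), ap p := by
  obtain ⟨C, hC, h⟩ := mass
  refine ⟨2 * C / (y - x), by apply div_pos <;> linarith, fun L R Y hL hR hY => ?_⟩
  have hd : 0 < y - x := by linarith
  have hL0 : 0 < L := lt_of_lt_of_le (by positivity) hL
  have hCL : C ≤ (y-x)/2 * L := by
    rw [div_le_iff₀ hd] at hL; linarith
  have hYR : 1 ≤ Y * R := by nlinarith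
  have h4 : ⌈Y * R⌉₊ ≤ ⌊(Y+4)*R⌋₊ := by
    apply Nat.le_floor
    have := Nat.ceil_lt_add_one (show 0 ≤ Y * R by linarith)
    nlinarith
  have hsub : (Finset.Ico ⌈Y*R⌉₊ ⌊(Y+4)*R⌋₊).biUnion (fun m : ℕ => Pr ((m+x)*L) ((m+y)*L)) ⊆
      Cls L x y (Y * (L * R)) ((Y + 4) * (L * R)) := by
    intro p hp
    rw [Finset.mem_biUnion] at hp
    obtain ⟨m, hm, hp⟩ := hp
    rw [Finset.mem_Ico] at hm
    rw [mem_Pr] at hp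
    obtain ⟨h1, h2, h3⟩ := hp
    set t := Real.log p / L with ht
    have e : Real.log p = t * L := by rw [ht]; field_simp
    rw [e] at h2 h3
    have ht1 : m + x < t := lt_of_mul_lt_mul_right h2 hL0.le
    have ht2 : t ≤ m + y := le_of_mul_le_mul_right h3 hL0
    have hm1 : Y * R ≤ m := Nat.ceil_le.1 hm.1
    have hm2 : (m:ℝ) + 1 ≤ (Y+4)*R := by
      have : ((m+1 : ℕ):ℝ) ≤ (Y+4)*R := (Nat.le_floor_iff (by nlinarith)).1 hm.2
      exact_mod_cast this
    rw [mem_Cls, ← ht, fr_eq (m := m) (by linarith) (by linarith), e]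
    refine ⟨⟨h1, ?_, ?_⟩, by linarith, by linarith⟩
    · calc Y * (L * R) = (Y * R) * L := by ring
        _ < t * L := mul_lt_mul_of_pos_right (by linarith) hL0
    · calc t * L ≤ ((Y+4)*R) * L := mul_le_mul_of_nonneg_right (by linarith) hL0.le
        _ = _ := by ring
  refine le_trans ?_ (Finset.sum_le_sum_of_subset_of_nonneg hsub fun p _ _ => (ap_pos p).le)
  rw [Finset.sum_biUnion]
  · have h1 : ∀ m ∈ Finset.Ico ⌈Y*R⌉₊ ⌊(Y+4)*R⌋₊, (y-x)/2/((Y+4)*R) ≤ ∑ p ∈ Pr ((m+x)*L) ((m+y)*L), ap p := by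
      intro m hm
      rw [Finset.mem_Ico] at hm
      have hm1 : Y * R ≤ m := Nat.ceil_le.1 hm.1
      have hm2 : (m:ℝ) + 1 ≤ (Y+4)*R := by
        have : ((m+1 : ℕ):ℝ) ≤ (Y+4)*R := (Nat.le_floor_iff (by nlinarith)).1 hm.2
        exact_mod_cast this
      refine le_trans ?_ (h ((m+x)*L) ((m+y)*L) (by apply mul_pos _ hL0; linarith) (by nlinarith)).1
      rw [div_le_div_iff₀ (by nlinarith) (by apply mul_pos _ hL0; linarith)]
      have e1 : (y-x)/2*L ≤ (m+y)*L - (m+x)*L - C := by linarith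
      have e2 : (m+y) ≤ (Y+4)*R := by linarith
      calc (y-x)/2*((m+y)*L) = ((y-x)/2*L) * (m+y) := by ring
        _ ≤ ((m+y)*L - (m+x)*L - C) * ((Y+4)*R) := by
          apply mul_le_mul e1 e2 (by linarith)
          exact le_trans (by positivity) e1
    refine le_trans ?_ (Finset.sum_le_sum h1)
    rw [Finset.sum_const, Nat.card_Ico, nsmul_eq_mul, Nat.cast_sub h4]
    have f1 := Nat.lt_floor_add_one ((Y+4)*R)
    have f2 := Nat.ceil_lt_add_one (show 0 ≤ Y * R by linarith)
    have f3 : 2 * R ≤ (⌊(Y+4)*R⌋₊:ℝ) - ⌈Y*R⌉₊ := by nlinarith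
    calc (y-x)/5/Y ≤ (2*R) * ((y-x)/2/((Y+4)*R)) := by
          have e : (2*R) * ((y-x)/2/((Y+4)*R)) = (y-x)/(Y+4) := by field_simp
          rw [e, div_div]
          apply div_le_div_of_nonneg_left hd.le (by linarith) (by linarith)
      _ ≤ _ := by
          apply mul_le_mul_of_nonneg_right f3
          apply div_nonneg (by linarith) (by nlinarith)
  · intro m _ m' _ hmm
    rcases Nat.lt_or_gt_of_ne hmm with h1 | h1
    · apply Pr_disj
      have : (m:ℝ) + 1 ≤ m' := by exact_mod_cast h1
      apply mul_le_mul_of_nonneg_right _ hL0.le; linarith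
    · apply Disjoint.symm
      apply Pr_disj
      have : (m':ℝ) + 1 ≤ m := by exact_mod_cast h1
      apply mul_le_mul_of_nonneg_right _ hL0.le; linarith

/-- main slots -/
noncomputable def Pm (σ η L : ℝ) (g : ℕ) : Finset ℕ :=
  Cls L η 1 (L * Real.exp (σ * g)) (L * Real.exp (σ * (g+1)))

set_option maxHeartbeats 2000000 in
theorem slot_ok {κ : ℝ} (hκ0 : 0 < κ) (hκ : κ < 1) : ∃ σ η B L0 : ℝ, 0 < σ ∧ σ < 1 ∧ 0 < η ∧ η < 1 ∧ 0 ≤ B ∧ 1 ≤ L0 ∧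
    ∀ L, L0 ≤ L → ∀ b i : ℕ,
      SlotOK (fun p => Real.log p / (L * Real.exp (σ * b))) w1 B σ (κ * σ) (Pm σ η L (i + b)) i := by
  obtain ⟨C, hC, h⟩ := mass
  obtain ⟨C', hC', h'⟩ := small_cls
  set D := max C C' with hD
  have hDC : C ≤ D := le_max_left _ _
  have hDC' : C' ≤ D := le_max_right _ _
  have hD0 : 0 < D := lt_of_lt_of_le hC hDC
  set g := 1 - κ with hg
  have hg0 : 0 < g := by linarith
  have hg1 : g < 1 := by linarith
  set σ := g / 8 with hσ
  have hσ0 : 0 < σ := by positivity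
  have hσ1 : σ < 1/8 := by linarith
  refine ⟨σ, σ * g / 160, 1 + C, max 1 (200 * D / (σ * g)), hσ0, by linarith, by positivity, ?_, by linarith,
    le_max_left _ _, fun L hL b i => ?_⟩
  · have : σ * g < 1 := by nlinarith
    linarith
  have hL1 : 1 ≤ L := (le_max_left _ _).trans hL
  have hL2 : 200 * D / (σ * g) ≤ L := (le_max_right _ _).trans hL
  have hL0 : 0 < L := by linarith
  have hDL : D / L ≤ σ * g / 200 := by
    rw [div_le_iff₀ (by positivity)] at hL2
    rw [div_le_iff₀ hL0]; linarith
  refine ⟨w1_good _, ?_, ?_⟩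
  · -- activity
    set A := Real.exp (σ * ((i + b : ℕ):ℝ)) with hA
    have hA1 : 1 ≤ A := Real.one_le_exp (by positivity)
    have hB : Real.exp (σ * (((i + b : ℕ):ℝ) + 1)) = A * Real.exp σ := by
      rw [hA, ← Real.exp_add]; congr 1; ring
    have hexp1 : Real.exp σ ≤ 1 + σ + σ^2 := by
      have := Real.abs_exp_sub_one_sub_id_le (x := σ) (by rw [abs_of_pos hσ0]; linarith)
      have := (abs_le.1 this).2
      linarith
    have hexp0 : 1 + σ ≤ Real.exp σ := by linarith [Real.add_one_le_exp σ]
    set E := Real.exp σ with hE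
    have hAE : A ≤ A * E := by nlinarith
    have hX := h (L*A) (L*(A*E)) (by positivity) (by nlinarith)
    set η := σ * g / 160 with hη
    have hη0 : 0 < η := by positivity
    have hsm := h' L η A (A*E) hL0 hη0.le hA1 hAE
    set P := Pm σ η L (i+b) with hP
    have hPe : P = Cls L η 1 (L*A) (L*(A*E)) := by rw [hP, Pm, hB]
    have hsplit : ∑ p ∈ Pr (L*A) (L*(A*E)), ap p ≤ ∑ p ∈ P, ap p + ∑ p ∈ Cls L 0 η (L*A) (L*(A*E)), ap p := by
      have : Pr (L*A) (L*(A*E)) ⊆ P ∪ Cls L 0 η (L*A) (L*(A*E)) := by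
        intro p hp
        rw [Finset.mem_union, hPe, mem_Cls, mem_Cls]
        rw [mem_Pr] at hp
        have hl : 0 ≤ Real.log p / L := by
          apply div_nonneg _ hL0.le
          have : 0 < L * A := by positivity
          linarith
        rcases le_or_gt (fr (Real.log p / L)) η with h1 | h1
        · exact Or.inr ⟨hp, fr_pos hl, h1⟩
        · exact Or.inl ⟨hp, h1, fr_le _⟩
      refine (Finset.sum_le_sum_of_subset_of_nonneg this fun p _ _ => (ap_pos p).le).trans ?_
      have := Finset.sum_union_inter (s₁ := P) (s₂ := Cls L 0 η (L*A) (L*(A*E))) (f := ap)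
      have : 0 ≤ ∑ p ∈ P ∩ Cls L 0 η (L*A) (L*(A*E)), ap p := Finset.sum_nonneg fun p _ => (ap_pos p).le
      linarith
    have hup : ∑ p ∈ P, ap p ≤ ∑ p ∈ Pr (L*A) (L*(A*E)), ap p := by
      rw [hPe]
      exact Finset.sum_le_sum_of_subset_of_nonneg (Cls_sub _ _ _ _ _) fun p _ _ => (ap_pos p).le
    have hCL : C / L ≤ σ * g / 200 := le_trans (div_le_div_of_nonneg_right hDC hL0.le) hDL
    have hCL' : C' / L ≤ σ * g / 200 := le_trans (div_le_div_of_nonneg_right hDC' hL0.le) hDL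
    have u1 : (L*(A*E) - L*A + C)/(L*A) ≤ E - 1 + C / L := by
      have : (L*(A*E) - L*A + C)/(L*A) = E - 1 + (C/L)/A := by field_simp
      rw [this]
      have : (C/L)/A ≤ C/L := div_le_self (by positivity) hA1
      linarith
    have u2 : 1 - E⁻¹ - C / L ≤ (L*(A*E) - L*A - C)/(L*(A*E)) := by
      have hE0 : 0 < E := by linarith
      have : (L*(A*E) - L*A - C)/(L*(A*E)) = 1 - E⁻¹ - (C/L)/(A*E) := by field_simp
      rw [this]
      have : (C/L)/(A*E) ≤ C/L := div_le_self (by positivity) (by nlinarith)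
      linarith
    have u3 : (A*E - A + 2) * (2 * (η + C' / L) / A) ≤ 8 * (η + C'/L) := by
      have : (A*E - A + 2) * (2 * (η + C' / L) / A) = 2*(η + C'/L) * ((E - 1) + 2/A) := by field_simp
      rw [this]
      have h2 : 2/A ≤ 2 := div_le_self (by norm_num) hA1
      have h3 : 0 ≤ η + C'/L := by positivity
      have h5 : σ^2 ≤ 1 := by rw [sq]; exact mul_le_one₀ (by linarith) hσ0.le (by linarith)
      have h4 : E - 1 + 2/A ≤ 4 := by linarith
      calc 2*(η + C'/L) * ((E - 1) + 2/A) ≤ 2*(η + C'/L) * 4 := mul_le_mul_of_nonneg_left h4 (by linarith)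
        _ = 8 * (η + C'/L) := by ring
    have u4 : 1 - E⁻¹ ≥ σ - σ^2 := by
      have hE0 : 0 < E := by linarith
      have : E⁻¹ ≤ (1+σ)⁻¹ := inv_anti₀ (by linarith) hexp0
      have h2 : (1+σ)⁻¹ ≤ 1 - σ + σ^2 := by
        rw [inv_le_iff_one_le_mul₀ (by linarith)]
        nlinarith [pow_pos hσ0 3]
      linarith
    set X := ∑ p ∈ P, ap p with hXd
    have hXup : X ≤ g / 4 := by
      have : X ≤ E - 1 + C/L := hup.trans (hX.2.trans u1)
      exact slot_arith1 hg0 hg1 hσ hexp1 hCL this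
    have hXlo : σ * (1 - g * 3/8) ≤ X := by
      have h1 : σ - σ^2 - σ*g/200 ≤ ∑ p ∈ Pr (L*A) (L*(A*E)), ap p := by
        refine le_trans ?_ hX.1
        refine le_trans ?_ u2
        linarith
      have h2 := hsm.trans u3
      have h4 : 8 * (η + C'/L) ≤ 8 * (σ*g/160 + σ*g/200) := by linarith
      exact slot_arith2 hg0 hσ h1 (hsplit.trans (by linarith))
    calc κ * σ ≤ X * (1 - X) := by
          have hh : 1 - g = κ := by linarith
          have h1 : 1 - g/4 ≤ 1 - X := by linarith
          calc κ * σ ≤ (σ * (1 - g*3/8)) * (1 - g/4) := slot_arith3 hg0 hσ0 hh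
            _ ≤ X * (1 - X) := mul_le_mul hXlo h1 (by linarith) (le_trans (by nlinarith) hXlo)
      _ = ∑ p ∈ P, ap p * (1 - X) := by rw [hXd, Finset.sum_mul]
      _ ≤ ∑ p ∈ P, w1 P p := Finset.sum_le_sum fun p _ => w1_ge P p
  · intro K hK x
    set Lb := L * Real.exp (σ * b) with hLb
    have hLb1 : 1 ≤ Lb := by
      have : 1 ≤ Real.exp (σ * b) := Real.one_le_exp (by positivity)
      nlinarith
    have hLb0 : 0 < Lb := by linarith
    set η := σ * g / 160 with hη
    set u := max (x * Lb - 1) (Lb * Real.exp (σ * i)) with hu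
    have hu1 : Lb * Real.exp (σ * i) ≤ u := le_max_right _ _
    have hu0 : 0 < Lb * Real.exp (σ * i) := by positivity
    set v := max u ((x + K) * Lb) with hv
    have huv : u ≤ v := le_max_left _ _
    have hvu : v - u ≤ K * Lb + 1 := by
      have h1 : x * Lb - 1 ≤ u := le_max_left _ _
      have : v ≤ u + (K * Lb + 1) := max_le (by nlinarith) (by linarith)
      linarith
    have hsub : (Pm σ η L (i+b)).filter (fun p : ℕ => x ≤ Real.log p / Lb ∧ Real.log p / Lb ≤ x + K) ⊆ Pr u v := by
      intro p hp
      rw [Finset.mem_filter, Pm, mem_Cls] at hp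
      obtain ⟨⟨⟨h1, h2, h3⟩, _⟩, h4, h5⟩ := hp
      rw [le_div_iff₀ hLb0] at h4
      rw [div_le_iff₀ hLb0] at h5
      rw [mem_Pr]
      refine ⟨h1, max_lt (by linarith) ?_, h5.trans (le_max_right _ _)⟩
      refine lt_of_le_of_lt (le_of_eq ?_) h2
      rw [hLb, mul_assoc, ← Real.exp_add]
      congr 2; push_cast; ring
    calc ∑ p ∈ (Pm σ η L (i+b)).filter (fun p : ℕ => x ≤ Real.log p / Lb ∧ Real.log p / Lb ≤ x + K), w1 (Pm σ η L (i+b)) p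
        ≤ ∑ p ∈ (Pm σ η L (i+b)).filter (fun p : ℕ => x ≤ Real.log p / Lb ∧ Real.log p / Lb ≤ x + K), ap p :=
          Finset.sum_le_sum fun p _ => w1_le _ _
      _ ≤ ∑ p ∈ Pr u v, ap p := Finset.sum_le_sum_of_subset_of_nonneg hsub fun p _ _ => (ap_pos p).le
      _ ≤ (v - u + C) / u := (h u v (by linarith) huv).2
      _ ≤ (K * Lb + 1 + C) / (Lb * Real.exp (σ * i)) := by
          apply div_le_div₀ (by positivity) (by linarith) hu0 hu1
      _ ≤ (1 + C) * (K + 1) * Real.exp (-σ * i) := by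
          rw [neg_mul, Real.exp_neg, div_le_iff₀ hu0]
          have e : (1 + C) * (K + 1) * (Real.exp (σ * i))⁻¹ * (Lb * Real.exp (σ * i)) = (1+C)*(K+1)*Lb := by
            field_simp
          rw [e]
          nlinarith [mul_nonneg hK hC.le, mul_nonneg (mul_nonneg hK hC.le) hLb0.le, mul_nonneg hC.le (sub_nonneg.2 hLb1)]

end EH

namespace EH

/-! ### leaves -/
def lastT {r : ℕ} (l : Lam r) : ℕ :=
  (Finset.univ.filter (fun i : Fin r => l i = true)).sup (fun i => i.1+1)

def clr {r : ℕ} (l : Lam r) : Lam r := fun i => if i.1 + 1 = lastT l then false else l i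

variable {r : ℕ}

lemma lastT_le (l : Lam r) : lastT l ≤ r := Finset.sup_le fun i _ => i.2

lemma lt_lastT {l : Lam r} {i : Fin r} (h : l i = true) : i.1 < lastT l :=
  Finset.le_sup (f := fun i : Fin r => i.1+1) (Finset.mem_filter.2 ⟨Finset.mem_univ i, h⟩)

lemma eq_false_of_lastT {l : Lam r} {i : Fin r} (h : lastT l ≤ i.1) : l i = false := by
  by_contra hc
  have := lt_lastT (l := l) (i := i) (by simpa using hc)
  omega

lemma exists_lastT {l : Lam r} (h : lastT l ≠ 0) : ∃ i : Fin r, i.1 + 1 = lastT l ∧ l i = true := by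
  have hne : (Finset.univ.filter (fun i : Fin r => l i = true)).Nonempty := by
    by_contra hc
    rw [Finset.not_nonempty_iff_eq_empty] at hc
    apply h; unfold lastT; rw [hc]; rfl
  obtain ⟨i, hi, h1⟩ := Finset.exists_mem_eq_sup _ hne (fun i : Fin r => i.1+1)
  exact ⟨i, h1.symm, (Finset.mem_filter.1 hi).2⟩

lemma lastT_le_iff {l : Lam r} {k : ℕ} : lastT l ≤ k ↔ ∀ i : Fin r, k ≤ i.1 → l i = false := by
  constructor
  · intro h i hi; exact eq_false_of_lastT (h.trans hi)
  · intro h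
    refine Finset.sup_le fun i hi => ?_
    by_contra hc
    have := h i (by omega)
    rw [(Finset.mem_filter.1 hi).2] at this
    exact absurd this (by simp)

lemma eq_of_agree {l l' : Lam r} {k : ℕ} (h : agree k l l') (h1 : lastT l ≤ k) (h2 : lastT l' ≤ k) : l = l' := by
  funext i
  rcases lt_or_ge i.1 k with hi | hi
  · exact h i hi
  · rw [eq_false_of_lastT (h1.trans hi), eq_false_of_lastT (h2.trans hi)]

lemma agree_clr {l : Lam r} {k : ℕ} (h : k < lastT l) : agree k l (clr l) := by
  intro i hi
  unfold clr
  rw [if_neg (by omega)]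

lemma lastT_clr {l : Lam r} (h : lastT l ≠ 0) : lastT (clr l) < lastT l := by
  have : lastT (clr l) ≤ lastT l - 1 := by
    rw [lastT_le_iff]
    intro i hi
    unfold clr
    split_ifs with h1
    · rfl
    · exact eq_false_of_lastT (by omega)
  omega

lemma tree_bound {z : Lam r → ℝ} {D : ℝ} (hD : 0 ≤ D)
    (h : ∀ l, lastT l ≠ 0 → |z l - z (clr l)| ≤ D) (l : Lam r) : |z l - z (fun _ => false)| ≤ r * D := by
  have key : ∀ k : ℕ, ∀ l : Lam r, lastT l ≤ k → |z l - z (fun _ => false)| ≤ k * D := by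
    intro k
    induction k with
    | zero =>
      intro l hl
      have : l = fun _ => false := by
        funext i; exact eq_false_of_lastT (by omega)
      rw [this]; simp
    | succ k ih =>
      intro l hl
      by_cases h0 : lastT l = 0
      · refine (ih l (by omega)).trans ?_
        push_cast; linarith
      · have h1 := h l h0
        have h2 := ih (clr l) (by have := lastT_clr h0; omega)
        have h3 := abs_add_le (z l - z (clr l)) (z (clr l) - z (fun _ => false))
        rw [sub_add_sub_cancel] at h3
        push_cast; linarith
  exact key r l (lastT_le l)

noncomputable def bb (l' l : Lam r) : ℝ := if agree (lastT l') l' l then 1 else 0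

lemma bb_diag {l' l : Lam r} (h' : lastT l' ≠ 0) (h : lastT l ≠ 0) :
    bb l' l - bb l' (clr l) = if l' = l then 1 else 0 := by
  unfold bb
  rcases lt_trichotomy (lastT l') (lastT l) with hlt | heq | hgt
  · have e : agree (lastT l') l' l ↔ agree (lastT l') l' (clr l) := by
      have := agree_clr hlt
      constructor
      · intro h i hi; rw [h i hi, this i hi]
      · intro h i hi; rw [h i hi, this i hi]
    have hne : l' ≠ l := by rintro rfl; omega
    rw [if_neg hne]
    simp only [e, sub_self]
  · have h1 : ¬ agree (lastT l') l' (clr l) := by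
      intro hc
      obtain ⟨i, hi, ht⟩ := exists_lastT h'
      have := hc i (by omega)
      rw [ht, clr, if_pos (by omega)] at this
      exact absurd this (by simp)
    rw [if_neg h1, sub_zero]
    by_cases h2 : l' = l
    · rw [if_pos h2, if_pos (by rw [h2]; exact agree_refl _)]
    · rw [if_neg h2, if_neg]
      intro hc
      exact h2 (eq_of_agree hc le_rfl heq.ge)
  · have hne : l' ≠ l := by rintro rfl; omega
    obtain ⟨i, hi, ht⟩ := exists_lastT h'
    have h1 : ¬ agree (lastT l') l' (clr l) := by
      intro hc
      have := hc i (by omega)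
      rw [ht, eq_false_of_lastT (l := clr l) (i := i) (by have := lastT_clr h; omega)] at this
      exact absurd this (by simp)
    have h2 : ¬ agree (lastT l') l' l := by
      intro hc
      have := hc i (by omega)
      rw [ht, eq_false_of_lastT (l := l) (i := i) (by omega)] at this
      exact absurd this (by simp)
    rw [if_neg h1, if_neg h2, if_neg hne, sub_self]

lemma lastT_snoc_true (l : Lam r) : lastT (Fin.snoc (α := fun _ => Bool) l true : Lam (r+1)) = r + 1 := by
  apply le_antisymm (lastT_le _)
  have := lt_lastT (l := (Fin.snoc (α := fun _ => Bool) l true : Lam (r+1))) (i := Fin.last r) (by simp)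
  simpa using this

lemma lastT_snoc_false (l : Lam r) : lastT (Fin.snoc (α := fun _ => Bool) l false : Lam (r+1)) = lastT l := by
  apply eq_of_forall_ge_iff
  intro k
  rw [lastT_le_iff, lastT_le_iff]
  constructor
  · intro h i hi
    have := h i.castSucc (by simpa using hi)
    simpa using this
  · intro h i
    refine Fin.lastCases ?_ (fun i => ?_) i
    · intro _; simp
    · intro hi; simpa using h i (by simpa using hi)

lemma sum_lastT (f : ℕ → ℝ) (r : ℕ) : ∑ l : Lam r, f (lastT l) = f 0 + ∑ k ∈ Finset.range r, 2^k * f (k+1) := by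
  induction r with
  | zero =>
    have : (Finset.univ : Finset (Lam 0)) = {fun _ => false} := by
      ext l; simp only [Finset.mem_univ, Finset.mem_singleton, true_iff]; funext i; exact i.elim0
    rw [this, Finset.sum_singleton]
    have : lastT (fun _ : Fin 0 => false) = 0 := by have := lastT_le (fun _ : Fin 0 => false); omega
    rw [this]; simp
  | succ r ih =>
    have e := Equiv.sum_comp (Fin.snocEquiv (fun _ : Fin (r+1) => Bool)) (fun l : Lam (r+1) => f (lastT l))
    unfold Lam
    rw [← e, Fintype.sum_prod_type, Fintype.sum_bool]
    have e1 : ∀ l : Lam r, f (lastT (Fin.snocEquiv (fun _ : Fin (r+1) => Bool) (true, l))) = f (r+1) := by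
      intro l; congr 1; exact lastT_snoc_true l
    have e2 : ∀ l : Lam r, f (lastT (Fin.snocEquiv (fun _ : Fin (r+1) => Bool) (false, l))) = f (lastT l) := by
      intro l; congr 1; exact lastT_snoc_false l
    have s1 : ∑ l : Lam r, f (lastT (Fin.snocEquiv (fun _ : Fin (r+1) => Bool) (true, l))) = 2^r * f (r+1) := by
      rw [Finset.sum_congr rfl (fun l _ => e1 l)]
      simp [Lam]
    have s2 : ∑ l : Lam r, f (lastT (Fin.snocEquiv (fun _ : Fin (r+1) => Bool) (false, l)))
        = f 0 + ∑ k ∈ Finset.range r, 2^k * f (k+1) := by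
      rw [Finset.sum_congr rfl (fun l _ => e2 l), ih]
    rw [Finset.sum_range_succ]
    exact (congrArg₂ (· + ·) s1 s2).trans (by ring)

/-- nonzero leaves -/
abbrev NZ (r : ℕ) := {l : Lam r // lastT l ≠ 0}

lemma sum_NZ (f : ℕ → ℝ) (r : ℕ) : ∑ l : NZ r, f (lastT l.1) = ∑ k ∈ Finset.range r, 2^k * f (k+1) := by
  have h := sum_lastT (fun k => if k = 0 then 0 else f k) r
  rw [if_pos rfl, zero_add] at h
  have e : ∑ l : NZ r, f (lastT l.1) = ∑ l : Lam r, (if lastT l = 0 then 0 else f (lastT l)) := by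
    rw [← Finset.sum_filter_add_sum_filter_not Finset.univ (fun l : Lam r => lastT l ≠ 0)]
    rw [Finset.sum_subtype (p := fun l : Lam r => lastT l ≠ 0) (F := inferInstance) _ (by simp)]
    rw [Finset.sum_eq_zero (s := Finset.univ.filter fun l : Lam r => ¬ lastT l ≠ 0)]
    · rw [add_zero]
      refine Finset.sum_congr rfl fun l _ => ?_
      rw [if_neg l.2]
    · intro l hl
      rw [if_pos]
      simpa using hl
  rw [e, h]
  refine Finset.sum_congr rfl fun k _ => ?_
  rw [if_neg (by omega)]

/-! ### cells -/
variable {μ : (j : ℕ) → Om j → ℝ}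

noncomputable def supp (r : ℕ) : List (ℝ × ℕ) → Finset (Lam r → ℝ)
  | [] => {0}
  | (l, j) :: a => Finset.univ.biUnion fun y : Om j => (supp r a).image fun d => d + l • upl r j (bv y)

lemma lawX_mono_supp (hμ : ∀ j, IsLaw (μ j)) (a : List (ℝ × ℕ)) {g g' : (Lam r → ℝ) → ℝ}
    (h : ∀ d ∈ supp r a, g d ≤ g' d) : lawX μ r a g ≤ lawX μ r a g' := by
  induction a generalizing g g' with
  | nil => exact h 0 (by simp [supp])
  | cons x a ih =>
    obtain ⟨l, j⟩ := x
    rw [lawX_cons, lawX_cons]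
    refine Finset.sum_le_sum fun y _ => mul_le_mul_of_nonneg_left (ih fun d hd => h _ ?_) ((hμ j).pos y).le
    rw [supp, Finset.mem_biUnion]
    exact ⟨y, Finset.mem_univ _, Finset.mem_image_of_mem _ hd⟩

noncomputable def cell (d : Lam r → ℝ) : NZ r → ℤ := fun l => ⌊(d l.1 - d (clr l.1)) / 4⌋

lemma near_of_cell {d d' : Lam r → ℝ} (h : cell d = cell d') : near (r * 4) (VV r 0) (d' - d) := by
  refine ⟨fun _ => (d' - d) (fun _ => false), ?_, ?_⟩
  · intro l l' _; rfl
  · refine fun l => tree_bound (by norm_num) (fun l hl => ?_) l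
    have h1 : ⌊(d l - d (clr l)) / 4⌋ = ⌊(d' l - d' (clr l)) / 4⌋ := congrFun h ⟨l, hl⟩
    have h2 := Int.abs_sub_lt_one_of_floor_eq_floor h1
    rw [abs_lt] at h2
    simp only [Pi.sub_apply]
    rw [abs_le]; constructor <;> linarith

theorem cells_card (hμ : ∀ j, IsLaw (μ j)) {s J : ℝ} (hs : 0 < s) (hJ : 0 < J) (a : List (ℝ × ℕ))
    (h : JJ μ (r * 4) s a (VV r 0) ≤ J) :
    1 / (2 * (2 * J) ^ (1/s)) ≤ (((supp r a).image cell).card : ℝ) := by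
  set t := (2 * J) ^ (1/s) with ht
  have ht0 : 0 < t := Real.rpow_pos_of_pos (by linarith) _
  set pc : (NZ r → ℤ) → ℝ := fun c => lawX μ r a (fun d => if cell d = c then 1 else 0) with hpc
  have hp0 : ∀ c, 0 ≤ pc c := fun c => lawX_nonneg hμ _ fun d => by split_ifs <;> norm_num
  have h1 : ∀ d, pc (cell d) ≤ conc μ (r*4) a (VV r 0) d := by
    intro d
    refine lawX_mono hμ _ fun d' => ?_
    unfold indn
    by_cases hc : cell d' = cell d
    · rw [if_pos hc, if_pos (near_of_cell hc.symm)]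
    · rw [if_neg hc]; split_ifs <;> norm_num
  have h2 : ∀ d, (1:ℝ) ≤ conc μ (r*4) a (VV r 0) d ^ s / (2*J) + (if pc (cell d) ≤ t then 1 else 0) := by
    intro d
    have h3 : 0 ≤ conc μ (r*4) a (VV r 0) d ^ s := Real.rpow_nonneg (conc_nonneg hμ) _
    split_ifs with hc
    · have : 0 ≤ conc μ (r*4) a (VV r 0) d ^ s / (2*J) := by positivity
      linarith
    · push Not at hc
      have h4 : t ^ s ≤ conc μ (r*4) a (VV r 0) d ^ s :=
        Real.rpow_le_rpow ht0.le (hc.le.trans (h1 d)) hs.le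
      rw [ht, ← Real.rpow_mul (by linarith), one_div, inv_mul_cancel₀ hs.ne', Real.rpow_one] at h4
      rw [add_zero, le_div_iff₀ (by linarith)]; linarith
  have h3 := lawX_mono (r := r) hμ a h2
  rw [lawX_const hμ, lawX_add] at h3
  have h4 : lawX μ r a (fun d => conc μ (r*4) a (VV r 0) d ^ s / (2*J)) ≤ 1/2 := by
    have e : (fun d => conc μ (r*4) a (VV r 0) d ^ s / (2*J)) =
        fun d => (2*J)⁻¹ * conc μ (r*4) a (VV r 0) d ^ s := by funext d; rw [div_eq_inv_mul]
    rw [e, lawX_smul]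
    have : lawX μ r a (fun d => conc μ (r*4) a (VV r 0) d ^ s) ≤ J := h
    rw [inv_mul_le_iff₀ (by linarith)]; linarith
  have h5 : lawX μ r a (fun d => if pc (cell d) ≤ t then (1:ℝ) else 0) ≤
      lawX μ r a (fun d => ∑ c ∈ (supp r a).image cell, (if pc c ≤ t then 1 else 0) * (if cell d = c then 1 else 0)) := by
    refine lawX_mono_supp hμ a fun d hd => ?_
    rw [Finset.sum_eq_single (cell d)]
    · simp
    · intro c _ hc; rw [if_neg (Ne.symm hc), mul_zero]
    · intro hc; exact absurd (Finset.mem_image_of_mem _ hd) hc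
  rw [lawX_sum] at h5
  have h6 : ∑ c ∈ (supp r a).image cell, lawX μ r a (fun d => (if pc c ≤ t then (1:ℝ) else 0) * (if cell d = c then 1 else 0))
      ≤ ∑ c ∈ (supp r a).image (cell (r := r)), t := by
    refine Finset.sum_le_sum fun c _ => ?_
    rw [lawX_smul]
    split_ifs with hc
    · rw [one_mul]; exact hc
    · rw [zero_mul]; exact ht0.le
  rw [Finset.sum_const, nsmul_eq_mul] at h6
  rw [div_le_iff₀ (by linarith)]
  linarith

/-! ### structure of the support -/
lemma supp_sub (val : ℕ → ℝ) {Ls : List (Finset ℕ × ℕ)} (hd : DisjL Ls) (S : Finset ℕ) {d : Lam r → ℝ}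
    (h : d ∈ supp r (vmap val (actv Ls S))) :
    ∃ Dl : Lam r → Finset ℕ, (∀ l, Dl l ⊆ S ∩ unL Ls) ∧ ∀ l, d l = ∑ p ∈ Dl l, val p := by
  induction Ls generalizing d with
  | nil =>
    refine ⟨fun _ => ∅, fun _ => by simp, fun l => ?_⟩
    have : d = 0 := by simpa [actv, vmap, supp] using h
    rw [this]; simp
  | cons x Ls ih =>
    obtain ⟨P, j⟩ := x
    obtain ⟨h1, h2⟩ := hd
    rw [actv_cons] at h
    split_ifs at h with hp
    · have hsp := hp.choose_spec
      set p := hp.choose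
      simp only [vmap, List.map_cons, supp, Finset.mem_biUnion, Finset.mem_image] at h
      obtain ⟨y, _, d', hd', rfl⟩ := h
      obtain ⟨Dl, hD1, hD2⟩ := ih h2 hd'
      have hpm : p ∈ S ∩ P := by rw [hsp]; exact Finset.mem_singleton_self _
      have hpn : ∀ l, p ∉ Dl l := by
        intro l hl
        exact Finset.disjoint_left.1 h1 (Finset.mem_inter.1 hpm).2 (Finset.mem_inter.1 (hD1 l hl)).2
      refine ⟨fun l => if y (tr j l) then insert p (Dl l) else Dl l, fun l => ?_, fun l => ?_⟩
      · have h3 : Dl l ⊆ S ∩ (P ∪ unL Ls) := (hD1 l).trans (Finset.inter_subset_inter_left Finset.subset_union_right)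
        dsimp only
        split_ifs
        · exact Finset.insert_subset (Finset.inter_subset_inter_left Finset.subset_union_left hpm) h3
        · exact h3
      · rw [Pi.add_apply, Pi.smul_apply, upl_apply, bv, hD2]
        dsimp only
        split_ifs
        · rw [Finset.sum_insert (hpn l)]; simp [add_comm]
        · simp
    · obtain ⟨Dl, hD1, hD2⟩ := ih h2 h
      exact ⟨Dl, fun l => (hD1 l).trans (Finset.inter_subset_inter_left Finset.subset_union_right), hD2⟩

lemma supp_diff (val : ℕ → ℝ) (f : ℕ → Finset ℕ × ℕ) (v : ℕ → ℝ) (hv0 : ∀ i, 0 ≤ v i)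
    (hv : ∀ i, ∀ p ∈ (f i).1, 0 ≤ val p ∧ val p ≤ v i) (nb k : ℕ) (S : Finset ℕ) {d : Lam r → ℝ}
    (h : d ∈ supp r (vmap val (actv (mkL f nb k) S))) {m : ℕ} {l l' : Lam r} (hl : agree m l l') :
    |d l - d l'| ≤ ∑ i ∈ Finset.range k, if m < (f (nb+i+1)).2 then v (nb+i+1) else 0 := by
  induction k generalizing d with
  | zero =>
    have : d = 0 := by simpa [actv, vmap, supp, mkL] using h
    rw [this]; simp
  | succ k ih =>
    rw [Finset.sum_range_succ]
    have hnn : 0 ≤ if m < (f (nb+k+1)).2 then v (nb+k+1) else 0 := by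
      split_ifs
      · exact hv0 _
      · exact le_rfl
    have e : mkL f nb (k+1) = ((f (nb+k+1)).1, (f (nb+k+1)).2) :: mkL f nb k := rfl
    rw [e, actv_cons] at h
    split_ifs at h with hp
    · have hsp := hp.choose_spec
      set p := hp.choose
      simp only [vmap, List.map_cons, supp, Finset.mem_biUnion, Finset.mem_image] at h
      obtain ⟨y, _, d', hd', rfl⟩ := h
      have h1 := ih hd'
      have hpm : p ∈ S ∩ (f (nb+k+1)).1 := by rw [hsp]; exact Finset.mem_singleton_self _
      obtain ⟨hv1, hv2⟩ := hv _ p (Finset.mem_inter.1 hpm).2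
      have h2 : |val p * bv y (tr (f (nb+k+1)).2 l) - val p * bv y (tr (f (nb+k+1)).2 l')| ≤ if m < (f (nb+k+1)).2 then v (nb+k+1) else 0 := by
        split_ifs with hm
        · unfold bv
          split_ifs <;> simp <;> first | exact hv0 _ | (rw [abs_of_nonneg hv1]; exact hv2)
        · have : tr (f (nb+k+1)).2 l = tr (f (nb+k+1)).2 l' := by
            funext i
            exact tr_agree hl i (by have := i.2; omega)
          rw [this]; simp
      have e2 : (d' + val p • upl r (f (nb+k+1)).2 (bv y)) l - (d' + val p • upl r (f (nb+k+1)).2 (bv y)) l' =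
          (d' l - d' l') + (val p * bv y (tr (f (nb+k+1)).2 l) - val p * bv y (tr (f (nb+k+1)).2 l')) := by
        simp only [Pi.add_apply, Pi.smul_apply, upl_apply, smul_eq_mul]; ring
      rw [e2]
      exact (abs_add_le _ _).trans (add_le_add h1 h2)
    · exact (ih h).trans (by linarith)

end EH

namespace EH

lemma hit_inner {ι : Type*} [Fintype ι] (H : ι → Finset ℕ)
    (hHH : ∀ i j, i ≠ j → Disjoint (H i) (H j)) (kk : ι → ℕ → ℤ) (Cells : Finset (ι → ℤ))
    (f : Finset ℕ → ℝ) (hf : ∀ S, 0 ≤ f S)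
    (hg : ∀ S, ∀ p : ι → ℕ, (∀ i, S ∩ H i = {p i}) → (fun i => kk i (p i)) ∈ Cells → 1 ≤ f S)
    (h : ι → ℝ) (hh0 : ∀ i, 0 ≤ h i)
    (hH : ∀ c ∈ Cells, ∀ i, h i ≤ ∑ p ∈ (H i).filter (fun p => kk i p = c i), w1 (H i) p) :
    (Cells.card : ℝ) * ∏ i, h i ≤ EE (Finset.univ.biUnion H) f := by
  refine le_trans ?_ (EE_tuple H hHH f hf (fun p => (fun i => kk i (p i)) ∈ Cells) hg)
  have h1 : ∀ p ∈ Fintype.piFinset H, (if (fun i => kk i (p i)) ∈ Cells then ∏ i, w1 (H i) (p i) else 0) =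
      ∑ c ∈ Cells, if (fun i => kk i (p i)) = c then ∏ i, w1 (H i) (p i) else 0 := by
    intro p _
    rw [Finset.sum_ite_eq]
  refine le_trans ?_ (le_of_eq (Finset.sum_congr rfl fun p hp => (h1 p hp).symm.trans (by congr)))
  rw [Finset.sum_comm, ← nsmul_eq_mul, ← Finset.sum_const]
  refine Finset.sum_le_sum fun c hc => ?_
  rw [← Finset.sum_filter]
  have e : (Fintype.piFinset H).filter (fun p => (fun i => kk i (p i)) = c) =
      Fintype.piFinset (fun i => (H i).filter (fun p => kk i p = c i)) := by
    ext p
    simp only [Finset.mem_filter, Fintype.mem_piFinset, funext_iff]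
    exact ⟨fun h i => ⟨h.1 i, h.2 i⟩, fun h => ⟨fun i => (h i).1, fun i => (h i).2⟩⟩
  rw [e, ← Finset.prod_univ_sum]
  exact Finset.prod_le_prod (fun i _ => hh0 i) fun i _ => hH c hc i

lemma hit_abs {ι : Type*} [Fintype ι] (B H : ι → Finset ℕ) (hBB : ∀ i j, i ≠ j → Disjoint (B i) (B j))
    (hHH : ∀ i j, i ≠ j → Disjoint (H i) (H j)) (hBH : ∀ i j, Disjoint (B i) (H j))
    (val : ℕ → ℝ) (Cells : Finset (ι → ℤ)) (f : Finset ℕ → ℝ) (hf : ∀ S, 0 ≤ f S)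
    (hg : ∀ S, ∀ p' p : ι → ℕ, (∀ i, S ∩ B i = {p' i}) → (∀ i, S ∩ H i = {p i}) →
      (fun i => ⌊(val (p' i) - val (p i)) / 4⌋) ∈ Cells → 1 ≤ f S)
    {cB : ℝ} (hc0 : 0 ≤ cB) (hB : ∀ i, cB ≤ ∑ p ∈ B i, w1 (B i) p)
    (h : ι → ℝ) (hh0 : ∀ i, 0 ≤ h i)
    (hH : ∀ c ∈ Cells, ∀ i, ∀ p' ∈ B i,
      h i ≤ ∑ p ∈ (H i).filter (fun p => ⌊(val p' - val p) / 4⌋ = c i), w1 (H i) p) :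
    cB ^ (Fintype.card ι) * ((Cells.card : ℝ) * ∏ i, h i) ≤
      EE (Finset.univ.biUnion B ∪ Finset.univ.biUnion H) f := by
  set UB := Finset.univ.biUnion B with hUB
  set UH := Finset.univ.biUnion H with hUH
  set K := (Cells.card : ℝ) * ∏ i, h i with hK
  have hK0 : 0 ≤ K := mul_nonneg (Nat.cast_nonneg _) (Finset.prod_nonneg fun i _ => hh0 i)
  rcases hK0.eq_or_lt with hKz | hKp
  · rw [← hKz, mul_zero]; exact EE_nonneg fun S _ => hf S
  have hd : Disjoint UB UH := by
    rw [hUB, hUH, Finset.disjoint_biUnion_left]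
    intro i _
    rw [Finset.disjoint_biUnion_right]
    exact fun j _ => hBH i j
  rw [EE_union hd]
  set F : Finset ℕ → Finset ℕ → ℝ := fun S T => f ((S ∩ UB) ∪ (T ∩ UH)) with hF
  have e1 : EE UB (fun S => EE UH (fun T => f (S ∪ T))) = EE UB (fun S => EE UH (F S)) := by
    refine EE_congr fun S hS => EE_congr fun T hT => ?_
    rw [hF]; dsimp only
    rw [Finset.inter_eq_left.2 hS, Finset.inter_eq_left.2 hT]
  rw [e1]
  have hBs : ∀ i, B i ⊆ UB := fun i => Finset.subset_biUnion_of_mem B (Finset.mem_univ i)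
  have hHs : ∀ i, H i ⊆ UH := fun i => Finset.subset_biUnion_of_mem H (Finset.mem_univ i)
  have eB : ∀ S T i, ((S ∩ UB) ∪ (T ∩ UH)) ∩ B i = S ∩ B i := by
    intro S T i; ext x
    simp only [Finset.mem_inter, Finset.mem_union]
    constructor
    · rintro ⟨h1 | h1, h2⟩
      · exact ⟨h1.1, h2⟩
      · exact absurd h1.2 (Finset.disjoint_left.1 hd (hBs i h2))
    · rintro ⟨h1, h2⟩
      exact ⟨Or.inl ⟨h1, hBs i h2⟩, h2⟩
  have eH : ∀ S T i, ((S ∩ UB) ∪ (T ∩ UH)) ∩ H i = T ∩ H i := by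
    intro S T i; ext x
    simp only [Finset.mem_inter, Finset.mem_union]
    constructor
    · rintro ⟨h1 | h1, h2⟩
      · exact absurd (hHs i h2) (Finset.disjoint_left.1 hd h1.2)
      · exact ⟨h1.1, h2⟩
    · rintro ⟨h1, h2⟩
      exact ⟨Or.inr ⟨h1, hHs i h2⟩, h2⟩
  have h1 := EE_tuple B hBB (fun S => K⁻¹ * EE UH (F S))
    (fun S => mul_nonneg (inv_nonneg.2 hK0) (EE_nonneg fun T _ => hf _)) (fun _ => True) (by
      intro S p' hp' _
      rw [← mul_inv_cancel₀ hKp.ne', mul_comm]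
      refine mul_le_mul_of_nonneg_left ?_ (inv_nonneg.2 hK0)
      refine hit_inner H hHH (fun i p => ⌊(val (p' i) - val p) / 4⌋) Cells (F S) (fun T => hf _) ?_ h hh0 ?_
      · intro T p hp hc
        exact hg _ p' p (fun i => by rw [eB]; exact hp' i) (fun i => by rw [eH]; exact hp i) hc
      · intro c hc i
        refine hH c hc i (p' i) ?_
        have : p' i ∈ S ∩ B i := by rw [hp' i]; exact Finset.mem_singleton_self _
        exact (Finset.mem_inter.1 this).2)
  simp only [if_true] at h1
  rw [EE_smul, ← Finset.prod_univ_sum] at h1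
  have h2 : cB ^ (Fintype.card ι) ≤ ∏ i, ∑ p ∈ B i, w1 (B i) p := by
    rw [← Finset.card_univ, ← Finset.prod_const]
    exact Finset.prod_le_prod (fun i _ => hc0) fun i _ => hB i
  have h3 := h2.trans h1
  rw [inv_mul_eq_div, le_div_iff₀ hKp] at h3
  exact h3

/-- number theoretic input for hits -/
lemma hit_nt {x y : ℝ} (hx : 0 ≤ x) (hxy : x < y) (hy : y ≤ 1) : ∃ L0 : ℝ, 0 < L0 ∧
    ∀ L R Q : ℝ, L0 ≤ L → 1 ≤ R → 4 ≤ Q →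
    ((y-x)/720 ≤ ∑ p ∈ Cls L x y (9*Q*(L*R)) (10*Q*(L*R)), w1 (Cls L x y (9*Q*(L*R)) (10*Q*(L*R))) p) ∧
    ∀ (t : ℝ) (c : ℤ), 9*Q ≤ t → t ≤ 10*Q → -Q ≤ 4*c+4 → 4*c ≤ Q →
      (y-x)/240/Q ≤ ∑ p ∈ (Cls L x y (7*Q*(L*R)) (12*Q*(L*R))).filter
        (fun p : ℕ => ⌊(t - Real.log p / (L*R))/4⌋ = c), w1 (Cls L x y (7*Q*(L*R)) (12*Q*(L*R))) p := by
  obtain ⟨L0, hL0, h⟩ := box_mass hx hxy hy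
  obtain ⟨C, hC, hm⟩ := mass
  refine ⟨max L0 C, lt_max_of_lt_left hL0, fun L R Q hL hR hQ => ?_⟩
  have hL1 : L0 ≤ L := (le_max_left _ _).trans hL
  have hL2 : C ≤ L := (le_max_right _ _).trans hL
  have hLp : 0 < L := by linarith
  have hLR : L ≤ L * R := by nlinarith
  have hLR0 : 0 < L * R := by linarith
  have hQL : 4 * C ≤ Q * (L*R) := by nlinarith
  have hQL0 : 0 < Q * (L*R) := by positivity
  have hB : ∀ a b : ℝ, 7 ≤ a → a ≤ b → (b - a + 1/4)/a ≤ 3/4 → ∀ p,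
      ap p / 4 ≤ w1 (Cls L x y (a*Q*(L*R)) (b*Q*(L*R))) p := by
    intro a b ha hab hr p
    have h1 : ∑ q ∈ Cls L x y (a*Q*(L*R)) (b*Q*(L*R)), ap q ≤ 3/4 := by
      refine (Finset.sum_le_sum_of_subset_of_nonneg (Cls_sub _ _ _ _ _) fun p _ _ => (ap_pos p).le).trans ?_
      refine ((hm (a*Q*(L*R)) (b*Q*(L*R)) (by positivity) ?_).2).trans ?_
      · rw [mul_assoc, mul_assoc]; exact mul_le_mul_of_nonneg_right hab hQL0.le
      · refine le_trans ?_ hr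
        rw [div_le_div_iff₀ (by positivity) (by linarith)]
        nlinarith
    have h2 := w1_ge (Cls L x y (a*Q*(L*R)) (b*Q*(L*R))) p
    have h3 := (ap_pos p).le
    nlinarith
  constructor
  · have h1 := h L (R*(Q/4)) 36 hL1 (by nlinarith) (by norm_num)
    have e1 : (36:ℝ) * (L * (R*(Q/4))) = 9*Q*(L*R) := by ring
    have e2 : ((36:ℝ)+4) * (L * (R*(Q/4))) = 10*Q*(L*R) := by ring
    rw [e1, e2] at h1
    calc (y-x)/720 = ((y-x)/5/36)/4 := by ring
      _ ≤ (∑ p ∈ Cls L x y (9*Q*(L*R)) (10*Q*(L*R)), ap p)/4 := by linarith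
      _ = ∑ p ∈ Cls L x y (9*Q*(L*R)) (10*Q*(L*R)), ap p/4 := by rw [Finset.sum_div]
      _ ≤ _ := Finset.sum_le_sum fun p _ => hB 9 10 (by norm_num) (by norm_num) (by norm_num) p
  · intro t c ht1 ht2 hc1 hc2
    set Y := t - 4*c - 4 with hY
    have hY1 : 7*Q ≤ Y := by linarith
    have hY2 : Y ≤ 11*Q := by linarith
    have h1 := h L R Y hL1 hR (by linarith)
    have hsub : Cls L x y (Y*(L*R)) ((Y+4)*(L*R)) ⊆ (Cls L x y (7*Q*(L*R)) (12*Q*(L*R))).filter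
        (fun p : ℕ => ⌊(t - Real.log p / (L*R))/4⌋ = c) := by
      intro p hp
      rw [mem_Cls] at hp
      obtain ⟨⟨hp1, hp2, hp3⟩, hp4⟩ := hp
      rw [Finset.mem_filter, mem_Cls]
      refine ⟨⟨⟨hp1, lt_of_le_of_lt ?_ hp2, hp3.trans ?_⟩, hp4⟩, ?_⟩
      · exact mul_le_mul_of_nonneg_right hY1 hLR0.le
      · exact mul_le_mul_of_nonneg_right (by linarith) hLR0.le
      · rw [← lt_div_iff₀ hLR0] at hp2
        rw [← div_le_iff₀ hLR0] at hp3
        rw [Int.floor_eq_iff]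
        constructor <;> linarith
    have hQ0 : 0 < Q := by linarith
    calc (y-x)/240/Q ≤ ((y-x)/5/Y)/4 := by
          have e : (y-x)/5/Y/4 = (y-x)/20/Y := by ring
          have e2 : (y-x)/240/Q = (y-x)/20/(12*Q) := by field_simp; ring
          rw [e, e2]
          apply div_le_div_of_nonneg_left <;> linarith
      _ ≤ (∑ p ∈ Cls L x y (Y*(L*R)) ((Y+4)*(L*R)), ap p)/4 := by linarith
      _ = ∑ p ∈ Cls L x y (Y*(L*R)) ((Y+4)*(L*R)), ap p/4 := by rw [Finset.sum_div]
      _ ≤ ∑ p ∈ Cls L x y (Y*(L*R)) ((Y+4)*(L*R)), w1 (Cls L x y (7*Q*(L*R)) (12*Q*(L*R))) p :=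
          Finset.sum_le_sum fun p _ => hB 7 12 (by norm_num) (by norm_num) (by norm_num) p
      _ ≤ _ := Finset.sum_le_sum_of_subset_of_nonneg hsub fun p _ _ => w1_nonneg _ _

/-- success: 2^r sub-products close together -/
def Succ (r : ℕ) (val : ℕ → ℝ) (X : ℝ) (S : Finset ℕ) : Prop :=
  ∃ D : Lam r → Finset ℕ, Function.Injective D ∧ (∀ l, D l ⊆ S) ∧
    ∃ z : ℝ, ∀ l, |∑ p ∈ D l, val p - z| ≤ X

lemma Succ.mono {r : ℕ} {val : ℕ → ℝ} {X : ℝ} {S T : Finset ℕ} (h : Succ r val X S) (hST : S ⊆ T) :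
    Succ r val X T := by
  obtain ⟨D, h1, h2, h3⟩ := h
  exact ⟨D, h1, fun l => (h2 l).trans hST, h3⟩

lemma Succ.scale {r : ℕ} {val val' : ℕ → ℝ} {X X' c : ℝ} {S : Finset ℕ} (h : Succ r val X S) (hc : 0 ≤ c)
    (hv : ∀ p, val' p = c * val p) (hX : c * X ≤ X') :
    Succ r val' X' S := by
  obtain ⟨D, h1, h2, z, h3⟩ := h
  refine ⟨D, h1, h2, c * z, fun l => ?_⟩
  have : ∑ p ∈ D l, val' p - c * z = c * (∑ p ∈ D l, val p - z) := by
    rw [mul_sub, Finset.mul_sum]; congr 1; exact Finset.sum_congr rfl fun p _ => hv p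
  rw [this, abs_mul, abs_of_nonneg hc]
  exact (mul_le_mul_of_nonneg_left (h3 l) hc).trans hX

lemma assemble {r : ℕ} (val : ℕ → ℝ) (B H : NZ r → Finset ℕ) (M : Finset ℕ)
    (hBB : ∀ i j, i ≠ j → Disjoint (B i) (B j))
    (hHH : ∀ i j, i ≠ j → Disjoint (H i) (H j)) (hBH : ∀ i j, Disjoint (B i) (H j))
    (hMB : ∀ i, Disjoint M (B i)) (hMH : ∀ i, Disjoint M (H i))
    (d : Lam r → ℝ) (Dl : Lam r → Finset ℕ) (S : Finset ℕ) (hDl : ∀ l, Dl l ⊆ S ∩ M)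
    (hd : ∀ l, d l = ∑ p ∈ Dl l, val p) (p' p : NZ r → ℕ)
    (hp' : ∀ i, p' i ∈ S ∩ B i) (hp : ∀ i, p i ∈ S ∩ H i)
    (hc : (fun i => ⌊(val (p' i) - val (p i)) / 4⌋) = cell d) : Succ r val (r * 4) S := by
  have hpH : ∀ i, p i ∈ H i := fun i => (Finset.mem_inter.1 (hp i)).2
  have hpB : ∀ i, p' i ∈ B i := fun i => (Finset.mem_inter.1 (hp' i)).2
  have ip : Function.Injective p := by
    intro i j hij
    by_contra hne
    exact Finset.disjoint_left.1 (hHH i j hne) (hpH i) (by rw [hij]; exact hpH j)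
  have ip' : Function.Injective p' := by
    intro i j hij
    by_contra hne
    exact Finset.disjoint_left.1 (hBB i j hne) (hpB i) (by rw [hij]; exact hpB j)
  set X : Lam r → Finset ℕ := fun l => (Finset.univ.filter (fun i : NZ r => agree (lastT i.1) i.1 l)).image p with hX
  set Y : Lam r → Finset ℕ := fun l => (Finset.univ.filter (fun i : NZ r => ¬ agree (lastT i.1) i.1 l)).image p' with hY
  have dXY : ∀ l, Disjoint (X l) (Y l) := by
    intro l
    rw [Finset.disjoint_left]
    intro q hq hq'
    obtain ⟨i, _, rfl⟩ := Finset.mem_image.1 hq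
    obtain ⟨j, _, hj⟩ := Finset.mem_image.1 hq'
    exact Finset.disjoint_left.1 (hBH j i) (hpB j) (by rw [hj]; exact hpH i)
  have dD : ∀ l, Disjoint (Dl l) (X l ∪ Y l) := by
    intro l
    rw [Finset.disjoint_left]
    intro q hq hq'
    have hM : q ∈ M := (Finset.mem_inter.1 (hDl l hq)).2
    rcases Finset.mem_union.1 hq' with h | h
    · obtain ⟨i, _, rfl⟩ := Finset.mem_image.1 h
      exact Finset.disjoint_left.1 (hMH i) hM (hpH i)
    · obtain ⟨i, _, rfl⟩ := Finset.mem_image.1 h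
      exact Finset.disjoint_left.1 (hMB i) hM (hpB i)
  have mem_iff : ∀ (i : NZ r) (l : Lam r), p i ∈ Dl l ∪ (X l ∪ Y l) ↔ agree (lastT i.1) i.1 l := by
    intro i l
    constructor
    · intro h
      rcases Finset.mem_union.1 h with h | h
      · exact absurd (hpH i) (Finset.disjoint_left.1 (hMH i) (Finset.mem_inter.1 (hDl l h)).2)
      rcases Finset.mem_union.1 h with h | h
      · obtain ⟨j, hj, hij⟩ := Finset.mem_image.1 h
        rw [← ip hij]; exact (Finset.mem_filter.1 hj).2
      · obtain ⟨j, hj, hij⟩ := Finset.mem_image.1 h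
        exact absurd (hpH i) (Finset.disjoint_left.1 (hBH j i) (by rw [← hij]; exact hpB j))
    · intro h
      refine Finset.mem_union_right _ (Finset.mem_union_left _ (Finset.mem_image_of_mem _ ?_))
      exact Finset.mem_filter.2 ⟨Finset.mem_univ _, h⟩
  have hsum : ∀ l, ∑ q ∈ Dl l ∪ (X l ∪ Y l), val q =
      d l + ∑ i : NZ r, (val (p' i) + (val (p i) - val (p' i)) * bb i.1 l) := by
    intro l
    rw [Finset.sum_union (dD l), Finset.sum_union (dXY l), ← hd, hX, hY]
    dsimp only
    rw [Finset.sum_image ip.injOn, Finset.sum_image ip'.injOn, Finset.sum_filter, Finset.sum_filter,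
      ← Finset.sum_add_distrib]
    congr 1
    refine Finset.sum_congr rfl fun i _ => ?_
    unfold bb
    split_ifs <;> ring
  refine ⟨fun l => Dl l ∪ (X l ∪ Y l), ?_, ?_, _, fun l => tree_bound (z := fun l => ∑ q ∈ Dl l ∪ (X l ∪ Y l), val q) (D := 4) (by norm_num) ?_ l⟩
  · -- injective
    have key : ∀ l1 l2 : Lam r, lastT l2 ≤ lastT l1 →
        Dl l1 ∪ (X l1 ∪ Y l1) = Dl l2 ∪ (X l2 ∪ Y l2) → l1 = l2 := by
      intro l1 l2 hle he
      by_cases h0 : lastT l1 = 0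
      · refine eq_of_agree (k := 0) (fun i hi => absurd hi (by omega)) (by omega) (by omega)
      · have h1 := (mem_iff ⟨l1, h0⟩ l1).2 (agree_refl _)
        rw [he] at h1
        exact eq_of_agree ((mem_iff ⟨l1, h0⟩ l2).1 h1) le_rfl hle
    intro l1 l2 he
    rcases le_total (lastT l2) (lastT l1) with h | h
    · exact key l1 l2 h he
    · exact (key l2 l1 h he.symm).symm
  · intro l
    refine Finset.union_subset ((hDl l).trans Finset.inter_subset_left) (Finset.union_subset ?_ ?_)
    · intro q hq
      obtain ⟨i, _, rfl⟩ := Finset.mem_image.1 hq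
      exact (Finset.mem_inter.1 (hp i)).1
    · intro q hq
      obtain ⟨i, _, rfl⟩ := Finset.mem_image.1 hq
      exact (Finset.mem_inter.1 (hp' i)).1
  · intro l hl
    rw [hsum, hsum]
    have e : ∑ i : NZ r, (val (p' i) + (val (p i) - val (p' i)) * bb i.1 l) -
        ∑ i : NZ r, (val (p' i) + (val (p i) - val (p' i)) * bb i.1 (clr l)) =
        val (p ⟨l, hl⟩) - val (p' ⟨l, hl⟩) := by
      rw [← Finset.sum_sub_distrib, Finset.sum_eq_single ⟨l, hl⟩]
      · have := bb_diag hl hl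
        rw [if_pos rfl] at this
        have e : (val (p ⟨l, hl⟩) - val (p' ⟨l, hl⟩)) * (bb l l - bb l (clr l)) = val (p ⟨l, hl⟩) - val (p' ⟨l, hl⟩) := by
          rw [this, mul_one]
        linarith
      · intro i _ hi
        have := bb_diag i.2 hl
        rw [if_neg (fun h => hi (Subtype.ext h))] at this
        have e : (val (p i) - val (p' i)) * (bb i.1 l - bb i.1 (clr l)) = 0 := by rw [this, mul_zero]
        linarith
      · intro h; exact absurd (Finset.mem_univ _) h
    have h1 : ⌊(val (p' ⟨l, hl⟩) - val (p ⟨l, hl⟩)) / 4⌋ = ⌊(d l - d (clr l)) / 4⌋ := congrFun hc ⟨l, hl⟩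
    have h2 := Int.abs_sub_lt_one_of_floor_eq_floor h1
    rw [abs_lt] at h2
    rw [abs_le]
    constructor <;> linarith

end EH

namespace EH

lemma one_sub_prod_bound {m : ℕ} (hm : 0 < m) {c : ℝ} (hc0 : 0 ≤ c) (hc1 : c ≤ 1) (g : ℕ → Prop) :
    ∏ a ∈ Finset.range (2*m), (1 - c * (if g a then 1 else 0)) ≤
      (1 - c)^m + (1/(m:ℝ)) * ∑ a ∈ Finset.range (2*m), (if g a then (0:ℝ) else 1) := by
  have e1 : ∀ a, (1 - c * (if g a then (1:ℝ) else 0)) = if g a then 1 - c else 1 := by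
    intro a; split_ifs <;> ring
  have e2 : ∑ a ∈ Finset.range (2*m), (if g a then (0:ℝ) else 1) = (((Finset.range (2*m)).filter (fun a => ¬ g a)).card : ℝ) := by
    rw [Finset.card_filter]; push_cast
    refine Finset.sum_congr rfl fun a _ => ?_
    by_cases h : g a <;> simp [h]
  rw [Finset.prod_congr rfl fun a _ => e1 a, Finset.prod_ite, Finset.prod_const, Finset.prod_const_one, mul_one, e2]
  have hcard := Finset.card_filter_add_card_filter_not (s := Finset.range (2*m)) g
  rw [Finset.card_range] at hcard
  have hmr : (0:ℝ) < m := by exact_mod_cast hm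
  by_cases h : m ≤ ((Finset.range (2*m)).filter g).card
  · have h1 : (1 - c)^((Finset.range (2*m)).filter g).card ≤ (1-c)^m :=
      pow_le_pow_of_le_one (by linarith) (by linarith) h
    have : 0 ≤ (1/(m:ℝ)) * (((Finset.range (2*m)).filter (fun a => ¬ g a)).card : ℝ) := by positivity
    linarith
  · have h1 : (1 - c)^((Finset.range (2*m)).filter g).card ≤ 1 := pow_le_one₀ (by linarith) (by linarith)
    have h2 : (m:ℝ) ≤ (((Finset.range (2*m)).filter (fun a => ¬ g a)).card : ℝ) := by
      exact_mod_cast (by omega : m ≤ ((Finset.range (2*m)).filter (fun a => ¬ g a)).card)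
    have h3 : 1 ≤ (1/(m:ℝ)) * (((Finset.range (2*m)).filter (fun a => ¬ g a)).card : ℝ) := by
      rw [one_div, ← div_eq_inv_mul, le_div_iff₀ hmr]; linarith
    have : 0 ≤ (1-c)^m := pow_nonneg (by linarith) _
    linarith

lemma multi {m : ℕ} (hm : 0 < m) (M W : Finset ℕ) (U : ℕ → Finset ℕ)
    (hMU : ∀ a, Disjoint M (U a)) (hUU : ∀ a b, a ≠ b → Disjoint (U a) (U b))
    (hW : M ∪ (Finset.range (2*m)).biUnion U ⊆ W)
    (succ good : ℕ → Finset ℕ → Prop) (hs : ∀ a S T, S ⊆ T → succ a S → succ a T)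
    {c δ : ℝ} (hc0 : 0 ≤ c) (hc1 : c ≤ 1)
    (hgood : ∀ a S, good a S → c ≤ EE (U a) (fun T => if succ a (S ∪ T) then 1 else 0))
    (hbad : ∀ a < 2*m, EE M (fun S => if good a S then 0 else 1) ≤ δ) :
    EE W (fun S => if ∃ a < 2*m, succ a S then 0 else 1) ≤ (1-c)^m + 2*δ := by
  set I := Finset.range (2*m) with hI
  set Z := I.biUnion U with hZ
  have hd : Disjoint M Z := by
    rw [hZ, Finset.disjoint_biUnion_right]; exact fun a _ => hMU a
  set h : ℕ → Finset ℕ → Finset ℕ → ℝ := fun a S T => if succ a (S ∪ T) then 1 else 0 with hh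
  have hh01 : ∀ a S T, 0 ≤ 1 - h a S T := by
    intro a S T; rw [hh]; dsimp only; split_ifs <;> norm_num
  calc EE W (fun S => if ∃ a < 2*m, succ a S then 0 else 1)
      ≤ EE W (fun S => (fun S' => ∏ a ∈ I, (1 - h a (S' ∩ M) (S' ∩ U a))) (S ∩ (M ∪ Z))) := by
        refine EE_mono fun S _ => ?_
        dsimp only
        split_ifs with he
        · exact Finset.prod_nonneg fun a _ => hh01 _ _ _
        · rw [Finset.prod_eq_one]
          intro a ha
          have : ¬ succ a (S ∩ (M ∪ Z) ∩ M ∪ S ∩ (M ∪ Z) ∩ U a) := by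
            intro hc
            refine he ⟨a, Finset.mem_range.1 ha, hs a _ _ ?_ hc⟩
            exact Finset.union_subset (Finset.inter_subset_left.trans Finset.inter_subset_left)
              (Finset.inter_subset_left.trans Finset.inter_subset_left)
          rw [hh]; dsimp only; rw [if_neg this]; ring
    _ = EE (M ∪ Z) (fun S' => ∏ a ∈ I, (1 - h a (S' ∩ M) (S' ∩ U a))) := EE_marg hW (fun S' => ∏ a ∈ I, (1 - h a (S' ∩ M) (S' ∩ U a)))
    _ = EE M (fun S => ∏ a ∈ I, (1 - EE (U a) (h a S))) := by
        rw [EE_union hd]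
        refine EE_congr fun S hS => ?_
        have e1 : ∀ a, 1 - EE (U a) (h a S) = EE (U a) (fun T => 1 - h a S T) := by
          intro a
          have := EE_add (U a) (fun T => 1 - h a S T) (h a S)
          simp only [sub_add_cancel] at this
          rw [EE_const] at this; linarith
        rw [Finset.prod_congr rfl fun a _ => e1 a, ← EE_prod I U (fun a _ b _ hab => hUU a b hab)]
        refine EE_congr fun T hT => Finset.prod_congr rfl fun a ha => ?_
        have hUa : U a ⊆ Z := Finset.subset_biUnion_of_mem U ha
        have e2 : (S ∪ T) ∩ M = S := inter_union_left hd hS hT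
        have e3 : (S ∪ T) ∩ U a = T ∩ U a := by
          have : (S ∪ T) ∩ Z = T := inter_union_right hd hS hT
          rw [← Finset.inter_eq_right.2 hUa, ← Finset.inter_assoc, this, Finset.inter_eq_right.2 hUa]
        rw [e2, e3]
    _ ≤ EE M (fun S => ∏ a ∈ I, (1 - c * (if good a S then 1 else 0))) := by
        refine EE_mono fun S _ => Finset.prod_le_prod (fun a _ => ?_) fun a _ => ?_
        · have : EE (U a) (h a S) ≤ 1 := by
            rw [← EE_const (U a) 1]
            refine EE_mono fun T _ => ?_
            linarith [hh01 a S T]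
          linarith
        · have h0 : 0 ≤ EE (U a) (h a S) := EE_nonneg fun T _ => by
            rw [hh]; dsimp only; split_ifs <;> norm_num
          split_ifs with hg
          · have := hgood a S hg
            have e : EE (U a) (h a S) = EE (U a) (fun T => if succ a (S ∪ T) then 1 else 0) := rfl
            linarith
          · linarith
    _ ≤ EE M (fun S => (1-c)^m + (1/(m:ℝ)) * ∑ a ∈ I, (if good a S then (0:ℝ) else 1)) :=
        EE_mono fun S _ => one_sub_prod_bound hm hc0 hc1 (fun a => good a S)
    _ = (1-c)^m + (1/(m:ℝ)) * ∑ a ∈ I, EE M (fun S => if good a S then (0:ℝ) else 1) := by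
        rw [EE_add, EE_const, EE_smul, EE_sum]
    _ ≤ (1-c)^m + (1/(m:ℝ)) * ∑ a ∈ I, δ := by
        have hmr : (0:ℝ) < m := by exact_mod_cast hm
        have := Finset.sum_le_sum fun a (ha : a ∈ I) => hbad a (Finset.mem_range.1 ha)
        have := mul_le_mul_of_nonneg_left this (show 0 ≤ 1/(m:ℝ) by positivity)
        linarith
    _ = (1-c)^m + 2*δ := by
        have hmr : (m:ℝ) ≠ 0 := by exact_mod_cast hm.ne'
        rw [Finset.sum_const, hI, Finset.card_range, nsmul_eq_mul]; push_cast; field_simp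

/-! ### concrete attempts -/
noncomputable def vl (σ L : ℝ) (b : ℕ) (p : ℕ) : ℝ := Real.log p / (L * Real.exp (σ * b))

noncomputable def LsA (σ η L : ℝ) (n : ℕ → ℕ) (r b : ℕ) : List (Finset ℕ × ℕ) :=
  mkL (fun i => (Pm σ η L (i+b), lev n r i)) (n (r+1)) (n 1 - n (r+1))

lemma mem_unL_mkL {f : ℕ → Finset ℕ × ℕ} {nb k p : ℕ} (h : p ∈ unL (mkL f nb k)) :
    ∃ i, nb < i ∧ i ≤ nb + k ∧ p ∈ (f i).1 := by
  induction k with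
  | zero => simp [mkL, unL] at h
  | succ k ih =>
    rw [mkL, unL, Finset.mem_union] at h
    rcases h with h | h
    · exact ⟨nb+k+1, by omega, by omega, h⟩
    · obtain ⟨i, h1, h2, h3⟩ := ih h
      exact ⟨i, h1, by omega, h3⟩

lemma DisjL_mkL {f : ℕ → Finset ℕ × ℕ} (h : ∀ i j, i < j → Disjoint (f i).1 (f j).1) (nb k : ℕ) :
    DisjL (mkL f nb k) := by
  induction k with
  | zero => simp [mkL, DisjL]
  | succ k ih =>
    refine ⟨?_, ih⟩
    rw [Finset.disjoint_left]
    intro p hp hp'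
    obtain ⟨i, h1, h2, h3⟩ := mem_unL_mkL hp'
    exact Finset.disjoint_left.1 (h i (nb+k+1) (by omega)) h3 hp

lemma Pm_disj {σ η L : ℝ} (hσ : 0 < σ) (hL : 0 < L) {i j : ℕ} (h : i < j) : Disjoint (Pm σ η L i) (Pm σ η L j) := by
  refine Finset.disjoint_of_subset_left (Cls_sub _ _ _ _ _) (Finset.disjoint_of_subset_right (Cls_sub _ _ _ _ _) (Pr_disj ?_))
  refine mul_le_mul_of_nonneg_left (Real.exp_le_exp.2 (mul_le_mul_of_nonneg_left ?_ hσ.le)) hL.le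
  exact_mod_cast h

lemma LsA_disj {σ η L : ℝ} (hσ : 0 < σ) (hL : 0 < L) (n : ℕ → ℕ) (r b : ℕ) : DisjL (LsA σ η L n r b) :=
  DisjL_mkL (fun i j hij => Pm_disj hσ hL (by omega)) _ _

lemma LsOK_mkL {val : ℕ → ℝ} {w : Finset ℕ → ℕ → ℝ} {B σ q : ℝ} {r nb : ℕ} {f : ℕ → Finset ℕ × ℕ} {k : ℕ}
    (h : ∀ i, nb < i → i ≤ nb + k → SlotOK val w B σ q (f i).1 i ∧ 1 ≤ (f i).2 ∧ (f i).2 ≤ r) :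
    LsOK val w B σ q r nb (mkL f nb k) := by
  induction k with
  | zero => trivial
  | succ k ih =>
    have h1 := h (nb+k+1) (by omega) (by omega)
    have e : mkL f nb (k+1) = ((f (nb+k+1)).1, (f (nb+k+1)).2) :: mkL f nb k := rfl
    rw [e, LsOK]
    refine ⟨?_, h1.2, ih fun i hi hi' => h i hi (by omega)⟩
    rw [mkL_length]; exact h1.1

lemma geo_bound {σ A : ℝ} (hσ : 0 ≤ σ) (hA : 0 ≤ A) (h : Real.exp (2*σ) ≤ A * (Real.exp σ - 1)) (nb M k : ℕ) :
    ∑ i ∈ Finset.range k, (if nb+i+1 ≤ M then Real.exp (σ * ((nb+i+1 : ℕ) + 1)) else 0) ≤ A * Real.exp (σ * M) := by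
  have key : ∀ k : ℕ, ∑ i ∈ Finset.range k, (if nb+i+1 ≤ M then Real.exp (σ * ((nb+i+1 : ℕ) + 1)) else 0) ≤
      A * Real.exp (σ * (min (nb+k) M : ℕ)) := by
    intro k
    induction k with
    | zero => rw [Finset.sum_range_zero]; positivity
    | succ k ih =>
      rw [Finset.sum_range_succ]
      split_ifs with hc
      · rw [min_eq_left (by omega)] at ih ⊢
        have e1 : Real.exp (σ * ((nb+k+1 : ℕ) + 1)) = Real.exp (2*σ) * Real.exp (σ * (nb+k : ℕ)) := by
          rw [← Real.exp_add]; congr 1; push_cast; ring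
        have e2 : Real.exp (σ * (nb+(k+1) : ℕ)) = Real.exp σ * Real.exp (σ * (nb+k : ℕ)) := by
          rw [← Real.exp_add]; congr 1; push_cast; ring
        rw [e1, e2]
        have := mul_le_mul_of_nonneg_right h (Real.exp_pos (σ * (nb+k : ℕ))).le
        linarith
      · rw [min_eq_right (by omega)] at ih ⊢
        linarith
  refine (key k).trans (mul_le_mul_of_nonneg_left (Real.exp_le_exp.2 (mul_le_mul_of_nonneg_left ?_ hσ)) hA)
  exact_mod_cast min_le_right _ _

end EH

namespace EH

noncomputable def kx {r : ℕ} (x : NZ r × Bool) : ℕ := (Fintype.equivFin (NZ r × Bool) x).val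

noncomputable def kk (r : ℕ) : ℝ := (Fintype.card (NZ r × Bool) : ℝ)

lemma kx_lt {r : ℕ} (x : NZ r × Bool) : (kx x : ℝ) + 1 ≤ kk r := by
  have := (Fintype.equivFin (NZ r × Bool) x).isLt
  unfold kx kk
  exact_mod_cast this

lemma kx_inj {r : ℕ} {x y : NZ r × Bool} (h : kx x = kx y) : x = y :=
  (Fintype.equivFin (NZ r × Bool)).injective (Fin.ext h)

lemma kk_pos {r : ℕ} (x : NZ r × Bool) : 0 < kk r := by
  have := kx_lt x
  have : (0:ℝ) ≤ kx x := Nat.cast_nonneg _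
  linarith

/-- the reserved primes -/
noncomputable def RS (σ η A L : ℝ) (n : ℕ → ℕ) {r : ℕ} (b : ℕ) (g h : ℝ) (x : NZ r × Bool) : Finset ℕ :=
  Cls L (kx x * (η / kk r)) ((kx x + 1) * (η / kk r))
    (g * (A * Real.exp (σ * n (lastT x.1.1))) * (L * Real.exp (σ * b)))
    (h * (A * Real.exp (σ * n (lastT x.1.1))) * (L * Real.exp (σ * b)))

lemma RS_disj {σ η A L : ℝ} (hη : 0 < η) (n : ℕ → ℕ) {r : ℕ} (b b' : ℕ) (g h g' h' : ℝ) {x y : NZ r × Bool}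
    (hxy : x ≠ y) : Disjoint (RS σ η A L n b g h x) (RS σ η A L n b' g' h' y) := by
  have hk := kk_pos x
  have hne : kx x ≠ kx y := fun h => hxy (kx_inj h)
  have hp : 0 ≤ η / kk r := by positivity
  rcases lt_or_gt_of_ne hne with h1 | h1
  · refine Cls_disj (mul_le_mul_of_nonneg_right ?_ hp)
    exact_mod_cast h1
  · refine (Cls_disj (mul_le_mul_of_nonneg_right ?_ hp)).symm
    exact_mod_cast h1

lemma RS_main {σ η A L : ℝ} (hη : 0 < η) (n : ℕ → ℕ) {r : ℕ} (b i : ℕ) (g h : ℝ) (x : NZ r × Bool) :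
    Disjoint (Pm σ η L i) (RS σ η A L n b g h x) := by
  have hk := kk_pos x
  refine (Cls_disj ?_).symm
  rw [← mul_div_assoc, div_le_iff₀ hk]
  nlinarith [kx_lt x]

lemma RS_att {σ η A L : ℝ} (hA : 0 < A) (hL : 0 < L) (n : ℕ → ℕ) {r : ℕ} {b b' : ℕ}
    (hb : 2 * Real.exp (σ * b) ≤ Real.exp (σ * b')) {g h : ℝ} (hh0 : 0 ≤ g) (hgh : h ≤ 2 * g) (x : NZ r × Bool) :
    Disjoint (RS σ η A L n b g h x) (RS σ η A L n b' g h x) := by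
  refine Finset.disjoint_of_subset_left (Cls_sub _ _ _ _ _) (Finset.disjoint_of_subset_right (Cls_sub _ _ _ _ _) (Pr_disj ?_))
  set Q := A * Real.exp (σ * n (lastT x.1.1)) with hQ
  have hQ0 : 0 < Q := by positivity
  have e1 : Real.exp (σ*b) > 0 := Real.exp_pos _
  calc h * Q * (L * Real.exp (σ*b)) ≤ (2*g) * Q * (L * Real.exp (σ*b)) := by gcongr
    _ = g * Q * (L * (2*Real.exp (σ*b))) := by ring
    _ ≤ _ := by gcongr

noncomputable def UU (σ η A L : ℝ) (n : ℕ → ℕ) (r : ℕ) (b : ℕ) : Finset ℕ :=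
  (Finset.univ.biUnion fun l : NZ r => RS σ η A L n b 9 10 (l, false)) ∪
    (Finset.univ.biUnion fun l : NZ r => RS σ η A L n b 7 12 (l, true))

lemma mem_UU {σ η A L : ℝ} {n : ℕ → ℕ} {r b p : ℕ} (h : p ∈ UU σ η A L n r b) :
    ∃ x : NZ r × Bool, p ∈ RS σ η A L n b (if x.2 then 7 else 9) (if x.2 then 12 else 10) x := by
  rw [UU, Finset.mem_union, Finset.mem_biUnion, Finset.mem_biUnion] at h
  rcases h with ⟨l, _, h⟩ | ⟨l, _, h⟩
  · exact ⟨(l, false), by simpa using h⟩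
  · exact ⟨(l, true), by simpa using h⟩

lemma UU_main {σ η A L : ℝ} (hη : 0 < η) (n : ℕ → ℕ) (r b i : ℕ) : Disjoint (Pm σ η L i) (UU σ η A L n r b) := by
  rw [Finset.disjoint_left]
  intro p hp hp'
  obtain ⟨x, hx⟩ := mem_UU hp'
  exact Finset.disjoint_left.1 (RS_main hη n b i _ _ x) hp hx

lemma UU_att {σ η A L : ℝ} (hη : 0 < η) (hA : 0 < A) (hL : 0 < L) (n : ℕ → ℕ) (r : ℕ) {b b' : ℕ}
    (hb : 2 * Real.exp (σ * b) ≤ Real.exp (σ * b')) : Disjoint (UU σ η A L n r b) (UU σ η A L n r b') := by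
  rw [Finset.disjoint_left]
  intro p hp hp'
  obtain ⟨x, hx⟩ := mem_UU hp
  obtain ⟨y, hy⟩ := mem_UU hp'
  by_cases hxy : x = y
  · subst hxy
    refine Finset.disjoint_left.1 (RS_att hA hL n hb ?_ ?_ x) hx hy <;> split_ifs <;> norm_num
  · exact Finset.disjoint_left.1 (RS_disj hη n b b' _ _ _ _ hxy) hx hy

lemma attempt_arith {s σ G X a q : ℝ} (hs : 0 < s) (hG : 0 < G) (k : ℕ) (N : ℝ)
    (hN : 1/(2*(2*(G * Real.exp (-(s*σ)*X)))^(1/s)) ≤ N) (ha : 0 ≤ a) (hq : 0 ≤ q) :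
    a^k * (q^k / (2*(2*G)^(1/s))) ≤ a^k * (N * (q^k * Real.exp (-(σ*X)))) := by
  have e : (2*(G * Real.exp (-(s*σ)*X)))^(1/s) = (2*G)^(1/s) * Real.exp (-(σ*X)) := by
    rw [← mul_assoc, Real.mul_rpow (by positivity) (Real.exp_pos _).le, ← Real.exp_mul]
    congr 2; field_simp
  rw [e] at hN
  refine mul_le_mul_of_nonneg_left ?_ (by positivity)
  have hP : 0 < (2*G)^(1/s) := Real.rpow_pos_of_pos (by positivity) _
  set P := (2*G)^(1/s)
  have hE := Real.exp_pos (-(σ*X))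
  set E := Real.exp (-(σ*X))
  calc q^k / (2*P) = 1/(2*(P*E)) * (q^k * E) := by field_simp
    _ ≤ _ := mul_le_mul_of_nonneg_right hN (by positivity)

lemma attempt {μ : ∀ j, Om j → ℝ} (hμ : ∀ j, IsLaw (μ j)) {r : ℕ} {s σ η A G : ℝ} (hs : 0 < s) (hσ : 0 < σ)
    (hη : 0 < η) (hη1 : η ≤ 1) (hA4 : 4 ≤ A) (hA : Real.exp (2*σ) ≤ A * (Real.exp σ - 1)) (hG : 0 < G) :
    ∃ c L1 : ℝ, 0 < c ∧ c ≤ 1 ∧ ∀ L, 1 ≤ L → L1 ≤ L → ∀ n : ℕ → ℕ, Antitone n → ∀ (b : ℕ) (S : Finset ℕ),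
      JJ μ (r*4) s (vmap (vl σ L b) (actv (LsA σ η L n r b) S)) (VV r 0) ≤
        G * Real.exp (-(s*σ) * ∑ k ∈ Finset.range r, (n (k+1) : ℝ) * 2^k) →
      c ≤ EE (UU σ η A L n r b) (fun T => if Succ r (vl σ L b) (r*4) (S ∪ T) then 1 else 0) := by
  have hA0 : 0 < A := by linarith
  have hnt : ∀ x : NZ r × Bool, ∃ L0 : ℝ, 0 < L0 ∧
    ∀ L R Q : ℝ, L0 ≤ L → 1 ≤ R → 4 ≤ Q →
    ((((kx x + 1) * (η / kk r)) - (kx x * (η / kk r)))/720 ≤ ∑ p ∈ Cls L (kx x * (η / kk r)) ((kx x + 1) * (η / kk r)) (9*Q*(L*R)) (10*Q*(L*R)), w1 (Cls L (kx x * (η / kk r)) ((kx x + 1) * (η / kk r)) (9*Q*(L*R)) (10*Q*(L*R))) p) ∧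
    ∀ (t : ℝ) (c : ℤ), 9*Q ≤ t → t ≤ 10*Q → -Q ≤ 4*c+4 → 4*c ≤ Q →
      (((kx x + 1) * (η / kk r)) - (kx x * (η / kk r)))/240/Q ≤ ∑ p ∈ (Cls L (kx x * (η / kk r)) ((kx x + 1) * (η / kk r)) (7*Q*(L*R)) (12*Q*(L*R))).filter
        (fun p : ℕ => ⌊(t - Real.log p / (L*R))/4⌋ = c), w1 (Cls L (kx x * (η / kk r)) ((kx x + 1) * (η / kk r)) (7*Q*(L*R)) (12*Q*(L*R))) p := by
    intro x
    have hk := kk_pos x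
    have hq : 0 < η / kk r := by positivity
    refine hit_nt (by positivity) (by nlinarith) ?_
    rw [← mul_div_assoc, div_le_iff₀ hk]
    nlinarith [kx_lt x]
  choose L0 hL0 hnt using hnt
  have hkk : 0 ≤ kk r := Nat.cast_nonneg _
  set e1 := η / kk r with he1
  have he0 : 0 ≤ e1 := by positivity
  have hsub : ∀ k : ℝ, (k+1)*e1 - k*e1 = e1 := fun k => by ring
  simp only [hsub] at hnt
  set cc0 := (e1/720)^(Fintype.card (NZ r)) * ((e1/240/A)^(Fintype.card (NZ r)) / (2*(2*G)^(1/s))) with hcc0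
  have hcc0p : 0 < cc0 := by
    have hP : 0 < (2*G)^(1/s) := Real.rpow_pos_of_pos (by positivity) _
    have h1 : ∀ a : ℝ, 0 < a → 0 < (e1/a)^(Fintype.card (NZ r)) := by
      intro a ha
      rcases isEmpty_or_nonempty (NZ r) with h | ⟨⟨x⟩⟩
      · rw [Fintype.card_eq_zero]; simp
      · have := kk_pos (x, true)
        positivity
    have h2 := h1 720 (by norm_num)
    have h3 := h1 (240*A) (by positivity)
    rw [← div_div] at h3
    positivity
  refine ⟨min cc0 1, ∑ x, L0 x, lt_min hcc0p one_pos, min_le_right _ _, fun L hL1 hL n hn b S hJ => ?_⟩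
  refine (min_le_left _ _).trans ?_
  have hLx : ∀ x, L0 x ≤ L := fun x =>
    (Finset.single_le_sum (f := L0) (fun y _ => (hL0 y).le) (Finset.mem_univ x)).trans hL
  have hLp : 0 < L := by linarith
  set a := vmap (vl σ L b) (actv (LsA σ η L n r b) S) with ha
  have hR : 1 ≤ Real.exp (σ * b) := Real.one_le_exp (by positivity)
  have hQ4 : ∀ l : NZ r, 4 ≤ A * Real.exp (σ * n (lastT l.1)) := by
    intro l
    have : 1 ≤ Real.exp (σ * n (lastT l.1)) := Real.one_le_exp (by positivity)
    nlinarith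
  have hvl0 : ∀ p, 0 ≤ vl σ L b p := fun p => by
    unfold vl; exact div_nonneg (Real.log_natCast_nonneg p) (by positivity)
  have hcards := cells_card hμ hs (by positivity) a hJ
  have hprod : ∏ l : NZ r, (e1/240/(A * Real.exp (σ * n (lastT l.1)))) =
      (e1/240/A)^(Fintype.card (NZ r)) * Real.exp (-(σ * ∑ k ∈ Finset.range r, (n (k+1) : ℝ) * 2^k)) := by
    have : ∀ l : NZ r, e1/240/(A * Real.exp (σ * n (lastT l.1))) = (e1/240/A) * Real.exp (-(σ * n (lastT l.1))) := by
      intro l; rw [Real.exp_neg]; field_simp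
    rw [Finset.prod_congr rfl fun l _ => this l, Finset.prod_mul_distrib, Finset.prod_const, ← Real.exp_sum,
      Finset.card_univ, Finset.sum_neg_distrib, ← Finset.mul_sum, sum_NZ (fun k => (n k : ℝ))]
    congr 4
    exact Finset.sum_congr rfl fun k _ => mul_comm _ _
  have hmain := hit_abs (fun l : NZ r => RS σ η A L n b 9 10 (l, false)) (fun l : NZ r => RS σ η A L n b 7 12 (l, true))
    (fun i j hij => RS_disj hη n b b _ _ _ _ (by simpa using hij))
    (fun i j hij => RS_disj hη n b b _ _ _ _ (by simpa using hij))
    (fun i j => RS_disj hη n b b _ _ _ _ (by simp)) (vl σ L b) ((supp r a).image cell)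
    (fun T => if Succ r (vl σ L b) (r*4) (S ∪ T) then 1 else 0) (fun T => by split_ifs <;> norm_num)
    ?_ (cB := e1/720) (by positivity) (fun l => (hnt (l, false) L _ _ (hLx _) hR (hQ4 l)).1)
    (fun l => e1/240/(A * Real.exp (σ * n (lastT l.1)))) (fun l => by positivity) ?_
  · rw [hprod] at hmain
    exact (attempt_arith hs hG _ _ hcards (by positivity) (by positivity)).trans hmain
  · intro T p' p hp' hp hc
    obtain ⟨d, hd, hdc⟩ := Finset.mem_image.1 hc
    obtain ⟨Dl, hDl, hDd⟩ := supp_sub (vl σ L b) (LsA_disj hσ hLp n r b) S hd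
    have hMU : ∀ (g h : ℝ) (x : NZ r × Bool), Disjoint (unL (LsA σ η L n r b)) (RS σ η A L n b g h x) := by
      intro g h x
      rw [Finset.disjoint_left]
      intro q hq hq'
      obtain ⟨i, _, _, hi⟩ := mem_unL_mkL hq
      exact Finset.disjoint_left.1 (RS_main hη n b _ g h x) hi hq'
    have := assemble (vl σ L b) (fun l : NZ r => RS σ η A L n b 9 10 (l, false)) (fun l : NZ r => RS σ η A L n b 7 12 (l, true))
      (unL (LsA σ η L n r b))
      (fun i j hij => RS_disj hη n b b _ _ _ _ (by simpa using hij))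
      (fun i j hij => RS_disj hη n b b _ _ _ _ (by simpa using hij))
      (fun i j => RS_disj hη n b b _ _ _ _ (by simp)) (fun i => hMU _ _ _) (fun i => hMU _ _ _)
      d Dl (S ∪ T) (fun l => (hDl l).trans (Finset.inter_subset_inter_right Finset.subset_union_left)) hDd p' p
      (fun i => by
        have h1 : p' i ∈ T ∩ RS σ η A L n b 9 10 (i, false) := by rw [hp' i]; simp
        exact Finset.inter_subset_inter_right Finset.subset_union_right h1)
      (fun i => by
        have h1 : p i ∈ T ∩ RS σ η A L n b 7 12 (i, true) := by rw [hp i]; simp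
        exact Finset.inter_subset_inter_right Finset.subset_union_right h1) hdc.symm
    rw [if_pos this]
  · intro c hc l p' hp'
    obtain ⟨d, hd, rfl⟩ := Finset.mem_image.1 hc
    have hlr : lastT l.1 ≤ r := lastT_le l.1
    have hl0 : lastT l.1 ≠ 0 := l.2
    have hdiff := supp_diff (vl σ L b) (fun i => (Pm σ η L (i+b), lev n r i)) (fun i => Real.exp (σ * ((i : ℕ) + 1)))
      (fun i => (Real.exp_pos _).le) (fun i p hp => ⟨hvl0 p, by
        have h1 := (mem_Cls.1 hp).1.2.2
        unfold vl
        rw [div_le_iff₀ (by positivity)]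
        refine h1.trans_eq ?_
        rw [mul_left_comm, ← Real.exp_add]
        congr 2; push_cast; ring⟩) _ _ S hd (agree_clr (show lastT l.1 - 1 < lastT l.1 by omega))
    have hdb : |d l.1 - d (clr l.1)| ≤ A * Real.exp (σ * n (lastT l.1)) := by
      refine hdiff.trans (le_trans (le_of_eq ?_) (geo_bound hσ.le hA0.le hA (n (r+1)) (n (lastT l.1)) (n 1 - n (r+1))))
      refine Finset.sum_congr rfl fun i _ => ?_
      have := lt_lev_iff (r := r) hn (i := n (r+1)+i+1) (k := lastT l.1 - 1) (by omega)
      rw [show lastT l.1 - 1 + 1 = lastT l.1 by omega] at this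
      simp only [this]
    have hp1 := (mem_Cls.1 hp').1
    have hLR : 0 < L * Real.exp (σ * b) := by positivity
    have hab := abs_le.1 hdb
    have hfl1 := Int.floor_le ((d l.1 - d (clr l.1)) / 4)
    have hfl2 := Int.lt_floor_add_one ((d l.1 - d (clr l.1)) / 4)
    refine (hnt (l, true) L _ _ (hLx _) hR (hQ4 l)).2 (vl σ L b p') (cell d l) ?_ ?_ ?_ ?_
    · unfold vl; rw [le_div_iff₀ hLR]; exact hp1.2.1.le
    · unfold vl; rw [div_le_iff₀ hLR]; exact hp1.2.2
    · unfold cell; linarith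
    · unfold cell; linarith

end EH

namespace EH

lemma mu_law {ρ : ℝ} {a : ℕ → ℝ} (h : ASeq ρ a) (r j : ℕ) : IsLaw (mu ρ a r j) := by
  rcases le_total j r with hj | hj
  · exact (mu_spec h hj).1
  · have e : mu ρ a r j = mu ρ a j j := by
      unfold mu; rw [Nat.sub_eq_zero_of_le hj, Nat.sub_self]
    rw [e]; exact (mu_spec h le_rfl).1

lemma nn_le {θ : ℝ} (h1 : θ < 1) (h0 : 0 < θ) {r : ℕ} (hr : 1 ≤ r) (N : ℕ) {j : ℕ} (hj : 1 ≤ j) : nn θ r N j ≤ N := by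
  refine (nn_anti h0 h1 N hj).trans ?_
  unfold nn cc
  rw [if_pos hr]; simp

lemma lt_nn {θ : ℝ} (r N : ℕ) : θ^r/20 * N < (nn θ r N (r+1) : ℝ) + 1 := by
  unfold nn cc
  rw [if_neg (by omega)]
  exact Nat.lt_floor_add_one _

lemma range_main {σ η L c : ℝ} (hσ : 0 < σ) (hL : 0 < L) {n : ℕ → ℕ} {r b N Z : ℕ}
    (h1 : n 1 ≤ N) (hn : n (r+1) ≤ n 1) (hc : c * N ≤ n (r+1) + 1) (hb : b ≤ Z) (hN : Z + 1 ≤ N) :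
    unL (LsA σ η L n r b) ⊆ Pr (L * Real.exp (σ * c * N)) (L * Real.exp (2 * σ * N)) := by
  intro p hp
  obtain ⟨i, hi1, hi2, hi⟩ := mem_unL_mkL hp
  obtain ⟨⟨h3, h4, h5⟩, -⟩ := mem_Cls.1 hi
  refine mem_Pr.2 ⟨h3, lt_of_le_of_lt ?_ h4, h5.trans ?_⟩
  · refine mul_le_mul_of_nonneg_left (Real.exp_le_exp.2 ?_) hL.le
    rw [mul_assoc]
    refine mul_le_mul_of_nonneg_left (hc.trans ?_) hσ.le
    exact_mod_cast (by omega : n (r+1) + 1 ≤ i + b)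
  · refine mul_le_mul_of_nonneg_left (Real.exp_le_exp.2 ?_) hL.le
    rw [mul_comm 2 σ, mul_assoc]
    refine mul_le_mul_of_nonneg_left ?_ hσ.le
    exact_mod_cast (by omega : i + b + 1 ≤ 2 * N)

lemma range_res {σ η A L c : ℝ} (hσ : 0 < σ) (hσ1 : σ < 1) (hA : 4 ≤ A) (hL : 0 < L) {n : ℕ → ℕ} (hanti : Antitone n) {r b N Z : ℕ}
    (h1 : n 1 ≤ N) (hc : c * N ≤ n (r+1) + 1) (hb : b ≤ Z) (hN : Real.log (12 * A) ≤ σ * ((N:ℝ) - Z)) :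
    UU σ η A L n r b ⊆ Pr (L * Real.exp (σ * c * N)) (L * Real.exp (2 * σ * N)) := by
  intro p hp
  obtain ⟨x, hx⟩ := mem_UU hp
  obtain ⟨⟨h3, h4, h5⟩, -⟩ := mem_Cls.1 hx
  have hl : lastT x.1.1 ≤ r := lastT_le _
  have hl0 : lastT x.1.1 ≠ 0 := x.1.2
  have hna : n (r+1) ≤ n (lastT x.1.1) := hanti (by omega)
  have hnb : n (lastT x.1.1) ≤ n 1 := hanti (by omega)
  set e := Real.exp (σ * n (lastT x.1.1)) with he
  set f := Real.exp (σ * b) with hf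
  have he0 : 0 < e := Real.exp_pos _
  have hf0 : 0 < f := Real.exp_pos _
  have hf1 : 1 ≤ f := Real.one_le_exp (by positivity)
  refine mem_Pr.2 ⟨h3, lt_of_le_of_lt ?_ h4, h5.trans ?_⟩
  · have hg : (7:ℝ) ≤ if x.2 = true then 7 else 9 := by split_ifs <;> norm_num
    have k1 : Real.exp (σ * c * N) ≤ 28 * e := by
      have h28 : Real.exp σ ≤ 28 := by
        have := Real.exp_le_exp.2 hσ1.le
        have := Real.exp_one_lt_d9
        linarith
      calc Real.exp (σ * c * N) ≤ Real.exp (σ + σ * n (lastT x.1.1)) := by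
            refine Real.exp_le_exp.2 ?_
            have : c * N ≤ 1 + n (lastT x.1.1) := by
              have : (n (r+1) : ℝ) ≤ n (lastT x.1.1) := by exact_mod_cast hna
              linarith
            nlinarith
        _ = Real.exp σ * e := Real.exp_add _ _
        _ ≤ 28 * e := by gcongr
    calc L * Real.exp (σ * c * N) ≤ L * (28 * e) := by gcongr
      _ = 7 * (4 * e) * (L * 1) := by ring
      _ ≤ _ := by gcongr
  · have hg : (if x.2 = true then (12:ℝ) else 10) ≤ 12 := by split_ifs <;> norm_num
    calc (if x.2 = true then (12:ℝ) else 10) * (A * e) * (L * f) ≤ 12 * (A * e) * (L * f) := by gcongr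
      _ = L * ((12 * A) * (e * f)) := by ring
      _ ≤ L * Real.exp (2 * σ * N) := by
        refine mul_le_mul_of_nonneg_left ?_ hL.le
        rw [he, hf, ← Real.exp_add]
        nth_rewrite 1 [← Real.exp_log (show 0 < 12 * A by linarith)]
        rw [← Real.exp_add]
        refine Real.exp_le_exp.2 ?_
        have q1 : (n (lastT x.1.1) : ℝ) ≤ N := by exact_mod_cast hnb.trans h1
        have q2 : (b : ℝ) ≤ Z := by exact_mod_cast hb
        nlinarith

lemma bad_prob {μ : (j : ℕ) → Om j → ℝ} (hμ : ∀ j, IsLaw (μ j)) {r : ℕ} {C s G E δ' : ℝ} (val : ℕ → ℝ)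
    {Ls : List (Finset ℕ × ℕ)} (hd : DisjL Ls) {M : Finset ℕ} (hM : unL Ls ⊆ M) (hδ : 0 < δ') (hG : 0 ≤ G) (hE : 0 < E)
    (hR : RR μ C s val w1 Ls (VV r 0) ≤ G * E) :
    EE M (fun S => if JJ μ C s (vmap val (actv Ls S)) (VV r 0) ≤ (G+1)/δ' * E then 0 else 1) ≤ δ' := by
  set J := (G+1)/δ' * E with hJ
  have hJ0 : 0 < J := by positivity
  calc EE M (fun S => if JJ μ C s (vmap val (actv Ls S)) (VV r 0) ≤ J then 0 else 1)
      ≤ EE M (fun S => (fun S' => J⁻¹ * JJ μ C s (vmap val (actv Ls S')) (VV r 0)) (S ∩ unL Ls)) := by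
        refine EE_mono fun S _ => ?_
        dsimp only
        rw [actv_congr (show S ∩ unL Ls ∩ unL Ls = S ∩ unL Ls by rw [Finset.inter_assoc, Finset.inter_self])]
        have h0 := JJ_nonneg (r := r) (U := VV r 0) (C := C) (s := s) (a := vmap val (actv Ls S)) hμ
        split_ifs with h
        · positivity
        · push Not at h
          rw [← div_eq_inv_mul, le_div_iff₀ hJ0]; linarith
    _ = EE (unL Ls) (fun S' => J⁻¹ * JJ μ C s (vmap val (actv Ls S')) (VV r 0)) := EE_marg hM (fun S' => J⁻¹ * JJ μ C s (vmap val (actv Ls S')) (VV r 0))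
    _ = J⁻¹ * RR μ C s val w1 Ls (VV r 0) := by
        rw [EE_smul, EE_actv val hd (fun a => JJ μ C s a (VV r 0))]; rfl
    _ ≤ J⁻¹ * (G * E) := by gcongr
    _ ≤ δ' := by
        rw [← div_eq_inv_mul, div_le_iff₀ hJ0, hJ]
        have : δ' * ((G+1)/δ' * E) = (G+1) * E := by field_simp
        rw [this]; nlinarith

theorem propW_aux {ρ : ℝ} {a : ℕ → ℝ} (h : ASeq ρ a) {θ α : ℝ} (h0 : 0 < θ) (h1 : θ < 1) {r : ℕ} (hr : 1 ≤ r)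
    (hα0 : 0 < α) (hα1 : α < 1) (F : Fam r α (mu ρ a r))
    (hp : ∀ m < r, 0 < ∑ k ∈ Finset.range r, (cc θ r (k+1) - cc θ r (r+1)) *
        (FF α (mu ρ a r) m (k+1) - FF α (mu ρ a r) m k) - cc θ r (r+1) * (2^r - 2^m)) {δ : ℝ} (hδ : 0 < δ) :
    ∃ (σ X L0 : ℝ) (N0 : ℕ), 0 < σ ∧ σ < 1 ∧ 0 < X ∧ 1 ≤ L0 ∧ ∀ N ≥ N0, ∀ L, L0 ≤ L →
      EE (Pr (L * Real.exp (σ * (θ^r/20) * N)) (L * Real.exp (2 * σ * N)))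
        (fun S => if Succ r (fun p : ℕ => Real.log p) (X * L) S then 0 else 1) ≤ δ := by
  have hμ := mu_law h r
  set μ := mu ρ a r with hμd
  clear_value μ
  obtain ⟨N1, hN1⟩ := levels h0 h1 hr F hp
  set α2 := (1+α)/2 with hα2
  have hα2a : α < α2 := by linarith
  set κ := Real.sqrt α2 with hκ
  have hκ0 : 0 < κ := Real.sqrt_pos.2 (by linarith)
  have hκ1 : κ < 1 := by rw [hκ, Real.sqrt_lt' one_pos]; linarith
  have hκκ : κ * κ = α2 := Real.mul_self_sqrt (by linarith)
  obtain ⟨σ, η, B, L2, hσ, hσ1, hη, hη1, hB, hL2, hslot⟩ := slot_ok hκ0 hκ1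
  obtain ⟨s, hs, hs1, hphi⟩ := exists_s hμ r (show 0 < 1 - κ by linarith)
  obtain ⟨G0, hG0, hLp⟩ := Lp_claim hμ (r*4) hs hs1 hσ hB hα0.le hα2a (mul_nonneg hκ0.le hσ.le)
    (fun j hj U => by
      have := mul_le_mul_of_nonneg_left (hphi j hj U) (mul_nonneg hκ0.le hσ.le)
      rw [← hκκ]
      refine le_trans (le_of_eq ?_) this
      ring) (VV r 0)
  have heσ : 0 < Real.exp σ - 1 := by
    have := Real.add_one_lt_exp hσ.ne'
    linarith
  set A := max 4 (Real.exp (2*σ) / (Real.exp σ - 1)) with hA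
  have hA4 : 4 ≤ A := le_max_left _ _
  have hAe : Real.exp (2*σ) ≤ A * (Real.exp σ - 1) := by
    rw [← div_le_iff₀ heσ]; exact le_max_right _ _
  clear_value A
  set δ' := δ/4 with hδ'
  have hδ'0 : 0 < δ' := by positivity
  obtain ⟨c, L3, hc0, hc1, hatt⟩ := attempt (r := r) hμ hs hσ hη hη1.le hA4 hAe (show 0 < (G0+1)/δ' by positivity)
  obtain ⟨m0, hm0⟩ := exists_pow_lt_of_lt_one (show 0 < δ/2 by positivity) (show 1 - c < 1 by linarith)
  set m := m0 + 1 with hm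
  have hmb : (1-c)^m ≤ δ/2 := by
    refine le_trans ?_ hm0.le
    exact pow_le_pow_of_le_one (by linarith) (by linarith) (by omega)
  obtain ⟨G, hG⟩ := exists_nat_ge (Real.log 2 / σ)
  have hG2 : 2 ≤ Real.exp (σ * G) := by
    rw [← Real.log_le_iff_le_exp (by norm_num)]
    rw [div_le_iff₀ hσ] at hG; linarith
  set Z := 2 * m * G with hZ
  obtain ⟨N2, hN2⟩ := exists_nat_ge (Real.log (12*A) / σ)
  refine ⟨σ, r * 4 * Real.exp (σ * Z) , max L2 (max 1 L3), max N1 (Z + 1 + N2), hσ, hσ1, by positivity, le_max_of_le_left hL2, fun N hN L hL => ?_⟩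
  have hNa : N1 ≤ N := (le_max_left _ _).trans hN
  have hNb : Z + 1 + N2 ≤ N := (le_max_right _ _).trans hN
  have hLa : L2 ≤ L := (le_max_left _ _).trans hL
  have hLb : 1 ≤ L := hL2.trans hLa
  have hLc : L3 ≤ L := (le_max_right _ _).trans ((le_max_right _ _).trans hL)
  have hLp0 : 0 < L := by linarith
  set n := nn θ r N with hn
  have hnanti : Antitone n := nn_anti h0 h1 N
  have hn1 : n 1 ≤ N := nn_le h1 h0 hr N le_rfl
  have hnr : n (r+1) ≤ n 1 := hnanti (by omega)
  have hcN : θ^r/20 * N ≤ (n (r+1) : ℝ) + 1 := (lt_nn r N).le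
  have hNlog : Real.log (12 * A) ≤ σ * ((N:ℝ) - Z) := by
    rw [div_le_iff₀ hσ] at hN2
    have : (N2 : ℝ) ≤ N - Z := by
      have : ((Z + 1 + N2 : ℕ) : ℝ) ≤ N := by exact_mod_cast hNb
      push_cast at this; linarith
    nlinarith
  have hbZ : ∀ x < 2*m, x * G ≤ Z := fun x hx => Nat.mul_le_mul_right G hx.le
  set W := Pr (L * Real.exp (σ * (θ^r/20) * N)) (L * Real.exp (2 * σ * N)) with hW
  set E := Real.exp (-(s*σ) * ∑ k ∈ Finset.range r, (n (k+1) : ℝ) * 2^k) with hE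
  set M := (Finset.range (2*m)).biUnion fun x => unL (LsA σ η L n r (x*G)) with hM
  have hLsOK : ∀ b, LsOK (vl σ L b) w1 B σ (κ*σ) r (n (r+1)) (LsA σ η L n r b) := by
    intro b
    refine LsOK_mkL fun i hi1 hi2 => ⟨hslot L hLa b i, ?_, lev_le i⟩
    exact (lt_lev_iff hnanti (show 0 < r by omega)).2 (by show i ≤ n 1; omega)
  have hRR : ∀ b, RR μ (r*4) s (vl σ L b) w1 (LsA σ η L n r b) (VV r 0) ≤ G0 * E := by
    intro b
    refine (hLp _ _ _ _ (hLsOK b)).trans (mul_le_mul_of_nonneg_left (Real.exp_le_exp.2 ?_) hG0)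
    have e : (LsA σ η L n r b).map Prod.snd = lsN θ r N := by
      unfold LsA lsN; rw [mkL_map]
    rw [e]
    have := mul_le_mul_of_nonneg_left (hN1 N hNa) (mul_nonneg hs.le hσ.le)
    linarith
  have hmulti := multi (m := m) (by omega) M W (fun x => UU σ η A L n r (x*G)) ?_ ?_ ?_
    (fun x S => Succ r (vl σ L (x*G)) (r*4) S)
    (fun x S => JJ μ (r*4) s (vmap (vl σ L (x*G)) (actv (LsA σ η L n r (x*G)) S)) (VV r 0) ≤ (G0+1)/δ' * E)
    (fun x S T hST hS => hS.mono hST) hc0.le hc1 (fun x S hS => hatt L hLb hLc n hnanti (x*G) S hS)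
    (δ := δ') (fun x hx => bad_prob hμ _ (LsA_disj hσ hLp0 n r _)
      (Finset.subset_biUnion_of_mem (fun x => unL (LsA σ η L n r (x*G))) (Finset.mem_range.2 hx)) hδ'0 hG0 (Real.exp_pos _) (hRR _))
  · refine le_trans (EE_mono fun S _ => ?_) (hmulti.trans (by linarith))
    split_ifs with k1 k2 k2
    · exact le_rfl
    · norm_num
    · obtain ⟨x, hx, hsx⟩ := k2
      refine absurd (Succ.scale hsx (c := L * Real.exp (σ * (x*G : ℕ))) (by positivity) (fun p => ?_) ?_) k1
      · unfold vl; field_simp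
      · have : Real.exp (σ * (x*G : ℕ)) ≤ Real.exp (σ * Z) :=
          Real.exp_le_exp.2 (mul_le_mul_of_nonneg_left (by exact_mod_cast hbZ x hx) hσ.le)
        calc L * Real.exp (σ * (x*G : ℕ)) * (r*4) ≤ L * Real.exp (σ * Z) * (r*4) := by gcongr
          _ = _ := by ring
    · exact le_rfl
  · intro x
    rw [hM, Finset.disjoint_left]
    intro p hp hp'
    obtain ⟨y, _, hy⟩ := Finset.mem_biUnion.1 hp
    obtain ⟨i, _, _, hi⟩ := mem_unL_mkL hy
    exact Finset.disjoint_left.1 (UU_main hη n r _ _) hi hp'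
  · have key : ∀ x y : ℕ, x < y → Disjoint (UU σ η A L n r (x*G)) (UU σ η A L n r (y*G)) := by
      intro x y hxy
      refine UU_att hη (by linarith) hLp0 n r ?_
      calc 2 * Real.exp (σ * (x*G : ℕ)) ≤ Real.exp (σ * G) * Real.exp (σ * (x*G : ℕ)) := by gcongr
        _ = Real.exp (σ * ((x+1)*G : ℕ)) := by rw [← Real.exp_add]; congr 1; push_cast; ring
        _ ≤ _ := Real.exp_le_exp.2 (mul_le_mul_of_nonneg_left (by exact_mod_cast Nat.mul_le_mul_right G hxy) hσ.le)
    intro x y hxy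
    rcases lt_or_gt_of_ne hxy with h' | h'
    · exact key x y h'
    · exact (key y x h').symm
  · refine Finset.union_subset ?_ ?_
    · rw [hM, Finset.biUnion_subset]
      exact fun x hx => range_main hσ hLp0 hn1 hnr hcN (hbZ x (Finset.mem_range.1 hx)) (by omega)
    · rw [Finset.biUnion_subset]
      exact fun x hx => range_res hσ hσ1 hA4 hLp0 hnanti hn1 hcN (hbZ x (Finset.mem_range.1 hx)) hNlog

theorem propW {ρ : ℝ} {a : ℕ → ℝ} (h : ASeq ρ a) (hlim : Tendsto (fun j : ℕ => (2:ℝ) ^ ((j:ℝ) - 2) / Real.log (a j))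
      atTop (nhds (1 - ρ/2))) {θ : ℝ} (h0 : 0 < θ) (h1 : θ < ρ/2) :
    ∃ r0 : ℕ, ∀ r ≥ r0, 1 ≤ r → ∀ δ : ℝ, 0 < δ →
    ∃ (σ X L0 : ℝ) (N0 : ℕ), 0 < σ ∧ σ < 1 ∧ 0 < X ∧ 1 ≤ L0 ∧ ∀ N ≥ N0, ∀ L, L0 ≤ L →
      EE (Pr (L * Real.exp (σ * (θ^r/20) * N)) (L * Real.exp (2 * σ * N)))
        (fun S => if Succ r (fun p : ℕ => Real.log p) (X * L) S then 0 else 1) ≤ δ := by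
  obtain ⟨r0, hr0⟩ := params h hlim h0 h1
  refine ⟨r0, fun r hr hr1 δ hδ => ?_⟩
  obtain ⟨α, hα0, hα1, F, hp⟩ := hr0 r hr hr1
  have := h.hρ1
  exact propW_aux h h0 (by linarith) hr1 hα0 hα1 F hp hδ

end EH

namespace EH

def Many (k Y : ℝ) (S : Finset ℕ) : Prop :=
  ∃ D : Finset (Finset ℕ), (∀ d ∈ D, d ⊆ S) ∧ k ≤ (D.card : ℝ) ∧ ∃ z : ℝ, ∀ d ∈ D, |∑ p ∈ d, Real.log p - z| ≤ Y

lemma many_windows {r : ℕ} {X : ℝ} (W : ℕ → Finset ℕ) (hW : ∀ i j, i ≠ j → Disjoint (W i) (W j)) (S : Finset ℕ)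
    (A : Finset ℕ) (h : ∀ w ∈ A, Succ r (fun p : ℕ => Real.log p) X (S ∩ W w)) :
    ∃ D : Finset (Finset ℕ), (∀ d ∈ D, d ⊆ S ∩ A.biUnion W) ∧ D.card = (2^r)^A.card ∧
      ∃ z : ℝ, ∀ d ∈ D, |∑ p ∈ d, Real.log p - z| ≤ A.card * X := by
  induction A using Finset.induction_on with
  | empty =>
    refine ⟨{∅}, by simp, by simp, 0, by simp⟩
  | insert w A hw ih =>
    obtain ⟨D, h1, h2, z, h3⟩ := ih fun v hv => h v (Finset.mem_insert_of_mem hv)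
    obtain ⟨E, e1, e2, y, e3⟩ := h w (Finset.mem_insert_self _ _)
    have hdW : ∀ d ∈ D, Disjoint d (W w) := by
      intro d hd
      refine Finset.disjoint_of_subset_left ((h1 d hd).trans Finset.inter_subset_right) ?_
      rw [Finset.disjoint_biUnion_left]
      intro v hv
      exact hW v w (fun hvw => hw (hvw ▸ hv))
    have hEW : ∀ l, E l ⊆ W w := fun l => (e2 l).trans Finset.inter_subset_right
    have hdE : ∀ d ∈ D, ∀ l, Disjoint d (E l) := fun d hd l => Finset.disjoint_of_subset_right (hEW l) (hdW d hd)
    refine ⟨(D ×ˢ (Finset.univ : Finset (Lam r))).image fun x => x.1 ∪ E x.2, ?_, ?_, z + y, ?_⟩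
    · intro d hd
      obtain ⟨⟨d', l⟩, hx, rfl⟩ := Finset.mem_image.1 hd
      have hd' := (Finset.mem_product.1 hx).1
      rw [Finset.biUnion_insert]
      refine Finset.union_subset ((h1 d' hd').trans ?_) ((e2 l).trans ?_)
      · exact Finset.inter_subset_inter_left Finset.subset_union_right
      · exact Finset.inter_subset_inter_left Finset.subset_union_left
    · rw [Finset.card_image_of_injOn, Finset.card_product, h2, Finset.card_insert_of_notMem hw, pow_succ]
      · congr 1
        simp [Lam]
      · rintro ⟨d, l⟩ hx ⟨d', l'⟩ hx' hdd
        have hd := (Finset.mem_product.1 (Finset.mem_coe.1 hx)).1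
        have hd' := (Finset.mem_product.1 (Finset.mem_coe.1 hx')).1
        dsimp only at hdd hd hd'
        have k1 : ∀ d ∈ D, ∀ l, (d ∪ E l) ∩ W w = E l := fun d hd l => by
          rw [Finset.union_inter_distrib_right, Finset.disjoint_iff_inter_eq_empty.1 (hdW d hd), Finset.empty_union,
            Finset.inter_eq_left.2 (hEW l)]
        have k2 : ∀ d ∈ D, ∀ l, (d ∪ E l) \ W w = d := fun d hd l => by
          rw [Finset.union_sdiff_distrib, Finset.sdiff_eq_empty_iff_subset.2 (hEW l), Finset.union_empty,
            Finset.sdiff_eq_self_of_disjoint (hdW d hd)]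
        have q1 := congrArg (fun s => s ∩ W w) hdd
        have q2 := congrArg (fun s => s \ W w) hdd
        simp only [k1 d hd, k1 d' hd', k2 d hd, k2 d' hd'] at q1 q2
        rw [q2, e1 q1]
    · intro d hd
      obtain ⟨⟨d', l⟩, hx, rfl⟩ := Finset.mem_image.1 hd
      have hd' := (Finset.mem_product.1 hx).1
      dsimp only at hd' ⊢
      rw [Finset.sum_union (hdE d' hd' l), Finset.card_insert_of_notMem hw]
      have a1 := h3 d' hd'
      have a2 := e3 l
      have := abs_add_le (∑ p ∈ d', Real.log p - z) (∑ p ∈ E l, Real.log p - y)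
      push_cast
      rw [show ∑ p ∈ d', Real.log p + ∑ p ∈ E l, Real.log p - (z + y) = (∑ p ∈ d', Real.log p - z) + (∑ p ∈ E l, Real.log p - y) by ring]
      linarith

lemma many_of_few {r M : ℕ} {X δ : ℝ} (hX : 0 ≤ X) (W : ℕ → Finset ℕ)
    (hW : ∀ i j, i ≠ j → Disjoint (W i) (W j)) (S : Finset ℕ) (h : ¬ Many ((2:ℝ)^((r:ℝ)*(1-10*δ)*M)) (M*X) S) :
    10*δ*M ≤ ∑ w ∈ Finset.range M, (if Succ r (fun p : ℕ => Real.log p) X (S ∩ W w) then (0:ℝ) else 1) := by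
  by_contra hlt
  push Not at hlt
  have e2 : ∑ w ∈ Finset.range M, (if Succ r (fun p : ℕ => Real.log p) X (S ∩ W w) then (0:ℝ) else 1) =
      (((Finset.range M).filter (fun w => ¬ Succ r (fun p : ℕ => Real.log p) X (S ∩ W w))).card : ℝ) := by
    rw [Finset.card_filter]; push_cast
    refine Finset.sum_congr rfl fun a _ => ?_
    by_cases h : Succ r (fun p : ℕ => Real.log p) X (S ∩ W a) <;> simp [h]
  rw [e2] at hlt
  have hcard := Finset.card_filter_add_card_filter_not (s := Finset.range M) (fun w => Succ r (fun p : ℕ => Real.log p) X (S ∩ W w))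
  rw [Finset.card_range] at hcard
  set A := (Finset.range M).filter (fun w => Succ r (fun p : ℕ => Real.log p) X (S ∩ W w)) with hA
  have hcr : (A.card : ℝ) + (((Finset.range M).filter (fun w => ¬ Succ r (fun p : ℕ => Real.log p) X (S ∩ W w))).card : ℝ) = M := by
    exact_mod_cast hcard
  have hA1 : (1-10*δ)*M ≤ A.card := by linarith
  have hAM : (A.card : ℝ) ≤ M := by exact_mod_cast (by omega : A.card ≤ M)
  obtain ⟨D, d1, d2, z, d3⟩ := many_windows (r := r) (X := X) W hW S A fun w hw => (Finset.mem_filter.1 hw).2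
  refine h ⟨D, fun d hd => (d1 d hd).trans Finset.inter_subset_left, ?_, z, fun d hd => (d3 d hd).trans (by gcongr)⟩
  rw [d2]; push_cast
  rw [← pow_mul, ← Real.rpow_natCast]
  refine Real.rpow_le_rpow_of_exponent_le (by norm_num) ?_
  push_cast
  rw [mul_assoc]; gcongr

lemma windows {r M : ℕ} {X δ : ℝ} (hX : 0 ≤ X) (hM : 0 < M) (hδ : 0 < δ) (W : ℕ → Finset ℕ)
    (hW : ∀ i j, i ≠ j → Disjoint (W i) (W j)) {P : Finset ℕ} (hP : ∀ w < M, W w ⊆ P)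
    (hf : ∀ w < M, EE (W w) (fun S => if Succ r (fun p : ℕ => Real.log p) X S then 0 else 1) ≤ δ) :
    EE P (fun S => if Many ((2:ℝ)^((r:ℝ)*(1-10*δ)*M)) (M*X) S then 0 else 1) ≤ 1/10 := by
  have hMr : (0:ℝ) < M := by exact_mod_cast hM
  set f : Finset ℕ → ℝ := fun S => if Succ r (fun p : ℕ => Real.log p) X S then 0 else 1 with hfd
  have hf0 : ∀ S, 0 ≤ f S := fun S => by rw [hfd]; dsimp only; split_ifs <;> norm_num
  calc EE P (fun S => if Many ((2:ℝ)^((r:ℝ)*(1-10*δ)*M)) (M*X) S then 0 else 1)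
      ≤ EE P (fun S => (10*δ*M)⁻¹ * ∑ w ∈ Finset.range M, f (S ∩ W w)) := by
        refine EE_mono fun S _ => ?_
        split_ifs with h
        · exact mul_nonneg (by positivity) (Finset.sum_nonneg fun w _ => hf0 _)
        · have := many_of_few hX W hW S h
          rw [← div_eq_inv_mul, le_div_iff₀ (by positivity), one_mul]
          exact this
    _ = (10*δ*M)⁻¹ * ∑ w ∈ Finset.range M, EE P (fun S => f (S ∩ W w)) := by rw [EE_smul, EE_sum]
    _ ≤ (10*δ*M)⁻¹ * ∑ w ∈ Finset.range M, δ := by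
        refine mul_le_mul_of_nonneg_left (Finset.sum_le_sum fun w hw => ?_) (by positivity)
        rw [EE_marg (hP w (Finset.mem_range.1 hw)) f]
        exact hf w (Finset.mem_range.1 hw)
    _ = 1/10 := by
        rw [Finset.sum_const, Finset.card_range, nsmul_eq_mul]; field_simp

/-! ### pigeonhole -/

lemma cardEq (n : ℕ) (u v : ℝ) :
    (n.divisors.filter fun d => Real.exp u < (d : ℝ) ∧ (d : ℝ) ≤ Real.exp (u + v)).card =
    (n.divisors.filter fun d : ℕ => Real.exp u < (d : ℝ) ∧ (d : ℝ) ≤ Real.exp (u + v)).card := by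
  symm
  refine Finset.card_bij (fun d _ => (d:ℝ)) ?_ ?_ ?_
  · intro d hd
    rw [Finset.mem_filter] at hd ⊢
    exact ⟨by simpa using hd.1, hd.2⟩
  · intro d _ e _ h
    exact_mod_cast h
  · intro x hx
    rw [Finset.mem_filter] at hx
    obtain ⟨h1, h2⟩ := hx
    have : ∃ d ∈ n.divisors, (d:ℝ) = x := by simpa using h1
    obtain ⟨d, hd, rfl⟩ := this
    exact ⟨d, Finset.mem_filter.2 ⟨hd, h2⟩, rfl⟩

lemma Delta_eq (n : ℕ) : Delta n =
    ⨆ u : ℝ, (n.divisors.filter fun d : ℕ => Real.exp u < (d : ℝ) ∧ (d : ℝ) ≤ Real.exp (u + 1)).card := by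
  unfold Delta DeltaV
  exact iSup_congr fun u => cardEq n u 1

lemma Delta_ge {n : ℕ} (_hn : n ≠ 0) (u : ℝ) :
    (n.divisors.filter fun d : ℕ => Real.exp u < (d : ℝ) ∧ (d : ℝ) ≤ Real.exp (u + 1)).card ≤ Delta n := by
  rw [Delta_eq]
  refine le_ciSup (f := fun u : ℝ => (n.divisors.filter fun d : ℕ => Real.exp u < (d : ℝ) ∧ (d : ℝ) ≤ Real.exp (u + 1)).card) ⟨n.divisors.card, ?_⟩ u
  rintro _ ⟨v, rfl⟩
  exact Finset.card_filter_le _ _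

lemma Delta_le_of {n : ℕ} {k : ℕ} (h : ∀ u : ℝ, (n.divisors.filter fun d : ℕ => Real.exp u < (d : ℝ) ∧ (d : ℝ) ≤ Real.exp (u + 1)).card ≤ k) :
    Delta n ≤ k := by
  rw [Delta_eq]; exact ciSup_le h

lemma Delta_mono {m n : ℕ} (hn : n ≠ 0) (h : m ∣ n) : Delta m ≤ Delta n := by
  refine Delta_le_of fun u => le_trans (Finset.card_le_card ?_) (Delta_ge hn u)
  exact Finset.filter_subset_filter _ (Nat.divisors_subset_of_dvd hn h)

lemma one_le_Delta {n : ℕ} (hn : n ≠ 0) : 1 ≤ Delta n := by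
  refine le_trans ?_ (Delta_ge hn (-1/2))
  rw [Finset.one_le_card]
  refine ⟨1, Finset.mem_filter.2 ⟨Nat.one_mem_divisors.2 hn, ?_, ?_⟩⟩
  · rw [Nat.cast_one]; exact Real.exp_lt_one_iff.2 (by norm_num)
  · rw [Nat.cast_one]; exact Real.one_le_exp (by norm_num)

lemma prod_inj {S T : Finset ℕ} (hS : ∀ p ∈ S, p.Prime) (hT : ∀ p ∈ T, p.Prime) (h : ∏ p ∈ S, p = ∏ p ∈ T, p) : S = T := by
  have := congrArg Nat.primeFactors h
  rwa [Nat.primeFactors_prod hS, Nat.primeFactors_prod hT] at this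

lemma log_prod_nat {S : Finset ℕ} (hS : ∀ p ∈ S, p.Prime) : Real.log ((∏ p ∈ S, p : ℕ) : ℝ) = ∑ p ∈ S, Real.log p := by
  rw [Nat.cast_prod, Real.log_prod fun p hp => by exact_mod_cast (hS p hp).ne_zero]

lemma pigeon {S S1 S2 : Finset ℕ} (hS : ∀ p ∈ S, p.Prime) (hS1 : S1 ⊆ S) (hS2 : S2 ⊆ S) (hd : Disjoint S1 S2) {k Y V : ℝ}
    (hY : 0 ≤ Y) (hV : ∑ p ∈ S1, Real.log p ≤ V) (h : Many k Y S2) :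
    (2:ℝ)^S1.card * k / (2*Y + V + 2) ≤ (Delta (∏ p ∈ S, p) : ℝ) := by
  obtain ⟨D, d1, d2, z, d3⟩ := h
  have hn : ∏ p ∈ S, p ≠ 0 := Finset.prod_ne_zero_iff.2 fun p hp => (hS p hp).ne_zero
  have hl0 : ∀ T : Finset ℕ, 0 ≤ ∑ p ∈ T, Real.log p := fun T => Finset.sum_nonneg fun p _ => Real.log_natCast_nonneg p
  have hV0 : 0 ≤ V := (hl0 S1).trans hV
  set n := ⌈2*Y+V⌉₊ + 1 with hnn
  set Q := S1.powerset ×ˢ D with hQ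
  set lg : Finset ℕ × Finset ℕ → ℝ := fun x => ∑ p ∈ x.1, Real.log p + ∑ p ∈ x.2, Real.log p with hlg
  set g : Finset ℕ × Finset ℕ → ℕ := fun x => ⌈lg x - (z - Y)⌉₊ with hg
  have hb : ∀ x ∈ Q, 0 ≤ lg x - (z - Y) ∧ lg x - (z-Y) ≤ 2*Y+V := by
    intro x hx
    obtain ⟨h1, h2⟩ := Finset.mem_product.1 hx
    have a1 := abs_le.1 (d3 _ h2)
    have a2 : ∑ p ∈ x.1, Real.log p ≤ ∑ p ∈ S1, Real.log p :=
      Finset.sum_le_sum_of_subset_of_nonneg (Finset.mem_powerset.1 h1) fun p _ _ => Real.log_natCast_nonneg p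
    have a3 := hl0 x.1
    rw [hlg]; dsimp only
    constructor <;> linarith
  have hmaps : ∀ x ∈ Q, g x ∈ Finset.range n := by
    intro x hx
    rw [Finset.mem_range, hnn, Nat.lt_succ_iff]
    exact Nat.ceil_mono (hb x hx).2
  have hfib : ∀ i ∈ Finset.range n, (Q.filter fun x => g x = i).card ≤ Delta (∏ p ∈ S, p) := by
    intro i _
    refine le_trans ?_ (Delta_ge hn (z - Y + i - 1))
    refine Finset.card_le_card_of_injOn (fun x => ∏ p ∈ x.1 ∪ x.2, p) ?_ ?_
    · intro x hx
      obtain ⟨hxQ, hxi⟩ := Finset.mem_filter.1 (Finset.mem_coe.1 hx)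
      obtain ⟨h1, h2⟩ := Finset.mem_product.1 hxQ
      have hs1 := Finset.mem_powerset.1 h1
      have hs2 := d1 _ h2
      have hsub : x.1 ∪ x.2 ⊆ S := Finset.union_subset (hs1.trans hS1) (hs2.trans hS2)
      have hdis : Disjoint x.1 x.2 := Finset.disjoint_of_subset_left hs1 (Finset.disjoint_of_subset_right hs2 hd)
      have hlog : Real.log ((∏ p ∈ x.1 ∪ x.2, p : ℕ) : ℝ) = lg x := by
        rw [log_prod_nat fun p hp => hS p (hsub hp), Finset.sum_union hdis]
      have hpos : (0:ℝ) < ((∏ p ∈ x.1 ∪ x.2, p : ℕ) : ℝ) := by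
        exact_mod_cast Finset.prod_pos fun p hp => (hS p (hsub hp)).pos
      have hc1 : lg x - (z-Y) ≤ i := by rw [← hxi]; exact Nat.le_ceil _
      have hc2 : (i:ℝ) < lg x - (z-Y) + 1 := by rw [← hxi]; exact Nat.ceil_lt_add_one (hb x hxQ).1
      refine Finset.mem_coe.2 (Finset.mem_filter.2 ⟨Nat.mem_divisors.2 ⟨Finset.prod_dvd_prod_of_subset _ _ _ hsub, hn⟩, ?_, ?_⟩)
      · rw [← Real.lt_log_iff_exp_lt hpos, hlog]; linarith
      · rw [← Real.log_le_iff_le_exp hpos, hlog]; linarith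
    · intro x hx y hy hxy
      have hxQ := (Finset.mem_filter.1 (Finset.mem_coe.1 hx)).1
      have hyQ := (Finset.mem_filter.1 (Finset.mem_coe.1 hy)).1
      have key : ∀ x ∈ Q, x.1 ∪ x.2 ⊆ S ∧ (x.1 ∪ x.2) ∩ S1 = x.1 ∧ (x.1 ∪ x.2) ∩ S2 = x.2 := by
        intro x hx
        obtain ⟨h1, h2⟩ := Finset.mem_product.1 hx
        have hs1 := Finset.mem_powerset.1 h1
        have hs2 := d1 _ h2
        exact ⟨Finset.union_subset (hs1.trans hS1) (hs2.trans hS2), inter_union_left hd hs1 hs2, inter_union_right hd hs1 hs2⟩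
      obtain ⟨x1, x2, x3⟩ := key x hxQ
      obtain ⟨y1, y2, y3⟩ := key y hyQ
      have e := prod_inj (fun p hp => hS p (x1 hp)) (fun p hp => hS p (y1 hp)) hxy
      refine Prod.ext ?_ ?_
      · rw [← x2, ← y2, e]
      · rw [← x3, ← y3, e]
  have hcard : Q.card ≤ n * Delta (∏ p ∈ S, p) := by
    rw [Finset.card_eq_sum_card_fiberwise hmaps]
    refine (Finset.sum_le_card_nsmul _ _ _ hfib).trans ?_
    rw [Finset.card_range, smul_eq_mul]
  have hQc : (Q.card : ℝ) = 2^S1.card * D.card := by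
    rw [hQ, Finset.card_product, Finset.card_powerset]; push_cast; rfl
  have hnr : (n:ℝ) ≤ 2*Y+V+2 := by
    rw [hnn]; push_cast
    have := (Nat.ceil_lt_add_one (show 0 ≤ 2*Y+V by linarith)).le
    linarith
  rw [div_le_iff₀ (by linarith)]
  calc (2:ℝ)^S1.card * k ≤ 2^S1.card * D.card := by gcongr
    _ = Q.card := hQc.symm
    _ ≤ n * Delta (∏ p ∈ S, p) := by exact_mod_cast hcard
    _ ≤ (2*Y+V+2) * Delta (∏ p ∈ S, p) := by gcongr
    _ = _ := mul_comm _ _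

end EH

namespace EH

/-! ### reduction to a logarithmic average -/

lemma primes_count : ∃ h : ℝ, 0 < h ∧ ∀ v : ℝ, h ≤ v → Real.exp (v - h) ≤ ((Pr (v-h) v).card : ℝ) * v := by
  obtain ⟨C, hC, hm⟩ := mertens
  refine ⟨C+1, by linarith, fun v hv => ?_⟩
  have h1 := (hm (v-(C+1)) v (by linarith) (by linarith)).1
  have hv0 : 0 ≤ v := by linarith
  have h2 : ∑ p ∈ Pr (v-(C+1)) v, Real.log p * ap p ≤ (Pr (v-(C+1)) v).card • (v * Real.exp (-(v-(C+1)))) := by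
    refine Finset.sum_le_card_nsmul _ _ _ fun p hp => ?_
    obtain ⟨q1, q2, q3⟩ := mem_Pr.1 hp
    have hp0 : (0:ℝ) < p := by exact_mod_cast q1.pos
    refine mul_le_mul q3 ?_ (ap_pos p).le hv0
    refine (ap_le_inv q1.pos).trans ?_
    rw [Real.exp_neg, one_div]
    refine inv_anti₀ (Real.exp_pos _) ?_
    exact ((Real.lt_log_iff_exp_lt hp0).1 q2).le
  rw [nsmul_eq_mul] at h2
  have h3 : 1 ≤ (Pr (v-(C+1)) v).card * (v * Real.exp (-(v-(C+1)))) := by linarith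
  have h4 := mul_le_mul_of_nonneg_right h3 (Real.exp_pos (v-(C+1))).le
  rw [Real.exp_neg] at h4
  have h5 : ((Pr (v-(C+1)) v).card * (v * (Real.exp (v-(C+1)))⁻¹)) * Real.exp (v-(C+1)) = (Pr (v-(C+1)) v).card * v := by
    field_simp
  linarith

lemma wt_eq {P S : Finset ℕ} (hP : ∀ p ∈ P, p.Prime) (hS : S ⊆ P) :
    wt P S = ((∏ p ∈ S, p : ℕ) : ℝ)⁻¹ * ∏ p ∈ P, (1 - ap p) := by
  rw [← Finset.prod_sdiff hS, wt, Nat.cast_prod, ← Finset.prod_inv_distrib, mul_comm (∏ p ∈ P \ S, (1 - ap p)), ← mul_assoc,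
    ← Finset.prod_mul_distrib]
  congr 1
  refine Finset.prod_congr rfl fun p hp => ?_
  have hp0 : (0:ℝ) < p := by exact_mod_cast (hP p (hS hp)).pos
  unfold ap; field_simp; ring

lemma wt_bound (N : ℕ) {S : Finset ℕ} (hS : S ⊆ prs N) :
    wt (prs N) S * (Real.log N / 3) ≤ ((∏ p ∈ S, p : ℕ) : ℝ)⁻¹ := by
  rw [wt_eq (fun p hp => (mem_prs.1 hp).2) hS, mul_assoc]
  refine mul_le_of_le_one_right (by positivity) ?_
  have h0 : 0 ≤ ∏ p ∈ prs N, (1 - ap p) := Finset.prod_nonneg fun p _ => by linarith [ap_le_one p]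
  refine (mul_le_mul_of_nonneg_left (euler_low N) h0).trans ?_
  rw [← Finset.prod_mul_distrib]
  refine Finset.prod_le_one (fun p _ => ?_) fun p _ => ?_
  · exact mul_nonneg (by linarith [ap_le_one p]) (by linarith [ap_pos p])
  · nlinarith [sq_nonneg (ap p)]

lemma log_floor_exp {t : ℝ} (ht : 2 ≤ t) : t / 2 ≤ Real.log (⌊Real.exp t⌋₊ : ℝ) := by
  have h1 : Real.exp t - 1 < ⌊Real.exp t⌋₊ := Nat.sub_one_lt_floor _
  have h2 : Real.exp (t/2) ≤ Real.exp t - 1 := by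
    have e : Real.exp t = Real.exp (t/2) * Real.exp (t/2) := by rw [← Real.exp_add]; ring_nf
    have := Real.add_one_le_exp (t/2)
    nlinarith
  rw [Real.le_log_iff_exp_le (by linarith [Real.exp_pos (t/2)])]
  linarith

lemma sum_inj_le {ι : Type*} (U : Finset ι) (F : ι → ℕ) (B : Finset ℕ) (hinj : Set.InjOn F U) (hB : ∀ y ∈ U, F y ∈ B)
    (f : ℕ → ℝ) (hf : ∀ n, 0 ≤ f n) : ∑ y ∈ U, f (F y) ≤ ∑ n ∈ B, f n := by
  rw [← Finset.sum_image hinj]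
  exact Finset.sum_le_sum_of_subset_of_nonneg (Finset.image_subset_iff.2 hB) fun n _ _ => hf n

theorem reduction : ∃ c x0 : ℝ, 0 < c ∧ 1 ≤ x0 ∧ ∀ x : ℝ, x0 ≤ x →
    c * x * EE (Pr 0 (Real.log x / 80)) (fun S => if ∑ p ∈ S, Real.log p ≤ Real.log x / 2 then (Delta (∏ p ∈ S, p) : ℝ) else 0)
      ≤ ∑ n ∈ Finset.Icc 1 ⌊x⌋₊, (Delta n : ℝ) := by
  obtain ⟨h, hh, hcnt⟩ := primes_count
  refine ⟨Real.exp (-h) / 480, Real.exp (160 + 4 * h), by positivity, Real.one_le_exp (by linarith), fun x hx => ?_⟩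
  have hx0 : 0 < x := (Real.exp_pos _).trans_le hx
  set l := Real.log x with hl
  have hl1 : 160 + 4 * h ≤ l := by rw [hl, Real.le_log_iff_exp_le hx0]; exact hx
  set P := Pr 0 (l/80) with hP
  have hPp : ∀ p ∈ P, p.Prime := fun p hp => (mem_Pr.1 hp).1
  set v : Finset ℕ → ℝ := fun S => l - ∑ p ∈ S, Real.log p with hv
  set G := P.powerset.filter (fun S : Finset ℕ => ∑ p ∈ S, Real.log p ≤ l/2) with hG
  set U : Finset (Σ _ : Finset ℕ, ℕ) := G.sigma fun S => Pr (v S - h) (v S) with hU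
  have hGm : ∀ S ∈ G, S ⊆ P ∧ l/2 ≤ v S ∧ v S ≤ l := by
    intro S hS
    obtain ⟨h1, h2⟩ := Finset.mem_filter.1 hS
    have : 0 ≤ ∑ p ∈ S, Real.log p := Finset.sum_nonneg fun p _ => Real.log_natCast_nonneg p
    refine ⟨Finset.mem_powerset.1 h1, ?_, ?_⟩ <;> rw [hv] <;> dsimp only <;> linarith
  have hUm : ∀ y ∈ U, y.1 ∈ G ∧ y.1 ⊆ P ∧ y.2.Prime ∧ l/80 < Real.log y.2 ∧ Real.log y.2 ≤ v y.1 := by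
    intro y hy
    obtain ⟨h1, h2⟩ := Finset.mem_sigma.1 hy
    obtain ⟨a1, a2, a3⟩ := hGm _ h1
    obtain ⟨b1, b2, b3⟩ := mem_Pr.1 h2
    exact ⟨h1, a1, b1, by linarith, b3⟩
  set F : (Σ _ : Finset ℕ, ℕ) → ℕ := fun y => (∏ p ∈ y.1, p) * y.2 with hF
  have hdvd : ∀ y, (∏ p ∈ y.1, p) ∣ F y := fun y => Nat.dvd_mul_right _ _
  have hpos : ∀ y ∈ U, 0 < F y := fun y hy => by
    obtain ⟨_, a2, a3, _, _⟩ := hUm y hy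
    exact Nat.mul_pos (Finset.prod_pos fun p hp => (hPp p (a2 hp)).pos) a3.pos
  have hnot : ∀ y ∈ U, y.2 ∉ P := by
    intro y hy hc
    obtain ⟨_, a2, a3, a4, _⟩ := hUm y hy
    linarith [(mem_Pr.1 hc).2.2]
  have hFins : ∀ y ∈ U, F y = ∏ p ∈ insert y.2 y.1, p := by
    intro y hy
    rw [Finset.prod_insert fun hc => hnot y hy ((hUm y hy).2.1 hc), mul_comm]
  have hpr : ∀ y ∈ U, ∀ p ∈ insert y.2 y.1, p.Prime := by
    intro y hy p hp
    obtain ⟨_, a2, a3, a4, _⟩ := hUm y hy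
    rcases Finset.mem_insert.1 hp with rfl | h1
    · exact a3
    · exact hPp p (a2 h1)
  have hinj : Set.InjOn F U := by
    intro y hy z hz hyz
    have hy := Finset.mem_coe.1 hy
    have hz := Finset.mem_coe.1 hz
    rw [hFins y hy, hFins z hz] at hyz
    have e := prod_inj (hpr y hy) (hpr z hz) hyz
    have k : ∀ y ∈ U, (insert y.2 y.1) ∩ P = y.1 ∧ insert y.2 y.1 \ P = {y.2} := by
      intro y hy
      have h1 := hnot y hy
      have h2 := (hUm y hy).2.1
      constructor
      · rw [Finset.insert_inter_of_notMem h1, Finset.inter_eq_left.2 h2]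
      · rw [Finset.insert_sdiff_of_notMem _ h1, Finset.sdiff_eq_empty_iff_subset.2 h2]
        rfl
    have e1 : y.1 = z.1 := by rw [← (k y hy).1, ← (k z hz).1, e]
    have e2 : y.2 = z.2 := by
      have : ({y.2} : Finset ℕ) = {z.2} := by rw [← (k y hy).2, ← (k z hz).2, e]
      exact Finset.singleton_injective this
    cases y; cases z
    simp only at e1 e2
    subst e1; subst e2; rfl
  have himg : ∀ y ∈ U, F y ∈ Finset.Icc 1 ⌊x⌋₊ := by
    intro y hy
    rw [Finset.mem_Icc]
    refine ⟨hpos y hy, Nat.le_floor ?_⟩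
    obtain ⟨_, a2, a3, a4, a5⟩ := hUm y hy
    have hp0 : (0:ℝ) < F y := by exact_mod_cast hpos y hy
    rw [← Real.log_le_log_iff hp0 hx0, hF]
    dsimp only
    have m0 : ((∏ p ∈ y.1, p : ℕ) : ℝ) ≠ 0 := by
      exact_mod_cast (Finset.prod_pos fun p hp => (hPp p (a2 hp)).pos).ne'
    rw [Nat.cast_mul, Real.log_mul m0 (by exact_mod_cast a3.ne_zero), log_prod_nat fun p hp => hPp p (a2 hp)]
    rw [hv] at a5; dsimp only at a5
    linarith
  have hmain : ∑ S ∈ G, ((Pr (v S - h) (v S)).card : ℝ) * (Delta (∏ p ∈ S, p) : ℝ) ≤ ∑ n ∈ Finset.Icc 1 ⌊x⌋₊, (Delta n : ℝ) := by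
    calc ∑ S ∈ G, ((Pr (v S - h) (v S)).card : ℝ) * (Delta (∏ p ∈ S, p) : ℝ)
        = ∑ y ∈ U, (Delta (∏ p ∈ y.1, p) : ℝ) := by
          rw [hU, Finset.sum_sigma]
          refine Finset.sum_congr rfl fun S _ => ?_
          symm
          refine (Finset.sum_const (s := Pr (v S - h) (v S)) (Delta (∏ p ∈ S, p) : ℝ)).trans (nsmul_eq_mul _ _)
      _ ≤ ∑ y ∈ U, (Delta (F y) : ℝ) := by
          refine Finset.sum_le_sum fun y hy => ?_
          exact Nat.cast_le.2 (Delta_mono (hpos y hy).ne' (hdvd y))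
      _ ≤ _ := sum_inj_le U F _ hinj himg (fun n => (Delta n : ℝ)) fun n => Nat.cast_nonneg _
  refine le_trans ?_ hmain
  rw [EE, Finset.mul_sum, hG, Finset.sum_filter]
  refine Finset.sum_le_sum fun S hS => ?_
  by_cases hc : ∑ p ∈ S, Real.log p ≤ l/2
  swap
  · rw [if_neg hc, if_neg hc, mul_zero, mul_zero]
  rw [if_pos hc, if_pos hc, ← mul_assoc]
  refine mul_le_mul_of_nonneg_right ?_ (by positivity)
  have hSG : S ∈ G := Finset.mem_filter.2 ⟨hS, hc⟩
  obtain ⟨a1, a2, a3⟩ := hGm S hSG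
  have b1 := hcnt (v S) (by linarith)
  have hPz : P = prs ⌊Real.exp (l/80)⌋₊ := by rw [hP, Pr_zero]
  have b2 := wt_bound ⌊Real.exp (l/80)⌋₊ (hPz ▸ a1)
  rw [← hPz] at b2
  have b3 := log_floor_exp (t := l/80) (by linarith)
  have hl0 : 0 < l := by linarith
  have hm0 : (0:ℝ) < ((∏ p ∈ S, p : ℕ) : ℝ) := by
    exact_mod_cast (Finset.prod_pos fun p hp => (hPp p (a1 hp)).pos)
  have b4 : Real.exp (v S - h) = Real.exp (-h) * x * ((∏ p ∈ S, p : ℕ) : ℝ)⁻¹ := by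
    have : v S - h = -h + l + -(∑ p ∈ S, Real.log p) := by rw [hv]; ring
    rw [this, ← log_prod_nat fun p hp => hPp p (a1 hp), Real.exp_add, Real.exp_add, Real.exp_neg (Real.log _),
      Real.exp_log hm0, hl, Real.exp_log hx0]
  have b5 : wt P S * l ≤ 480 * ((∏ p ∈ S, p : ℕ) : ℝ)⁻¹ := by
    have := mul_le_mul_of_nonneg_left b3 (wt_nonneg P S)
    linarith
  have b6 : Real.exp (v S - h) ≤ ((Pr (v S - h) (v S)).card : ℝ) * l := b1.trans (by gcongr)
  rw [b4] at b6
  refine le_of_mul_le_mul_right ?_ hl0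
  refine le_trans ?_ b6
  have := mul_le_mul_of_nonneg_left b5 (show 0 ≤ Real.exp (-h) / 480 * x by positivity)
  linarith

end EH

namespace EH

/-! ### the peak argument -/

lemma EE_prodc (P : Finset ℕ) (c : ℝ) : EE P (fun S => c ^ S.card) = ∏ p ∈ P, (1 + (c - 1) * ap p) := by
  induction P using Finset.induction_on with
  | empty => rw [EE_empty]; simp
  | insert p P hp ih =>
    rw [EE_insert hp, Finset.prod_insert hp, ← ih]
    have : EE P (fun S => c ^ (insert p S).card) = EE P (fun S => c * c ^ S.card) := by
      refine EE_congr fun S hS => ?_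
      rw [Finset.card_insert_of_notMem fun h => hp (hS h), pow_succ, mul_comm]
    rw [this, EE_smul]; ring

noncomputable def Eu (Q : Finset ℕ) : ℝ := ∏ p ∈ Q, (1 + ap p)

lemma Eu_pos (Q : Finset ℕ) : 0 < Eu Q := Finset.prod_pos fun p _ => by linarith [ap_pos p]

noncomputable def Mt (Q S : Finset ℕ) : ℝ := 2 ^ (S ∩ Q).card / Eu Q

lemma Mt_pos (Q S : Finset ℕ) : 0 < Mt Q S := div_pos (by positivity) (Eu_pos Q)

lemma EE_Mt_self (Q : Finset ℕ) : EE Q (fun S => (2:ℝ) ^ S.card / Eu Q) = 1 := by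
  have : (fun S : Finset ℕ => (2:ℝ) ^ S.card / Eu Q) = fun S => (Eu Q)⁻¹ * 2 ^ S.card := by
    funext S; rw [div_eq_inv_mul]
  rw [this, EE_smul, EE_prodc]
  have e : ∏ p ∈ Q, (1 + ((2:ℝ) - 1) * ap p) = Eu Q := by
    unfold Eu; refine Finset.prod_congr rfl fun p _ => by ring
  rw [e, inv_mul_cancel₀ (Eu_pos Q).ne']

lemma EE_Mt {P Q : Finset ℕ} (h : Q ⊆ P) : EE P (Mt Q) = 1 := by
  rw [← EE_Mt_self Q]
  exact EE_marg h (fun S => (2:ℝ)^S.card / Eu Q)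

lemma EE_Mt_mul {P Q : Finset ℕ} (h : Q ⊆ P) (g : Finset ℕ → ℝ) :
    EE P (fun S => Mt Q S * g (S \ Q)) = EE (P \ Q) g := by
  have e : P = Q ∪ (P \ Q) := by rw [Finset.union_sdiff_of_subset h]
  have h1 := EE_mul (P := Q) (Q := P \ Q) Finset.disjoint_sdiff (fun S => (2:ℝ)^S.card / Eu Q) g
  rw [EE_Mt_self, one_mul, ← e] at h1
  rw [← h1]
  refine EE_congr fun S hS => ?_
  have : S ∩ (P \ Q) = S \ Q := by
    ext x; simp only [Finset.mem_inter, Finset.mem_sdiff]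
    exact ⟨fun a => ⟨a.1, a.2.2⟩, fun a => ⟨a.1, hS a.1, a.2⟩⟩
  rw [this]; rfl

lemma EE_Mt_ind {P Q : Finset ℕ} (h : Q ⊆ P) {q : ℕ} (hq : q ∈ P) :
    EE P (fun S => Mt Q S * (if q ∈ S then 1 else 0)) ≤ 2 * ap q := by
  have e : P = insert q (P.erase q) := (Finset.insert_erase hq).symm
  have hn : q ∉ P.erase q := Finset.notMem_erase q P
  have h1 : EE (P.erase q) (fun S => Mt Q S * (if q ∈ S then 1 else 0)) = 0 := by
    refine (EE_congr (g := fun _ => 0) fun S hS => ?_).trans (EE_const _ _)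
    rw [if_neg fun hc => hn (hS hc), mul_zero]
  have hge : ∀ S, Mt Q S ≤ Mt Q (insert q S) := by
    intro S; unfold Mt
    refine div_le_div_of_nonneg_right ?_ (Eu_pos Q).le
    exact pow_le_pow_right₀ (by norm_num) (Finset.card_le_card (Finset.inter_subset_inter_right (Finset.subset_insert _ _)))
  have hle : ∀ S, Mt Q (insert q S) ≤ 2 * Mt Q S := by
    intro S; unfold Mt
    rw [← mul_div_assoc]
    refine div_le_div_of_nonneg_right ?_ (Eu_pos Q).le
    rw [← pow_succ']
    refine pow_le_pow_right₀ (by norm_num) ?_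
    refine (Finset.card_le_card (t := insert q (S ∩ Q)) ?_).trans (Finset.card_insert_le _ _)
    intro x; simp only [Finset.mem_inter, Finset.mem_insert]; tauto
  have h2 : EE (P.erase q) (Mt Q) ≤ 1 := by
    rw [← EE_Mt h]
    conv_rhs => rw [e]
    rw [EE_insert hn]
    have : EE (P.erase q) (Mt Q) ≤ EE (P.erase q) (fun S => Mt Q (insert q S)) := EE_mono fun S _ => hge S
    nlinarith [ap_pos q]
  have h3 : EE (P.erase q) (fun S => Mt Q (insert q S) * (if q ∈ insert q S then 1 else 0)) ≤ 2 * EE (P.erase q) (Mt Q) := by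
    rw [← EE_smul]
    refine EE_mono fun S _ => ?_
    rw [if_pos (Finset.mem_insert_self _ _), mul_one]; exact hle S
  conv_lhs => rw [e]
  rw [EE_insert hn, h1]
  nlinarith [ap_pos q]

lemma EE_Mt_log {P Q R : Finset ℕ} (h : Q ⊆ P) (hR : R ⊆ P) :
    EE P (fun S => Mt Q S * ∑ p ∈ S ∩ R, Real.log p) ≤ 2 * ∑ p ∈ R, Real.log p * ap p := by
  have e : EE P (fun S => Mt Q S * ∑ p ∈ S ∩ R, Real.log p) =
      EE P (fun S => ∑ p ∈ R, Real.log p * (Mt Q S * (if p ∈ S then 1 else 0))) := by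
    refine EE_congr fun S hS => ?_
    rw [Finset.inter_comm, ← Finset.filter_mem_eq_inter, Finset.sum_filter, Finset.mul_sum]
    refine Finset.sum_congr rfl fun p _ => ?_
    split_ifs <;> ring
  rw [e, EE_sum, Finset.mul_sum]
  refine Finset.sum_le_sum fun p hp => ?_
  rw [EE_smul]
  have := mul_le_mul_of_nonneg_left (EE_Mt_ind h (hR hp)) (Real.log_natCast_nonneg p)
  linarith

lemma sqrt2_ineq {a : ℝ} (h0 : 0 ≤ a) (h1 : a ≤ 1/3) : (1 + (Real.sqrt 2 - 1) * a)^2 ≤ (1 + a) * Real.exp (-(2/25 * a)) := by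
  have hs : Real.sqrt 2 ≤ 1.41422 := by
    rw [Real.sqrt_le_left (by norm_num)]; norm_num
  have hs1 : 1 ≤ Real.sqrt 2 := by rw [Real.one_le_sqrt]; norm_num
  have he := Real.add_one_le_exp (-(2/25 * a))
  have k1 : (1 + (Real.sqrt 2 - 1) * a)^2 ≤ (1 + 0.41422 * a)^2 := by
    have : (Real.sqrt 2 - 1) * a ≤ 0.41422 * a := by nlinarith
    have h3 : 0 ≤ (Real.sqrt 2 - 1) * a := mul_nonneg (by linarith) h0
    gcongr
  have k2 : (1 + 0.41422 * a)^2 ≤ (1 + a) * (-(2/25 * a) + 1) := by nlinarith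
  have k3 := mul_le_mul_of_nonneg_left he (show 0 ≤ 1 + a by linarith)
  linarith

lemma EE_sqrt {R : Finset ℕ} (hR : ∀ p ∈ R, p.Prime) :
    EE R (fun S => Real.sqrt (2 ^ S.card / Eu R)) ≤ Real.exp (-(1/25 * ∑ p ∈ R, ap p)) := by
  have e : (fun S : Finset ℕ => Real.sqrt (2 ^ S.card / Eu R)) = fun S => (Real.sqrt (Eu R))⁻¹ * (Real.sqrt 2) ^ S.card := by
    funext S
    rw [Real.sqrt_div (by positivity), div_eq_inv_mul]
    congr 1
    rw [Real.sqrt_eq_iff_mul_self_eq (by positivity) (by positivity), ← mul_pow, Real.mul_self_sqrt (by norm_num)]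
  have hs1 : 1 ≤ Real.sqrt 2 := by rw [Real.one_le_sqrt]; norm_num
  rw [e, EE_smul, EE_prodc, ← div_eq_inv_mul, div_le_iff₀ (Real.sqrt_pos.2 (Eu_pos R))]
  refine le_of_sq_le_sq ?_ (by positivity)
  rw [mul_pow, Real.sq_sqrt (Eu_pos R).le, ← Finset.prod_pow, ← Real.exp_nat_mul]
  have : Real.exp ((2:ℕ) * -(1/25 * ∑ p ∈ R, ap p)) = ∏ p ∈ R, Real.exp (-(2/25 * ap p)) := by
    rw [← Real.exp_sum, Finset.sum_neg_distrib, ← Finset.mul_sum]; push_cast; ring_nf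
  rw [this, Eu, ← Finset.prod_mul_distrib]
  refine Finset.prod_le_prod (fun p _ => sq_nonneg _) fun p hp => ?_
  rw [mul_comm (Real.exp _)]
  refine sqrt2_ineq (ap_pos p).le ?_
  unfold ap
  have : (2:ℝ) ≤ p := by exact_mod_cast (hR p hp).two_le
  exact one_div_le_one_div_of_le (by norm_num) (by linarith)

lemma EE_sqrt_Mt {P Q1 Q2 : Finset ℕ} (hP : ∀ p ∈ P, p.Prime) (h1 : Q1 ⊆ Q2) (h2 : Q2 ⊆ P) :
    EE P (fun S => Real.sqrt (Mt Q1 S * Mt Q2 S)) ≤ Real.exp (-(1/25 * ∑ p ∈ Q2 \ Q1, ap p)) := by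
  have hR : ∀ p ∈ Q2 \ Q1, p.Prime := fun p hp => hP p (h2 (Finset.sdiff_subset hp))
  refine le_trans (le_of_eq ?_) (EE_sqrt hR)
  have h3 : Q2 \ Q1 ⊆ P \ Q1 := Finset.sdiff_subset_sdiff h2 (Finset.Subset.refl _)
  rw [← EE_marg h3 (fun S => Real.sqrt (2 ^ S.card / Eu (Q2 \ Q1))), ← EE_Mt_mul (h1.trans h2)]
  refine EE_congr fun S hS => ?_
  have e1 : Eu Q2 = Eu Q1 * Eu (Q2 \ Q1) := by
    unfold Eu; rw [mul_comm, Finset.prod_sdiff h1]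
  have e2 : (S ∩ Q2).card = (S ∩ Q1).card + ((S \ Q1) ∩ (Q2 \ Q1)).card := by
    rw [← Finset.card_union_of_disjoint]
    · congr 1; ext x; simp only [Finset.mem_inter, Finset.mem_union, Finset.mem_sdiff]
      constructor
      · rintro ⟨a, b⟩
        by_cases hx : x ∈ Q1
        · exact Or.inl ⟨a, hx⟩
        · exact Or.inr ⟨⟨a, hx⟩, b, hx⟩
      · rintro (⟨a, b⟩ | ⟨⟨a, b⟩, c, d⟩)
        · exact ⟨a, h1 b⟩
        · exact ⟨a, c⟩
    · rw [Finset.disjoint_left]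
      intro x hx hy
      simp only [Finset.mem_inter, Finset.mem_sdiff] at hx hy
      exact hy.2.2 hx.2
  have e3 : Mt Q1 S * Mt Q2 S = Mt Q1 S ^ 2 * (2 ^ ((S \ Q1) ∩ (Q2 \ Q1)).card / Eu (Q2 \ Q1)) := by
    unfold Mt; rw [e1, e2, pow_add]
    have := (Eu_pos Q1).ne'
    have := (Eu_pos (Q2 \ Q1)).ne'
    field_simp
  rw [e3, Real.sqrt_mul (sq_nonneg _), Real.sqrt_sq (Mt_pos _ _).le]

def Peak (J : Finset ℕ) (Q : ℕ → Finset ℕ) (j : ℕ) (S : Finset ℕ) : Prop := ∀ i ∈ J, i ≠ j → Mt (Q i) S < Mt (Q j) S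

lemma peak_sum_le (J : Finset ℕ) (Q : ℕ → Finset ℕ) (S : Finset ℕ) (g : ℕ → ℝ) (B : ℝ) (hB : 0 ≤ B)
    (hg : ∀ j ∈ J, g j ≤ B) : ∑ j ∈ J, (if Peak J Q j S then g j else 0) ≤ B := by
  by_cases h : ∃ j ∈ J, Peak J Q j S
  · obtain ⟨j, hj, hp⟩ := h
    rw [Finset.sum_eq_single_of_mem j hj, if_pos hp]
    · exact hg j hj
    · intro i hi hij
      rw [if_neg]
      intro hpi
      exact lt_asymm (hp i hi hij) (hpi j hj hij.symm)
  · push Not at h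
    rw [Finset.sum_eq_zero fun j hj => if_neg (h j hj)]
    exact hB

theorem peak {P : Finset ℕ} (hP : ∀ p ∈ P, p.Prime) (J : Finset ℕ) (Q : ℕ → Finset ℕ) (hQP : ∀ j ∈ J, Q j ⊆ P)
    (hmono : ∀ i j, i ≤ j → Q i ⊆ Q j) {k l : ℝ} {Y V : ℕ → ℝ} (hk : 0 ≤ k) (hl : 0 < l) (hY : ∀ j ∈ J, 0 ≤ Y j)
    (hV : ∀ j ∈ J, 0 < V j)
    (h1 : ∀ j ∈ J, ∑ i ∈ J.erase j, Real.exp (-(1/25 * ∑ p ∈ Q (max i j) \ Q (min i j), ap p)) ≤ 1/10)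
    (h2 : ∀ j ∈ J, EE (P \ Q j) (fun S => if Many k (Y j) S then 0 else 1) ≤ 1/10)
    (h3 : ∀ j ∈ J, ∑ p ∈ Q j, Real.log p * ap p ≤ V j / 20)
    (h4 : ∑ p ∈ P, Real.log p * ap p ≤ l / 40) :
    ∑ j ∈ J, (1/2) * (Eu (Q j) * k / (2 * Y j + V j + 2)) ≤
      EE P (fun S => if ∑ p ∈ S, Real.log p ≤ l / 2 then (Delta (∏ p ∈ S, p) : ℝ) else 0) := by
  let A : ℕ → Finset ℕ → Prop := fun j S => Many k (Y j) (S \ Q j) ∧ ∑ p ∈ S ∩ Q j, Real.log p ≤ V j ∧ ∑ p ∈ S, Real.log p ≤ l/2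
  have key : ∀ j ∈ J, 1/2 ≤ EE P (fun S => if Peak J Q j S then (if A j S then Mt (Q j) S else 0) else 0) := by
    intro j hj
    have hpt : ∀ S ⊆ P, Mt (Q j) S ≤ (if Peak J Q j S then (if A j S then Mt (Q j) S else 0) else 0) +
        (∑ i ∈ J.erase j, Real.sqrt (Mt (Q (min i j)) S * Mt (Q (max i j)) S) +
        (Mt (Q j) S * (if Many k (Y j) (S \ Q j) then 0 else 1) +
        ((V j)⁻¹ * (Mt (Q j) S * ∑ p ∈ S ∩ Q j, Real.log p) + (l/2)⁻¹ * (Mt (Q j) S * ∑ p ∈ S ∩ P, Real.log p)))) := by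
      intro S hS
      have hM := Mt_pos (Q j) S
      have n1 : 0 ≤ ∑ i ∈ J.erase j, Real.sqrt (Mt (Q (min i j)) S * Mt (Q (max i j)) S) := Finset.sum_nonneg fun _ _ => Real.sqrt_nonneg _
      have n2 : 0 ≤ Mt (Q j) S * (if Many k (Y j) (S \ Q j) then (0:ℝ) else 1) := mul_nonneg hM.le (by split_ifs <;> norm_num)
      have hl0 : ∀ T : Finset ℕ, 0 ≤ ∑ p ∈ T, Real.log p := fun T => Finset.sum_nonneg fun p _ => Real.log_natCast_nonneg p
      have n3 : 0 ≤ (V j)⁻¹ * (Mt (Q j) S * ∑ p ∈ S ∩ Q j, Real.log p) :=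
        mul_nonneg (inv_nonneg.2 (hV j hj).le) (mul_nonneg hM.le (hl0 _))
      have n4 : 0 ≤ (l/2)⁻¹ * (Mt (Q j) S * ∑ p ∈ S ∩ P, Real.log p) :=
        mul_nonneg (by positivity) (mul_nonneg hM.le (hl0 _))
      have n5 : 0 ≤ (if Peak J Q j S then (if A j S then Mt (Q j) S else 0) else 0) := by
        split_ifs <;> linarith
      by_cases c1 : Peak J Q j S
      swap
      · have c1' := c1
        unfold Peak at c1'
        push Not at c1'
        obtain ⟨i, hi, hij, hle⟩ := c1'
        have : Mt (Q j) S ≤ Real.sqrt (Mt (Q (min i j)) S * Mt (Q (max i j)) S) := by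
          refine Real.le_sqrt_of_sq_le ?_
          rcases le_total i j with h | h
          · rw [min_eq_left h, max_eq_right h]; nlinarith
          · rw [min_eq_right h, max_eq_left h]; nlinarith
        have := this.trans (Finset.single_le_sum (f := fun i => Real.sqrt (Mt (Q (min i j)) S * Mt (Q (max i j)) S))
          (fun _ _ => Real.sqrt_nonneg _) (Finset.mem_erase.2 ⟨hij, hi⟩))
        linarith
      by_cases c2 : Many k (Y j) (S \ Q j)
      swap
      · have : Mt (Q j) S * (if Many k (Y j) (S \ Q j) then (0:ℝ) else 1) = Mt (Q j) S := by rw [if_neg c2, mul_one]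
        linarith
      by_cases c3 : ∑ p ∈ S ∩ Q j, Real.log p ≤ V j
      swap
      · push Not at c3
        have : Mt (Q j) S ≤ (V j)⁻¹ * (Mt (Q j) S * ∑ p ∈ S ∩ Q j, Real.log p) := by
          rw [← div_eq_inv_mul, le_div_iff₀ (hV j hj)]
          exact mul_le_mul_of_nonneg_left c3.le hM.le
        linarith
      by_cases c4 : ∑ p ∈ S, Real.log p ≤ l/2
      swap
      · push Not at c4
        have : Mt (Q j) S ≤ (l/2)⁻¹ * (Mt (Q j) S * ∑ p ∈ S ∩ P, Real.log p) := by
          rw [← div_eq_inv_mul, le_div_iff₀ (by positivity), Finset.inter_eq_left.2 hS]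
          exact mul_le_mul_of_nonneg_left c4.le hM.le
        linarith
      have : (if Peak J Q j S then (if A j S then Mt (Q j) S else 0) else 0) = Mt (Q j) S := by
        rw [if_pos c1, if_pos (show A j S from ⟨c2, c3, c4⟩)]
      linarith
    have hE := EE_mono hpt
    simp only [EE_add, EE_smul] at hE
    rw [EE_sum, EE_Mt_mul (hQP j hj) (fun S => if Many k (Y j) S then 0 else 1)] at hE
    have e0 : EE P (fun S => Mt (Q j) S) = 1 := EE_Mt (hQP j hj)
    rw [e0] at hE
    have b1 : ∑ i ∈ J.erase j, EE P (fun S => Real.sqrt (Mt (Q (min i j)) S * Mt (Q (max i j)) S)) ≤ 1/10 := by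
      refine (Finset.sum_le_sum fun i hi => ?_).trans (h1 j hj)
      refine EE_sqrt_Mt hP (hmono _ _ (min_le_max)) ?_
      rcases le_total i j with h | h
      · rw [max_eq_right h]; exact hQP j hj
      · rw [max_eq_left h]; exact hQP i (Finset.mem_erase.1 hi).2
    have b2 := h2 j hj
    have b3 : (V j)⁻¹ * EE P (fun S => Mt (Q j) S * ∑ p ∈ S ∩ Q j, Real.log p) ≤ 1/10 := by
      rw [← div_eq_inv_mul, div_le_iff₀ (hV j hj)]
      have := EE_Mt_log (hQP j hj) (hQP j hj)
      linarith [h3 j hj]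
    have b4 : (l/2)⁻¹ * EE P (fun S => Mt (Q j) S * ∑ p ∈ S ∩ P, Real.log p) ≤ 1/10 := by
      rw [← div_eq_inv_mul, div_le_iff₀ (by positivity)]
      have := EE_Mt_log (hQP j hj) (Finset.Subset.refl P)
      linarith
    linarith
  calc ∑ j ∈ J, (1/2) * (Eu (Q j) * k / (2 * Y j + V j + 2))
      ≤ ∑ j ∈ J, (Eu (Q j) * k / (2 * Y j + V j + 2)) * EE P (fun S => if Peak J Q j S then (if A j S then Mt (Q j) S else 0) else 0) := by
        refine Finset.sum_le_sum fun j hj => ?_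
        rw [mul_comm]
        refine mul_le_mul_of_nonneg_left (key j hj) ?_
        have := hY j hj
        have := hV j hj
        have := Eu_pos (Q j)
        positivity
    _ = EE P (fun S => ∑ j ∈ J, (Eu (Q j) * k / (2 * Y j + V j + 2)) * (if Peak J Q j S then (if A j S then Mt (Q j) S else 0) else 0)) := by
        rw [EE_sum]; simp only [EE_smul]
    _ ≤ _ := by
        refine EE_mono fun S hS => ?_
        have hSp : ∀ p ∈ S, p.Prime := fun p hp => hP p (hS hp)
        have hr : ∀ j ∈ J, (Eu (Q j) * k / (2 * Y j + V j + 2)) * (if Peak J Q j S then (if A j S then Mt (Q j) S else 0) else 0) =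
          if Peak J Q j S then (if A j S then (2:ℝ) ^ (S ∩ Q j).card * k / (2 * Y j + V j + 2) else 0) else 0 := by
          intro j hj
          split_ifs
          · unfold Mt
            have := (Eu_pos (Q j)).ne'
            field_simp
          · rw [mul_zero]
          · rw [mul_zero]
        rw [Finset.sum_congr rfl hr]
        have hnn : (0:ℝ) ≤ if ∑ p ∈ S, Real.log p ≤ l / 2 then (Delta (∏ p ∈ S, p) : ℝ) else 0 := by
          split_ifs
          · exact Nat.cast_nonneg _
          · exact le_rfl
        refine peak_sum_le J Q S _ _ hnn fun j hj => ?_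
        split_ifs with a1 a2 a2
        · exact pigeon hSp Finset.inter_subset_left Finset.sdiff_subset (by
            rw [Finset.disjoint_left]; intro x hx hy
            exact (Finset.mem_sdiff.1 hy).2 (Finset.mem_inter.1 hx).2) (hY j hj) a1.2.1 a1.1
        · exact absurd a1.2.2 a2
        · exact Nat.cast_nonneg _
        · exact le_rfl

end EH

namespace EH

/-! ### instantiation -/

lemma Pr_sub {u u' v v' : ℝ} (h1 : u' ≤ u) (h2 : v ≤ v') : Pr u v ⊆ Pr u' v' := by
  intro p hp
  obtain ⟨a, b, c⟩ := mem_Pr.1 hp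
  exact mem_Pr.2 ⟨a, h1.trans_lt b, c.trans h2⟩

lemma sep : ∃ k0 : ℕ, ∀ i j : ℕ, k0 ≤ i → i ≤ j → ((j:ℝ) - i)/2 ≤ ∑ p ∈ Pr (Real.exp i) (Real.exp j), ap p := by
  obtain ⟨C, hC, hm⟩ := mass
  obtain ⟨k0, hk0⟩ := exists_nat_gt (10 * C)
  refine ⟨k0, fun i j hi hij => ?_⟩
  induction j, hij using Nat.le_induction with
  | base => rw [sub_self, zero_div]; exact Finset.sum_nonneg fun p _ => (ap_pos p).le
  | succ j hij ih =>
    have h1 : Real.exp i ≤ Real.exp j := Real.exp_le_exp.2 (by exact_mod_cast hij)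
    have h2 : Real.exp j ≤ Real.exp ((j+1:ℕ):ℝ) := Real.exp_le_exp.2 (by push_cast; linarith)
    rw [Pr_split h1 h2, Finset.sum_union (Pr_disj le_rfl)]
    have h3 := (hm _ _ (Real.exp_pos j) h2).1
    have h4 : (1:ℝ)/2 ≤ (Real.exp ((j+1:ℕ):ℝ) - Real.exp j - C) / Real.exp ((j+1:ℕ):ℝ) := by
      rw [le_div_iff₀ (Real.exp_pos _)]
      push_cast
      rw [Real.exp_add]
      have e1 := Real.exp_one_gt_d9
      have e2 := Real.add_one_le_exp (j:ℝ)
      have e3 : (k0:ℝ) ≤ j := by exact_mod_cast hi.trans hij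
      nlinarith [Real.exp_pos (j:ℝ)]
    push_cast at h3 h4 ⊢
    linarith

lemma geo (U : Finset ℕ) (hU : ∀ n ∈ U, 1 ≤ n) : ∑ n ∈ U, ((1:ℝ)/40)^n ≤ 1/20 := by
  have h0 : 0 ∉ U := fun h => by have := hU 0 h; omega
  have h1 := (summable_geometric_of_lt_one (r := (1:ℝ)/40) (by norm_num) (by norm_num)).sum_le_tsum (insert 0 U) (fun n _ => by positivity)
  rw [tsum_geometric_of_lt_one (by norm_num) (by norm_num), Finset.sum_insert h0] at h1
  norm_num at h1 ⊢
  linarith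

lemma geo2 (J : Finset ℕ) (j : ℕ) : ∑ i ∈ J.erase j, ((1:ℝ)/40)^(max i j - min i j) ≤ 1/10 := by
  rw [← Finset.sum_filter_add_sum_filter_not (J.erase j) (fun i => i < j)]
  have key : ∀ U : Finset ℕ, (∀ i ∈ U, i ≠ j) → Set.InjOn (fun i => max i j - min i j) U →
      ∑ i ∈ U, ((1:ℝ)/40)^(max i j - min i j) ≤ 1/20 := by
    intro U hU hinj
    rw [← Finset.sum_image (f := fun n => ((1:ℝ)/40)^n) hinj]
    refine geo _ fun n hn => ?_
    obtain ⟨i, hi, rfl⟩ := Finset.mem_image.1 hn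
    have := hU i hi
    omega
  have a1 := key ((J.erase j).filter (fun i => i < j)) (fun i hi => by
    have := (Finset.mem_filter.1 hi).2; omega) (by
    intro i hi i' hi' h
    have := (Finset.mem_filter.1 (Finset.mem_coe.1 hi)).2
    have := (Finset.mem_filter.1 (Finset.mem_coe.1 hi')).2
    dsimp only at h
    omega)
  have a2 := key ((J.erase j).filter (fun i => ¬ i < j)) (fun i hi => by
    have := Finset.mem_filter.1 hi; have := Finset.mem_erase.1 this.1; exact this.1) (by
    intro i hi i' hi' h
    have := (Finset.mem_filter.1 (Finset.mem_coe.1 hi)).2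
    have := (Finset.mem_filter.1 (Finset.mem_coe.1 hi')).2
    dsimp only at h
    omega)
  linarith

lemma exp_five (n : ℕ) : Real.exp (-(5 * (n:ℝ))) ≤ (1/40)^n := by
  have h : Real.exp (-5) ≤ 1/40 := by
    rw [Real.exp_neg, one_div]
    refine inv_anti₀ (by norm_num) ?_
    have e : Real.exp 5 = Real.exp 1 ^ 5 := by rw [← Real.exp_nat_mul]; norm_num
    rw [e]
    have := Real.exp_one_gt_d9
    calc (40:ℝ) ≤ 2.7^5 := by norm_num
      _ ≤ _ := by gcongr; linarith
  calc Real.exp (-(5 * (n:ℝ))) = Real.exp (-5) ^ n := by rw [← Real.exp_nat_mul]; ring_nf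
    _ ≤ _ := by gcongr

noncomputable def Qt (t : ℕ) : Finset ℕ := Pr 0 (Real.exp ((250 * t : ℕ) : ℝ))

lemma Qt_mono (i j : ℕ) (h : i ≤ j) : Qt i ⊆ Qt j :=
  Pr_sub le_rfl (Real.exp_le_exp.2 (by exact_mod_cast Nat.mul_le_mul_left _ h))

lemma Qt_sdiff {i j : ℕ} (h : i ≤ j) : Qt j \ Qt i = Pr (Real.exp ((250 * i : ℕ) : ℝ)) (Real.exp ((250 * j : ℕ) : ℝ)) := by
  unfold Qt
  have h1 : Real.exp ((250 * i : ℕ) : ℝ) ≤ Real.exp ((250 * j : ℕ) : ℝ) := Real.exp_le_exp.2 (by exact_mod_cast Nat.mul_le_mul_left _ h)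
  rw [Pr_split (Real.exp_pos _).le h1, Finset.union_sdiff_cancel_left (Pr_disj le_rfl)]

lemma sep2 : ∃ k0 : ℕ, ∀ J : Finset ℕ, (∀ t ∈ J, k0 ≤ t) → ∀ j ∈ J,
    ∑ i ∈ J.erase j, Real.exp (-(1/25 * ∑ p ∈ Qt (max i j) \ Qt (min i j), ap p)) ≤ 1/10 := by
  obtain ⟨k0, hk⟩ := sep
  refine ⟨k0, fun J hJ j hj => (Finset.sum_le_sum fun i hi => ?_).trans (geo2 J j)⟩
  have hi' := hJ i (Finset.mem_erase.1 hi).2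
  have hj' := hJ j hj
  have hmm : min i j ≤ max i j := min_le_max
  rw [Qt_sdiff hmm]
  refine le_trans (Real.exp_le_exp.2 ?_) (exp_five _)
  have := hk (250 * min i j) (250 * max i j) (by omega) (by omega)
  have e : (((max i j - min i j : ℕ)) : ℝ) = ((max i j : ℕ):ℝ) - ((min i j : ℕ) : ℝ) := Nat.cast_sub hmm
  rw [e]
  rw [Nat.cast_mul, Nat.cast_mul] at this
  norm_num only [Nat.cast_ofNat] at this
  rw [Nat.cast_mul, Nat.cast_mul]
  norm_num only [Nat.cast_ofNat]
  linarith

lemma window_many {r N1 B M : ℕ} {δ σ X L0 c L b : ℝ} (hδ : 0 < δ) (hσ : 0 < σ) (hσ1 : σ < 1) (hX : 0 < X) (hc : 0 < c)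
    (hB : 2 ≤ c * B) (hB1 : 1 ≤ B) (hL0 : 1 ≤ L0) (hM : 0 < M)
    (hW : ∀ N : ℕ, N1 ≤ N → ∀ L : ℝ, L0 ≤ L →
      EE (Pr (L * Real.exp (σ * c * N)) (L * Real.exp (2 * σ * N)))
        (fun S => if Succ r (fun p : ℕ => Real.log p) (X * L) S then 0 else 1) ≤ δ)
    (hL : L0 ≤ L) (hb : L * Real.exp (2 * (N1 * (B:ℝ)^M)) ≤ b) :
    EE (Pr 0 b \ Pr 0 L) (fun S => if Many ((2:ℝ)^((r:ℝ)*(1-10*δ)*M)) (M*(X*L)) S then 0 else 1) ≤ 1/10 := by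
  have hLp : 0 < L := by linarith
  set W : ℕ → Finset ℕ := fun w => Pr (L * Real.exp (σ * c * (N1 * B^w : ℕ))) (L * Real.exp (2 * σ * (N1 * B^w : ℕ))) with hWd
  have hlt : ∀ i j, i < j → Disjoint (W i) (W j) := by
    intro i j hij
    refine Pr_disj (mul_le_mul_of_nonneg_left (Real.exp_le_exp.2 ?_) hLp.le)
    have h1 : B * (N1 * B^i) ≤ N1 * B^j := by
      calc B * (N1 * B^i) = N1 * B^(i+1) := by ring
        _ ≤ _ := Nat.mul_le_mul_left _ (Nat.pow_le_pow_right hB1 hij)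
    have h2 : (B:ℝ) * (N1 * B^i : ℕ) ≤ (N1 * B^j : ℕ) := by exact_mod_cast h1
    have h3 : (0:ℝ) ≤ (N1 * B^i : ℕ) := Nat.cast_nonneg _
    calc 2 * σ * ((N1 * B^i : ℕ):ℝ) = σ * (2 * ((N1 * B^i : ℕ):ℝ)) := by ring
      _ ≤ σ * (c * B * ((N1 * B^i : ℕ):ℝ)) := by gcongr
      _ = σ * c * (B * ((N1 * B^i : ℕ):ℝ)) := by ring
      _ ≤ _ := by gcongr
  have hdis : ∀ i j, i ≠ j → Disjoint (W i) (W j) := by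
    intro i j hij
    rcases lt_or_gt_of_ne hij with h | h
    · exact hlt i j h
    · exact (hlt j i h).symm
  refine windows (mul_nonneg hX.le hLp.le) hM hδ W hdis ?_ ?_
  · intro w hw p hp
    obtain ⟨a1, a2, a3⟩ := mem_Pr.1 hp
    have b1 : L ≤ L * Real.exp (σ * c * (N1 * B^w : ℕ)) := le_mul_of_one_le_right hLp.le (Real.one_le_exp (by positivity))
    have b2 : L * Real.exp (2 * σ * (N1 * B^w : ℕ)) ≤ L * Real.exp (2 * (N1 * (B:ℝ)^M)) := by
      refine mul_le_mul_of_nonneg_left (Real.exp_le_exp.2 ?_) hLp.le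
      have h1 : N1 * B^w ≤ N1 * B^M := Nat.mul_le_mul_left _ (Nat.pow_le_pow_right hB1 hw.le)
      have h2 : ((N1 * B^w : ℕ):ℝ) ≤ N1 * (B:ℝ)^M := by exact_mod_cast h1
      have h3 : (0:ℝ) ≤ (N1 * B^w : ℕ) := Nat.cast_nonneg _
      nlinarith
    rw [Finset.mem_sdiff, mem_Pr, mem_Pr]
    refine ⟨⟨a1, by linarith, by linarith⟩, fun h => ?_⟩
    linarith [h.2.2]
  · intro w hw
    exact hW (N1 * B^w) (Nat.le_mul_of_pos_right _ (Nat.pow_pos hB1)) L hL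

lemma term_bound {L E C k X M : ℝ} (hL : 1 ≤ L) (hE : L/6 ≤ E) (hC : 0 < C) (hk : 0 ≤ k) (hX : 0 < X) (hM : 1 ≤ M) :
    k / M / (12 * (2*X + 22 + 20*C)) ≤ (1/2) * (E * k / (2*(M*(X*L)) + 20*(L+C) + 2)) := by
  have h1 : 2*(M*(X*L)) + 20*(L+C) + 2 ≤ (2*X + 22 + 20*C) * M * L := by
    have hML : 1 ≤ M * L := by nlinarith
    have : L ≤ M * L := by nlinarith
    nlinarith
  have hd : 0 < 2*(M*(X*L)) + 20*(L+C) + 2 := by positivity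
  rw [div_div, ← mul_div_assoc, div_le_div_iff₀ (by positivity) hd]
  calc k * (2*(M*(X*L)) + 20*(L+C) + 2) ≤ k * ((2*X + 22 + 20*C) * M * L) := by gcongr
    _ = (1/2) * (L/6*k) * (M*(12*(2*X+22+20*C))) := by ring
    _ ≤ _ := by gcongr

theorem main_lower {r N1 B : ℕ} {δ σ X L0 c : ℝ} (hδ : 0 < δ) (hσ : 0 < σ) (hσ1 : σ < 1) (hX : 0 < X) (hc : 0 < c)
    (hB : 2 ≤ c * B) (hB1 : 1 ≤ B) (hL0 : 1 ≤ L0)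
    (hW : ∀ N : ℕ, N1 ≤ N → ∀ L : ℝ, L0 ≤ L →
      EE (Pr (L * Real.exp (σ * c * N)) (L * Real.exp (2 * σ * N)))
        (fun S => if Succ r (fun p : ℕ => Real.log p) (X * L) S then 0 else 1) ≤ δ) :
    ∃ c' T0 : ℝ, 0 < c' ∧ 1 ≤ T0 ∧ ∀ x : ℝ, 1 < x → T0 ≤ Real.log (Real.log x) → ∀ M : ℕ, 1 ≤ M →
      8 * (N1 * (B:ℝ)^M) ≤ Real.log (Real.log x) →
      c' * x * (Real.log (Real.log x) * ((2:ℝ)^((r:ℝ)*(1-10*δ)*M) / M)) ≤ ∑ n ∈ Finset.Icc 1 ⌊x⌋₊, (Delta n : ℝ) := by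
  obtain ⟨c1, x0, hc1, hx0, hred⟩ := reduction
  obtain ⟨k0, hk0⟩ := sep2
  obtain ⟨C, hC, hm⟩ := mertens
  obtain ⟨t0, ht0⟩ := exists_nat_gt (max (k0:ℝ) (max L0 1))
  have ht01 : (k0:ℝ) < t0 := (le_max_left _ _).trans_lt ht0
  have ht02 : L0 < t0 := ((le_max_left _ _).trans (le_max_right _ _)).trans_lt ht0
  have ht03 : (1:ℝ) < t0 := ((le_max_right _ _).trans (le_max_right _ _)).trans_lt ht0
  refine ⟨c1 * (1/1000 / (12 * (2*X + 22 + 20*C))), max (Real.log (Real.log x0 + 80*C + 1)) (1000 * (t0 + 1)), by positivity,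
    le_max_of_le_right (by linarith), fun x hx hT M hM hMT => ?_⟩
  have hlp : 0 < Real.log x := Real.log_pos hx
  set l := Real.log x with hl
  set T := Real.log l with hTd
  have hT1 : 1000 * ((t0:ℝ) + 1) ≤ T := (le_max_right _ _).trans hT
  have hlx0 : 0 ≤ Real.log x0 := Real.log_nonneg hx0
  have hl1 : Real.log x0 + 80*C + 1 ≤ l := by
    rw [← Real.log_le_log_iff (by positivity) hlp]; exact (le_max_left _ _).trans hT
  have hxx0 : x0 ≤ x := by
    rw [← Real.log_le_log_iff (by linarith) (by linarith)]; linarith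
  have hTl : Real.exp T = l := Real.exp_log hlp
  set J := Finset.Ico t0 ⌊T/500⌋₊ with hJ
  have hfl : ∀ t ∈ J, (t:ℝ) ≤ T/500 := by
    intro t ht
    have h1 := (Finset.mem_Ico.1 ht).2
    exact (Nat.cast_le.2 h1.le).trans (Nat.floor_le (by linarith))
  have hbig : 80 * Real.exp (T/2 + T/4) ≤ l := by
    rw [← hTl]
    have e1 : Real.exp T = Real.exp (T/4) * Real.exp (T/2 + T/4) := by rw [← Real.exp_add]; ring_nf
    rw [e1]
    have := Real.add_one_le_exp (T/4)
    exact mul_le_mul_of_nonneg_right (by linarith) (Real.exp_pos _).le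
  have hLt : ∀ t ∈ J, L0 ≤ Real.exp ((250*t:ℕ):ℝ) ∧ 2 ≤ Real.exp ((250*t:ℕ):ℝ) := by
    intro t ht
    have h1 : (t0:ℝ) ≤ t := by exact_mod_cast (Finset.mem_Ico.1 ht).1
    have h2 := Real.add_one_le_exp ((250*t:ℕ):ℝ)
    push_cast at h2 ⊢
    constructor <;> linarith
  have hexp : ∀ t ∈ J, Real.exp ((250*t:ℕ):ℝ) ≤ Real.exp (T/2) := by
    intro t ht
    have := hfl t ht
    refine Real.exp_le_exp.2 ?_
    push_cast; linarith
  have hb : ∀ t ∈ J, Real.exp ((250*t:ℕ):ℝ) * Real.exp (2 * (N1 * (B:ℝ)^M)) ≤ l/80 := by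
    intro t ht
    have h1 : Real.exp (2 * (N1 * (B:ℝ)^M)) ≤ Real.exp (T/4) := Real.exp_le_exp.2 (by linarith)
    have h2 := mul_le_mul (hexp t ht) h1 (Real.exp_pos _).le (Real.exp_pos _).le
    rw [← Real.exp_add (T/2)] at h2
    linarith
  have hPeak := peak (P := Pr 0 (l/80)) (fun p hp => (mem_Pr.1 hp).1) J Qt (k := (2:ℝ)^((r:ℝ)*(1-10*δ)*M)) (l := l)
    (Y := fun t => M * (X * Real.exp ((250*t:ℕ):ℝ))) (V := fun t => 20 * (Real.exp ((250*t:ℕ):ℝ) + C))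
    (fun t ht => Pr_sub le_rfl ((le_mul_of_one_le_right (Real.exp_pos _).le (Real.one_le_exp (by positivity))).trans (hb t ht)))
    Qt_mono (by positivity) hlp (fun t _ => by positivity) (fun t _ => by positivity)
    (hk0 J fun t ht => by
      have h1 := (Finset.mem_Ico.1 ht).1
      have : k0 < t0 := by exact_mod_cast ht01
      omega)
    (fun t ht => window_many hδ hσ hσ1 hX hc hB hB1 hL0 (by omega) hW (hLt t ht).1 (hb t ht))
    (fun t ht => by
      have h1 := (hm 0 (Real.exp ((250*t:ℕ):ℝ)) le_rfl (Real.exp_pos _).le).2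
      have h2 : ∑ p ∈ Qt t, Real.log p * ap p ≤ ∑ p ∈ Pr 0 (Real.exp ((250*t:ℕ):ℝ)), Real.log p / p := by
        refine Finset.sum_le_sum fun p hp => ?_
        have := mul_le_mul_of_nonneg_left (ap_le_inv (mem_Pr.1 hp).1.pos) (Real.log_natCast_nonneg p)
        rwa [mul_one_div] at this
      linarith)
    (by
      have h1 := (hm 0 (l/80) le_rfl (by positivity)).2
      have h2 : ∑ p ∈ Pr 0 (l/80), Real.log p * ap p ≤ ∑ p ∈ Pr 0 (l/80), Real.log p / p := by
        refine Finset.sum_le_sum fun p hp => ?_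
        have := mul_le_mul_of_nonneg_left (ap_le_inv (mem_Pr.1 hp).1.pos) (Real.log_natCast_nonneg p)
        rwa [mul_one_div] at this
      linarith)
  have hR := hred x hxx0
  rw [← hl] at hR
  refine le_trans ?_ hR
  have hx0' : 0 < x := by linarith
  have hMr : (1:ℝ) ≤ M := by exact_mod_cast hM
  set k := (2:ℝ)^((r:ℝ)*(1-10*δ)*M) with hk
  have hkp : 0 < k := by positivity
  have hsum : ∑ t ∈ J, k / M / (12 * (2*X + 22 + 20*C)) ≤
      ∑ j ∈ J, (1/2) * (Eu (Qt j) * k / (2 * (M * (X * Real.exp ((250*j:ℕ):ℝ))) + 20 * (Real.exp ((250*j:ℕ):ℝ) + C) + 2)) := by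
    refine Finset.sum_le_sum fun t ht => ?_
    have h2 := (hLt t ht).2
    refine term_bound (by linarith) ?_ hC hkp.le hX hMr
    unfold Eu Qt
    rw [Pr_zero]
    have := euler_low ⌊Real.exp (Real.exp ((250*t:ℕ):ℝ))⌋₊
    have := log_floor_exp h2
    linarith
  have hcardJ : T/1000 ≤ (J.card : ℝ) := by
    rw [hJ, Nat.card_Ico]
    have h1 : T/500 - 1 < ⌊T/500⌋₊ := Nat.sub_one_lt_floor _
    have h2 : t0 ≤ ⌊T/500⌋₊ := Nat.le_floor (by linarith)
    rw [Nat.cast_sub h2]; linarith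
  rw [Finset.sum_const, nsmul_eq_mul] at hsum
  have hq : 0 ≤ k / M / (12 * (2*X + 22 + 20*C)) := by positivity
  have hfin := (mul_le_mul_of_nonneg_right hcardJ hq).trans (hsum.trans hPeak)
  have := mul_le_mul_of_nonneg_left hfin (show 0 ≤ c1 * x by positivity)
  refine le_trans (le_of_eq ?_) this
  ring

end EH

namespace EH

/-! ### choice of parameters and conclusion -/

lemma gamma_bound {Λ e δ r b l2 l80 : ℝ} (hl2 : 0 < l2) (hl21 : l2 ≤ 1) (hΛ : 1 ≤ Λ) (he : 0 < e) (hδ : 0 < δ) (hδ1 : δ ≤ 1/20)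
    (hr : 1 ≤ r) (hre : l80 ≤ r * e) (hb0 : 0 < b) (hb : b ≤ l80 + r * (Λ + e)) :
    l2 / Λ - 10 * δ - 2 * e ≤ r * (1 - 10 * δ) * l2 / b := by
  have hb2 : b ≤ r * (Λ + 2 * e) := by linarith
  have h1 : r * (1 - 10 * δ) * l2 / (r * (Λ + 2 * e)) ≤ r * (1 - 10 * δ) * l2 / b := by
    refine div_le_div_of_nonneg_left ?_ hb0 hb2
    have : 0 ≤ 1 - 10 * δ := by linarith
    positivity
  refine le_trans ?_ h1
  rw [le_div_iff₀ (by positivity)]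
  obtain ⟨q, hq⟩ : ∃ q, q = l2 / Λ := ⟨_, rfl⟩
  have hqΛ : l2 = q * Λ := by rw [hq]; field_simp
  have hq0 : 0 < q := by rw [hq]; positivity
  have hq1 : q ≤ 1 := by rw [hq, div_le_one (by linarith)]; linarith
  rw [← hq, hqΛ]
  have k : (q - 10 * δ - 2 * e) * (Λ + 2 * e) ≤ (1 - 10 * δ) * (q * Λ) := by
    have a1 : 0 ≤ e * (Λ - q) := mul_nonneg he.le (by linarith)
    have a2 : 0 ≤ δ * Λ * (1 - q) := mul_nonneg (by positivity) (by linarith)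
    have a3 : 0 ≤ δ * e := by positivity
    nlinarith [sq_nonneg e]
  calc (q - 10 * δ - 2 * e) * (r * (Λ + 2 * e)) = r * ((q - 10 * δ - 2 * e) * (Λ + 2 * e)) := by ring
    _ ≤ r * ((1 - 10 * δ) * (q * Λ)) := by gcongr
    _ = _ := by ring

lemma pickM {N1 B : ℕ} {s T : ℝ} (hN : 1 ≤ N1) (hB : 3 ≤ B) (hs : 0 ≤ s) (hT : 8 * (N1:ℝ) * B ≤ T) :
    ∃ M : ℕ, 1 ≤ M ∧ 8 * (N1 * (B:ℝ)^M) ≤ T ∧ (M:ℝ) ≤ Real.log T ∧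
      (T / (8 * N1 * B)) ^ (s * Real.log 2 / Real.log B) ≤ (2:ℝ)^(s * M) := by
  have hNr : (1:ℝ) ≤ N1 := by exact_mod_cast hN
  have hBr : (3:ℝ) ≤ B := by exact_mod_cast hB
  have hlB : 1 < Real.log B := by
    rw [Real.lt_log_iff_exp_lt (by linarith)]; have := Real.exp_one_lt_d9; linarith
  have hTp : 0 < T := by
    have : 0 < 8 * (N1:ℝ) * B := by positivity
    linarith
  have hl1 : Real.log B ≤ Real.log (T / (8 * N1)) := by
    refine Real.log_le_log (by linarith) ?_
    rw [le_div_iff₀ (by positivity)]; linarith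
  have hl2 : Real.log (T / (8*N1)) ≤ Real.log T := by
    refine Real.log_le_log (by positivity) (div_le_self hTp.le (by linarith))
  have hlB0 : 0 < Real.log B := by linarith
  set M := ⌊Real.log (T / (8 * N1)) / Real.log B⌋₊ with hM
  have hM1 : (M:ℝ) ≤ Real.log (T / (8 * N1)) / Real.log B := Nat.floor_le (div_nonneg (by linarith) hlB0.le)
  have hM2 : Real.log (T / (8 * N1)) / Real.log B < M + 1 := Nat.lt_floor_add_one _
  rw [le_div_iff₀ hlB0] at hM1
  rw [div_lt_iff₀ hlB0] at hM2
  refine ⟨M, Nat.le_floor ?_, ?_, ?_, ?_⟩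
  · rw [Nat.cast_one, le_div_iff₀ hlB0]; linarith
  · have h1 : (B:ℝ)^M ≤ T / (8 * N1) := by
      rw [← Real.log_le_log_iff (by positivity) (by positivity), Real.log_pow]; exact hM1
    rw [le_div_iff₀ (by positivity)] at h1
    linarith
  · have : (0:ℝ) ≤ M := Nat.cast_nonneg _
    nlinarith
  · have e1 : T / (8 * N1 * B) = T / (8 * N1) / B := by rw [div_div]
    have hpos : 0 < T / (8 * N1 * B) := by positivity
    have h3 : Real.log (T / (8 * N1 * B)) ≤ M * Real.log B := by
      rw [e1, Real.log_div (by positivity) (by positivity)]; linarith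
    rw [Real.rpow_def_of_pos hpos, Real.rpow_def_of_pos (by norm_num : (0:ℝ) < 2)]
    refine Real.exp_le_exp.2 ?_
    have hl20 : 0 < Real.log 2 := Real.log_pos (by norm_num)
    calc Real.log (T / (8 * N1 * B)) * (s * Real.log 2 / Real.log B)
        ≤ (M * Real.log B) * (s * Real.log 2 / Real.log B) := by gcongr
      _ = Real.log 2 * (s * M) := by field_simp

theorem large {ρ : ℝ} {a : ℕ → ℝ} (h : ASeq ρ a) (hlim : Tendsto (fun j : ℕ => (2:ℝ) ^ ((j:ℝ) - 2) / Real.log (a j))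
      atTop (𝓝 (1 - ρ/2))) {ε : ℝ} (hε : 0 < ε) :
    ∃ c T1 : ℝ, 0 < c ∧ 1 ≤ T1 ∧ ∀ x : ℝ, 1 < x → T1 ≤ Real.log (Real.log x) →
      c * x * Real.log (Real.log x) ^ (1 + Real.log 2 / Real.log (2/ρ) - ε) ≤ ∑ n ∈ Finset.Icc 1 ⌊x⌋₊, (Delta n : ℝ) := by
  have hρ0 := h.hρ0
  have hρ1 := h.hρ1
  obtain ⟨e, he⟩ : ∃ e, e = ε / 10 := ⟨_, rfl⟩
  have he0 : 0 < e := by rw [he]; positivity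
  obtain ⟨θ, hθ⟩ : ∃ θ, θ = ρ/2 * Real.exp (-e) := ⟨_, rfl⟩
  have hθ0 : 0 < θ := by rw [hθ]; positivity
  have hθ1 : θ < ρ/2 := by
    rw [hθ]; exact mul_lt_of_lt_one_right (by positivity) (Real.exp_lt_one_iff.2 (by linarith))
  have hθ2 : θ ≤ 1 := by linarith
  obtain ⟨r0, hr0⟩ := propW h hlim hθ0 hθ1
  obtain ⟨r, hr⟩ := exists_nat_gt (max (r0:ℝ) (max 1 (Real.log 80 / e)))
  have hr1 : (r0:ℝ) < r := (le_max_left _ _).trans_lt hr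
  have hr2 : (1:ℝ) < r := ((le_max_left _ _).trans (le_max_right _ _)).trans_lt hr
  have hr3 : Real.log 80 / e < r := ((le_max_right _ _).trans (le_max_right _ _)).trans_lt hr
  obtain ⟨δ, hδ⟩ : ∃ δ, δ = min (ε/100) (1/20) := ⟨_, rfl⟩
  have hδ0 : 0 < δ := by rw [hδ]; exact lt_min (by positivity) (by norm_num)
  have hδ1 : δ ≤ ε/100 := by rw [hδ]; exact min_le_left _ _
  have hδ2 : δ ≤ 1/20 := by rw [hδ]; exact min_le_right _ _
  obtain ⟨σ, X, L0, N0, hσ, hσ1, hX, hL0, hW⟩ := hr0 r (by exact_mod_cast hr1.le) (by exact_mod_cast hr2.le) δ hδ0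
  obtain ⟨N1, hN1⟩ : ∃ N1, N1 = max N0 1 := ⟨_, rfl⟩
  have hN11 : 1 ≤ N1 := by omega
  have hc : 0 < θ^r/20 := by positivity
  have hθr : θ^r ≤ 1 := pow_le_one₀ hθ0.le hθ2
  have hθrp : 0 < θ^r := by positivity
  obtain ⟨B, hB⟩ : ∃ B, B = ⌈40/θ^r⌉₊ := ⟨_, rfl⟩
  have hB1 : 40/θ^r ≤ B := by rw [hB]; exact Nat.le_ceil _
  have hB40 : 40 ≤ 40/θ^r := by rw [le_div_iff₀ hθrp]; linarith
  have hBr : (40:ℝ) ≤ B := hB40.trans hB1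
  have hB3 : 3 ≤ B := by have : 40 ≤ B := by exact_mod_cast hBr
                         omega
  have hB2 : (B:ℝ) ≤ 80/θ^r := by
    have h1 : (B:ℝ) < 40/θ^r + 1 := by rw [hB]; exact Nat.ceil_lt_add_one (by positivity)
    have : 80/θ^r = 40/θ^r + 40/θ^r := by ring
    linarith
  have hcB : 2 ≤ θ^r/20 * B := by
    rw [div_le_iff₀ hθrp] at hB1; linarith
  obtain ⟨c', T0, hc', hT0, hmain⟩ := main_lower hδ0 hσ hσ1 hX hc hcB (by omega) hL0 (r := r) (N1 := N1)
    (fun N hN L hL => hW N (by omega) L hL)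
  obtain ⟨Λ, hΛ⟩ : ∃ Λ, Λ = Real.log (2/ρ) := ⟨_, rfl⟩
  have hΛ1 : 1 ≤ Λ := by
    rw [hΛ, Real.le_log_iff_exp_le (by positivity), le_div_iff₀ hρ0]
    have := Real.exp_one_lt_d9
    nlinarith
  obtain ⟨s, hs⟩ : ∃ s, s = (r:ℝ)*(1-10*δ) := ⟨_, rfl⟩
  have hs0 : 0 ≤ s := by rw [hs]; exact mul_nonneg (by linarith) (by linarith)
  obtain ⟨g, hg⟩ : ∃ g, g = s * Real.log 2 / Real.log B := ⟨_, rfl⟩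
  have hlB : 0 < Real.log B := Real.log_pos (by linarith)
  have hl2 : 0 < Real.log 2 := Real.log_pos (by norm_num)
  have hgam : Real.log 2 / Λ - 10 * δ - 2 * e ≤ g := by
    rw [hg, hs]
    refine gamma_bound (l80 := Real.log 80) hl2 (by have := Real.log_two_lt_d9; linarith) hΛ1 he0 hδ0 hδ2 hr2.le ?_ hlB ?_
    · rw [div_lt_iff₀ he0] at hr3; exact hr3.le
    · refine (Real.log_le_log (by linarith) hB2).trans ?_
      rw [Real.log_div (by norm_num) hθrp.ne', Real.log_pow, hθ, Real.log_mul (by positivity) (by positivity), Real.log_exp, hΛ]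
      have : Real.log (2/ρ) = - Real.log (ρ/2) := by rw [← Real.log_inv, inv_div]
      rw [this]
      apply le_of_eq; ring
  obtain ⟨K, hK⟩ : ∃ K, K = 8 * (N1:ℝ) * B := ⟨_, rfl⟩
  have hN1r : (1:ℝ) ≤ N1 := by exact_mod_cast hN11
  have hK0 : 0 < K := by rw [hK]; positivity
  refine ⟨c' * (K ^ (-g) * (ε/4)), max T0 K, by positivity, le_max_of_le_left hT0, fun x hx hT => ?_⟩
  obtain ⟨T, hTd⟩ : ∃ T, T = Real.log (Real.log x) := ⟨_, rfl⟩
  rw [← hTd] at hT ⊢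
  have hT0' : T0 ≤ T := (le_max_left _ _).trans hT
  have hTK : K ≤ T := (le_max_right _ _).trans hT
  have hT1 : 1 ≤ T := hT0.trans hT0'
  have hTp : 0 < T := by linarith
  obtain ⟨M, hM1, hM2, hM3, hM4⟩ := pickM (T := T) hN11 hB3 hs0 (by rw [← hK]; exact hTK)
  have hfin := hmain x hx (by rw [← hTd]; exact hT0') M hM1 (by rw [← hTd]; exact hM2)
  rw [← hTd, ← hs] at hfin
  refine le_trans ?_ hfin
  rw [← hg, ← hK] at hM4
  have hMr : (1:ℝ) ≤ M := by exact_mod_cast hM1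
  have hlog : Real.log T ≤ T ^ (ε/4) / (ε/4) := Real.log_le_rpow_div hTp.le (by positivity)
  have hMle : (M:ℝ) ≤ T ^ (ε/4) / (ε/4) := hM3.trans hlog
  have hTe : 0 < T ^ (ε/4) := by positivity
  have step : K ^ (-g) * (ε/4) * T ^ (g - ε/4) ≤ (2:ℝ)^(s*M) / M := by
    calc K ^ (-g) * (ε/4) * T ^ (g - ε/4) = (T/K)^g / (T ^ (ε/4) / (ε/4)) := by
          rw [Real.rpow_sub hTp, Real.div_rpow hTp.le hK0.le, Real.rpow_neg hK0.le]
          have := (Real.rpow_pos_of_pos hK0 g).ne'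
          field_simp
      _ ≤ (2:ℝ)^(s*M) / M := by gcongr
  have hexp : T ^ (1 + Real.log 2 / Λ - ε) ≤ T * T ^ (g - ε/4) := by
    have e1 : T * T ^ (g - ε/4) = T ^ (1 + (g - ε/4)) := by rw [Real.rpow_add hTp, Real.rpow_one]
    rw [e1]
    refine Real.rpow_le_rpow_of_exponent_le hT1 ?_
    rw [he] at hgam; linarith
  rw [← hΛ]
  have hx0 : 0 < x := by linarith
  have hA : 0 ≤ K ^ (-g) * (ε/4) := by positivity
  calc c' * (K ^ (-g) * (ε/4)) * x * T ^ (1 + Real.log 2 / Λ - ε)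
      ≤ c' * (K ^ (-g) * (ε/4)) * x * (T * T ^ (g - ε/4)) := by gcongr
    _ = c' * x * (T * (K ^ (-g) * (ε/4) * T ^ (g - ε/4))) := by ring
    _ ≤ _ := by gcongr

end EH

theorem statement0 (ρ : ℝ) (hρ0 : 0 < ρ) (hρ1 : ρ < 1/3)
    (a : ℕ → ℝ) (ha1 : a 1 = 2) (ha2 : a 2 = 2 + (2:ℝ) ^ ρ)
    (harec : ∀ j : ℕ, 3 ≤ j → a j = a (j-1) ^ 2 + a (j-1) ^ ρ - a (j-2) ^ (2*ρ))
    (hlim : Filter.Tendsto (fun j : ℕ => (2:ℝ) ^ ((j:ℝ) - 2) / Real.log (a j))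
      Filter.atTop (nhds (1 - ρ/2)))
    (ε : ℝ) (hε : 0 < ε) :
    ∃ c : ℝ, 0 < c ∧ ∀ x : ℝ, 1 ≤ x →
      c * x * LLog2 x ^ (1 + Real.log 2 / Real.log (2/ρ) - ε)
        ≤ ∑ n ∈ Finset.Icc 1 ⌊x⌋₊, (Delta n : ℝ) := by
  obtain ⟨c, T1, hc, hT1, hlarge⟩ := EH.large ⟨hρ0, hρ1, ha1, ha2, harec⟩ hlim hε
  obtain ⟨e, he⟩ : ∃ e, e = 1 + Real.log 2 / Real.log (2/ρ) - ε := ⟨_, rfl⟩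
  rw [← he] at hlarge ⊢
  have hTp : 0 < T1 ^ |e| := Real.rpow_pos_of_pos (by linarith) _
  refine ⟨min c (1 / (2 * T1 ^ |e|)), lt_min hc (by positivity), fun x hx => ?_⟩
  have hx0 : 0 < x := by linarith
  have hL1 : 1 ≤ LLog2 x := le_max_left _ _
  have hLp : 0 < LLog2 x ^ e := Real.rpow_pos_of_pos (by linarith) _
  rcases le_or_gt (LLog2 x) T1 with h | h
  · have h1 : LLog2 x ^ e ≤ T1 ^ |e| :=
      (Real.rpow_le_rpow_of_exponent_le hL1 (le_abs_self e)).trans (Real.rpow_le_rpow (by linarith) h (abs_nonneg e))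
    have h2 : (⌊x⌋₊ : ℝ) ≤ ∑ n ∈ Finset.Icc 1 ⌊x⌋₊, (Delta n : ℝ) := by
      have : ∑ n ∈ Finset.Icc 1 ⌊x⌋₊, (1:ℝ) ≤ ∑ n ∈ Finset.Icc 1 ⌊x⌋₊, (Delta n : ℝ) := by
        refine Finset.sum_le_sum fun n hn => ?_
        have hn1 := (Finset.mem_Icc.1 hn).1
        exact_mod_cast EH.one_le_Delta (n := n) (by omega)
      simpa using this
    have h3 : x / 2 ≤ ⌊x⌋₊ := by
      have a1 : x - 1 < ⌊x⌋₊ := Nat.sub_one_lt_floor _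
      have a2 : 1 ≤ ⌊x⌋₊ := Nat.le_floor (by simpa using hx)
      have a3 : (1:ℝ) ≤ ⌊x⌋₊ := by exact_mod_cast a2
      linarith
    calc min c (1 / (2 * T1 ^ |e|)) * x * LLog2 x ^ e ≤ 1 / (2 * T1 ^ |e|) * x * T1 ^ |e| := by
          gcongr; exact min_le_right _ _
      _ = x / 2 := by field_simp
      _ ≤ _ := h3.trans h2
  · have hl1 : 1 < LLog2 x := by linarith
    have e1 : LLog2 x = Real.log (LLog x) := by
      unfold LLog2 at hl1 ⊢
      rw [LLog] at hl1 ⊢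
      rcases lt_max_iff.1 hl1 with h | h
      · exact absurd h (lt_irrefl _)
      · exact max_eq_right h.le
    have e2 : 1 < LLog x := by
      by_contra hc
      push Not at hc
      have : 1 ≤ LLog x := le_max_left _ _
      have e3 : LLog x = 1 := le_antisymm hc this
      rw [e1, e3, Real.log_one] at hl1
      linarith
    have e3 : LLog x = Real.log x := by
      unfold LLog at e2 ⊢
      rcases lt_max_iff.1 e2 with h | h
      · exact absurd h (lt_irrefl _)
      · exact max_eq_right h.le
    rw [e3] at e1 e2
    have hx1 : 1 < x := (Real.log_pos_iff hx0.le).1 (by linarith)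
    have := hlarge x hx1 (by rw [← e1]; exact h.le)
    rw [← e1] at this
    refine le_trans ?_ this
    gcongr
    exact min_le_left _ _
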